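/- Let G be a compact subgroup of O(n) whose action on ℝ^n admits a section Σ, and assume the generalized Weyl group W = W(Σ) is finite of order m. Let M and N be DC-weight sequences with N strongly regular and sup_{k≥1} (M_{km}/N_k)^{1/k} < ∞. Then every W-invariant differential p-form ω of class C^M on Σ has an extension to a G-invariant horizontal differential p-form η of class C^N on ℝ^n; that is, η is G-invariant and horizontal, and η_s(v_1,…,v_p) = ω_s(v_1,…,v_p) for all s ∈ Σ and v_1,…,v_p ∈ Σ. -/

import Mathlib

open scoped Nat ENNReal
open Matrix

/-- `f` belongs to the Denjoy–Carleman class `C^M` on the open set `U`. -/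
def CMClassOn {E F : Type*} [NormedAddCommGroup E] [NormedSpace ℝ E]
    [NormedAddCommGroup F] [NormedSpace ℝ F]
    (M : ℕ → ℝ) (U : Set E) (f : E → F) : Prop :=
  ContDiffOn ℝ (⊤ : ℕ∞) f U ∧
    ∀ K : Set E, K ⊆ U → IsCompact K →
      ∃ C > (0 : ℝ), ∃ ρ > (0 : ℝ), ∀ k : ℕ, ∀ x ∈ K,
        ‖iteratedFDerivWithin ℝ k f U x‖ ≤ C * ρ ^ k * (k ! : ℝ) * M k

/-- DC-weight sequence: `M 0 = 1`, positive, increasing, logarithmically convex,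
and `sup_k (M (k+1) / M k) ^ (1/k) < ∞`. -/
def DCWeightSeq (M : ℕ → ℝ) : Prop :=
  M 0 = 1 ∧ (∀ k, 0 < M k) ∧ (∀ k, M k ≤ M (k + 1)) ∧
    (∀ k : ℕ, 1 ≤ k → M k ^ 2 ≤ M (k - 1) * M (k + 1)) ∧
    ∃ C : ℝ, ∀ k : ℕ, 1 ≤ k → (M (k + 1) / M k) ^ ((1 : ℝ) / k) ≤ C

/-- Strong regularity: strong non-quasianalyticity together with moderate growth. -/
def StronglyRegular (N : ℕ → ℝ) : Prop :=
  (∃ C > (0 : ℝ), ∀ j : ℕ,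
      ∑' k : ℕ, N (j + k) / (((j + k + 1 : ℕ) : ℝ) * N (j + k + 1)) ≤ C * (N j / N (j + 1))) ∧
    ∃ C : ℝ, ∀ j k : ℕ, 1 ≤ j → 1 ≤ k →
      (N (j + k) / (N j * N k)) ^ ((1 : ℝ) / ((j : ℝ) + (k : ℝ))) ≤ C

section Poly
open scoped ContDiff
universe u v w
variable {E : Type u} [NormedAddCommGroup E] [NormedSpace ℝ E]
  {F : Type v} [NormedAddCommGroup F] [NormedSpace ℝ F]

/-- Smooth maps that are homogeneous of degree `k` (hence homogeneous polynomial maps). -/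
def homFun (E : Type u) [NormedAddCommGroup E] [NormedSpace ℝ E]
    (F : Type v) [NormedAddCommGroup F] [NormedSpace ℝ F] (k : ℕ) : Submodule ℝ (E → F) where
  carrier := {f | ContDiff ℝ ∞ f ∧ ∀ (t : ℝ) (x : E), f (t • x) = t ^ k • f x}
  add_mem' := by
    rintro f g ⟨hf, hf'⟩ ⟨hg, hg'⟩
    exact ⟨hf.add hg, fun t x => by simp [hf', hg']⟩
  zero_mem' := ⟨contDiff_const, fun t x => by simp⟩
  smul_mem' := by
    rintro c f ⟨hf, hf'⟩
    exact ⟨hf.const_smul c, fun t x => by simp [hf', smul_comm c]⟩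

theorem homFun_contDiff {k : ℕ} {f : E → F} (hf : f ∈ homFun E F k) : ContDiff ℝ ∞ f := hf.1

theorem homFun_smul {k : ℕ} {f : E → F} (hf : f ∈ homFun E F k) (t : ℝ) (x : E) :
    f (t • x) = t ^ k • f x := hf.2 t x

theorem homFun_differentiable {k : ℕ} {f : E → F} (hf : f ∈ homFun E F k) :
    Differentiable ℝ f := hf.1.differentiable (by simp)

theorem homFun_zero_const {f : E → F} (hf : f ∈ homFun E F 0) (x : E) : f x = f 0 := by
  have := homFun_smul hf 0 x
  simpa using this.symm

theorem homFun_succ_zero {k : ℕ} {f : E → F} (hf : f ∈ homFun E F (k + 1)) : f 0 = 0 := by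
  have := homFun_smul hf 0 (0 : E)
  simpa using this

theorem homFun_fderiv {k : ℕ} {f : E → F} (hf : f ∈ homFun E F (k + 1)) :
    fderiv ℝ f ∈ homFun E (E →L[ℝ] F) k := by
  refine ⟨hf.1.fderiv_right (by simp), fun t x => ?_⟩
  by_cases ht : t = 0
  · subst ht
    rcases Nat.eq_zero_or_pos k with rfl | hk
    · simp only [zero_smul, pow_zero, one_smul]
      have key : ∀ x, HasFDerivAt f (fderiv ℝ f 0) x := by
        intro x
        have hc := (hf.1.fderiv_right (m := ∞) (by simp)).continuous
        have h1 : ∀ s : ℝ, s ≠ 0 → fderiv ℝ f (s • x) = fderiv ℝ f x := by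
          intro s hs
          have e : (fun y => f (s • y)) = fun y => s • f y := by
            funext y; simpa using homFun_smul hf s y
          have d1 : HasFDerivAt (fun y => f (s • y)) ((fderiv ℝ f (s • x)).comp
              (s • ContinuousLinearMap.id ℝ E)) x :=
            (homFun_differentiable hf (s • x)).hasFDerivAt.comp x
              ((ContinuousLinearMap.id ℝ E).hasFDerivAt.const_smul s)
          rw [e] at d1
          have d2 := (homFun_differentiable hf x).hasFDerivAt.const_smul s
          have := d1.unique d2
          ext v
          have := DFunLike.congr_fun this v
          simp at this
          simpa [hs] using this
        have h2 : Filter.Tendsto (fun s : ℝ => fderiv ℝ f (s • x)) (nhdsWithin 0 {0}ᶜ)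
            (nhds (fderiv ℝ f 0)) := by
          have : Continuous fun s : ℝ => fderiv ℝ f (s • x) := by fun_prop
          have := this.tendsto 0
          rw [zero_smul] at this
          exact this.mono_left nhdsWithin_le_nhds
        have h3 : Filter.Tendsto (fun s : ℝ => fderiv ℝ f (s • x)) (nhdsWithin 0 {0}ᶜ)
            (nhds (fderiv ℝ f x)) := by
          refine tendsto_const_nhds.congr' ?_
          filter_upwards [self_mem_nhdsWithin] with s hs using (h1 s hs).symm
        rw [tendsto_nhds_unique h2 h3]
        exact (homFun_differentiable hf x).hasFDerivAt
      exact (key x).fderiv.symm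
    · rw [zero_smul, zero_pow hk.ne', zero_smul]
      ext v
      have h := (homFun_differentiable hf 0).hasFDerivAt.comp_hasDerivAt_of_eq (0 : ℝ)
        ((hasDerivAt_id (0 : ℝ)).smul_const v) (by simp)
      have e : (f ∘ fun s : ℝ => id s • v) = fun s => s ^ (k + 1) • f v := by
        funext s; exact homFun_smul hf s v
      rw [e] at h
      have h' := (hasDerivAt_pow (k + 1) (0 : ℝ)).smul_const (f v)
      have := h.unique h'
      simpa [hk.ne'] using this
  · have e : (fun y => f (t • y)) = fun y => t ^ (k + 1) • f y := by
      funext y; exact homFun_smul hf t y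
    have d1 : HasFDerivAt (fun y => f (t • y)) ((fderiv ℝ f (t • x)).comp
        (t • ContinuousLinearMap.id ℝ E)) x :=
      (homFun_differentiable hf (t • x)).hasFDerivAt.comp x
        ((ContinuousLinearMap.id ℝ E).hasFDerivAt.const_smul t)
    rw [e] at d1
    have d2 := (homFun_differentiable hf x).hasFDerivAt.const_smul (t ^ (k + 1))
    have := d1.unique d2
    ext v
    have := DFunLike.congr_fun this v
    simp only [pow_succ', mul_smul, ContinuousLinearMap.comp_apply, _root_.smul_apply,
      ContinuousLinearMap.id_apply, map_smul] at this
    exact smul_right_injective F ht this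

theorem homFun_fderiv_zero {f : E → F} (hf : f ∈ homFun E F 0) : fderiv ℝ f = 0 := by
  have : f = fun _ => f 0 := funext (homFun_zero_const hf)
  rw [this]; funext x; simp

theorem homFun_comp_clm {F' : Type w} [NormedAddCommGroup F'] [NormedSpace ℝ F'] {k : ℕ}
    {f : E → F} (hf : f ∈ homFun E F k) (A : F →L[ℝ] F') :
    (fun x => A (f x)) ∈ homFun E F' k :=
  ⟨A.contDiff.comp hf.1, fun t x => by simp [homFun_smul hf]⟩

theorem homFun_comp_right {E' : Type w} [NormedAddCommGroup E'] [NormedSpace ℝ E'] {k : ℕ}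
    {f : E → F} (hf : f ∈ homFun E F k) (A : E' →L[ℝ] E) :
    (fun x => f (A x)) ∈ homFun E' F k :=
  ⟨hf.1.comp A.contDiff, fun t x => by simp [homFun_smul hf]⟩

theorem homFun_smul_mem {k l : ℕ} {f : E → ℝ} {g : E → F} (hf : f ∈ homFun E ℝ k)
    (hg : g ∈ homFun E F l) : (fun x => f x • g x) ∈ homFun E F (k + l) :=
  ⟨hf.1.smul hg.1, fun t x => by
    simp only [homFun_smul hf, homFun_smul hg, pow_add, smul_smul, smul_eq_mul]; congr 1; ring⟩

theorem homFun_mul_mem {k l : ℕ} {f g : E → ℝ} (hf : f ∈ homFun E ℝ k)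
    (hg : g ∈ homFun E ℝ l) : (fun x => f x * g x) ∈ homFun E ℝ (k + l) :=
  homFun_smul_mem hf hg

theorem homFun_clm (A : E →L[ℝ] F) : (fun x => A x) ∈ homFun E F 1 :=
  ⟨A.contDiff, fun t x => by simp⟩

theorem homFun_const (c : F) : (fun _ => c) ∈ homFun E F 0 :=
  ⟨contDiff_const, fun t x => by simp⟩

/-- Derivative in a fixed direction. -/
noncomputable def dirD (v : E) (f : E → F) : E → F := fun x => fderiv ℝ f x v

theorem homFun_dirD {k : ℕ} {f : E → F} (hf : f ∈ homFun E F (k + 1)) (v : E) :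
    dirD v f ∈ homFun E F k :=
  homFun_comp_clm (homFun_fderiv hf) (ContinuousLinearMap.apply ℝ F v)

theorem homFun_dirD_zero {f : E → F} (hf : f ∈ homFun E F 0) (v : E) : dirD v f = 0 := by
  funext x; simp [dirD, homFun_fderiv_zero hf]

theorem homFun_eq_of_fderiv {k : ℕ} {f : E → F} (hf : f ∈ homFun E F (k + 1))
    (h : fderiv ℝ f = 0) : f = 0 := by
  funext x
  rw [is_const_of_fderiv_eq_zero (homFun_differentiable hf) (fun y => congrFun h y) x 0,
    homFun_succ_zero hf]; rfl

instance homFun_finiteDimensional [FiniteDimensional ℝ E] [FiniteDimensional ℝ F] (k : ℕ) :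
    FiniteDimensional ℝ (homFun E F k) := by
  have key : ∀ (k : ℕ) (F : Type (max u v)) [NormedAddCommGroup F] [NormedSpace ℝ F]
      [FiniteDimensional ℝ F], FiniteDimensional ℝ (homFun E F k) := by
    intro k
    induction k with
    | zero =>
      intro F _ _ _
      let Θ : homFun E F 0 →ₗ[ℝ] F :=
        { toFun := fun f => f.1 0, map_add' := fun _ _ => rfl, map_smul' := fun _ _ => rfl }
      refine FiniteDimensional.of_injective Θ fun f g h => ?_
      ext x
      rw [homFun_zero_const f.2, homFun_zero_const g.2]; exact h
    | succ k ih =>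
      intro F _ _ _
      have := ih (E →L[ℝ] F)
      let Θ : homFun E F (k + 1) →ₗ[ℝ] homFun E (E →L[ℝ] F) k :=
        { toFun := fun f => ⟨fderiv ℝ f.1, homFun_fderiv f.2⟩
          map_add' := fun f g => by
            ext x : 2
            exact fderiv_add (homFun_differentiable f.2 x) (homFun_differentiable g.2 x)
          map_smul' := fun c f => by
            ext x : 2
            exact fderiv_const_smul (homFun_differentiable f.2 x) c }
      refine FiniteDimensional.of_injective Θ ?_
      rw [← LinearMap.ker_eq_bot, LinearMap.ker_eq_bot']
      intro f hf
      ext1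
      exact homFun_eq_of_fderiv f.2 (congrArg Subtype.val hf)
  have := key k (ULift.{max u v} F)
  let Θ : homFun E F k →ₗ[ℝ] homFun E (ULift.{max u v} F) k :=
    { toFun := fun f => ⟨fun x => ULift.up (f.1 x),
        homFun_comp_clm f.2
          ((ContinuousLinearEquiv.ulift (R₁ := ℝ) (M₁ := F)).symm : F →L[ℝ] ULift.{max u v} F)⟩
      map_add' := fun f g => rfl
      map_smul' := fun c f => rfl }
  refine FiniteDimensional.of_injective Θ fun f g h => ?_
  ext x
  exact congrArg ULift.down (congrFun (congrArg Subtype.val h) x)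

/-- Finite Taylor expansion of a homogeneous polynomial along a line. -/
theorem homFun_taylor {k : ℕ} {f : E → F} (hf : f ∈ homFun E F k) (u x : E) (t : ℝ) :
    f (x + t • u) = ∑ j ∈ Finset.range (k + 1), (t ^ j / (j ! : ℝ)) • ((dirD u)^[j] f) x := by
  induction k generalizing f t with
  | zero => rw [homFun_zero_const hf, Finset.sum_range_one]; simp [homFun_zero_const hf x]
  | succ k ih =>
    have hd : ∀ s : ℝ, HasDerivAt (fun s : ℝ => f (x + s • u)) (dirD u f (x + s • u)) s := by
      intro s
      have := (homFun_differentiable hf (x + s • u)).hasFDerivAt.comp_hasDerivAt s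
        (((hasDerivAt_id s).smul_const u).const_add x)
      simpa [dirD, Function.comp_def] using this
    have hd2 : ∀ s : ℝ, HasDerivAt (fun s : ℝ => ∑ j ∈ Finset.range (k + 1 + 1),
        (s ^ j / (j ! : ℝ)) • ((dirD u)^[j] f) x) (dirD u f (x + s • u)) s := by
      intro s
      rw [ih (homFun_dirD hf u)]
      simp_rw [Finset.sum_range_succ' _ (k + 1)]
      have h0 : HasDerivAt (fun s : ℝ => (s ^ 0 / (0 ! : ℝ)) • ((dirD u)^[0] f) x) 0 s := by
        simpa using hasDerivAt_const s _
      rw [← add_zero (∑ j ∈ Finset.range (k + 1), _)]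
      refine HasDerivAt.add (HasDerivAt.fun_sum fun j _ => ?_) h0
      rw [← Function.iterate_succ_apply]
      have := ((hasDerivAt_pow (j + 1) s).div_const ((j + 1)! : ℝ)).smul_const
        (((dirD u)^[j + 1] f) x)
      convert this using 2
      rw [Nat.factorial_succ]; push_cast
      have : (j ! : ℝ) ≠ 0 := by positivity
      field_simp
    have hz := is_const_of_deriv_eq_zero
      (f := fun s : ℝ => f (x + s • u) - ∑ j ∈ Finset.range (k + 1 + 1),
        (s ^ j / (j ! : ℝ)) • ((dirD u)^[j] f) x)
      (fun s => ((hd s).fun_sub (hd2 s)).differentiableAt)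
      (fun s => by rw [((hd s).fun_sub (hd2 s)).deriv, sub_self]) t 0
    rw [sub_eq_iff_eq_add] at hz
    rw [hz]
    simp [Finset.sum_range_succ' _ (k + 1)]

theorem homFun_sum_eq_zero {N : ℕ} {q : ℕ → E → F} (hq : ∀ j < N, q j ∈ homFun E F j)
    {r : ℝ} (hr : 0 < r) (h : ∀ x, ‖x‖ < r → ∑ j ∈ Finset.range N, q j x = 0) :
    ∀ j < N, q j = 0 := by
  intro j hj
  funext x
  refine SeparatingDual.eq_zero_of_forall_dual_eq_zero (R := ℝ) fun l => ?_
  let P : Polynomial ℝ := ∑ j ∈ Finset.range N, Polynomial.monomial j (l (q j x))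
  have hc : ∀ i < N, P.coeff i = l (q i x) := by
    intro i hi
    simp [P, Polynomial.coeff_monomial, hi]
  have hP : P = 0 := by
    refine Polynomial.eq_zero_of_infinite_isRoot _
      (Set.Infinite.mono ?_ (Set.Ioo_infinite (show (0 : ℝ) < r / (‖x‖ + 1) by positivity)))
    intro t ht
    have h1 : ‖t • x‖ < r := by
      rw [norm_smul, Real.norm_of_nonneg ht.1.le]
      have := (lt_div_iff₀ (by positivity)).1 ht.2
      nlinarith [ht.1, norm_nonneg x]
    have h2 := congrArg l (h _ h1)
    rw [Set.mem_ofPred_eq, Polynomial.IsRoot, Polynomial.eval_finsetSum]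
    rw [map_sum, map_zero] at h2
    rw [← h2]
    refine Finset.sum_congr rfl fun i hi => ?_
    rw [homFun_smul (hq i (Finset.mem_range.1 hi)), map_smul, Polynomial.eval_monomial,
      smul_eq_mul, mul_comm]
  have := hc j hj
  rw [hP] at this
  simpa using this.symm
end Poly

section GeoBasic
open Filter Topology

/-- An isometric representation of a group on `V`, with a section given as the range of an
isometric embedding of `U`. -/
structure PolarRep (Γ : Type*) [Group Γ] [TopologicalSpace Γ] (V : Type*)
    [NormedAddCommGroup V] [InnerProductSpace ℝ V] (U : Type*)
    [NormedAddCommGroup U] [InnerProductSpace ℝ U] where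
  ρ : Γ →* (V →L[ℝ] V)
  cont : Continuous ρ
  isom : ∀ g x, ‖ρ g x‖ = ‖x‖
  ι : U →ₗᵢ[ℝ] V
  meets : ∀ v, ∃ g u, ρ g v = ι u
  orth : ∀ (s : U) (c : ℝ → V), ContDiff ℝ 1 c → c 0 = ι s → (∀ t, ∃ g, c t = ρ g (ι s)) →
    ∀ u : U, inner ℝ (deriv c 0) (ι u) = 0

variable {Γ : Type*} [Group Γ] [TopologicalSpace Γ] {V : Type*}
    [NormedAddCommGroup V] [InnerProductSpace ℝ V] {U : Type*}
    [NormedAddCommGroup U] [InnerProductSpace ℝ U]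

theorem norm_pow_sub_pow_le_of_bound {A : Type*} [NormedRing A] [NormOneClass A] (a b : A) (C : ℝ)
    (ha : ‖a‖ ≤ 1) (k : ℕ) (hb : ∀ j ≤ k, ‖b ^ j‖ ≤ C) :
    ‖a ^ k - b ^ k‖ ≤ k * (C * ‖a - b‖) := by
  induction k with
  | zero => simp
  | succ k ih =>
    have e : a ^ (k + 1) - b ^ (k + 1) = a * (a ^ k - b ^ k) + (a - b) * b ^ k := by
      rw [pow_succ', pow_succ']; noncomm_ring
    have ih' := ih fun j hj => hb j (hj.trans (Nat.le_succ k))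
    calc ‖a ^ (k + 1) - b ^ (k + 1)‖ ≤ ‖a‖ * ‖a ^ k - b ^ k‖ + ‖a - b‖ * ‖b ^ k‖ := by
          rw [e]; exact (norm_add_le _ _).trans (add_le_add (norm_mul_le _ _) (norm_mul_le _ _))
      _ ≤ 1 * (k * (C * ‖a - b‖)) + ‖a - b‖ * C := by
          gcongr
          · exact hb k (Nat.le_succ k)
      _ = _ := by push_cast; ring

namespace PolarRep
variable (P : PolarRep Γ V U)

theorem mul_apply (g h : Γ) (x : V) : P.ρ (g * h) x = P.ρ g (P.ρ h x) := by rw [map_mul]; rfl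

@[simp] theorem inv_apply_self (g : Γ) (x : V) : P.ρ g⁻¹ (P.ρ g x) = x := by
  rw [← mul_apply, inv_mul_cancel, map_one]; rfl

@[simp] theorem apply_inv_self (g : Γ) (x : V) : P.ρ g (P.ρ g⁻¹ x) = x := by
  rw [← mul_apply, mul_inv_cancel, map_one]; rfl

theorem inner_map (g : Γ) (x y : V) : inner ℝ (P.ρ g x) (P.ρ g y) = inner ℝ x y :=
  (LinearMap.norm_map_iff_inner_map_map (P.ρ g)).1 (P.isom g) x y

theorem inner_map_left (g : Γ) (x y : V) : inner ℝ (P.ρ g x) y = inner ℝ x (P.ρ g⁻¹ y) := by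
  rw [← P.inner_map g x, apply_inv_self]

theorem norm_le_one (g : Γ) : ‖P.ρ g‖ ≤ 1 :=
  ContinuousLinearMap.opNorm_le_bound _ zero_le_one fun x => by rw [P.isom, one_mul]

/-- Membership in the Lie algebra of the image group. -/
def IsLie (X : V →L[ℝ] V) : Prop := ∀ t : ℝ, ∃ g, P.ρ g = NormedSpace.exp (t • X)

variable [FiniteDimensional ℝ V]

instance : CompleteSpace (V →L[ℝ] V) := FiniteDimensional.complete ℝ _

theorem exp_natCast_smul (X : V →L[ℝ] V) (k : ℕ) :
    NormedSpace.exp ((k : ℝ) • X) = NormedSpace.exp X ^ k := by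
  let _ := NormedAlgebra.restrictScalars ℚ ℝ (V →L[ℝ] V)
  rw [Nat.cast_smul_eq_nsmul, NormedSpace.exp_nsmul]

theorem exp_smul_mul_exp_neg_smul (X : V →L[ℝ] V) (t : ℝ) :
    NormedSpace.exp (t • X) * NormedSpace.exp ((-t) • X) = 1 := by
  let _ := NormedAlgebra.restrictScalars ℚ ℝ (V →L[ℝ] V)
  rw [← NormedSpace.exp_add_of_commute (((Commute.refl X).smul_left _).smul_right _)]
  simp

theorem norm_exp_le_exp_norm (X : V →L[ℝ] V) [Nontrivial V] :
    ‖NormedSpace.exp X‖ ≤ Real.exp ‖X‖ := by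
  rw [NormedSpace.exp_eq_tsum ℝ, Real.exp_eq_exp_ℝ, NormedSpace.exp_eq_tsum ℝ]
  refine tsum_of_norm_bounded (NormedSpace.expSeries_summable' (𝕂 := ℝ) ‖X‖).hasSum fun n => ?_
  rw [norm_smul, smul_eq_mul, Real.norm_of_nonneg (by positivity)]
  gcongr
  exact norm_pow_le X n

theorem inv_eq_exp_neg {X : V →L[ℝ] V} {t : ℝ} {g : Γ}
    (hg : P.ρ g = NormedSpace.exp (t • X)) : P.ρ g⁻¹ = NormedSpace.exp ((-t) • X) := by
  have h1 : P.ρ g⁻¹ * P.ρ g = 1 := by rw [← map_mul]; simp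
  calc P.ρ g⁻¹ = P.ρ g⁻¹ * (P.ρ g * NormedSpace.exp ((-t) • X)) := by
        rw [hg, exp_smul_mul_exp_neg_smul, mul_one]
    _ = _ := by rw [← mul_assoc, h1, one_mul]

theorem exp_hasDerivAt_zero (X : V →L[ℝ] V) :
    HasDerivAt (fun t : ℝ => NormedSpace.exp (t • X)) X 0 := by
  simpa using hasDerivAt_exp_smul_const (𝕂 := ℝ) X 0

theorem tendsto_slope_seq {F : Type*} [NormedAddCommGroup F] [NormedSpace ℝ F] {f : ℝ → F} {f' : F}
    (h : HasDerivAt f f' 0) {t : ℕ → ℝ} (ht : ∀ n, 0 < t n) (ht0 : Tendsto t atTop (𝓝 0)) :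
    Tendsto (fun n => (t n)⁻¹ • (f (t n) - f 0)) atTop (𝓝 f') := by
  have := hasDerivAt_iff_tendsto_slope.1 h
  have h2 := this.comp (tendsto_nhdsWithin_iff.2 ⟨ht0, Eventually.of_forall fun n => (ht n).ne'⟩)
  refine h2.congr fun n => ?_
  simp [slope_def_module]

theorem isLie_of_seq [CompactSpace Γ] {g : ℕ → Γ} {t : ℕ → ℝ} (ht : ∀ n, 0 < t n)
    (ht0 : Tendsto t atTop (𝓝 0)) {X : V →L[ℝ] V}
    (hX : Tendsto (fun n => (t n)⁻¹ • (P.ρ (g n) - 1)) atTop (𝓝 X)) : P.IsLie X := by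
  have hclosed : IsClosed (Set.range P.ρ) := (isCompact_range P.cont).isClosed
  have main : ∀ τ : ℝ, 0 ≤ τ → ∃ h, P.ρ h = NormedSpace.exp (τ • X) := by
    intro τ hτ
    rcases subsingleton_or_nontrivial V with hV | hV
    · exact ⟨1, Subsingleton.elim _ _⟩
    let k : ℕ → ℕ := fun n => ⌊τ / t n⌋₊
    have hk : ∀ n, k n * t n ≤ τ := fun n => by
      rw [← le_div_iff₀ (ht n)]; exact Nat.floor_le (div_nonneg hτ (ht n).le)
    have hk2 : ∀ n, τ - t n ≤ k n * t n := fun n => by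
      have := Nat.lt_floor_add_one (τ / t n)
      rw [div_lt_iff₀ (ht n)] at this
      have h2 : (k n : ℝ) = ⌊τ / t n⌋₊ := rfl
      rw [h2]; linarith
    have hkt : Tendsto (fun n => (k n : ℝ) * t n) atTop (𝓝 τ) := by
      refine tendsto_of_tendsto_of_tendsto_of_le_of_le ?_ tendsto_const_nhds hk2 hk
      simpa using ht0.const_sub τ
    have hB : Tendsto (fun n => (NormedSpace.exp (t n • X)) ^ (k n)) atTop
        (𝓝 (NormedSpace.exp (τ • X))) := by
      have : Tendsto (fun n => NormedSpace.exp (((k n : ℝ) * t n) • X)) atTop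
          (𝓝 (NormedSpace.exp (τ • X))) := by
        let _ := NormedAlgebra.restrictScalars ℚ ℝ (V →L[ℝ] V)
        exact ((NormedSpace.exp_continuous (𝔸 := V →L[ℝ] V)).tendsto _).comp (hkt.smul_const X)
      refine this.congr fun n => ?_
      rw [mul_smul, exp_natCast_smul]
    have hdiff : Tendsto (fun n => P.ρ (g n) ^ k n - (NormedSpace.exp (t n • X)) ^ (k n)) atTop
        (𝓝 0) := by
      have hz : Tendsto (fun n => (t n)⁻¹ • (P.ρ (g n) - NormedSpace.exp (t n • X))) atTop
          (𝓝 0) := by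
        have h2 := tendsto_slope_seq (exp_hasDerivAt_zero X) ht ht0
        have := hX.sub h2
        rw [sub_self] at this
        refine this.congr fun n => ?_
        rw [← smul_sub]; simp
      have hb : ∀ n, ∀ j ≤ k n, ‖NormedSpace.exp (t n • X) ^ j‖ ≤ Real.exp (τ * ‖X‖) := by
        intro n j hj
        rw [← exp_natCast_smul]
        refine (norm_exp_le_exp_norm _).trans (Real.exp_le_exp.2 ?_)
        rw [smul_smul, norm_smul]
        gcongr
        rw [Real.norm_of_nonneg (mul_nonneg (Nat.cast_nonneg _) (ht n).le)]
        exact le_trans (mul_le_mul_of_nonneg_right (Nat.cast_le.2 hj) (ht n).le) (hk n)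
      refine squeeze_zero_norm (a := fun n => τ * (Real.exp (τ * ‖X‖) *
        ‖(t n)⁻¹ • (P.ρ (g n) - NormedSpace.exp (t n • X))‖)) (fun n => ?_) ?_
      · refine (norm_pow_sub_pow_le_of_bound _ _ _ (P.norm_le_one _) _ (hb n)).trans ?_
        rw [norm_smul, Real.norm_of_nonneg (inv_nonneg.2 (ht n).le)]
        have : (k n : ℝ) ≤ τ * (t n)⁻¹ := by
          rw [← div_eq_mul_inv]; exact Nat.floor_le (div_nonneg hτ (ht n).le)
        calc _ ≤ (τ * (t n)⁻¹) * (Real.exp (τ * ‖X‖) *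
              ‖P.ρ (g n) - NormedSpace.exp (t n • X)‖) := by gcongr
          _ = _ := by ring
      · simpa using ((hz.norm.const_mul (Real.exp (τ * ‖X‖))).const_mul τ)
    have : Tendsto (fun n => P.ρ (g n ^ k n)) atTop (𝓝 (NormedSpace.exp (τ • X))) := by
      have := hdiff.add hB
      simpa using this
    exact hclosed.mem_of_tendsto this (Eventually.of_forall fun n => ⟨_, rfl⟩)
  intro τ
  rcases le_total 0 τ with h | h
  · exact main τ h
  · obtain ⟨a, ha⟩ := main (-τ) (neg_nonneg.2 h)
    exact ⟨a⁻¹, by rw [P.inv_eq_exp_neg ha, neg_neg]⟩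

variable [CompactSpace Γ]

/-- The Lie algebra of the image group. -/
def lie : Submodule ℝ (V →L[ℝ] V) where
  carrier := {X | P.IsLie X}
  zero_mem' := fun t => ⟨1, by simp⟩
  smul_mem' := fun c X hX t => by
    obtain ⟨g, hg⟩ := hX (t * c)
    exact ⟨g, by rw [hg, mul_smul]⟩
  add_mem' := by
    intro X Y hX hY
    let t : ℕ → ℝ := fun n => 1 / ((n : ℝ) + 1)
    have ht : ∀ n, 0 < t n := fun n => Nat.one_div_pos_of_nat
    have ht0 : Tendsto t atTop (𝓝 0) := tendsto_one_div_add_atTop_nhds_zero_nat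
    choose a ha using hX
    choose b hb using hY
    refine P.isLie_of_seq (g := fun n => a (t n) * b (t n)) ht ht0 ?_
    have hd := (exp_hasDerivAt_zero X).fun_mul (exp_hasDerivAt_zero Y)
    have := tendsto_slope_seq hd ht ht0
    simpa [ha, hb] using this

theorem lie_ad {X : V →L[ℝ] V} (hX : X ∈ P.lie) (g : Γ) : P.ρ g * X * P.ρ g⁻¹ ∈ P.lie := by
  intro t
  obtain ⟨h, hh⟩ := hX t
  refine ⟨g * h * g⁻¹, ?_⟩
  let u : (V →L[ℝ] V)ˣ := ⟨P.ρ g, P.ρ g⁻¹, by rw [← map_mul]; simp, by rw [← map_mul]; simp⟩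
  let _ := NormedAlgebra.restrictScalars ℚ ℝ (V →L[ℝ] V)
  have := NormedSpace.exp_units_conj u (t • X)
  rw [map_mul, map_mul, hh]
  rw [mul_smul_comm, smul_mul_assoc] at this
  exact this.symm

theorem mem_of_hasDerivAt_submodule {F : Type*} [NormedAddCommGroup F] [NormedSpace ℝ F]
    [FiniteDimensional ℝ F] (K : Submodule ℝ F) {f : ℝ → F} {f' : F} (h : HasDerivAt f f' 0)
    (hf : ∀ t, f t ∈ K) : f' ∈ K := by
  refine K.closed_of_finiteDimensional.mem_of_tendsto (hasDerivAt_iff_tendsto_slope.1 h)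
    (Eventually.of_forall fun t => ?_)
  rw [slope_def_module]
  exact K.smul_mem _ (K.sub_mem (hf _) (hf _))

theorem lie_bracket {X Y : V →L[ℝ] V} (hX : X ∈ P.lie) (hY : Y ∈ P.lie) :
    X * Y - Y * X ∈ P.lie := by
  have h1 : HasDerivAt (fun t : ℝ => NormedSpace.exp ((-t) • X)) (-X) 0 := by
    have := exp_hasDerivAt_zero (-X)
    simpa using this
  have hd := ((exp_hasDerivAt_zero X).mul_const Y).fun_mul h1
  have := mem_of_hasDerivAt_submodule P.lie hd fun t => by
    obtain ⟨g, hg⟩ := hX t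
    rw [← P.inv_eq_exp_neg hg, ← hg]
    exact P.lie_ad hY g
  simpa [sub_eq_add_neg] using this

theorem lie_curve_hasDerivAt (X : V →L[ℝ] V) (x : V) :
    HasDerivAt (fun t : ℝ => NormedSpace.exp (t • X) x) (X x) 0 := by
  have := (ContinuousLinearMap.apply ℝ V x).hasFDerivAt.comp_hasDerivAt (0 : ℝ)
    (exp_hasDerivAt_zero X)
  simpa [Function.comp_def] using this

theorem lie_skew_self {X : V →L[ℝ] V} (hX : X ∈ P.lie) (x : V) : inner ℝ (X x) x = 0 := by
  have h := (lie_curve_hasDerivAt X x).norm_sq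
  have hc : (fun t : ℝ => ‖NormedSpace.exp (t • X) x‖ ^ 2) = fun _ => ‖x‖ ^ 2 := by
    funext t
    obtain ⟨g, hg⟩ := hX t
    rw [← hg, P.isom]
  rw [hc] at h
  have := h.unique (hasDerivAt_const (0 : ℝ) _)
  simp at this
  rw [real_inner_comm]; exact this

theorem lie_skew {X : V →L[ℝ] V} (hX : X ∈ P.lie) (x y : V) :
    inner ℝ (X x) y = - inner ℝ x (X y) := by
  have h := P.lie_skew_self hX (x + y)
  rw [map_add, inner_add_left, inner_add_right, inner_add_right, P.lie_skew_self hX x,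
    P.lie_skew_self hX y, real_inner_comm (X y) x] at *
  linarith

theorem lie_orth {X : V →L[ℝ] V} (hX : X ∈ P.lie) (s u : U) :
    inner ℝ (X (P.ι s)) (P.ι u) = 0 := by
  have := P.orth s (fun t : ℝ => NormedSpace.exp (t • X) (P.ι s)) ?_ (by simp) (fun t => ?_) u
  · rwa [(lie_curve_hasDerivAt X _).deriv] at this
  · have h2 : ContDiff ℝ 1 (fun t : ℝ => NormedSpace.exp (t • X)) := by
      have : ContDiff ℝ 1 (NormedSpace.exp : (V →L[ℝ] V) → _) :=
        contDiff_iff_contDiffAt.2 fun x => (NormedSpace.exp_analytic (𝕂 := ℝ) x).contDiffAt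
      exact this.comp (contDiff_id.smul contDiff_const)
    exact h2.clm_apply contDiff_const
  · obtain ⟨g, hg⟩ := hX t
    exact ⟨g, by rw [hg]⟩

end PolarRep
end GeoBasic

section GeoDim
open Filter Topology

variable {Γ : Type*} [Group Γ] [TopologicalSpace Γ] {V : Type*}
    [NormedAddCommGroup V] [InnerProductSpace ℝ V] [FiniteDimensional ℝ V] {U : Type*}
    [NormedAddCommGroup U] [InnerProductSpace ℝ U] [FiniteDimensional ℝ U]

namespace PolarRep
variable (P : PolarRep Γ V U)

/-- Trace of an endomorphism computed in an orthonormal basis. -/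
noncomputable def otr (A : V →L[ℝ] V) : ℝ :=
  ∑ i, inner ℝ (stdOrthonormalBasis ℝ V i) (A (stdOrthonormalBasis ℝ V i))

theorem otr_continuous : Continuous (otr : (V →L[ℝ] V) → ℝ) := by
  unfold otr; fun_prop

theorem otr_sub (A B : V →L[ℝ] V) : otr (A - B) = otr A - otr B := by
  simp [otr, inner_sub_right]

theorem otr_smul (c : ℝ) (A : V →L[ℝ] V) : otr (c • A) = c * otr A := by
  simp [otr, inner_smul_right, Finset.mul_sum]

theorem eq_one_of_otr (g : Γ) (h : otr (1 : V →L[ℝ] V) ≤ otr (P.ρ g)) : P.ρ g = 1 := by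
  set b := stdOrthonormalBasis ℝ V
  have h1 : ∀ i, inner ℝ (b i) (P.ρ g (b i)) ≤ 1 := fun i => by
    refine (real_inner_le_norm _ _).trans ?_
    rw [P.isom, b.orthonormal.1 i]; norm_num
  have h2 : ∀ i, inner ℝ (b i) (P.ρ g (b i)) = 1 := by
    have : ∑ i, (1 - inner ℝ (b i) (P.ρ g (b i))) ≤ 0 := by
      rw [Finset.sum_sub_distrib]
      have e : otr (1 : V →L[ℝ] V) = ∑ i : Fin (Module.finrank ℝ V), (1 : ℝ) :=
        Finset.sum_congr rfl fun i _ => by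
          rw [ContinuousLinearMap.one_apply, real_inner_self_eq_norm_sq]
          simp
      rw [← e]
      have : otr (P.ρ g) = ∑ i, inner ℝ (b i) (P.ρ g (b i)) := rfl
      linarith
    have h0 := (Finset.sum_eq_zero_iff_of_nonneg
      (fun i _ => sub_nonneg.2 (h1 i))).1 (le_antisymm this
        (Finset.sum_nonneg fun i _ => sub_nonneg.2 (h1 i)))
    intro i
    linarith [h0 i (Finset.mem_univ i)]
  ext1 x
  have : ((P.ρ g : V →L[ℝ] V) : V →ₗ[ℝ] V) = LinearMap.id := by
    refine b.toBasis.ext fun i => ?_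
    simp only [OrthonormalBasis.coe_toBasis, ContinuousLinearMap.coe_coe, LinearMap.id_apply]
    have n1 : ‖b i‖ = 1 := b.orthonormal.1 i
    exact ((inner_eq_one_iff_of_norm_eq_one (𝕜 := ℝ) n1 (by rw [P.isom, n1])).1 (h2 i)).symm
  exact LinearMap.congr_fun this x

theorem eq_zero_of_otr_mul_self {X : V →L[ℝ] V} [CompactSpace Γ] (hX : X ∈ P.lie)
    (h : otr (X * X) = 0) : X = 0 := by
  set b := stdOrthonormalBasis ℝ V
  have h1 : ∑ i, ‖X (b i)‖ ^ 2 = 0 := by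
    have : otr (X * X) = - ∑ i, ‖X (b i)‖ ^ 2 := by
      rw [← Finset.sum_neg_distrib]
      refine Finset.sum_congr rfl fun i _ => ?_
      have := P.lie_skew hX (b i) (X (b i))
      rw [real_inner_self_eq_norm_sq] at this
      rw [ContinuousLinearMap.mul_apply]
      change inner ℝ (b i) (X (X (b i))) = _
      linarith
    linarith
  have h2 := (Finset.sum_eq_zero_iff_of_nonneg (fun i _ => sq_nonneg _)).1 h1
  have : (X : V →ₗ[ℝ] V) = 0 := by
    refine b.toBasis.ext fun i => ?_
    have := h2 i (Finset.mem_univ i)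
    simpa using this
  ext1 x
  exact LinearMap.congr_fun this x

/-- Restriction of a group element to the section. -/
noncomputable def res (g : Γ) : U →L[ℝ] V := (P.ρ g).comp P.ι.toContinuousLinearMap

theorem res_apply (g : Γ) (s : U) : P.res g s = P.ρ g (P.ι s) := rfl

theorem res_continuous : Continuous P.res := by
  have := P.cont
  unfold res; fun_prop

theorem exp_apply_eq_self {X : V →L[ℝ] V} {x : V} (hx : X x = 0) (t : ℝ) :
    NormedSpace.exp (t • X) x = x := by
  have hd : ∀ t : ℝ, HasDerivAt (fun t : ℝ => NormedSpace.exp (t • X) x) 0 t := by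
    intro t
    have := (ContinuousLinearMap.apply ℝ V x).hasFDerivAt.comp_hasDerivAt t
      (hasDerivAt_exp_smul_const (𝕂 := ℝ) X t)
    simpa [Function.comp_def, hx] using this
  have := is_const_of_deriv_eq_zero (fun t => (hd t).differentiableAt) (fun t => (hd t).deriv) t 0
  simpa using this

variable [CompactSpace Γ] [IsTopologicalGroup Γ]

/-- Restriction of the Lie algebra to the section. -/
noncomputable def lieRes : Submodule ℝ (U →L[ℝ] V) :=
  P.lie.map (ContinuousLinearMap.precomp V P.ι.toContinuousLinearMap : (V →L[ℝ] V) →L[ℝ] (U →L[ℝ] V)).toLinearMap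

theorem mem_lieRes {X : V →L[ℝ] V} (hX : X ∈ P.lie) : X.comp P.ι.toContinuousLinearMap ∈ P.lieRes :=
  ⟨X, hX, rfl⟩

set_option maxHeartbeats 1000000 in
theorem exists_local_bound {r : ℕ} (p : (U →L[ℝ] V) →L[ℝ] (Fin r → ℝ)) (hp : ∀ Y ∈ P.lieRes, p Y = 0 → Y = 0)
    (g : Γ) : ∃ C : ℝ, ∃ ε > 0, ∀ a b, ‖P.res a - P.res g‖ < ε → ‖P.res b - P.res g‖ < ε →
      ‖P.res a - P.res b‖ ≤ C * ‖p ((P.ρ g⁻¹).comp (P.res a - P.res b))‖ := by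
  by_contra! hcon
  have hpos : ∀ n : ℕ, (0 : ℝ) < 1 / ((n : ℝ) + 1) := fun n => Nat.one_div_pos_of_nat
  choose a b ha hb hab using fun n : ℕ => hcon ((n : ℝ) + 1) _ (hpos n)
  -- maximise the trace over the fixer of the section
  let K : Set Γ := {k | P.res k = P.res 1}
  have hK : IsCompact K := (isClosed_eq P.res_continuous continuous_const).isCompact
  have hmax : ∀ n, ∃ h ∈ K, ∀ h' ∈ K, otr (P.ρ ((b n)⁻¹ * a n * h')) ≤ otr (P.ρ ((b n)⁻¹ * a n * h)) := by
    intro n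
    have hc : Continuous fun h => otr (P.ρ ((b n)⁻¹ * a n * h)) :=
      otr_continuous.comp (P.cont.comp (continuous_const.mul continuous_id))
    obtain ⟨h, hh, hm⟩ := hK.exists_isMaxOn ⟨1, rfl⟩ hc.continuousOn
    exact ⟨h, hh, fun h' hh' => hm hh'⟩
  choose h hhK hhmax using hmax
  let k : ℕ → Γ := fun n => (b n)⁻¹ * a n * h n
  have hKapp : ∀ {k : Γ}, k ∈ K → ∀ s : U, P.ρ k (P.ι s) = P.ι s := fun {k} hk s => by
    have := DFunLike.congr_fun hk s
    simpa [res_apply] using this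
  have hdiff : ∀ n, P.res (a n) - P.res (b n) =
      (P.ρ (b n)).comp ((P.ρ (k n) - 1).comp P.ι.toContinuousLinearMap) := by
    intro n
    ext1 s
    simp [k, res_apply, mul_apply, hKapp (hhK n)]
  have hkmax : ∀ n, ∀ h' ∈ K, otr (P.ρ (k n * h')) ≤ otr (P.ρ (k n)) := by
    intro n h' hh'
    have : k n * h' = (b n)⁻¹ * a n * (h n * h') := by simp [k, mul_assoc]
    rw [this]
    refine hhmax n _ ?_
    ext1 s
    simp [res_apply, mul_apply, hKapp (hhK n), hKapp hh']
  have hk1 : ∀ n, 0 < ‖P.ρ (k n) - 1‖ := by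
    intro n
    rw [norm_pos_iff]
    intro h0
    have h1 := hab n
    have h2 : P.res (a n) - P.res (b n) = 0 := by rw [hdiff n, h0]; simp
    rw [h2, norm_zero] at h1
    exact absurd h1 (not_lt.2 (by positivity))
  -- extract convergent subsequences
  let Z : ℕ → (V →L[ℝ] V) × (V →L[ℝ] V) × (V →L[ℝ] V) := fun n =>
    (P.ρ (k n), P.ρ (b n), ‖P.ρ (k n) - 1‖⁻¹ • (P.ρ (k n) - 1))
  have hproper : ProperSpace (V →L[ℝ] V) := FiniteDimensional.proper ℝ _
  have hcomp : IsCompact (Set.range P.ρ ×ˢ (Set.range P.ρ ×ˢ Metric.sphere (0 : V →L[ℝ] V) 1)) :=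
    (isCompact_range P.cont).prod ((isCompact_range P.cont).prod (isCompact_sphere _ _))
  obtain ⟨⟨k0, b0, X⟩, ⟨⟨κ, hκ⟩, ⟨β, hβ⟩, hXs⟩, ν, hν, hlim⟩ := hcomp.tendsto_subseq (x := Z)
    (fun n => ⟨⟨_, rfl⟩, ⟨_, rfl⟩, by
      rw [mem_sphere_zero_iff_norm, norm_smul, norm_inv, norm_norm]
      exact inv_mul_cancel₀ (hk1 n).ne'⟩)
  simp only at hκ hβ
  have limk : Tendsto (fun n => P.ρ (k (ν n))) atTop (𝓝 (P.ρ κ)) := by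
    rw [hκ]; exact (continuous_fst.tendsto _).comp hlim
  have limb : Tendsto (fun n => P.ρ (b (ν n))) atTop (𝓝 (P.ρ β)) := by
    rw [hβ]; exact ((continuous_fst.comp continuous_snd).tendsto _).comp hlim
  have limX : Tendsto (fun n => ‖P.ρ (k (ν n)) - 1‖⁻¹ • (P.ρ (k (ν n)) - 1)) atTop (𝓝 X) :=
    ((continuous_snd.comp continuous_snd).tendsto _).comp hlim
  have hsmall : ∀ c : ℕ → Γ, (∀ n, ‖P.res (c n) - P.res g‖ < 1 / ((n : ℝ) + 1)) →
      Tendsto (fun n => P.res (c (ν n))) atTop (𝓝 (P.res g)) := by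
    intro c hc
    have : Tendsto (fun n => P.res (c n)) atTop (𝓝 (P.res g)) := by
      exact tendsto_iff_norm_sub_tendsto_zero.2 <| squeeze_zero (fun n => norm_nonneg _) (fun n => (hc n).le)
        tendsto_one_div_add_atTop_nhds_zero_nat
    exact this.comp hν.tendsto_atTop
  have hβg : P.res β = P.res g := by
    refine tendsto_nhds_unique ?_ (hsmall b hb)
    have hc : Continuous fun A : V →L[ℝ] V => A.comp P.ι.toContinuousLinearMap := by fun_prop
    exact (hc.tendsto _).comp limb
  have hκK : κ ∈ K := by
    have h1 : Tendsto (fun n => P.res (a (ν n)) - P.res (b (ν n))) atTop (𝓝 0) := by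
      simpa using (hsmall a ha).sub (hsmall b hb)
    have h2 : Tendsto (fun n => P.res (a (ν n)) - P.res (b (ν n))) atTop
        (𝓝 ((P.ρ β).comp ((P.ρ κ - 1).comp P.ι.toContinuousLinearMap))) := by
      simp_rw [hdiff]
      have hc : Continuous fun A : (V →L[ℝ] V) × (V →L[ℝ] V) =>
        A.1.comp ((A.2 - 1).comp P.ι.toContinuousLinearMap) := by fun_prop
      exact (hc.tendsto (P.ρ β, P.ρ κ)).comp (limb.prodMk_nhds limk)
    have h3 := tendsto_nhds_unique h2 h1
    ext1 s
    have h4 := DFunLike.congr_fun h3 s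
    have h5 : P.ρ β (P.ρ κ (P.ι s) - P.ι s) = 0 := by simpa using h4
    have h6 : P.ρ κ (P.ι s) - P.ι s = 0 := by
      rw [← norm_eq_zero, ← P.isom β, h5, norm_zero]
    rw [res_apply, res_apply, map_one]
    exact sub_eq_zero.1 h6
  have hκ1 : P.ρ κ = 1 := by
    refine P.eq_one_of_otr κ ?_
    have hinv : κ⁻¹ ∈ K := by
      ext1 s
      have := hKapp hκK s
      rw [res_apply, res_apply, map_one]
      conv_lhs => rw [← this]
      simp
    have l1 : Tendsto (fun n => otr (P.ρ (k (ν n)))) atTop (𝓝 (otr (P.ρ κ))) :=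
      (otr_continuous.tendsto _).comp limk
    have l2 : Tendsto (fun n => otr (P.ρ (k (ν n) * κ⁻¹))) atTop (𝓝 (otr (1 : V →L[ℝ] V))) := by
      have e : (1 : V →L[ℝ] V) = P.ρ κ * P.ρ κ⁻¹ := by rw [← map_mul]; simp
      simp_rw [map_mul]
      rw [e]
      exact (otr_continuous.tendsto _).comp (limk.mul_const _)
    exact le_of_tendsto_of_tendsto' l2 l1 fun n => hkmax _ _ hinv
  rw [hκ1] at limk
  have hXlie : X ∈ P.lie := by
    refine P.isLie_of_seq (g := fun n => k (ν n)) (t := fun n => ‖P.ρ (k (ν n)) - 1‖)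
      (fun n => hk1 _) ?_ limX
    simpa using (limk.sub_const 1).norm
  -- the direction is non-trivial on the section
  have hXres : X.comp P.ι.toContinuousLinearMap ≠ 0 := by
    intro h0
    have hX0 : ∀ s : U, X (P.ι s) = 0 := fun s => DFunLike.congr_fun h0 s
    have hder : ∀ n, otr (P.ρ (k n) * X) = 0 := by
      intro n
      have hd : HasDerivAt (fun t : ℝ => otr (P.ρ (k n) * NormedSpace.exp (t • X)))
          (otr (P.ρ (k n) * X)) 0 := by
        unfold otr
        refine HasDerivAt.fun_sum fun i _ => ?_
        have h1 := lie_curve_hasDerivAt X (stdOrthonormalBasis ℝ V i)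
        have h2 := (P.ρ (k n)).hasFDerivAt.comp_hasDerivAt (0 : ℝ) h1
        have h3 := (hasDerivAt_const (0 : ℝ) (stdOrthonormalBasis ℝ V i)).inner ℝ h2
        simpa using h3
      refine IsLocalMax.hasDerivAt_eq_zero (Eventually.of_forall fun t => ?_) hd
      obtain ⟨h', hh'⟩ := hXlie t
      simp only [zero_smul, NormedSpace.exp_zero, mul_one]
      rw [← hh', ← map_mul]
      refine hkmax n h' ?_
      ext1 s
      rw [res_apply, res_apply, map_one, hh', exp_apply_eq_self (hX0 s)]; rfl
    have htrX : otr X = 0 := by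
      have : Tendsto (fun n => otr (P.ρ (k (ν n)) * X)) atTop (𝓝 (otr (1 * X))) :=
        (otr_continuous.tendsto _).comp (limk.mul_const X)
      simp_rw [hder, one_mul] at this
      exact (tendsto_nhds_unique this tendsto_const_nhds)
    have htr : otr (X * X) = 0 := by
      have : Tendsto (fun n => otr ((‖P.ρ (k (ν n)) - 1‖⁻¹ • (P.ρ (k (ν n)) - 1)) * X)) atTop
          (𝓝 (otr (X * X))) :=
        (otr_continuous.tendsto _).comp (limX.mul_const X)
      have e : ∀ n, otr ((‖P.ρ (k (ν n)) - 1‖⁻¹ • (P.ρ (k (ν n)) - 1)) * X) = 0 := by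
        intro n
        rw [smul_mul_assoc, otr_smul, sub_mul, otr_sub, hder, one_mul, htrX]; simp
      simp_rw [e] at this
      exact (tendsto_nhds_unique this tendsto_const_nhds)
    have := P.eq_zero_of_otr_mul_self hXlie htr
    rw [this] at hXs
    simp at hXs
  -- pass to the limit in the inequality
  have hlim2 : Tendsto (fun n => p ((P.ρ g⁻¹).comp ((P.ρ (b (ν n))).comp
      ((‖P.ρ (k (ν n)) - 1‖⁻¹ • (P.ρ (k (ν n)) - 1)).comp P.ι.toContinuousLinearMap)))) atTop
      (𝓝 (p ((P.ρ g⁻¹).comp ((P.ρ β).comp (X.comp P.ι.toContinuousLinearMap))))) := by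
    have hc : Continuous fun A : (V →L[ℝ] V) × (V →L[ℝ] V) =>
        p ((P.ρ g⁻¹).comp (A.1.comp (A.2.comp P.ι.toContinuousLinearMap))) := by fun_prop
    have h1 := limb.prodMk_nhds limX
    have h2 := hc.tendsto (P.ρ β, X)
    exact Tendsto.comp (f := fun n => (P.ρ (b (ν n)),
      ‖P.ρ (k (ν n)) - 1‖⁻¹ • (P.ρ (k (ν n)) - 1))) h2 h1
  have hzero : Tendsto (fun n => p ((P.ρ g⁻¹).comp ((P.ρ (b (ν n))).comp
      ((‖P.ρ (k (ν n)) - 1‖⁻¹ • (P.ρ (k (ν n)) - 1)).comp P.ι.toContinuousLinearMap)))) atTop (𝓝 0) := by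
    have h1 : Tendsto (fun n : ℕ => 1 / (((ν n : ℕ) : ℝ) + 1) * (‖P.ι.toContinuousLinearMap‖)) atTop (𝓝 0) := by
      simpa using ((tendsto_one_div_add_atTop_nhds_zero_nat (𝕜 := ℝ)).comp
        hν.tendsto_atTop).mul_const ‖P.ι.toContinuousLinearMap‖
    refine squeeze_zero_norm (fun n => ?_) h1
    set τ := ‖P.ρ (k (ν n)) - 1‖ with hτ
    have hτ0 : 0 < τ := hk1 _
    have e : (P.ρ g⁻¹).comp ((P.ρ (b (ν n))).comp
        ((τ⁻¹ • (P.ρ (k (ν n)) - 1)).comp P.ι.toContinuousLinearMap)) =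
        τ⁻¹ • (P.ρ g⁻¹).comp (P.res (a (ν n)) - P.res (b (ν n))) := by
      rw [hdiff]; ext1 s; simp
    rw [e, map_smul, norm_smul, norm_inv, Real.norm_of_nonneg hτ0.le]
    have h2 := hab (ν n)
    have h3 : ‖P.res (a (ν n)) - P.res (b (ν n))‖ ≤ τ * ‖P.ι.toContinuousLinearMap‖ := by
      rw [hdiff]
      refine (ContinuousLinearMap.opNorm_comp_le _ _).trans ?_
      refine (mul_le_of_le_one_left (norm_nonneg _) (P.norm_le_one _)).trans ?_
      exact ContinuousLinearMap.opNorm_comp_le _ _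
    have hn : (0 : ℝ) < (ν n : ℝ) + 1 := by positivity
    rw [div_mul_eq_mul_div, one_mul, inv_mul_eq_div, div_le_div_iff₀ hτ0 hn]
    nlinarith
  have hfin := tendsto_nhds_unique hlim2 hzero
  have hmem : (P.ρ g⁻¹).comp ((P.ρ β).comp (X.comp P.ι.toContinuousLinearMap)) ∈ P.lieRes := by
    have h1 := P.mem_lieRes (P.lie_ad hXlie (g⁻¹ * β))
    convert h1 using 1
    ext1 s
    have h2 : P.ρ (g⁻¹ * β)⁻¹ (P.ι s) = P.ι s := by
      have h3 : P.ρ β (P.ι s) = P.ρ g (P.ι s) := DFunLike.congr_fun hβg s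
      have h4 : P.ρ (g⁻¹ * β) (P.ι s) = P.ι s := by rw [mul_apply, h3, inv_apply_self]
      conv_lhs => rw [← h4]
      simp
    change P.ρ g⁻¹ (P.ρ β (X (P.ι s))) = P.ρ (g⁻¹ * β) (X (P.ρ (g⁻¹ * β)⁻¹ (P.ι s)))
    rw [h2, mul_apply]
  have h1 := hp _ hmem hfin
  apply hXres
  ext1 s
  have h2 := DFunLike.congr_fun h1 s
  simp only [ContinuousLinearMap.comp_apply, ContinuousLinearMap.zero_apply] at h2 ⊢
  rw [← norm_eq_zero, P.isom, P.isom, norm_eq_zero] at h2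
  exact h2

theorem exists_lieRes_coord : ∃ p : (U →L[ℝ] V) →L[ℝ] (Fin (Module.finrank ℝ P.lieRes) → ℝ),
    ∀ Y ∈ P.lieRes, p Y = 0 → Y = 0 := by
  obtain ⟨q, hq⟩ := LinearMap.exists_leftInverse_of_injective P.lieRes.subtype
    (LinearMap.ker_eq_bot.2 P.lieRes.injective_subtype)
  let e := (Module.finBasis ℝ P.lieRes).equivFun
  refine ⟨LinearMap.toContinuousLinearMap (e.toLinearMap ∘ₗ q), fun Y hY h => ?_⟩
  have h1 : e (q Y) = 0 := h
  rw [LinearEquiv.map_eq_zero_iff] at h1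
  have h2 : q Y = ⟨Y, hY⟩ := LinearMap.congr_fun hq ⟨Y, hY⟩
  rw [h2] at h1
  exact congrArg Subtype.val h1

theorem finrank_le_add_of_coord {r : ℕ} (p : (U →L[ℝ] V) →L[ℝ] (Fin r → ℝ))
    (hp : ∀ Y ∈ P.lieRes, p Y = 0 → Y = 0) :
    Module.finrank ℝ V ≤ r + Module.finrank ℝ U := by
  let X : Set ((U →L[ℝ] V) × U) := Set.range P.res ×ˢ Set.univ
  have hproper : ProperSpace (U →L[ℝ] V) := FiniteDimensional.proper ℝ _
  have hproper2 : ProperSpace U := FiniteDimensional.proper ℝ _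
  have hX : dimH X ≤ ((r + Module.finrank ℝ U : ℕ) : ℝ≥0∞) := by
    by_contra! hlt
    obtain ⟨⟨_, u⟩, ⟨⟨g, rfl⟩, -⟩, hx⟩ := exists_mem_nhdsWithin_lt_dimH_of_lt_dimH hlt
    obtain ⟨C, ε, hε, hC⟩ := P.exists_local_bound p hp g
    let t : Set ((U →L[ℝ] V) × U) := X ∩ {y | ‖y.1 - P.res g‖ < ε}
    have ht : t ∈ 𝓝[X] (P.res g, u) := by
      refine Filter.inter_mem self_mem_nhdsWithin (mem_nhdsWithin_of_mem_nhds ?_)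
      refine IsOpen.mem_nhds ?_ (by simpa using hε)
      exact isOpen_lt (by fun_prop) continuous_const
    refine absurd (hx t ht) (not_lt.2 ?_)
    let q : (U →L[ℝ] V) →L[ℝ] (Fin r → ℝ) :=
      p.comp (ContinuousLinearMap.postcomp U (P.ρ g⁻¹))
    let f : t → (Fin r → ℝ) × U := fun y => (q y.1.1, y.1.2)
    have hf : AntilipschitzWith (max C 1).toNNReal f := by
      refine AntilipschitzWith.of_le_mul_dist ?_
      intro y y'
      obtain ⟨a, ha'⟩ := y.2.1.1
      obtain ⟨b, hb'⟩ := y'.2.1.1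
      have ha : ‖P.res a - P.res g‖ < ε := by rw [ha']; exact y.2.2
      have hb : ‖P.res b - P.res g‖ < ε := by rw [hb']; exact y'.2.2
      have h0 : (0 : ℝ) ≤ max C 1 := le_max_of_le_right zero_le_one
      rw [Real.coe_toNNReal _ h0, Subtype.dist_eq, Prod.dist_eq, Prod.dist_eq]
      refine max_le ?_ ?_
      · rw [dist_eq_norm]
        rw [← ha', ← hb']
        refine (hC a b ha hb).trans ?_
        refine mul_le_mul (le_max_left _ _) ?_ (norm_nonneg _) h0
        refine le_trans (le_of_eq ?_) (le_max_left _ _)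
        simp only [f, dist_eq_norm, ← map_sub, ← ha', ← hb']
        rfl
      · calc dist y.1.2 y'.1.2 ≤ 1 * dist y.1.2 y'.1.2 := by rw [one_mul]
          _ ≤ _ := mul_le_mul (le_max_right _ _) (le_max_right _ _) dist_nonneg h0
    calc dimH t = dimH ((↑) '' (Set.univ : Set t) : Set ((U →L[ℝ] V) × U)) := by
          rw [Set.image_univ, Subtype.range_coe]
      _ = dimH (Set.univ : Set t) := isometry_subtype_coe.dimH_image _
      _ ≤ dimH (f '' Set.univ) := hf.le_dimH_image _
      _ ≤ dimH (Set.univ : Set ((Fin r → ℝ) × U)) := dimH_mono (Set.subset_univ _)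
      _ = _ := by
        rw [Real.dimH_univ_eq_finrank]
        simp
  have himg : (fun y : (U →L[ℝ] V) × U => y.1 y.2) '' X = Set.univ := by
    refine Set.eq_univ_of_forall fun v => ?_
    obtain ⟨g, u, hgu⟩ := P.meets v
    exact ⟨(P.res g⁻¹, u), ⟨⟨_, rfl⟩, trivial⟩, by
      change P.ρ g⁻¹ (P.ι u) = v
      rw [← hgu]; simp⟩
  have hle : dimH ((fun y : (U →L[ℝ] V) × U => y.1 y.2) '' X) ≤ dimH X := by
    refine dimH_image_le_of_locally_lipschitzOn fun x _ => ?_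
    have hc : ContDiffAt ℝ 1 (fun y : (U →L[ℝ] V) × U => y.1 y.2) x :=
      contDiffAt_fst.clm_apply contDiffAt_snd
    obtain ⟨K, t, ht, hK⟩ := hc.exists_lipschitzOnWith
    exact ⟨K, t, mem_nhdsWithin_of_mem_nhds ht, hK⟩
  rw [himg, Real.dimH_univ_eq_finrank] at hle
  exact_mod_cast hle.trans hX

theorem finrank_le_lieRes_add :
    Module.finrank ℝ V ≤ Module.finrank ℝ P.lieRes + Module.finrank ℝ U := by
  obtain ⟨p, hp⟩ := P.exists_lieRes_coord
  exact P.finrank_le_add_of_coord p hp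

end PolarRep
end GeoDim

section GeoRoots
open Filter Topology

theorem exists_orthonormalBasis_joint {E : Type*} [NormedAddCommGroup E] [InnerProductSpace ℝ E]
    [FiniteDimensional ℝ E] {n : Type*} (T : n → E →ₗ[ℝ] E) (hs : ∀ i, (T i).IsSymmetric)
    (hc : ∀ i j, Commute (T i) (T j)) :
    ∃ (γ : Fin (Module.finrank ℝ E) → n → ℝ) (b : OrthonormalBasis (Fin (Module.finrank ℝ E)) ℝ E),
      ∀ i j, T j (b i) = γ i j • b i := by
  classical
  have hint := LinearMap.IsSymmetric.directSum_isInternal_of_pairwise_commute hs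
    (fun i j _ => hc i j)
  have horth := LinearMap.IsSymmetric.orthogonalFamily_iInf_eigenspaces hs
  have hfin : {χ : n → ℝ | (⨅ j, Module.End.eigenspace (T j) (χ j)) ≠ ⊥}.Finite :=
    WellFoundedGT.finite_ne_bot_of_iSupIndep hint.submodule_iSupIndep
  have hint2 := DirectSum.isInternal_ne_bot_iff.mpr hint
  let _ : Fintype {χ : n → ℝ // (⨅ j, Module.End.eigenspace (T j) (χ j)) ≠ ⊥} := hfin.fintype
  have horth2 := horth.comp (f := fun χ : {χ : n → ℝ // (⨅ j, Module.End.eigenspace (T j) (χ j)) ≠ ⊥} => χ.1)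
    Subtype.val_injective
  let b := hint2.subordinateOrthonormalBasis rfl horth2
  refine ⟨fun i => (hint2.subordinateOrthonormalBasisIndex rfl i horth2).1, b, fun i j => ?_⟩
  have := hint2.subordinateOrthonormalBasis_subordinate rfl i horth2
  simp only [Submodule.mem_iInf, Module.End.mem_eigenspace_iff] at this
  exact this j

variable {Γ : Type*} [Group Γ] [TopologicalSpace Γ] {V : Type*}
    [NormedAddCommGroup V] [InnerProductSpace ℝ V] [FiniteDimensional ℝ V] {U : Type*}
    [NormedAddCommGroup U] [InnerProductSpace ℝ U] [FiniteDimensional ℝ U]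

namespace PolarRep
variable (P : PolarRep Γ V U)

/-- The orthogonal complement of the section. -/
noncomputable def tan : Submodule ℝ V := (LinearMap.range P.ι.toLinearMap)ᗮ

theorem mem_tan {v : V} : v ∈ P.tan ↔ ∀ u, inner ℝ v (P.ι u) = 0 := by
  simp only [tan, Submodule.mem_orthogonal', LinearMap.mem_range]
  constructor
  · intro h u; exact h _ ⟨u, rfl⟩
  · rintro h _ ⟨u, rfl⟩; exact h u

/-- The orthogonal projection onto the section. -/
noncomputable def pr : V →L[ℝ] U := ContinuousLinearMap.adjoint P.ι.toContinuousLinearMap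

theorem inner_pr (v : V) (u : U) : inner ℝ (P.pr v) u = inner ℝ v (P.ι u) :=
  ContinuousLinearMap.adjoint_inner_left _ _ _

@[simp] theorem pr_ι (u : U) : P.pr (P.ι u) = u := by
  refine ext_inner_right ℝ fun w => ?_
  rw [inner_pr, P.ι.inner_map_map]

theorem mem_tan_iff_pr {v : V} : v ∈ P.tan ↔ P.pr v = 0 := by
  rw [mem_tan]
  constructor
  · intro h
    refine ext_inner_right ℝ fun w => ?_
    rw [inner_pr, h, inner_zero_left]
  · intro h u; rw [← inner_pr, h, inner_zero_left]

theorem finrank_tan : Module.finrank ℝ P.tan + Module.finrank ℝ U = Module.finrank ℝ V := by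
  have h := Submodule.finrank_add_finrank_orthogonal (LinearMap.range P.ι.toLinearMap)
  rw [LinearMap.finrank_range_of_inj P.ι.injective] at h
  rw [tan]; omega

variable [CompactSpace Γ] [IsTopologicalGroup Γ]

/-- Tangent space of the orbit through a vector. -/
noncomputable def orbT (v : V) : Submodule ℝ V :=
  P.lie.map (ContinuousLinearMap.apply ℝ V v).toLinearMap

theorem mem_orbT {v w : V} : w ∈ P.orbT v ↔ ∃ X ∈ P.lie, X v = w := Iff.rfl

theorem orbT_le_tan (s : U) : P.orbT (P.ι s) ≤ P.tan := by
  rintro w ⟨X, hX, rfl⟩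
  exact P.mem_tan.2 fun u => P.lie_orth hX s u

theorem exists_max_orbT : ∃ s0 : U, ∀ s : U,
    Module.finrank ℝ (P.orbT (P.ι s)) ≤ Module.finrank ℝ (P.orbT (P.ι s0)) := by
  have hb : ∃ B : ℕ, ∀ s : U, Module.finrank ℝ (P.orbT (P.ι s)) ≤ B :=
    ⟨_, fun s => Submodule.finrank_le _⟩
  have hne : ∃ n, ∃ s : U, Module.finrank ℝ (P.orbT (P.ι s)) = n := ⟨_, 0, rfl⟩
  obtain ⟨B, hB⟩ := hb
  classical
  have := Nat.findGreatest_spec (P := fun n => ∃ s : U, Module.finrank ℝ (P.orbT (P.ι s)) = n)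
    (hB 0) ⟨0, rfl⟩
  obtain ⟨s0, hs0⟩ := this
  refine ⟨s0, fun s => ?_⟩
  rw [hs0]
  exact Nat.le_findGreatest (hB s) ⟨s, rfl⟩

theorem lie_eq_zero_of_max {s0 : U} (h0 : ∀ s : U,
    Module.finrank ℝ (P.orbT (P.ι s)) ≤ Module.finrank ℝ (P.orbT (P.ι s0)))
    {X : V →L[ℝ] V} (hX : X ∈ P.lie) (hX0 : X (P.ι s0) = 0) (y : U) : X (P.ι y) = 0 := by
  by_contra hne
  let b := Module.finBasis ℝ (P.orbT (P.ι s0))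
  have hZ : ∀ i, ∃ Z ∈ P.lie, Z (P.ι s0) = (b i : V) := fun i => P.mem_orbT.1 (b i).2
  choose Z hZl hZ0 using hZ
  have hperp : ∀ Y ∈ P.lie, inner ℝ (X (P.ι y)) (Y (P.ι s0)) = 0 := by
    intro Y hY
    have h1 := P.lie_orth (P.lie_bracket hX hY) s0 y
    simp only [_root_.sub_apply, mul_apply_eq_comp, hX0, map_zero, sub_zero] at h1
    rw [P.lie_skew hX, real_inner_comm, ] 
    rw [h1, neg_zero]
  let f : ℝ → Option (Fin (Module.finrank ℝ (P.orbT (P.ι s0)))) → V := fun ε o =>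
    o.elim (X (P.ι y)) (fun i => Z i (P.ι (s0 + ε • y)))
  have hf0 : LinearIndependent ℝ (f 0) := by
    rw [linearIndependent_option]
    have hrange : f 0 ∘ ((↑) : _ → Option _) = fun i => (b i : V) := by
      funext i
      simp [f, hZ0]
    rw [hrange]
    refine ⟨b.linearIndependent.map' (Submodule.subtype _) (Submodule.ker_subtype _), fun hmem => ?_⟩
    have hsub : Submodule.span ℝ (Set.range fun i => (b i : V)) ≤ P.orbT (P.ι s0) := by
      refine Submodule.span_le.2 ?_
      rintro _ ⟨i, rfl⟩
      exact (b i).2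
    obtain ⟨Y, hY, hYx⟩ := P.mem_orbT.1 (hsub hmem)
    have h1 := hperp Y hY
    rw [hYx] at h1
    exact hne (inner_self_eq_zero.1 h1)
  have hfc : Continuous f := by
    refine continuous_pi fun o => ?_
    cases o
    · exact continuous_const
    · simp only [f, Option.elim]
      have := P.ι.continuous
      fun_prop
  have hopen := (isOpen_setOfPred_linearIndependent (𝕜 := ℝ) (E := V)
    (ι := Option (Fin (Module.finrank ℝ (P.orbT (P.ι s0)))))).preimage hfc
  obtain ⟨ε, hε, hε0⟩ : ∃ ε : ℝ, LinearIndependent ℝ (f ε) ∧ ε ≠ 0 := by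
    have h1 : ∀ᶠ ε in 𝓝[≠] (0 : ℝ), LinearIndependent ℝ (f ε) :=
      (IsOpen.mem_nhds hopen hf0 : _ ∈ 𝓝 (0 : ℝ)) |> fun h => mem_nhdsWithin_of_mem_nhds h
    obtain ⟨ε, h⟩ := (h1.and self_mem_nhdsWithin).exists
    exact ⟨ε, h⟩
  have hspan : Set.range (f ε) ⊆ P.orbT (P.ι (s0 + ε • y)) := by
    rintro _ ⟨o, rfl⟩
    cases o with
    | none =>
      refine ⟨ε⁻¹ • X, P.lie.smul_mem _ hX, ?_⟩
      simp [f, hX0, smul_smul, inv_mul_cancel₀ hε0]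
    | some i => exact ⟨Z i, hZl i, rfl⟩
  have hcard := finrank_span_eq_card hε
  have hle := Submodule.finrank_mono (Submodule.span_le.2 hspan)
  have := h0 (s0 + ε • y)
  simp only [Fintype.card_option, Fintype.card_fin] at hcard
  omega

theorem exists_orbT_eq_tan : ∃ s0 : U, P.orbT (P.ι s0) = P.tan ∧
    ∀ X ∈ P.lie, X (P.ι s0) = 0 → ∀ y, X (P.ι y) = 0 := by
  obtain ⟨s0, h0⟩ := P.exists_max_orbT
  have hz := fun (X : V →L[ℝ] V) (hX : X ∈ P.lie) (h : X (P.ι s0) = 0) =>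
    P.lie_eq_zero_of_max h0 hX h
  refine ⟨s0, ?_, hz⟩
  refine Submodule.eq_of_le_of_finrank_le (P.orbT_le_tan s0) ?_
  have h1 : Module.finrank ℝ P.lieRes ≤ Module.finrank ℝ (P.orbT (P.ι s0)) := by
    let F : P.lieRes →ₗ[ℝ] P.orbT (P.ι s0) :=
      ((ContinuousLinearMap.apply ℝ V s0).toLinearMap.comp P.lieRes.subtype).codRestrict _ (by
        rintro ⟨Y, X, hX, rfl⟩
        exact ⟨X, hX, rfl⟩)
    refine LinearMap.finrank_le_finrank_of_injective (f := F) ?_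
    rw [← LinearMap.ker_eq_bot, LinearMap.ker_eq_bot']
    rintro ⟨Y, X, hX, rfl⟩ h
    have h2 : X (P.ι s0) = 0 := congrArg Subtype.val h
    apply Subtype.ext
    ext1 y
    exact hz X hX h2 y
  have := P.finrank_le_lieRes_add
  have := P.finrank_tan
  omega

/-- The restricted roots of a polar representation, with adapted Lie algebra elements. -/
structure Roots where
  m : ℕ
  e : Fin m → V
  a : Fin m → U
  X : Fin m → V →L[ℝ] V
  s0 : U
  orth : Orthonormal ℝ e
  e_tan : ∀ i, e i ∈ P.tan
  decomp : ∀ v, v = P.ι (P.pr v) + ∑ i, (inner ℝ (e i) v : ℝ) • e i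
  X_lie : ∀ i, X i ∈ P.lie
  X_apply : ∀ i s, X i (P.ι s) = (inner ℝ (a i) s : ℝ) • e i
  a_s0 : ∀ i, inner ℝ (a i) s0 = 1
  lie_inner : ∀ Y ∈ P.lie, ∀ s i, inner ℝ (Y (P.ι s)) (e i) =
    inner ℝ (a i) s * inner ℝ (Y (P.ι s0)) (e i)

theorem exists_roots : Nonempty P.Roots := by
  obtain ⟨s0, h0, hz⟩ := P.exists_orbT_eq_tan
  have hex : ∀ τ : P.tan, ∃ X ∈ P.lie, X (P.ι s0) = τ := fun τ => h0.ge τ.2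
  choose Xf hXl hX0 using hex
  have hlin : ∀ Y ∈ P.lie, ∀ τ : P.tan, Y (P.ι s0) = τ → ∀ u, Y (P.ι u) = Xf τ (P.ι u) := by
    intro Y hY τ h u
    have := hz (Y - Xf τ) (P.lie.sub_mem hY (hXl τ)) (by simp [h, hX0]) u
    rwa [_root_.sub_apply, sub_eq_zero] at this
  let A : U → P.tan →ₗ[ℝ] P.tan := fun u =>
    { toFun := fun τ => ⟨Xf τ (P.ι u), P.orbT_le_tan u ⟨_, hXl τ, rfl⟩⟩
      map_add' := fun τ τ' => Subtype.ext
        (hlin (Xf τ + Xf τ') (P.lie.add_mem (hXl τ) (hXl τ')) (τ + τ') (by simp [hX0]) u).symm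
      map_smul' := fun c τ => Subtype.ext
        (hlin (c • Xf τ) (P.lie.smul_mem c (hXl τ)) (c • τ) (by simp [hX0]) u).symm }
  have hAc : ∀ u τ, (A u τ : V) = Xf τ (P.ι u) := fun _ _ => rfl
  have hcross : ∀ Y ∈ P.lie, ∀ Z ∈ P.lie, ∀ u u' : U,
      inner ℝ (Y (P.ι u)) (Z (P.ι u')) = inner ℝ (Z (P.ι u)) (Y (P.ι u')) := by
    intro Y hY Z hZ u u'
    have h1 := P.lie_orth (P.lie_bracket hY hZ) u u'
    have h2 : (Y * Z - Z * Y) (P.ι u) = Y (Z (P.ι u)) - Z (Y (P.ι u)) := rfl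
    rw [h2, inner_sub_left, P.lie_skew hY (Z _), P.lie_skew hZ (Y _)] at h1
    linarith
  have hsym : ∀ u, (A u).IsSymmetric := by
    intro u τ τ'
    change inner ℝ (A u τ : V) (τ' : V) = inner ℝ (τ : V) (A u τ' : V)
    rw [hAc, hAc, ← hX0 τ', hcross _ (hXl _) _ (hXl _), ← hX0 τ, real_inner_comm]
  have hcomm : ∀ u u', Commute (A u) (A u') := by
    intro u u'
    refine LinearMap.ext fun τ => ?_
    refine ext_inner_right ℝ fun τ' => ?_
    rw [Module.End.mul_apply, Module.End.mul_apply, hsym u (A u' τ) τ', hsym u' (A u τ) τ']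
    change inner ℝ (A u' τ : V) (A u τ' : V) = inner ℝ (A u τ : V) (A u' τ' : V)
    rw [hAc, hAc, hAc, hAc, hcross _ (hXl _) _ (hXl _), real_inner_comm]
  obtain ⟨γ, b, hb⟩ := exists_orthonormalBasis_joint A hsym hcomm
  have hXb : ∀ i u, Xf (b i) (P.ι u) = γ i u • (b i : V) := fun i u =>
    congrArg Subtype.val (hb i u)
  have hbn : ∀ i j, inner ℝ (b i : V) (b j : V) = if i = j then (1 : ℝ) else 0 := fun i j =>
    orthonormal_iff_ite.1 b.orthonormal i j
  have hγ : ∀ i u, γ i u = inner ℝ (P.pr (ContinuousLinearMap.adjoint (Xf (b i)) (b i : V))) u := by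
    intro i u
    rw [inner_pr, ContinuousLinearMap.adjoint_inner_left, hXb, inner_smul_right, hbn, if_pos rfl, mul_one]
  refine ⟨⟨_, fun i => b i, fun i => P.pr (ContinuousLinearMap.adjoint (Xf (b i)) (b i : V)),
    fun i => Xf (b i), s0, orthonormal_iff_ite.2 hbn, fun i => (b i).2, fun v => ?_, fun i => hXl _,
    fun i s => ?_, fun i => ?_, fun Y hY s i => ?_⟩⟩
  · have hmem : v - P.ι (P.pr v) ∈ P.tan := by
      rw [mem_tan_iff_pr, map_sub, pr_ι, sub_self]
    have h1 := congrArg Subtype.val (b.sum_repr' ⟨_, hmem⟩)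
    simp only [AddSubmonoidClass.coe_finsetSum, Submodule.coe_smul] at h1
    have h2 : ∀ i, inner ℝ (b i) (⟨_, hmem⟩ : P.tan) = inner ℝ (b i : V) v := by
      intro i
      change inner ℝ (b i : V) (v - P.ι (P.pr v)) = _
      rw [inner_sub_right, P.mem_tan.1 (b i).2, sub_zero]
    simp only [h2] at h1
    rw [h1]; abel
  · rw [← hγ, hXb]
  · rw [← hγ]
    have := hXb i s0
    rw [hX0] at this
    have h2 := congrArg (fun x => inner ℝ x (b i : V)) this
    simp only [inner_smul_left, hbn] at h2
    simpa using h2.symm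
  · have hYt : Y (P.ι s0) ∈ P.tan := P.orbT_le_tan s0 ⟨Y, hY, rfl⟩
    rw [hlin Y hY ⟨_, hYt⟩ rfl, ← hγ]
    have h1 := hsym s ⟨_, hYt⟩ (b i)
    change inner ℝ (A s ⟨_, hYt⟩ : V) (b i : V) = inner ℝ (Y (P.ι s0)) (A s (b i) : V) at h1
    rw [hAc] at h1
    rw [h1, hAc, hXb, inner_smul_right]

end PolarRep
end GeoRoots

section GeoWeyl
open Filter Topology

variable {Γ : Type*} [Group Γ] [TopologicalSpace Γ] {V : Type*}
    [NormedAddCommGroup V] [InnerProductSpace ℝ V] [FiniteDimensional ℝ V] {U : Type*}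
    [NormedAddCommGroup U] [InnerProductSpace ℝ U] [FiniteDimensional ℝ U]

namespace PolarRep
variable (P : PolarRep Γ V U)

/-- The generalized Weyl group acting on the section. -/
def weyl : Subgroup (U ≃ₗᵢ[ℝ] U) where
  carrier := {w | ∃ g, ∀ s, P.ρ g (P.ι s) = P.ι (w s)}
  one_mem' := ⟨1, fun s => by simp⟩
  mul_mem' := by
    rintro w w' ⟨g, hg⟩ ⟨g', hg'⟩
    exact ⟨g * g', fun s => by rw [mul_apply, hg', hg]; rfl⟩
  inv_mem' := by
    rintro w ⟨g, hg⟩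
    refine ⟨g⁻¹, fun s => ?_⟩
    have := hg (w⁻¹ s)
    rw [show w (w⁻¹ s) = s from w.apply_symm_apply s] at this
    rw [← this, inv_apply_self]

theorem mem_weyl {w : U ≃ₗᵢ[ℝ] U} : w ∈ P.weyl ↔ ∃ g, ∀ s, P.ρ g (P.ι s) = P.ι (w s) := Iff.rfl

theorem exists_weyl_of_preserve {g : Γ} (h : ∀ s, P.ρ g (P.ι s) = P.ι (P.pr (P.ρ g (P.ι s)))) :
    ∃ w ∈ P.weyl, ∀ s, P.ρ g (P.ι s) = P.ι (w s) := by
  let f : U →ₗᵢ[ℝ] U :=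
    { toLinearMap := (P.pr.comp ((P.ρ g).comp P.ι.toContinuousLinearMap)).toLinearMap
      norm_map' := fun s => by
        change ‖P.pr (P.ρ g (P.ι s))‖ = ‖s‖
        rw [← P.ι.norm_map, ← h, P.isom, P.ι.norm_map] }
  exact ⟨f.toLinearIsometryEquiv rfl, ⟨g, h⟩, h⟩

variable [CompactSpace Γ] [IsTopologicalGroup Γ]

theorem eq_ι_pr_iff {R : P.Roots} {v : V} : v = P.ι (P.pr v) ↔ ∀ i, inner ℝ (R.e i) v = (0 : ℝ) := by
  constructor
  · intro h i
    rw [h]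
    exact P.mem_tan.1 (R.e_tan i) _
  · intro h
    conv_lhs => rw [R.decomp v]
    simp [h]

theorem inner_eq_zero_of_isLocalExtr {X : V →L[ℝ] V} {y z : V}
    (h : IsLocalExtr (fun t : ℝ => (inner ℝ (NormedSpace.exp (t • X) y) z : ℝ)) 0) :
    inner ℝ (X y) z = (0 : ℝ) := by
  have h1 := (lie_curve_hasDerivAt X y).inner ℝ (hasDerivAt_const (0 : ℝ) z)
  simpa using h.hasDerivAt_eq_zero h1

theorem inner_lie_of_fix {g : Γ} {s t : U} (hg : P.ρ g (P.ι t) = P.ι s) {X : V →L[ℝ] V}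
    (hX : X ∈ P.lie) (u : U) : inner ℝ (P.ρ g (P.ι u)) (X (P.ι s)) = (0 : ℝ) := by
  have h1 := P.lie_orth (P.lie_ad hX g⁻¹) t u
  have h2 : (P.ρ g⁻¹ * X * P.ρ g⁻¹⁻¹) (P.ι t) = P.ρ g⁻¹ (X (P.ι s)) := by
    rw [inv_inv, ← hg]; rfl
  rw [h2] at h1
  rw [← P.inner_map g, apply_inv_self, real_inner_comm] at h1
  exact h1

theorem exists_weyl_of_orbit (R : P.Roots) {g : Γ} {s t : U} (hg : P.ρ g (P.ι s) = P.ι t) :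
    ∃ w ∈ P.weyl, w s = t := by
  have hK : IsClosed {h : Γ | P.ρ h (P.ι t) = P.ι t} :=
    isClosed_eq (P.cont.clm_apply continuous_const) continuous_const
  have hc : Continuous fun h : Γ => (inner ℝ (P.ρ h (P.ρ g (P.ι R.s0))) (P.ι R.s0) : ℝ) :=
    (P.cont.clm_apply continuous_const).inner continuous_const
  obtain ⟨h, hh, hmax⟩ := hK.isCompact.exists_isMaxOn ⟨1, by simp⟩ hc.continuousOn
  have hcrit : ∀ X ∈ P.lie, X (P.ι t) = 0 →
      inner ℝ (X (P.ρ h (P.ρ g (P.ι R.s0)))) (P.ι R.s0) = (0 : ℝ) := by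
    intro X hX hX0
    refine inner_eq_zero_of_isLocalExtr (Or.inr ?_)
    refine Eventually.of_forall fun τ => ?_
    obtain ⟨k, hk⟩ := hX τ
    simp only []
    rw [← hk]
    have := hmax (show k * h ∈ {h : Γ | P.ρ h (P.ι t) = P.ι t} by
      change P.ρ (k * h) (P.ι t) = P.ι t
      rw [mul_apply, hh, hk, exp_apply_eq_self hX0])
    simpa [mul_apply] using this
  have hks : P.ρ (h * g) (P.ι s) = P.ι t := by rw [mul_apply, hg, hh]
  have hy : P.ρ (h * g) (P.ι R.s0) = P.ι (P.pr (P.ρ (h * g) (P.ι R.s0))) := by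
    refine (P.eq_ι_pr_iff (R := R)).2 fun i => ?_
    by_cases hi : inner ℝ (R.a i) t = (0 : ℝ)
    · have := hcrit _ (R.X_lie i) (by rw [R.X_apply, hi, zero_smul])
      rw [P.lie_skew (R.X_lie i), R.X_apply, R.a_s0, one_smul, ← mul_apply, neg_eq_zero] at this
      rw [real_inner_comm]; exact this
    · have := P.inner_lie_of_fix hks (R.X_lie i) R.s0
      rw [R.X_apply, inner_smul_right] at this
      rw [real_inner_comm]
      exact (mul_eq_zero.1 this).resolve_left hi
  have hpres : ∀ u, P.ρ (h * g) (P.ι u) = P.ι (P.pr (P.ρ (h * g) (P.ι u))) := by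
    intro u
    have hle : P.tan.map (P.ρ (h * g)).toLinearMap ≤ P.tan := by
      rintro _ ⟨τ, hτ, rfl⟩
      have hτ2 : τ = (∑ i, (inner ℝ (R.e i) τ : ℝ) • R.X i) (P.ι R.s0) := by
        conv_lhs => rw [R.decomp τ]
        rw [P.mem_tan_iff_pr.1 hτ]
        simp [R.X_apply, R.a_s0]
      have hZ : ∑ i, (inner ℝ (R.e i) τ : ℝ) • R.X i ∈ P.lie :=
        Submodule.sum_mem _ fun i _ => P.lie.smul_mem _ (R.X_lie i)
      generalize ∑ i, (inner ℝ (R.e i) τ : ℝ) • R.X i = Z at hτ2 hZ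
      refine P.mem_tan.2 fun u' => ?_
      have h1 := P.lie_orth (P.lie_ad hZ (h * g)) (P.pr (P.ρ (h * g) (P.ι R.s0))) u'
      rw [← hy] at h1
      have h2 : (P.ρ (h * g) * Z * P.ρ (h * g)⁻¹) (P.ρ (h * g) (P.ι R.s0)) = P.ρ (h * g) τ := by
        rw [hτ2]
        change P.ρ (h * g) (Z (P.ρ (h * g)⁻¹ (P.ρ (h * g) (P.ι R.s0)))) = _
        rw [inv_apply_self]
      rw [h2] at h1
      exact h1
    have heq : P.tan.map (P.ρ (h * g)).toLinearMap = P.tan := by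
      refine Submodule.eq_of_le_of_finrank_le hle (le_of_eq ?_)
      refine (LinearEquiv.finrank_eq (Submodule.equivMapOfInjective (P.ρ (h * g)).toLinearMap
        (fun x y hxy => ?_) P.tan))
      have h3 := congrArg (P.ρ (h * g)⁻¹) hxy
      simpa using h3
    refine (P.eq_ι_pr_iff (R := R)).2 fun i => ?_
    obtain ⟨τ, hτ, hτe⟩ := heq.ge (R.e_tan i)
    rw [← hτe]
    change inner ℝ (P.ρ (h * g) τ) _ = _
    rw [P.inner_map]
    exact P.mem_tan.1 hτ u
  obtain ⟨w, hw, hws⟩ := P.exists_weyl_of_preserve hpres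
  refine ⟨w, hw, P.ι.injective ?_⟩
  rw [← hws, hks]

theorem exists_weyl_reflection (R : P.Roots) (i : Fin R.m) :
    ∃ w ∈ P.weyl, ∀ s, w s = s - (2 * inner ℝ (R.a i) s / ‖R.a i‖ ^ 2) • R.a i := by
  set u := R.a i with hu
  have hune : u ≠ 0 := by
    intro h
    have := R.a_s0 i
    rw [← hu, h, inner_zero_left] at this
    exact zero_ne_one this
  have hun : ‖u‖ ^ 2 ≠ 0 := by simpa using hune
  have hK : IsClosed {h : Γ | ∀ σ, inner ℝ u σ = (0 : ℝ) → P.ρ h (P.ι σ) = P.ι σ} := by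
    simp only [Set.ofPred_forall]
    exact isClosed_iInter fun σ => isClosed_iInter fun _ =>
      isClosed_eq (P.cont.clm_apply continuous_const) continuous_const
  have hc : Continuous fun h : Γ => (inner ℝ (P.ρ h (P.ι u)) (P.ι u) : ℝ) :=
    (P.cont.clm_apply continuous_const).inner continuous_const
  obtain ⟨h, hh, hmin⟩ := hK.isCompact.exists_isMinOn ⟨1, by simp⟩ hc.continuousOn
  have hexp : ∀ X ∈ P.lie, (∀ σ, inner ℝ u σ = (0 : ℝ) → X (P.ι σ) = 0) → ∀ τ : ℝ,
      (inner ℝ (P.ρ h (P.ι u)) (P.ι u) : ℝ) ≤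
        inner ℝ (NormedSpace.exp (τ • X) (P.ρ h (P.ι u))) (P.ι u) := by
    intro X hX hX0 τ
    obtain ⟨k, hk⟩ := hX τ
    rw [← hk]
    have := hmin (show k * h ∈ {h : Γ | ∀ σ, inner ℝ u σ = (0 : ℝ) → P.ρ h (P.ι σ) = P.ι σ} by
      intro σ hσ
      rw [mul_apply, hh σ hσ, hk, exp_apply_eq_self (hX0 σ hσ)])
    simpa [mul_apply] using this
  have hcrit : ∀ X ∈ P.lie, (∀ σ, inner ℝ u σ = (0 : ℝ) → X (P.ι σ) = 0) →
      inner ℝ (X (P.ρ h (P.ι u))) (P.ι u) = (0 : ℝ) := by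
    intro X hX hX0
    refine inner_eq_zero_of_isLocalExtr (Or.inl ?_)
    refine Eventually.of_forall fun τ => ?_
    simpa using hexp X hX hX0 τ
  have hy : P.ρ h (P.ι u) = P.ι (P.pr (P.ρ h (P.ι u))) := by
    refine (P.eq_ι_pr_iff (R := R)).2 fun j => ?_
    rw [real_inner_comm]
    by_cases hj : ∀ σ, inner ℝ u σ = (0 : ℝ) → inner ℝ (R.a j) σ = (0 : ℝ)
    · have := hcrit _ (R.X_lie j) fun σ hσ => by rw [R.X_apply, hj σ hσ, zero_smul]
      rw [P.lie_skew (R.X_lie j), R.X_apply, inner_smul_right, neg_eq_zero] at this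
      refine (mul_eq_zero.1 this).resolve_left fun h0 => ?_
      have h1 := hj (R.s0 - (1 / ‖u‖ ^ 2) • u) (by
        rw [inner_sub_right, inner_smul_right, real_inner_self_eq_norm_sq, R.a_s0]
        field_simp
        simp)
      rw [inner_sub_right, inner_smul_right, h0, R.a_s0] at h1
      norm_num at h1
    · push Not at hj
      obtain ⟨σ, hσ, hjσ⟩ := hj
      have := P.inner_lie_of_fix (hh σ hσ) (R.X_lie j) u
      rw [R.X_apply, inner_smul_right] at this
      exact (mul_eq_zero.1 this).resolve_left hjσ
  set u' := P.pr (P.ρ h (P.ι u)) with hu'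
  have hperp : ∀ σ, inner ℝ u σ = (0 : ℝ) → inner ℝ u' σ = (0 : ℝ) := by
    intro σ hσ
    rw [← P.ι.inner_map_map, ← hy, ← hh σ hσ, P.inner_map, P.ι.inner_map_map, hσ]
  obtain ⟨c, hc⟩ : ∃ c : ℝ, u' = c • u := by
    refine ⟨inner ℝ u u' / ‖u‖ ^ 2, ?_⟩
    rw [← sub_eq_zero, ← inner_self_eq_zero (𝕜 := ℝ)]
    have h1 : inner ℝ u (u' - (inner ℝ u u' / ‖u‖ ^ 2) • u) = (0 : ℝ) := by
      rw [inner_sub_right, inner_smul_right, real_inner_self_eq_norm_sq]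
      field_simp
      ring
    rw [inner_sub_left, inner_smul_left, h1, hperp _ h1]
    simp
  have hnorm : ‖u'‖ = ‖u‖ := by rw [← P.ι.norm_map, ← hy, P.isom, P.ι.norm_map]
  have hc1 : c = 1 ∨ c = -1 := by
    rw [hc, norm_smul, Real.norm_eq_abs] at hnorm
    have : |c| = 1 := by
      have h2 : ‖u‖ ≠ 0 := norm_ne_zero_iff.2 hune
      exact mul_right_cancel₀ h2 (by rw [hnorm, one_mul])
    rcases abs_cases c with ⟨h1, _⟩ | ⟨h1, _⟩ <;> [left; right] <;> linarith
  have hcm : c = -1 := by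
    refine hc1.resolve_left fun h1 => ?_
    rw [h1, one_smul] at hc
    have hX0 : ∀ σ, inner ℝ u σ = (0 : ℝ) → R.X i (P.ι σ) = 0 := fun σ hσ => by
      rw [R.X_apply, ← hu, hσ, zero_smul]
    have hfix : ∀ τ : ℝ, NormedSpace.exp (τ • R.X i) (P.ι u) = P.ι u := by
      intro τ
      have h2 := hexp _ (R.X_lie i) hX0 τ
      rw [hy, hc, real_inner_self_eq_norm_sq] at h2
      obtain ⟨k, hk⟩ := (R.X_lie i) τ
      rw [← hk] at h2 ⊢
      rw [← sub_eq_zero, ← norm_eq_zero, ← sq_eq_zero_iff]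
      have h3 := norm_sub_sq_real (P.ρ k (P.ι u)) (P.ι u)
      rw [P.isom] at h3
      nlinarith [sq_nonneg ‖P.ρ k (P.ι u) - P.ι u‖]
    have hd := lie_curve_hasDerivAt (R.X i) (P.ι u)
    simp only [hfix] at hd
    have h4 := hd.unique (hasDerivAt_const _ _)
    rw [R.X_apply, ← hu, real_inner_self_eq_norm_sq, smul_eq_zero] at h4
    exact h4.elim hun (R.orth.ne_zero i)
  have hform : ∀ s, P.ρ h (P.ι s) = P.ι (s - (2 * inner ℝ u s / ‖u‖ ^ 2) • u) := by
    intro s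
    have hσ : inner ℝ u (s - (inner ℝ u s / ‖u‖ ^ 2) • u) = (0 : ℝ) := by
      rw [inner_sub_right, inner_smul_right, real_inner_self_eq_norm_sq]
      field_simp
      ring
    have h1 := hh _ hσ
    rw [map_sub, map_smul, map_sub, map_smul, hy, hc, hcm, sub_eq_iff_eq_add] at h1
    rw [h1, map_sub, map_smul, map_smul]
    module
  obtain ⟨w, hw, hws⟩ := P.exists_weyl_of_preserve (g := h) fun s => by rw [hform, pr_ι]
  exact ⟨w, hw, fun s => P.ι.injective (by rw [← hws, hform])⟩

end PolarRep
end GeoWeyl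

section DirDeriv
open scoped ContDiff
variable {E : Type*} [NormedAddCommGroup E] [NormedSpace ℝ E]
  {F : Type*} [NormedAddCommGroup F] [NormedSpace ℝ F]
  {F' : Type*} [NormedAddCommGroup F'] [NormedSpace ℝ F']
  {E' : Type*} [NormedAddCommGroup E'] [NormedSpace ℝ E']

theorem dirD_contDiff {f : E → F} (hf : ContDiff ℝ ∞ f) (v : E) : ContDiff ℝ ∞ (dirD v f) :=
  (hf.fderiv_right (by simp)).clm_apply contDiff_const

theorem contDiff_diff {f : E → F} (hf : ContDiff ℝ ∞ f) : Differentiable ℝ f :=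
  hf.differentiable (by simp)

theorem dirD_add_left (a b : E) (f : E → F) (x : E) : dirD (a + b) f x = dirD a f x + dirD b f x :=
  map_add _ _ _

theorem dirD_smul_left (c : ℝ) (a : E) (f : E → F) (x : E) : dirD (c • a) f x = c • dirD a f x :=
  map_smul _ _ _

theorem dirD_sum_left {κ : Type*} (s : Finset κ) (a : κ → E) (f : E → F) (x : E) :
    dirD (∑ i ∈ s, a i) f x = ∑ i ∈ s, dirD (a i) f x :=
  map_sum _ _ _

theorem dirD_clm {f : E → F} (hf : ContDiff ℝ ∞ f) (L : F →L[ℝ] F') (v x : E) :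
    dirD v (fun x => L (f x)) x = L (dirD v f x) := by
  have := (L.hasFDerivAt.comp x (contDiff_diff hf x).hasFDerivAt).fderiv
  simp only [dirD]
  rw [show (fun x => L (f x)) = L ∘ f from rfl, this]; rfl

theorem dirD_comp {f : E → F} (hf : ContDiff ℝ ∞ f) (A : E' →L[ℝ] E) (v x : E') :
    dirD v (fun x => f (A x)) x = dirD (A v) f (A x) := by
  have := ((contDiff_diff hf (A x)).hasFDerivAt.comp x A.hasFDerivAt).fderiv
  simp only [dirD]
  rw [show (fun x => f (A x)) = f ∘ A from rfl, this]; rfl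

theorem dirD_add {f g : E → F} (hf : ContDiff ℝ ∞ f) (hg : ContDiff ℝ ∞ g) (v x : E) :
    dirD v (fun x => f x + g x) x = dirD v f x + dirD v g x := by
  simp only [dirD]
  rw [fderiv_fun_add (contDiff_diff hf x) (contDiff_diff hg x)]; rfl

theorem dirD_sum {κ : Type*} {s : Finset κ} {f : κ → E → F} (hf : ∀ i, ContDiff ℝ ∞ (f i)) (v x : E) :
    dirD v (fun x => ∑ i ∈ s, f i x) x = ∑ i ∈ s, dirD v (f i) x := by
  simp only [dirD]
  rw [fderiv_fun_sum fun i _ => contDiff_diff (hf i) x]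
  simp

theorem dirD_const_smul {f : E → F} (hf : ContDiff ℝ ∞ f) (c : ℝ) (v x : E) :
    dirD v (fun x => c • f x) x = c • dirD v f x := by
  simp only [dirD]
  rw [fderiv_fun_const_smul (contDiff_diff hf x)]; rfl

theorem dirD_dirD {f : E → F} (hf : ContDiff ℝ ∞ f) (a b x : E) :
    dirD a (dirD b f) x = fderiv ℝ (fderiv ℝ f) x a b := by
  have h : ContDiff ℝ ∞ (fderiv ℝ f) := hf.fderiv_right (by simp)
  exact dirD_clm h (ContinuousLinearMap.apply ℝ F b) a x

theorem dirD_eq_of_eq {f g : E → F} (h : ∀ x, f x = g x) (v x : E) : dirD v f x = dirD v g x := by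
  rw [funext h]

theorem dirD_zero (v x : E) : dirD v (fun _ : E => (0 : F)) x = 0 := by simp [dirD]

end DirDeriv

section Lap
open scoped ContDiff
variable {E : Type*} [NormedAddCommGroup E] [InnerProductSpace ℝ E] [FiniteDimensional ℝ E]
  {F : Type*} [NormedAddCommGroup F] [NormedSpace ℝ F]
  {F' : Type*} [NormedAddCommGroup F'] [NormedSpace ℝ F']

/-- Laplacian as a sum of second directional derivatives. -/
noncomputable def lap (f : E → F) : E → F := fun x =>
  ∑ i, dirD (stdOrthonormalBasis ℝ E i) (dirD (stdOrthonormalBasis ℝ E i) f) x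

theorem lap_eq {κ : Type*} [Fintype κ] (b : OrthonormalBasis κ ℝ E) {f : E → F}
    (hf : ContDiff ℝ ∞ f) (x : E) : lap f x = ∑ i, dirD (b i) (dirD (b i) f) x := by
  have h1 : lap f x = Laplacian.laplacian f x := by
    rw [InnerProductSpace.laplacian_eq_iteratedFDeriv_orthonormalBasis f (stdOrthonormalBasis ℝ E)]
    refine Finset.sum_congr rfl fun i _ => ?_
    rw [dirD_dirD hf, iteratedFDeriv_two_apply]
    simp
  rw [h1, InnerProductSpace.laplacian_eq_iteratedFDeriv_orthonormalBasis f b]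
  refine Finset.sum_congr rfl fun i _ => ?_
  rw [dirD_dirD hf, iteratedFDeriv_two_apply]
  simp

theorem lap_contDiff {f : E → F} (hf : ContDiff ℝ ∞ f) : ContDiff ℝ ∞ (lap f) :=
  ContDiff.sum fun _ _ => dirD_contDiff (dirD_contDiff hf _) _

theorem lap_clm {f : E → F} (hf : ContDiff ℝ ∞ f) (L : F →L[ℝ] F') (x : E) :
    lap (fun x => L (f x)) x = L (lap f x) := by
  simp only [lap, map_sum]
  refine Finset.sum_congr rfl fun i _ => ?_
  rw [← dirD_clm (dirD_contDiff hf _)]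
  exact dirD_eq_of_eq (fun y => dirD_clm hf L _ y) _ _

theorem lap_comp_isometry {f : E → F} (hf : ContDiff ℝ ∞ f) (g : E ≃ₗᵢ[ℝ] E) (x : E) :
    lap (fun x => f (g x)) x = lap f (g x) := by
  rw [lap_eq ((stdOrthonormalBasis ℝ E).map g) hf, lap]
  refine Finset.sum_congr rfl fun i _ => ?_
  let A : E →L[ℝ] E := g.toContinuousLinearEquiv.toContinuousLinearMap
  have h1 := dirD_comp (dirD_contDiff hf (A (stdOrthonormalBasis ℝ E i))) A (stdOrthonormalBasis ℝ E i) x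
  exact (dirD_eq_of_eq (fun y => dirD_comp hf A _ y) _ _).trans h1

theorem homFun_lap {k : ℕ} {f : E → F} (hf : f ∈ homFun E F (k + 2)) : lap f ∈ homFun E F k := by
  have : lap f = ∑ i, dirD (stdOrthonormalBasis ℝ E i) (dirD (stdOrthonormalBasis ℝ E i) f) := by
    funext x; simp [lap]
  rw [this]
  exact Submodule.sum_mem _ fun i _ => homFun_dirD (homFun_dirD hf _) _

theorem homFun_lap_zero {k : ℕ} (hk : k < 2) {f : E → F} (hf : f ∈ homFun E F k) : lap f = 0 := by
  funext x
  simp only [lap]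
  refine Finset.sum_eq_zero fun i _ => ?_
  interval_cases k
  · rw [homFun_dirD_zero hf]; exact dirD_zero _ _
  · rw [homFun_dirD_zero (homFun_dirD hf _)]; rfl

end Lap

section Alt
variable {E : Type*} [NormedAddCommGroup E] [NormedSpace ℝ E] {p : ℕ}

instance alt_finiteDimensional [FiniteDimensional ℝ E] :
    FiniteDimensional ℝ (E [⋀^Fin p]→L[ℝ] ℝ) := by
  let L : (E [⋀^Fin p]→L[ℝ] ℝ) →ₗ[ℝ] MultilinearMap ℝ (fun _ : Fin p => E) ℝ :=
    { toFun := fun A => A.toMultilinearMap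
      map_add' := fun _ _ => rfl
      map_smul' := fun _ _ => rfl }
  exact FiniteDimensional.of_injective L fun A B h => by
    ext v
    exact congrArg (fun f : MultilinearMap ℝ (fun _ : Fin p => E) ℝ => f v) h

open Function in
theorem alt_update_shift (A : E [⋀^Fin p]→L[ℝ] ℝ) (s : Fin p → E) (c : Fin p → ℝ) (u : E)
    (a : Fin p) (J : Finset (Fin p)) (ha : a ∉ J) :
    A (update (fun b => if b ∈ J then s b + c b • u else s b) a u) = A (update s a u) := by
  induction J using Finset.induction_on with
  | empty => simp
  | insert b J hb ih =>
    have hab : a ≠ b := fun h => ha (h ▸ Finset.mem_insert_self _ _)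
    rw [← ih fun h => ha (Finset.mem_insert_of_mem h)]
    set w : Fin p → E := fun d => if d ∈ J then s d + c d • u else s d with hw
    have h1 : (fun d => if d ∈ insert b J then s d + c d • u else s d) =
        update w b (w b + c b • u) := by
      funext d
      by_cases hd : d = b
      · subst hd; simp [hw, hb]
      · simp [hw, Finset.mem_insert, hd]
    rw [h1, update_comm hab.symm, A.map_update_add, A.map_update_smul]
    have h2 : A (update (update w a u) b u) = 0 := by
      refine A.map_eq_zero_of_eq _ (i := a) (j := b) ?_ hab
      simp [hab]
    rw [h2, smul_zero, add_zero]
    congr 1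
    funext d
    by_cases hd : d = b
    · subst hd; simp [update_of_ne hab.symm]
    · simp [hd]

open Function in
theorem alt_add_smul (A : E [⋀^Fin p]→L[ℝ] ℝ) (s : Fin p → E) (c : Fin p → ℝ) (u : E) :
    A (fun b => s b + c b • u) = A s + ∑ a, c a * A (update s a u) := by
  have key : ∀ J : Finset (Fin p), A (fun b => if b ∈ J then s b + c b • u else s b) =
      A s + ∑ a ∈ J, c a * A (update s a u) := by
    intro J
    induction J using Finset.induction_on with
    | empty => simp
    | insert b J hb ih =>
      set w : Fin p → E := fun d => if d ∈ J then s d + c d • u else s d with hw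
      have h1 : (fun d => if d ∈ insert b J then s d + c d • u else s d) =
          update w b (w b + c b • u) := by
        funext d
        by_cases hd : d = b
        · subst hd; simp [hw, hb]
        · simp [hw, Finset.mem_insert, hd]
      rw [h1, A.map_update_add, A.map_update_smul, update_eq_self, ih, Finset.sum_insert hb,
        alt_update_shift A s c u b J hb, smul_eq_mul]
      ring
  simpa using key Finset.univ

end Alt

section ApplyDeriv
open scoped ContDiff
variable {E : Type*} [NormedAddCommGroup E] [NormedSpace ℝ E]
  {F : Type*} [NormedAddCommGroup F] [NormedSpace ℝ F]
  {F' : Type*} [NormedAddCommGroup F'] [NormedSpace ℝ F']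

theorem dirD_clm_apply {L : E → F →L[ℝ] F'} {g : E → F} (hL : ContDiff ℝ ∞ L)
    (hg : ContDiff ℝ ∞ g) (b x : E) :
    dirD b (fun y => L y (g y)) x = dirD b L x (g x) + L x (dirD b g x) := by
  have := ((contDiff_diff hL x).hasFDerivAt.clm_apply (contDiff_diff hg x).hasFDerivAt).fderiv
  simp only [dirD]
  rw [this]
  simp [add_comm]

theorem dirD_clm_self (A : E →L[ℝ] F) (b x : E) : dirD b (fun y => A y) x = A b := by
  simp [dirD]

/-- Evaluation of alternating maps on a fixed tuple. -/
noncomputable def altEval {p : ℕ} (v : Fin p → E) : (E [⋀^Fin p]→L[ℝ] ℝ) →L[ℝ] ℝ :=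
  ContinuousAlternatingMap.apply ℝ E ℝ v

@[simp] theorem altEval_apply {p : ℕ} (v : Fin p → E) (A : E [⋀^Fin p]→L[ℝ] ℝ) :
    altEval v A = A v := rfl

theorem dirD_altEval {p : ℕ} {Q : E → F [⋀^Fin p]→L[ℝ] ℝ} (hQ : ContDiff ℝ ∞ Q) (b : E)
    (v : Fin p → F) (x : E) : dirD b (fun y => Q y v) x = dirD b Q x v :=
  dirD_clm hQ (altEval v) b x

end ApplyDeriv

section Slot
variable {E : Type*} [NormedAddCommGroup E] [NormedSpace ℝ E] [FiniteDimensional ℝ E] {p : ℕ}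

open Function in
/-- `A ↦ (y ↦ A (v with the a-th entry replaced by X y))`. -/
noncomputable def slotL (v : Fin p → E) (a : Fin p) (X : E →L[ℝ] E) :
    (E [⋀^Fin p]→L[ℝ] ℝ) →L[ℝ] (E →L[ℝ] ℝ) :=
  LinearMap.toContinuousLinearMap
    { toFun := fun A => LinearMap.toContinuousLinearMap
        { toFun := fun y => A (update v a (X y))
          map_add' := fun y z => by rw [map_add, A.map_update_add]
          map_smul' := fun c y => by rw [map_smul, A.map_update_smul]; rfl }
      map_add' := fun A B => by ext; rfl
      map_smul' := fun c A => by ext; rfl }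

open Function in
@[simp] theorem slotL_apply (v : Fin p → E) (a : Fin p) (X : E →L[ℝ] E) (A : E [⋀^Fin p]→L[ℝ] ℝ)
    (y : E) : slotL v a X A y = A (update v a (X y)) := rfl

end Slot

namespace PolarRep
open scoped ContDiff
open Function
variable {Γ : Type*} [Group Γ] [TopologicalSpace Γ] {V : Type*}
    [NormedAddCommGroup V] [InnerProductSpace ℝ V] [FiniteDimensional ℝ V] {U : Type*}
    [NormedAddCommGroup U] [InnerProductSpace ℝ U] [FiniteDimensional ℝ U]
variable (P : PolarRep Γ V U) {p : ℕ}

/-- Smooth, invariant and horizontal `p`-forms. -/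
structure Basic (Q : V → V [⋀^Fin p]→L[ℝ] ℝ) : Prop where
  smooth : ContDiff ℝ ∞ Q
  inv : ∀ g x v, Q (P.ρ g x) (fun i => P.ρ g (v i)) = Q x v
  hor : ∀ s v a, v a ∈ P.tan → Q (P.ι s) v = 0

variable {P} [CompactSpace Γ] [IsTopologicalGroup Γ]

namespace Roots
variable (R : P.Roots)

theorem orthonormal_sum : Orthonormal ℝ
    (Sum.elim (fun j => P.ι (stdOrthonormalBasis ℝ U j)) R.e) := by
  rw [orthonormal_iff_ite]
  have h1 := orthonormal_iff_ite.1 (stdOrthonormalBasis ℝ U).orthonormal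
  have h2 := orthonormal_iff_ite.1 R.orth
  rintro (i | i) (j | j)
  · simp [P.ι.inner_map_map, h1]
  · simp only [Sum.elim_inl, Sum.elim_inr, reduceCtorEq, if_false]
    rw [real_inner_comm]; exact P.mem_tan.1 (R.e_tan j) _
  · simp only [Sum.elim_inl, Sum.elim_inr, reduceCtorEq, if_false]
    exact P.mem_tan.1 (R.e_tan i) _
  · simp [h2]

/-- The adapted orthonormal basis of `V`. -/
noncomputable def basis : OrthonormalBasis (Fin (Module.finrank ℝ U) ⊕ Fin R.m) ℝ V :=
  OrthonormalBasis.mk R.orthonormal_sum (by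
    intro v _
    rw [R.decomp v]
    refine Submodule.add_mem _ ?_ (Submodule.sum_mem _ fun i _ => Submodule.smul_mem _ _
      (Submodule.subset_span ⟨Sum.inr i, rfl⟩))
    rw [← (stdOrthonormalBasis ℝ U).sum_repr (P.pr v), map_sum]
    refine Submodule.sum_mem _ fun i _ => ?_
    rw [map_smul]
    exact Submodule.smul_mem _ _ (Submodule.subset_span ⟨Sum.inl i, rfl⟩))

@[simp] theorem basis_inl (j) : R.basis (Sum.inl j) = P.ι (stdOrthonormalBasis ℝ U j) := by
  simp [basis]

@[simp] theorem basis_inr (i) : R.basis (Sum.inr i) = R.e i := by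
  simp [basis]

theorem pr_X (i : Fin R.m) (v : V) : P.pr (R.X i v) = -(inner ℝ (R.e i) v : ℝ) • R.a i := by
  refine ext_inner_right ℝ fun u => ?_
  rw [P.inner_pr, P.lie_skew (R.X_lie i), R.X_apply, inner_smul_right, inner_smul_left,
    real_inner_comm (R.e i) v]
  simp; ring

theorem pr_X_e_self (i : Fin R.m) : P.pr (R.X i (R.e i)) = -R.a i := by
  rw [pr_X, real_inner_self_eq_norm_sq, R.orth.1]; simp

/-- Regular points. -/
def Regular (s : U) : Prop := ∀ i, inner ℝ (R.a i) s ≠ (0 : ℝ)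

theorem eventually_regular (s : U) : ∀ᶠ t : ℝ in nhdsWithin 0 {0}ᶜ, R.Regular (s + t • R.s0) := by
  simp only [Regular, Filter.eventually_all]
  intro i
  have h : ∀ t : ℝ, inner ℝ (R.a i) (s + t • R.s0) = inner ℝ (R.a i) s + t := fun t => by
    rw [inner_add_right, inner_smul_right, R.a_s0, mul_one]
  simp only [h]
  by_cases h0 : inner ℝ (R.a i) s = (0 : ℝ)
  · filter_upwards [self_mem_nhdsWithin] with t ht
    simpa [h0] using ht
  · have hc : Filter.Tendsto (fun t : ℝ => (inner ℝ (R.a i) s : ℝ) + t) (nhdsWithin 0 {0}ᶜ)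
        (nhds (inner ℝ (R.a i) s + 0)) :=
      (continuous_const.add continuous_id).continuousAt.tendsto.mono_left nhdsWithin_le_nhds
    rw [add_zero] at hc
    exact hc.eventually_ne h0

theorem eq_of_regular {F : Type*} [TopologicalSpace F] [T2Space F] {f g : U → F} (hf : Continuous f)
    (hg : Continuous g) (h : ∀ s, R.Regular s → f s = g s) (s : U) : f s = g s := by
  have hl : Filter.Tendsto (fun t : ℝ => s + t • R.s0) (nhdsWithin 0 {0}ᶜ) (nhds s) := by
    have : Continuous fun t : ℝ => s + t • R.s0 := by fun_prop
    have h2 := this.continuousAt.tendsto.mono_left (nhdsWithin_le_nhds (a := (0 : ℝ)) (s := {0}ᶜ))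
    simpa using h2
  refine tendsto_nhds_unique ((hf.tendsto s).comp hl) (((hg.tendsto s).comp hl).congr' ?_)
  filter_upwards [R.eventually_regular s] with t ht
  exact (h _ ht).symm

end Roots

namespace Basic
variable {Q : V → V [⋀^Fin p]→L[ℝ] ℝ}

theorem hor_update (hQ : P.Basic Q) (s : U) (v : Fin p → V) (a : Fin p) (y : V) :
    Q (P.ι s) (update v a y) = Q (P.ι s) (update v a (P.ι (P.pr y))) := by
  have h : y = P.ι (P.pr y) + (y - P.ι (P.pr y)) := by abel
  conv_lhs => rw [h, (Q (P.ι s)).map_update_add]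
  rw [hQ.hor s (update v a (y - P.ι (P.pr y))) a, add_zero]
  rw [update_self, P.mem_tan_iff_pr, map_sub, P.pr_ι, sub_self]

theorem inv_lie (hQ : P.Basic Q) {X : V →L[ℝ] V} (hX : X ∈ P.lie) (x : V) (v : Fin p → V) :
    dirD (X x) Q x v + ∑ a, Q x (update v a (X (v a))) = 0 := by
  let c : ℝ → V → V := fun t y => NormedSpace.exp (t • X) y
  have hc : ∀ y, HasDerivAt (fun t => c t y) (X y) 0 := lie_curve_hasDerivAt X
  have c0 : ∀ y, c 0 y = y := fun y => by simp [c]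
  have hQc : HasDerivAt (fun t => Q (c t x)) (dirD (X x) Q x) 0 := by
    have h1 : HasFDerivAt Q (fderiv ℝ Q x) (c 0 x) := by
      rw [c0]; exact (contDiff_diff hQ.smooth x).hasFDerivAt
    exact h1.comp_hasDerivAt (0 : ℝ) (hc x)
  have h2 := hQc.hasFDerivAt.continuousAlternatingMap_apply (g := fun i t => c t (v i))
    (fun i => (hc (v i)).hasFDerivAt)
  have h3 : (fun t => Q (c t x) fun i => c t (v i)) = fun _ => Q x v := by
    funext t
    obtain ⟨g, hg⟩ := hX t
    simp only [c, ← hg]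
    exact hQ.inv g x v
  rw [h3] at h2
  have h4 := DFunLike.congr_fun (h2.unique (hasFDerivAt_const _ _)) (1 : ℝ)
  simpa [c0, ContinuousMultilinearMap.toContinuousLinearMap] using h4

theorem hor_lie (hQ : P.Basic Q) {X : V →L[ℝ] V} (hX : X ∈ P.lie) (x : V) (v : Fin p → V)
    (a : Fin p) : Q x (update v a (X x)) = 0 := by
  obtain ⟨g, s, hg⟩ := P.meets x
  rw [← hQ.inv g, hg]
  refine hQ.hor _ _ a ?_
  rw [update_self]
  have h := P.lie_ad hX g
  have h2 : (P.ρ g * X * P.ρ g⁻¹) (P.ι s) = P.ρ g (X x) := by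
    rw [← hg]
    change P.ρ g (X (P.ρ g⁻¹ (P.ρ g x))) = _
    rw [P.inv_apply_self]
  rw [← h2]
  exact P.mem_tan.2 fun u => P.lie_orth h s u

theorem inv_lie_diff (hQ : P.Basic Q) {X : V →L[ℝ] V} (hX : X ∈ P.lie) (b x : V)
    (v : Fin p → V) :
    dirD b (dirD (X x) Q) x v + dirD (X b) Q x v + ∑ a, dirD b Q x (update v a (X (v a))) = 0 := by
  have h0 : (fun y => dirD (X y) Q y v + ∑ a, Q y (update v a (X (v a)))) = fun _ => 0 :=
    funext fun y => hQ.inv_lie hX y v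
  have hf : ContDiff ℝ ∞ (fderiv ℝ Q) := hQ.smooth.fderiv_right (by simp)
  have hs : ContDiff ℝ ∞ fun y => dirD (X y) Q y := hf.clm_apply X.contDiff
  have h1 : dirD b (fun y => dirD (X y) Q y v + ∑ a, Q y (update v a (X (v a)))) x = 0 := by
    rw [h0]; exact dirD_zero _ _
  have hsv : ContDiff ℝ ∞ fun y => dirD (X y) Q y v := (altEval v).contDiff.comp hs
  have hQv : ∀ w, ContDiff ℝ ∞ fun y => Q y w := fun w => (altEval w).contDiff.comp hQ.smooth
  rw [dirD_add hsv (ContDiff.sum fun a _ => hQv _), dirD_sum (fun a => hQv _),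
    dirD_altEval hs] at h1
  simp only [dirD_altEval hQ.smooth] at h1
  rw [show (fun y => dirD (X y) Q y) = fun y => fderiv ℝ Q y (X y) from rfl,
    dirD_clm_apply hf X.contDiff, dirD_clm_self] at h1
  rw [dirD_dirD hQ.smooth]
  exact h1

end Basic
end PolarRep

namespace PolarRep
open scoped ContDiff
open Function
variable {Γ : Type*} [Group Γ] [TopologicalSpace Γ] {V : Type*}
    [NormedAddCommGroup V] [InnerProductSpace ℝ V] [FiniteDimensional ℝ V] {U : Type*}
    [NormedAddCommGroup U] [InnerProductSpace ℝ U] [FiniteDimensional ℝ U]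
variable {P : PolarRep Γ V U} {p : ℕ} [CompactSpace Γ] [IsTopologicalGroup Γ]

variable (P) in
/-- Restriction of a form to the section. -/
noncomputable def restr (Q : V → V [⋀^Fin p]→L[ℝ] ℝ) : U → U [⋀^Fin p]→L[ℝ] ℝ :=
  fun s => (Q (P.ι s)).compContinuousLinearMap P.ι.toContinuousLinearMap

theorem restr_apply (Q : V → V [⋀^Fin p]→L[ℝ] ℝ) (s : U) (v : Fin p → U) :
    P.restr Q s v = Q (P.ι s) (fun i => P.ι (v i)) := rfl

variable (P p) in
/-- Pullback of alternating forms to the section. -/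
noncomputable def pullL : (V [⋀^Fin p]→L[ℝ] ℝ) →L[ℝ] (U [⋀^Fin p]→L[ℝ] ℝ) :=
  ContinuousAlternatingMap.compContinuousLinearMapCLM P.ι.toContinuousLinearMap

theorem restr_contDiff {Q : V → V [⋀^Fin p]→L[ℝ] ℝ} (hQ : ContDiff ℝ ∞ Q) :
    ContDiff ℝ ∞ (P.restr Q) :=
  (P.pullL p).contDiff.comp (hQ.comp P.ι.toContinuousLinearMap.contDiff)

theorem dirD_restr {Q : V → V [⋀^Fin p]→L[ℝ] ℝ} (hQ : ContDiff ℝ ∞ Q) (u s : U) :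
    dirD u (P.restr Q) s = P.restr (dirD (P.ι u) Q) s := by
  have h1 : ContDiff ℝ ∞ fun s => Q (P.ι s) := hQ.comp P.ι.toContinuousLinearMap.contDiff
  refine (dirD_clm h1 (P.pullL p) u s).trans ?_
  rw [show (fun s => Q (P.ι s)) = fun s => Q (P.ι.toContinuousLinearMap s) from rfl, dirD_comp hQ]
  rfl

/-- The right-hand side of the radial part of the Laplacian, evaluated on a tuple. -/
noncomputable def radial (R : P.Roots) (q : U → U [⋀^Fin p]→L[ℝ] ℝ) (s : U) (v : Fin p → U) : ℝ :=
  lap q s v + ∑ i, ((inner ℝ (R.a i) s : ℝ)⁻¹ * dirD (R.a i) q s v -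
    ((inner ℝ (R.a i) s : ℝ)⁻¹) ^ 2 *
      ∑ c, inner ℝ (R.a i) (v c) * q s (update v c (R.a i)))

namespace Basic
variable {Q : V → V [⋀^Fin p]→L[ℝ] ℝ} (R : P.Roots)

theorem dirD_e (hQ : P.Basic Q) {s : U} (hs : R.Regular s) (i : Fin R.m) (w : Fin p → V) :
    dirD (R.e i) Q (P.ι s) w =
      -(inner ℝ (R.a i) s : ℝ)⁻¹ * ∑ c, Q (P.ι s) (update w c (R.X i (w c))) := by
  have h := hQ.inv_lie (R.X_lie i) (P.ι s) w
  rw [R.X_apply, dirD_smul_left] at h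
  have h0 := hs i
  have h' : (inner ℝ (R.a i) s : ℝ) * dirD (R.e i) Q (P.ι s) w
    + ∑ c, Q (P.ι s) (update w c (R.X i (w c))) = 0 := h
  field_simp
  linarith

theorem dirD_e_ι (hQ : P.Basic Q) {s : U} (hs : R.Regular s) (i : Fin R.m) (v : Fin p → U) :
    dirD (R.e i) Q (P.ι s) (fun c => P.ι (v c)) = 0 := by
  rw [hQ.dirD_e R hs, Finset.sum_eq_zero, mul_zero]
  intro c _
  rw [hQ.hor s _ c]
  rw [update_self, R.X_apply]
  exact P.tan.smul_mem _ (R.e_tan i)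

theorem dirD_e_update (hQ : P.Basic Q) {s : U} (hs : R.Regular s) (i : Fin R.m) (v : Fin p → U)
    (c : Fin p) : dirD (R.e i) Q (P.ι s) (update (fun c => P.ι (v c)) c (R.e i)) =
      (inner ℝ (R.a i) s : ℝ)⁻¹ * P.restr Q s (update v c (R.a i)) := by
  rw [hQ.dirD_e R hs, Finset.sum_eq_single c]
  · rw [update_self, update_idem, hQ.hor_update, R.pr_X_e_self, map_neg,
      ← neg_one_smul ℝ (P.ι (R.a i)), (Q (P.ι s)).map_update_smul, restr_apply,
      show (fun j => P.ι (update v c (R.a i) j)) = update (fun c => P.ι (v c)) c (P.ι (R.a i)) from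
        funext fun j => apply_update (fun _ => P.ι) v c (R.a i) j]
    simp
  · intro d _ hd
    refine hQ.hor s _ c ?_
    rw [update_of_ne hd.symm, update_self]
    exact R.e_tan i
  · simp

theorem dirD_pr (Q : V → V [⋀^Fin p]→L[ℝ] ℝ) (y x : V) : dirD y Q x =
    dirD (P.ι (P.pr y)) Q x + ∑ j, (inner ℝ (R.e j) y : ℝ) • dirD (R.e j) Q x := by
  conv_lhs => rw [R.decomp y, dirD_add_left, dirD_sum_left]
  simp only [dirD_smul_left]

theorem dirD_e_e (hQ : P.Basic Q) {s : U} (hs : R.Regular s) (i : Fin R.m) (v : Fin p → U) :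
    dirD (R.e i) (dirD (R.e i) Q) (P.ι s) (fun c => P.ι (v c)) =
      (inner ℝ (R.a i) s : ℝ)⁻¹ * dirD (R.a i) (P.restr Q) s v -
    ((inner ℝ (R.a i) s : ℝ)⁻¹) ^ 2 *
      ∑ c, inner ℝ (R.a i) (v c) * P.restr Q s (update v c (R.a i)) := by
  have h := hQ.inv_lie_diff (R.X_lie i) (R.e i) (P.ι s) (fun c => P.ι (v c))
  have e1 : dirD (R.e i) (dirD (R.X i (P.ι s)) Q) (P.ι s) =
      (inner ℝ (R.a i) s : ℝ) • dirD (R.e i) (dirD (R.e i) Q) (P.ι s) := by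
    rw [R.X_apply, dirD_eq_of_eq (fun x => dirD_smul_left _ _ Q x),
      dirD_const_smul (dirD_contDiff hQ.smooth _)]
  have e2 : dirD (R.X i (R.e i)) Q (P.ι s) (fun c => P.ι (v c)) = - dirD (R.a i) (P.restr Q) s v := by
    have h1 := DFunLike.congr_fun (dirD_pr R Q (R.X i (R.e i)) (P.ι s)) (fun c => P.ι (v c))
    rw [h1, R.pr_X_e_self, dirD_restr hQ.smooth, restr_apply, map_neg, ← neg_one_smul ℝ (P.ι (R.a i)),
      dirD_smul_left]
    have h2 : (∑ j, (inner ℝ (R.e j) (R.X i (R.e i)) : ℝ) • dirD (R.e j) Q (P.ι s))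
        (fun c => P.ι (v c)) = 0 := by
      rw [ContinuousAlternatingMap.sum_apply]
      refine Finset.sum_eq_zero fun j _ => ?_
      change (inner ℝ (R.e j) (R.X i (R.e i)) : ℝ) • (dirD (R.e j) Q (P.ι s) (fun c => P.ι (v c))) = 0
      rw [hQ.dirD_e_ι R hs, smul_zero]
    rw [ContinuousAlternatingMap.add_apply, h2]
    simp
  have e3 : ∀ c, dirD (R.e i) Q (P.ι s) (update (fun c => P.ι (v c)) c (R.X i (P.ι (v c)))) =
      inner ℝ (R.a i) (v c) * ((inner ℝ (R.a i) s : ℝ)⁻¹ * P.restr Q s (update v c (R.a i))) := by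
    intro c
    rw [R.X_apply, ContinuousAlternatingMap.map_update_smul, hQ.dirD_e_update R hs, smul_eq_mul]
  rw [e1, e2] at h
  simp only [e3] at h
  have h' : (inner ℝ (R.a i) s : ℝ) * dirD (R.e i) (dirD (R.e i) Q) (P.ι s) (fun c => P.ι (v c)) +
     - dirD (R.a i) (P.restr Q) s v + ∑ c, inner ℝ (R.a i) (v c) * ((inner ℝ (R.a i) s : ℝ)⁻¹ * P.restr Q s (update v c (R.a i))) = 0 := h
  have h0 := hs i
  have e4 : ∑ c, inner ℝ (R.a i) (v c) * ((inner ℝ (R.a i) s : ℝ)⁻¹ * P.restr Q s (update v c (R.a i)))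
     = (inner ℝ (R.a i) s : ℝ)⁻¹ * ∑ c, inner ℝ (R.a i) (v c) * P.restr Q s (update v c (R.a i)) := by
    rw [Finset.mul_sum]; exact Finset.sum_congr rfl fun c _ => by ring
  rw [e4] at h'
  field_simp at h' ⊢
  linear_combination h'

theorem restr_lap (hQ : P.Basic Q) {s : U} (hs : R.Regular s) (v : Fin p → U) :
    P.restr (lap Q) s v = P.radial R (P.restr Q) s v := by
  rw [restr_apply, lap_eq R.basis hQ.smooth, Fintype.sum_sum_type]
  rw [radial, lap, ContinuousAlternatingMap.add_apply, ContinuousAlternatingMap.sum_apply,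
    ContinuousAlternatingMap.sum_apply, ContinuousAlternatingMap.sum_apply]
  congr 1
  · refine Finset.sum_congr rfl fun j _ => ?_
    rw [R.basis_inl, dirD_eq_of_eq (fun s => dirD_restr hQ.smooth _ s),
      dirD_restr (dirD_contDiff hQ.smooth _)]
    rfl
  · refine Finset.sum_congr rfl fun i _ => ?_
    rw [R.basis_inr, hQ.dirD_e_e R hs]

theorem hor_update_update (hQ : P.Basic Q) (s : U) (v : Fin p → V) {a c : Fin p} (hac : c ≠ a)
    (y z : V) : Q (P.ι s) (update (update v a y) c z) =
      Q (P.ι s) (update (update v a (P.ι (P.pr y))) c (P.ι (P.pr z))) := by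
  rw [hQ.hor_update, update_comm hac.symm, hQ.hor_update, update_comm hac.symm]

theorem dirD_lie_basis (hQ : P.Basic Q) {s : U} (hs : R.Regular s) (l : Fin R.m) (v : Fin p → V)
    (a : Fin p) (j) : dirD (R.basis j) Q (P.ι s) (update v a (R.X l (R.basis j))) = 0 := by
  rcases j with j | i
  · rw [R.basis_inl, R.X_apply, ContinuousAlternatingMap.map_update_smul,
      ← dirD_altEval hQ.smooth]
    have h1 : ContDiff ℝ ∞ fun y => Q y (update v a (R.e l)) :=
      (altEval (update v a (R.e l))).contDiff.comp hQ.smooth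
    have h2 := dirD_comp h1 P.ι.toContinuousLinearMap (stdOrthonormalBasis ℝ U j) s
    change _ = dirD (P.ι (stdOrthonormalBasis ℝ U j)) _ (P.ι s) at h2
    rw [← h2, dirD_eq_of_eq (g := fun _ => 0), dirD_zero, smul_zero]
    intro u
    exact hQ.hor u _ a (by rw [update_self]; exact R.e_tan l)
  · rw [R.basis_inr, hQ.dirD_e R hs, Finset.sum_eq_zero, mul_zero]
    intro c _
    by_cases hc : c = a
    · subst hc
      refine hQ.hor s _ c ?_
      rw [update_self, update_self, P.mem_tan_iff_pr, R.pr_X, real_inner_comm,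
        P.lie_skew_self (R.X_lie l)]
      simp
    · rw [update_of_ne hc, hQ.hor_update_update s v hc, R.pr_X, R.pr_X]
      by_cases hil : i = l
      · subst hil
        rw [map_smul, map_smul, ContinuousAlternatingMap.map_update_smul, update_comm (Ne.symm hc),
          ContinuousAlternatingMap.map_update_smul]
        rw [(Q (P.ι s)).map_eq_zero_of_eq _ (i := a) (j := c) _ (Ne.symm hc)]
        · simp
        · simp [update_of_ne hc]
      · rw [R.orth.2 (Ne.symm hil)]
        rw [neg_zero, zero_smul, map_zero, update_comm (Ne.symm hc),
          ContinuousAlternatingMap.map_update_zero]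

theorem lap_slot (hQ : P.Basic Q) {s : U} (hs : R.Regular s) (l : Fin R.m) (v : Fin p → V)
    (a : Fin p) : lap Q (P.ι s) (update v a (R.X l (P.ι s))) = 0 := by
  set S := slotL v a (R.X l) with hS
  let L : V → V →L[ℝ] ℝ := fun x => S (Q x)
  have hL : ContDiff ℝ ∞ L := S.contDiff.comp hQ.smooth
  have h0 : (fun x => L x x) = fun _ => 0 := funext fun x => hQ.hor_lie (R.X_lie l) x v a
  have hid : ContDiff ℝ ∞ fun x : V => x := contDiff_id
  have d1 : ∀ b x : V, dirD b (fun y : V => y) x = b := fun b x =>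
    dirD_clm_self (ContinuousLinearMap.id ℝ V) b x
  have hLb : ∀ b : V, ContDiff ℝ ∞ fun x => L x b := fun b =>
    (ContinuousLinearMap.apply ℝ ℝ b).contDiff.comp hL
  have d2 : ∀ b x : V, dirD b (dirD b fun y => L y y) x =
      dirD b (dirD b L) x x + 2 * dirD b L x b := by
    intro b x
    rw [dirD_eq_of_eq (fun y => dirD_clm_apply hL hid b y)]
    simp only [d1]
    rw [dirD_add ((dirD_contDiff hL b).clm_apply hid) (hLb b),
      dirD_clm_apply (dirD_contDiff hL b) hid, d1,
      show dirD b (fun x => L x b) x = dirD b L x b from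
        dirD_clm hL (ContinuousLinearMap.apply ℝ ℝ b) b x]
    ring
  have d3 : ∀ b, dirD b L = fun x => S (dirD b Q x) := fun b =>
    funext fun x => dirD_clm hQ.smooth S b x
  have d4 : ∀ b x, dirD b (dirD b L) x = S (dirD b (dirD b Q) x) := fun b x => by
    rw [d3, dirD_clm (dirD_contDiff hQ.smooth b)]
  have hsum : ∑ j, dirD (R.basis j) (dirD (R.basis j) fun y => L y y) (P.ι s) = 0 := by
    refine Finset.sum_eq_zero fun j _ => ?_
    rw [h0, dirD_eq_of_eq (fun y => dirD_zero (R.basis j) y), dirD_zero]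
  simp only [d2, Finset.sum_add_distrib] at hsum
  have h5 : ∑ j, 2 * dirD (R.basis j) L (P.ι s) (R.basis j) = 0 := by
    refine Finset.sum_eq_zero fun j _ => ?_
    rw [d3, hS, slotL_apply, hQ.dirD_lie_basis R hs, mul_zero]
  rw [h5, add_zero] at hsum
  rw [lap_eq R.basis hQ.smooth, ContinuousAlternatingMap.sum_apply, ← hsum]
  refine Finset.sum_congr rfl fun j _ => ?_
  rw [d4]; rfl

protected theorem lap (hQ : P.Basic Q) : P.Basic (lap Q) where
  smooth := lap_contDiff hQ.smooth
  inv := fun g x v => by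
    let h : V ≃ₗᵢ[ℝ] V :=
      { toFun := P.ρ g
        invFun := P.ρ g⁻¹
        left_inv := P.inv_apply_self g
        right_inv := P.apply_inv_self g
        map_add' := map_add _
        map_smul' := map_smul _
        norm_map' := P.isom g }
    have h1 := lap_clm hQ.smooth (altEval fun i => P.ρ g (v i)) (h x)
    have h2 := lap_clm hQ.smooth (altEval v) x
    have h3 := lap_comp_isometry ((altEval fun i => P.ρ g (v i)).contDiff.comp hQ.smooth) h x
    have h4 : (fun x => ((altEval fun i => P.ρ g (v i)) ∘ Q) (h x)) = fun x => altEval v (Q x) :=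
      funext fun x => hQ.inv g x v
    rw [h4, h2] at h3
    exact (h3.trans h1).symm
  hor := fun s v a hv => by
    obtain ⟨R⟩ := P.exists_roots
    have hc : Continuous fun s => lap Q (P.ι s) v :=
      (altEval v).continuous.comp ((lap_contDiff hQ.smooth).continuous.comp P.ι.continuous)
    refine R.eq_of_regular hc continuous_const (fun s hs => ?_) s
    have h1 : v = update v a (∑ l, (inner ℝ (R.e l) (v a) * (inner ℝ (R.a l) s)⁻¹ : ℝ) •
        R.X l (P.ι s)) := by
      conv_lhs => rw [← update_eq_self a v, R.decomp (v a), P.mem_tan_iff_pr.1 hv, map_zero, zero_add]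
      congr 1
      refine Finset.sum_congr rfl fun l _ => ?_
      rw [R.X_apply, smul_smul, mul_assoc, inv_mul_cancel₀ (hs l), mul_one]
    rw [h1]
    have h2 : (lap Q (P.ι s)) (update v a (∑ l, (inner ℝ (R.e l) (v a) * (inner ℝ (R.a l) s)⁻¹ : ℝ) •
        R.X l (P.ι s))) = ∑ l, (lap Q (P.ι s)) (update v a ((inner ℝ (R.e l) (v a) * (inner ℝ (R.a l) s)⁻¹ : ℝ) •
        R.X l (P.ι s))) :=
      MultilinearMap.map_update_sum (lap Q (P.ι s)).toMultilinearMap _ _ _ _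
    rw [h2]
    refine Finset.sum_eq_zero fun l _ => ?_
    rw [ContinuousAlternatingMap.map_update_smul, hQ.lap_slot R hs, smul_zero]

end Basic
end PolarRep

namespace PolarRep
open scoped ContDiff
open Function
variable {Γ : Type*} [Group Γ] [TopologicalSpace Γ] {V : Type*}
    [NormedAddCommGroup V] [InnerProductSpace ℝ V] [FiniteDimensional ℝ V] {U : Type*}
    [NormedAddCommGroup U] [InnerProductSpace ℝ U] [FiniteDimensional ℝ U]
variable {P : PolarRep Γ V U} {p : ℕ} [CompactSpace Γ] [IsTopologicalGroup Γ]

namespace Roots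
variable (R : P.Roots)

/-- The operator sending `X s` to `X u` for `X` in the Lie algebra, and killing the section. -/
noncomputable def shift (s u : U) : V →ₗ[ℝ] V :=
  ∑ i, (inner ℝ (R.a i) u * (inner ℝ (R.a i) s)⁻¹ : ℝ) •
    ((innerₛₗ ℝ (R.e i)).smulRight (R.e i))

theorem shift_apply (s u : U) (v : V) : R.shift s u v =
    ∑ i, (inner ℝ (R.a i) u * (inner ℝ (R.a i) s)⁻¹ : ℝ) • (inner ℝ (R.e i) v : ℝ) • R.e i := by
  simp [shift, LinearMap.sum_apply]

theorem shift_ι (s u t : U) : R.shift s u (P.ι t) = 0 := by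
  rw [shift_apply]
  refine Finset.sum_eq_zero fun i _ => ?_
  rw [P.mem_tan.1 (R.e_tan i), zero_smul, smul_zero]

theorem shift_e (s u : U) (i) : R.shift s u (R.e i) =
    (inner ℝ (R.a i) u * (inner ℝ (R.a i) s)⁻¹ : ℝ) • R.e i := by
  rw [shift_apply, Finset.sum_eq_single i]
  · rw [real_inner_self_eq_norm_sq, R.orth.1]; simp
  · intro j _ hj
    rw [R.orth.2 hj]; simp
  · simp

theorem eq_sum_of_tan {v : V} (hv : v ∈ P.tan) : v = ∑ i, (inner ℝ (R.e i) v : ℝ) • R.e i := by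
  conv_lhs => rw [R.decomp v, P.mem_tan_iff_pr.1 hv, map_zero, zero_add]

theorem shift_lie {s : U} (hs : R.Regular s) (u : U) {X : V →L[ℝ] V} (hX : X ∈ P.lie) :
    R.shift s u (X (P.ι s)) = X (P.ι u) := by
  rw [shift_apply, R.eq_sum_of_tan (P.mem_tan.2 fun t => P.lie_orth hX u t)]
  refine Finset.sum_congr rfl fun i _ => ?_
  rw [smul_smul]
  congr 1
  rw [real_inner_comm (X (P.ι s)) (R.e i), R.lie_inner X hX s,
    real_inner_comm (X (P.ι u)) (R.e i), R.lie_inner X hX u]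
  have := hs i
  field_simp

theorem linearMap_ext {s : U} (hs : R.Regular s) {A B : V →ₗ[ℝ] V} (h1 : ∀ t, A (P.ι t) = B (P.ι t))
    (h2 : ∀ X ∈ P.lie, A (X (P.ι s)) = B (X (P.ι s))) : A = B := by
  have h3 : ∀ i, A (R.e i) = B (R.e i) := fun i => by
    have h4 : R.e i = (inner ℝ (R.a i) s : ℝ)⁻¹ • R.X i (P.ι s) := by
      rw [R.X_apply, smul_smul, inv_mul_cancel₀ (hs i), one_smul]
    rw [h4, map_smul, map_smul, h2 _ (R.X_lie i)]
  ext v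
  rw [R.decomp v]
  simp [h1, h3]

theorem trace_shift (s u : U) : LinearMap.trace ℝ V (R.shift s u) =
    ∑ i, (inner ℝ (R.a i) u * (inner ℝ (R.a i) s)⁻¹ : ℝ) := by
  rw [LinearMap.trace_eq_sum_inner _ R.basis, Fintype.sum_sum_type]
  simp only [basis_inl, basis_inr, shift_ι, shift_e, inner_zero_right, Finset.sum_const_zero, zero_add,
    inner_smul_right, real_inner_self_eq_norm_sq, R.orth.1]
  simp

theorem trace_shift_shift (s u u' : U) : LinearMap.trace ℝ V (R.shift s u * R.shift s u') =
    ∑ i, (inner ℝ (R.a i) u * inner ℝ (R.a i) u' * ((inner ℝ (R.a i) s)⁻¹) ^ 2 : ℝ) := by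
  rw [LinearMap.trace_eq_sum_inner _ R.basis, Fintype.sum_sum_type]
  simp only [basis_inl, basis_inr, Module.End.mul_apply, shift_ι, shift_e, map_zero, map_smul,
    inner_zero_right, Finset.sum_const_zero, zero_add,
    inner_smul_right, real_inner_self_eq_norm_sq, R.orth.1]
  refine Finset.sum_congr rfl fun i _ => ?_
  ring

variable {w : U ≃ₗᵢ[ℝ] U}

theorem regular_weyl (hw : w ∈ P.weyl) {s : U} (hs : R.Regular s) : R.Regular (w s) := by
  obtain ⟨g, hg⟩ := hw
  intro i h0
  have h1 : P.ρ g⁻¹ (R.e i) ∈ P.tan := P.mem_tan.2 fun u => by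
    rw [P.inner_map_left, inv_inv, hg]
    exact P.mem_tan.1 (R.e_tan i) _
  have h2 : R.e i = ∑ l, (inner ℝ (R.e l) (P.ρ g⁻¹ (R.e i)) * (inner ℝ (R.a l) s)⁻¹ : ℝ) •
      (P.ρ g * R.X l * P.ρ g⁻¹) (P.ι (w s)) := by
    have h3 := congrArg (P.ρ g) (R.eq_sum_of_tan h1)
    rw [P.apply_inv_self, map_sum] at h3
    rw [h3]
    conv_rhs => rw [← h3]
    refine Finset.sum_congr rfl fun l _ => ?_
    have h4 : (P.ρ g * R.X l * P.ρ g⁻¹) (P.ι (w s)) = (inner ℝ (R.a l) s : ℝ) • P.ρ g (R.e l) := by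
      change P.ρ g (R.X l (P.ρ g⁻¹ (P.ι (w s)))) = _
      rw [← hg, P.inv_apply_self, R.X_apply, map_smul]
    rw [h4, smul_smul, mul_assoc, inv_mul_cancel₀ (hs l), mul_one, map_smul]
  have h5 : inner ℝ (R.e i) (R.e i) = (0 : ℝ) := by
    conv_lhs => lhs; rw [h2]
    rw [sum_inner]
    refine Finset.sum_eq_zero fun l _ => ?_
    rw [inner_smul_left, R.lie_inner _ (P.lie_ad (R.X_lie l) g), h0, zero_mul, mul_zero]
  rw [real_inner_self_eq_norm_sq, R.orth.1] at h5
  norm_num at h5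

theorem shift_weyl {g : Γ} (hg : ∀ s, P.ρ g (P.ι s) = P.ι (w s)) {s : U} (hs : R.Regular s) (u : U) :
    R.shift (w s) (w u) = (P.ρ g).toLinearMap * R.shift s u * (P.ρ g⁻¹).toLinearMap := by
  have hg' : ∀ s, P.ρ g⁻¹ (P.ι s) = P.ι (w.symm s) := fun s => by
    rw [← w.apply_symm_apply s, ← hg, P.inv_apply_self]; simp
  refine R.linearMap_ext (R.regular_weyl ⟨g, hg⟩ hs) (fun t => ?_) fun X hX => ?_
  · rw [shift_ι]
    change 0 = P.ρ g (R.shift s u (P.ρ g⁻¹ (P.ι t)))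
    rw [hg', shift_ι, map_zero]
  · rw [R.shift_lie (R.regular_weyl ⟨g, hg⟩ hs) _ hX]
    change _ = P.ρ g (R.shift s u (P.ρ g⁻¹ (X (P.ι (w s)))))
    have h1 := P.lie_ad hX g⁻¹
    rw [inv_inv] at h1
    have h2 := R.shift_lie hs u h1
    rw [← hg, ← hg]
    change R.shift s u (P.ρ g⁻¹ (X (P.ρ g (P.ι s)))) = P.ρ g⁻¹ (X (P.ρ g (P.ι u))) at h2
    rw [h2, P.apply_inv_self]

theorem ρ_inv_mul (g : Γ) : (P.ρ g⁻¹).toLinearMap * (P.ρ g).toLinearMap = 1 :=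
  LinearMap.ext fun x => P.inv_apply_self g x

theorem sum_weyl (hw : w ∈ P.weyl) {s : U} (hs : R.Regular s) (u : U) :
    ∑ i, (inner ℝ (R.a i) (w u) * (inner ℝ (R.a i) (w s))⁻¹ : ℝ) =
      ∑ i, (inner ℝ (R.a i) u * (inner ℝ (R.a i) s)⁻¹ : ℝ) := by
  obtain ⟨g, hg⟩ := hw
  rw [← trace_shift, ← trace_shift, R.shift_weyl hg hs, LinearMap.trace_mul_comm, ← mul_assoc,
    ρ_inv_mul, one_mul]

theorem sum_weyl₂ (hw : w ∈ P.weyl) {s : U} (hs : R.Regular s) (u u' : U) :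
    ∑ i, (inner ℝ (R.a i) (w u) * inner ℝ (R.a i) (w u') * ((inner ℝ (R.a i) (w s))⁻¹) ^ 2 : ℝ) =
      ∑ i, (inner ℝ (R.a i) u * inner ℝ (R.a i) u' * ((inner ℝ (R.a i) s)⁻¹) ^ 2 : ℝ) := by
  obtain ⟨g, hg⟩ := hw
  have h : (P.ρ g).toLinearMap * R.shift s u * (P.ρ g⁻¹).toLinearMap *
      ((P.ρ g).toLinearMap * R.shift s u' * (P.ρ g⁻¹).toLinearMap) =
      (P.ρ g).toLinearMap * (R.shift s u * R.shift s u') * (P.ρ g⁻¹).toLinearMap := by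
    rw [show (P.ρ g).toLinearMap * R.shift s u * (P.ρ g⁻¹).toLinearMap *
      ((P.ρ g).toLinearMap * R.shift s u' * (P.ρ g⁻¹).toLinearMap) =
      (P.ρ g).toLinearMap * R.shift s u * ((P.ρ g⁻¹).toLinearMap *
      (P.ρ g).toLinearMap) * R.shift s u' * (P.ρ g⁻¹).toLinearMap by simp only [mul_assoc],
      ρ_inv_mul]
    simp only [mul_assoc, one_mul]
  rw [← trace_shift_shift, ← trace_shift_shift, R.shift_weyl hg hs, R.shift_weyl hg hs, h,
    LinearMap.trace_mul_comm, ← mul_assoc, ρ_inv_mul, one_mul]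

/-- The mean-curvature vector: the logarithmic gradient of the product of the roots. -/
noncomputable def meanCurv (s : U) : U := ∑ i, (inner ℝ (R.a i) s : ℝ)⁻¹ • R.a i

/-- The (negative) derivative of `meanCurv`. -/
noncomputable def curvOp (s u : U) : U :=
  ∑ i, (((inner ℝ (R.a i) s : ℝ)⁻¹) ^ 2 * inner ℝ (R.a i) u) • R.a i

theorem meanCurv_weyl (hw : w ∈ P.weyl) {s : U} (hs : R.Regular s) :
    R.meanCurv (w s) = w (R.meanCurv s) := by
  refine ext_inner_right ℝ fun u => ?_
  obtain ⟨u, rfl⟩ := w.surjective u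
  rw [w.inner_map_map]
  have := R.sum_weyl hw hs u
  simp only [meanCurv, sum_inner, inner_smul_left, conj_trivial]
  simpa only [mul_comm] using this

theorem curvOp_weyl (hw : w ∈ P.weyl) {s : U} (hs : R.Regular s) (u : U) :
    R.curvOp (w s) (w u) = w (R.curvOp s u) := by
  refine ext_inner_right ℝ fun u' => ?_
  obtain ⟨u', rfl⟩ := w.surjective u'
  rw [w.inner_map_map]
  have := R.sum_weyl₂ hw hs u u'
  simp only [curvOp, sum_inner, inner_smul_left, conj_trivial]
  convert this using 2 <;> ring

theorem radial_eq (q : U → U [⋀^Fin p]→L[ℝ] ℝ) (s : U) (v : Fin p → U) :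
    P.radial R q s v = lap q s v + dirD (R.meanCurv s) q s v -
      ∑ c, q s (update v c (R.curvOp s (v c))) := by
  rw [radial, Finset.sum_sub_distrib, meanCurv, dirD_sum_left]
  have h1 : (∑ i, dirD ((inner ℝ (R.a i) s : ℝ)⁻¹ • R.a i) q s) v =
      ∑ i, (inner ℝ (R.a i) s : ℝ)⁻¹ * dirD (R.a i) q s v := by
    rw [ContinuousAlternatingMap.sum_apply]
    refine Finset.sum_congr rfl fun i _ => ?_
    rw [dirD_smul_left]; rfl
  have h2 : ∀ c, q s (update v c (R.curvOp s (v c))) =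
      ∑ i, (((inner ℝ (R.a i) s : ℝ)⁻¹) ^ 2 * inner ℝ (R.a i) (v c)) * q s (update v c (R.a i)) := by
    intro c
    have h3 : q s (update v c (R.curvOp s (v c))) =
      ∑ i, q s (update v c ((((inner ℝ (R.a i) s : ℝ)⁻¹) ^ 2 * inner ℝ (R.a i) (v c)) • R.a i)) :=
      MultilinearMap.map_update_sum (q s).toMultilinearMap _ _ _ _
    rw [h3]
    simp only [ContinuousAlternatingMap.map_update_smul, smul_eq_mul]
  rw [h1]
  simp only [h2]
  rw [Finset.sum_comm]
  simp only [Finset.mul_sum]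
  simp only [mul_assoc]
  ring

end Roots

variable (P) in
/-- Invariance of a form on the section under the Weyl group. -/
def WInv (q : U → U [⋀^Fin p]→L[ℝ] ℝ) : Prop :=
  ∀ w ∈ P.weyl, ∀ s v, q (w s) (fun i => w (v i)) = q s v

theorem lap_WInv {q : U → U [⋀^Fin p]→L[ℝ] ℝ} (hs : ContDiff ℝ ∞ q) (hq : P.WInv q) :
    P.WInv (lap q) := by
  intro w hw s v
  have h1 := lap_clm hs (altEval fun i => w (v i)) (w s)
  have h2 := lap_clm hs (altEval v) s
  have h3 := lap_comp_isometry ((altEval fun i => w (v i)).contDiff.comp hs) w s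
  have h4 : (fun x => ((altEval fun i => w (v i)) ∘ q) (w x)) = fun x => altEval v (q x) :=
    funext fun x => hq w hw x v
  rw [h4, h2] at h3
  exact (h3.trans h1).symm

theorem dirD_WInv {q : U → U [⋀^Fin p]→L[ℝ] ℝ} (hs : ContDiff ℝ ∞ q) (hq : P.WInv q)
    {w : U ≃ₗᵢ[ℝ] U} (hw : w ∈ P.weyl) (b s : U) (v : Fin p → U) :
    dirD (w b) q (w s) (fun i => w (v i)) = dirD b q s v := by
  rw [← dirD_altEval hs, ← dirD_altEval hs,
    ← dirD_eq_of_eq (fun s => hq w hw s v)]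
  have h1 : ContDiff ℝ ∞ fun y => q y (fun i => w (v i)) :=
    (altEval fun i => w (v i)).contDiff.comp hs
  exact (dirD_comp h1 w.toContinuousLinearEquiv.toContinuousLinearMap b s).symm

theorem radial_WInv (R : P.Roots) {q : U → U [⋀^Fin p]→L[ℝ] ℝ} (hs : ContDiff ℝ ∞ q)
    (hq : P.WInv q) {w : U ≃ₗᵢ[ℝ] U} (hw : w ∈ P.weyl) {s : U} (hr : R.Regular s) (v : Fin p → U) :
    P.radial R q (w s) (fun i => w (v i)) = P.radial R q s v := by
  rw [R.radial_eq, R.radial_eq, lap_WInv hs hq w hw, R.meanCurv_weyl hw hr, dirD_WInv hs hq hw]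
  congr 1
  refine Finset.sum_congr rfl fun c _ => ?_
  rw [R.curvOp_weyl hw hr, ← hq w hw s]
  congr 1
  exact (funext fun j => apply_update (fun _ => w) v c (R.curvOp s (v c)) j).symm

/-- The iterated directional derivative has the expected homogeneity. -/
theorem homFun_dirD_iterate {E F : Type*} [NormedAddCommGroup E] [NormedSpace ℝ E]
    [NormedAddCommGroup F] [NormedSpace ℝ F] {k : ℕ} (j : ℕ) {f : E → F}
    (hf : f ∈ homFun E F (k + j)) (v : E) : (dirD v)^[j] f ∈ homFun E F k := by
  induction j generalizing f with
  | zero => simpa using hf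
  | succ j ih =>
    rw [iterate_succ_apply]
    exact ih (homFun_dirD hf v)

/-- The contribution of one root to the radial part, as a polynomial form. -/
noncomputable def rootPart (a : U) (k : ℕ) (q : U → U [⋀^Fin p]→L[ℝ] ℝ) :
    U → U [⋀^Fin p]→L[ℝ] ℝ := fun s =>
  ∑ i ∈ Finset.range (k + 1), ((2 / ‖a‖ ^ 2) * (-2 / ‖a‖ ^ 2) ^ i / ((i + 2)! : ℝ)) •
    ((inner ℝ a s : ℝ) ^ i • ((dirD a)^[i + 2] q) s)

theorem homFun_inner_pow (a : U) (i : ℕ) : (fun s => (inner ℝ a s : ℝ) ^ i) ∈ homFun U ℝ i :=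
  ⟨((innerSL ℝ a).contDiff).pow i, fun t x => by
    simp [inner_smul_right, mul_pow]⟩

theorem homFun_rootPart (a : U) {k : ℕ} {q : U → U [⋀^Fin p]→L[ℝ] ℝ}
    (hq : q ∈ homFun U (U [⋀^Fin p]→L[ℝ] ℝ) (k + 2)) :
    rootPart a k q ∈ homFun U (U [⋀^Fin p]→L[ℝ] ℝ) k := by
  have : rootPart a k q = ∑ i ∈ Finset.range (k + 1),
    ((2 / ‖a‖ ^ 2) * (-2 / ‖a‖ ^ 2) ^ i / ((i + 2)! : ℝ)) •
      fun s => ((inner ℝ a s : ℝ) ^ i • ((dirD a)^[i + 2] q) s) := by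
    funext s; simp [rootPart]
  rw [this]
  refine Submodule.sum_mem _ fun i hi => Submodule.smul_mem _ _ ?_
  have hik : i ≤ k := Nat.lt_succ_iff.1 (Finset.mem_range.1 hi)
  have h1 := homFun_smul_mem (homFun_inner_pow a i)
    (homFun_dirD_iterate (k := k - i) (i + 2) (by
      rwa [show k - i + (i + 2) = k + 2 by omega]) a)
  rwa [show i + (k - i) = k by omega] at h1

theorem bracket_eq (a : U) (ha : a ≠ 0) {k : ℕ} {q : U → U [⋀^Fin p]→L[ℝ] ℝ}
    (hq : q ∈ homFun U (U [⋀^Fin p]→L[ℝ] ℝ) k) {w : U ≃ₗᵢ[ℝ] U}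
    (hw : ∀ s, w s = s - (2 * inner ℝ a s / ‖a‖ ^ 2) • a)
    (hinv : ∀ s v, q (w s) (fun i => w (v i)) = q s v) {s : U} (hs : inner ℝ a s ≠ (0 : ℝ))
    (v : Fin p → U) :
    (inner ℝ a s : ℝ)⁻¹ * dirD a q s v -
    ((inner ℝ a s : ℝ)⁻¹) ^ 2 * ∑ c, inner ℝ a (v c) * q s (update v c a) =
     ((inner ℝ a s : ℝ)⁻¹) ^ 2 * (‖a‖ ^ 2 / 2) * ∑ j ∈ Finset.Ico 2 (k + 1),
      ((-2 * inner ℝ a s / ‖a‖ ^ 2) ^ j / (j ! : ℝ)) * ((dirD a)^[j] q) s v := by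
  have hN : ‖a‖ ^ 2 ≠ 0 := by positivity
  have hww : ∀ s, w (w s) = s := fun s => by
    rw [hw (w s), hw s, inner_sub_right, inner_smul_right, real_inner_self_eq_norm_sq]
    rw [sub_sub, ← add_smul]
    have : 2 * inner ℝ a s / ‖a‖ ^ 2 + 2 * (inner ℝ a s - 2 * inner ℝ a s / ‖a‖ ^ 2 * ‖a‖ ^ 2) / ‖a‖ ^ 2
      = (0 : ℝ) := by field_simp; ring
    rw [this, zero_smul, sub_zero]
  have h1 : q s (fun i => w (v i)) = q s v + ∑ c, (-2 * inner ℝ a (v c) / ‖a‖ ^ 2) * q s (update v c a) := by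
    rw [← alt_add_smul]
    congr 1
    funext i
    rw [hw, sub_eq_add_neg, ← neg_smul]
    congr 2; ring
  have h2 : q s (fun i => w (v i)) = q (w s) v := by
    rw [← hinv s]
    simp only [hww]
  have h3 : q (w s) v = ∑ j ∈ Finset.range (k + 1),
      ((-2 * inner ℝ a s / ‖a‖ ^ 2) ^ j / (j ! : ℝ)) * ((dirD a)^[j] q) s v := by
    rw [hw, sub_eq_add_neg, ← neg_smul, homFun_taylor hq, ContinuousAlternatingMap.sum_apply]
    refine Finset.sum_congr rfl fun j _ => ?_
    rw [show -(2 * inner ℝ a s / ‖a‖ ^ 2) = -2 * inner ℝ a s / ‖a‖ ^ 2 by ring]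
    rfl
  have h4 : ∑ c, (-2 * inner ℝ a (v c) / ‖a‖ ^ 2) * q s (update v c a) =
      (-2 / ‖a‖ ^ 2) * ∑ c, inner ℝ a (v c) * q s (update v c a) := by
    rw [Finset.mul_sum]; exact Finset.sum_congr rfl fun c _ => by ring
  have h5 : ∑ j ∈ Finset.range (k + 1),
      ((-2 * inner ℝ a s / ‖a‖ ^ 2) ^ j / (j ! : ℝ)) * ((dirD a)^[j] q) s v =
      q s v + (-2 * inner ℝ a s / ‖a‖ ^ 2) * dirD a q s v + ∑ j ∈ Finset.Ico 2 (k + 1),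
      ((-2 * inner ℝ a s / ‖a‖ ^ 2) ^ j / (j ! : ℝ)) * ((dirD a)^[j] q) s v := by
    rcases k with _ | k
    · rw [homFun_dirD_zero hq]; simp
    · rw [Finset.range_eq_Ico, Finset.sum_eq_sum_Ico_succ_bot (by omega),
        Finset.sum_eq_sum_Ico_succ_bot (by omega)]
      simp [add_assoc]
  have h6 := h1.symm.trans (h2.trans (h3.trans h5))
  rw [h4] at h6
  set K := ∑ c, inner ℝ a (v c) * q s (update v c a)
  set T := ∑ j ∈ Finset.Ico 2 (k + 1),
      ((-2 * inner ℝ a s / ‖a‖ ^ 2) ^ j / (j ! : ℝ)) * ((dirD a)^[j] q) s v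
  have h7 : K = inner ℝ a s * dirD a q s v - (‖a‖ ^ 2 / 2) * T := by
    field_simp at h6 ⊢
    linear_combination (-1 : ℝ) * h6
  rw [h7]
  field_simp
  ring

theorem rootPart_eq (a : U) (ha : a ≠ 0) {k : ℕ} {q : U → U [⋀^Fin p]→L[ℝ] ℝ} {s : U}
    (hs : inner ℝ a s ≠ (0 : ℝ)) (v : Fin p → U) :
    ((inner ℝ a s : ℝ)⁻¹) ^ 2 * (‖a‖ ^ 2 / 2) * ∑ j ∈ Finset.Ico 2 (k + 2 + 1),
      ((-2 * inner ℝ a s / ‖a‖ ^ 2) ^ j / (j ! : ℝ)) * ((dirD a)^[j] q) s v =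
      rootPart a k q s v := by
  rw [rootPart, ContinuousAlternatingMap.sum_apply, Finset.sum_Ico_eq_sum_range, Finset.mul_sum]
  refine Finset.sum_congr (by congr 1) fun j _ => ?_
  rw [add_comm 2 j]
  change _ = (2 / ‖a‖ ^ 2) * (-2 / ‖a‖ ^ 2) ^ j / ((j + 2)! : ℝ) *
    ((inner ℝ a s : ℝ) ^ j * ((dirD a)^[j + 2] q) s v)
  have hN : ‖a‖ ≠ 0 := by positivity
  have hf : ((j + 2)! : ℝ) ≠ 0 := by positivity
  have hN2 : ‖a‖ ^ 2 ≠ 0 := pow_ne_zero 2 hN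
  generalize ‖a‖ ^ 2 = N at hN2 ⊢
  rw [pow_add, div_pow, mul_pow, div_pow]
  field_simp
  ring_nf
  rw [mul_assoc _ (N ^ j), ← mul_pow, mul_inv_cancel₀ hN2, one_pow, mul_one]

theorem Roots.a_ne_zero (R : P.Roots) (i) : R.a i ≠ 0 := fun h => by
  have := R.a_s0 i
  rw [h, inner_zero_left] at this
  norm_num at this

theorem radial_zero (R : P.Roots) {k : ℕ} (hk : k < 2) {q : U → U [⋀^Fin p]→L[ℝ] ℝ}
    (hq : q ∈ homFun U (U [⋀^Fin p]→L[ℝ] ℝ) k) (hinv : P.WInv q) {s : U} (hs : R.Regular s)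
    (v : Fin p → U) : P.radial R q s v = 0 := by
  rw [radial, homFun_lap_zero hk hq, Finset.sum_eq_zero]
  · simp
  · intro i _
    obtain ⟨w, hw, hws⟩ := P.exists_weyl_reflection R i
    rw [bracket_eq (R.a i) (R.a_ne_zero i) hq hws (hinv w hw) (hs i),
      Finset.Ico_eq_empty (by omega)]
    simp

/-- The radial part of the Laplacian preserves polynomial Weyl-invariant forms. -/
theorem exists_radial (R : P.Roots) {k : ℕ} {q : U → U [⋀^Fin p]→L[ℝ] ℝ}
    (hq : q ∈ homFun U (U [⋀^Fin p]→L[ℝ] ℝ) (k + 2)) (hinv : P.WInv q) :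
    ∃ q' ∈ homFun U (U [⋀^Fin p]→L[ℝ] ℝ) k, P.WInv q' ∧
      ∀ s, R.Regular s → ∀ v, q' s v = P.radial R q s v := by
  set q' : U → U [⋀^Fin p]→L[ℝ] ℝ := lap q + ∑ i, rootPart (R.a i) k q with hq'
  have h1 : q' ∈ homFun U (U [⋀^Fin p]→L[ℝ] ℝ) k :=
    Submodule.add_mem _ (homFun_lap hq) (Submodule.sum_mem _ fun i _ => homFun_rootPart _ hq)
  have h2 : ∀ s, R.Regular s → ∀ v, q' s v = P.radial R q s v := by
    intro s hs v
    rw [radial, hq', Pi.add_apply, ContinuousAlternatingMap.add_apply, Finset.sum_apply,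
      ContinuousAlternatingMap.sum_apply]
    congr 1
    refine Finset.sum_congr rfl fun i _ => ?_
    obtain ⟨w, hw, hws⟩ := P.exists_weyl_reflection R i
    rw [bracket_eq (R.a i) (R.a_ne_zero i) hq hws (hinv w hw) (hs i),
      rootPart_eq _ (R.a_ne_zero i) (hs i)]
  refine ⟨q', h1, fun w hw s v => ?_, h2⟩
  have hc : Continuous q' := (homFun_contDiff h1).continuous
  refine R.eq_of_regular (f := fun s => q' (w s) fun i => w (v i)) (g := fun s => q' s v)
    ((altEval fun i => w (v i)).continuous.comp (hc.comp w.continuous))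
    ((altEval v).continuous.comp hc) (fun s hs => ?_) s
  rw [h2 _ (R.regular_weyl hw hs), h2 _ hs, radial_WInv R (homFun_contDiff hq) hinv hw hs]

end PolarRep

section Weight
open scoped ContDiff
open Function MeasureTheory

theorem hasDerivAt_max_sq (t : ℝ) : HasDerivAt (fun t : ℝ => (max 0 t) ^ 2) (2 * max 0 t) t := by
  rcases lt_trichotomy t 0 with h | rfl | h
  · rw [max_eq_left h.le, mul_zero]
    refine (hasDerivAt_const t (0 : ℝ)).congr_of_eventuallyEq ?_
    filter_upwards [gt_mem_nhds h] with y hy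
    rw [max_eq_left (le_of_lt hy)]; simp
  · rw [max_self, mul_zero, hasDerivAt_iff_isLittleO_nhds_zero]
    have h1 : (fun h : ℝ => max 0 (0 + h) ^ 2 - max 0 0 ^ 2 - h • (0 : ℝ)) =O[nhds 0]
        fun h : ℝ => h ^ 2 := by
      refine Asymptotics.IsBigO.of_bound 1 (Filter.Eventually.of_forall fun h => ?_)
      simp only [zero_add, max_self, smul_zero, sub_zero, Real.norm_eq_abs, one_mul]
      rw [zero_pow two_ne_zero, sub_zero, abs_pow, abs_pow]
      refine pow_le_pow_left₀ (abs_nonneg _) ?_ 2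
      rw [abs_of_nonneg (le_max_left _ _)]
      exact max_le (abs_nonneg _) (le_abs_self _)
    refine h1.trans_isLittleO ?_
    simpa using Asymptotics.isLittleO_pow_pow (𝕜 := ℝ) (m := 1) (n := 2) one_lt_two
  · rw [max_eq_right h.le]
    have : HasDerivAt (fun t : ℝ => t ^ 2) (2 * t) t := by simpa using hasDerivAt_pow 2 t
    refine this.congr_of_eventuallyEq ?_
    filter_upwards [lt_mem_nhds h] with y hy
    rw [max_eq_right (le_of_lt hy)]

theorem contDiff_max_sq : ContDiff ℝ 1 (fun t : ℝ => (max 0 t) ^ 2) := by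
  rw [contDiff_one_iff_deriv]
  refine ⟨fun t => (hasDerivAt_max_sq t).differentiableAt, ?_⟩
  have : deriv (fun t : ℝ => (max 0 t) ^ 2) = fun t => 2 * max 0 t :=
    funext fun t => (hasDerivAt_max_sq t).deriv
  rw [this]
  fun_prop

variable {U : Type*} [NormedAddCommGroup U] [InnerProductSpace ℝ U] [FiniteDimensional ℝ U]

/-- A `C¹` bump supported in the unit ball. -/
noncomputable def bump (x : U) : ℝ := (max 0 (1 - ‖x‖ ^ 2)) ^ 2

theorem bump_contDiff : ContDiff ℝ 1 (bump : U → ℝ) :=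
  contDiff_max_sq.comp (contDiff_const.sub (contDiff_norm_sq ℝ))

theorem bump_eq_zero {x : U} (hx : 1 ≤ ‖x‖) : bump x = 0 := by
  rw [bump, max_eq_left (by nlinarith)]; simp

theorem bump_pos {x : U} (hx : ‖x‖ < 1) : 0 < bump x := by
  have : 0 < 1 - ‖x‖ ^ 2 := by nlinarith [norm_nonneg x]
  rw [bump, max_eq_right this.le]; positivity

theorem bump_nonneg (x : U) : 0 ≤ bump x := sq_nonneg _

theorem bump_hasCompactSupport : HasCompactSupport (bump : U → ℝ) :=
  HasCompactSupport.intro (isCompact_closedBall (0 : U) 1) fun x hx => bump_eq_zero (by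
    simp at hx; exact hx.le)

theorem dirD_bump (v x : U) : dirD v bump x = -4 * max 0 (1 - ‖x‖ ^ 2) * inner ℝ x v := by
  have h1 : HasFDerivAt (fun x : U => 1 - ‖x‖ ^ 2) (-(2 • innerSL ℝ x)) x := by
    simpa using (hasFDerivAt_id x).norm_sq.const_sub 1
  have h2 := (hasDerivAt_max_sq (1 - ‖x‖ ^ 2)).comp_hasFDerivAt x h1
  have h3 : HasFDerivAt (bump : U → ℝ) _ x := h2
  rw [dirD, h3.fderiv]
  simp
  ring

theorem integral_dir_eq_zero [MeasurableSpace U] [BorelSpace U] (v : U) {P h : U → ℝ}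
    (hP : ContDiff ℝ 1 P) (hPc : HasCompactSupport P) (hh : ContDiff ℝ 1 h)
    (hhc : HasCompactSupport h) : Integrable (fun x => lineDeriv ℝ (fun y => |P y| * h y) x v) ∧
      ∫ x, lineDeriv ℝ (fun y => |P y| * h y) x v = 0 := by
  obtain ⟨C, hC⟩ := hP.lipschitzWith_of_hasCompactSupport hPc one_ne_zero
  obtain ⟨D, hD⟩ := hh.lipschitzWith_of_hasCompactSupport hhc one_ne_zero
  obtain ⟨A, hA⟩ := hP.continuous.bounded_above_of_compact_support hPc
  obtain ⟨B, hB⟩ := hh.continuous.bounded_above_of_compact_support hhc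
  have hA0 : 0 ≤ A := (norm_nonneg _).trans (hA 0)
  have hB0 : 0 ≤ B := (norm_nonneg _).trans (hB 0)
  have hl : LipschitzWith (A.toNNReal * D + B.toNNReal * C) (fun y => |P y| * h y) := by
    refine LipschitzWith.of_dist_le_mul fun x y => ?_
    have e : |P x| * h x - |P y| * h y = |P x| * (h x - h y) + h y * (|P x| - |P y|) := by ring
    have h1 := hD.dist_le_mul x y
    have h2 := hC.dist_le_mul x y
    rw [Real.dist_eq] at h1 h2 ⊢
    rw [e]
    push_cast
    rw [Real.coe_toNNReal _ hA0, Real.coe_toNNReal _ hB0]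
    calc _ ≤ |P x| * |h x - h y| + |h y| * |P x - P y| := by
          refine (abs_add_le _ _).trans ?_
          rw [abs_mul, abs_mul, abs_abs]
          exact add_le_add le_rfl (mul_le_mul_of_nonneg_left (abs_abs_sub_abs_le (P x) (P y))
            (abs_nonneg _))
      _ ≤ A * (D * dist x y) + B * (C * dist x y) := by
          gcongr
          · exact hA x
          · exact hB y
      _ = _ := by ring
  have hs : HasCompactSupport (fun y => |P y| * h y) := hhc.mul_left
  refine ⟨?_, ?_⟩
  · rw [← integrableOn_iff_integrable_of_support_subset (s := tsupport fun y => |P y| * h y)]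
    · exact Measure.integrableOn_of_bounded hs.isCompact.measure_lt_top.ne
        (measurable_lineDeriv hl.continuous).aestronglyMeasurable
        (Filter.Eventually.of_forall fun x => norm_lineDeriv_le_of_lipschitz ℝ hl)
    · intro x hx
      by_contra h0
      refine hx ?_
      change lineDeriv ℝ (fun y => |P y| * h y) x v = 0
      rw [(notMem_tsupport_iff_eventuallyEq.1 h0).lineDeriv_eq]
      simp [lineDeriv]
  have h0 : LipschitzWith 0 (fun _ : U => (1 : ℝ)) := LipschitzWith.const 1
  have := h0.integral_lineDeriv_mul_eq (μ := volume) hl hhc.mul_left (-v)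
  simp only [neg_neg, mul_one] at this
  rw [← this]
  simp [lineDeriv]

variable {m : ℕ}

/-- The product of the linear forms `⟪a i, ·⟫`. -/
noncomputable def rootProd (a : Fin m → U) (x : U) : ℝ := ∏ i, inner ℝ (a i) x

theorem rootProd_contDiff (a : Fin m → U) : ContDiff ℝ ∞ (rootProd a) :=
  contDiff_prod fun _ _ => contDiff_const.inner ℝ contDiff_id

theorem rootProd_ne_zero {a : Fin m → U} {x : U} : rootProd a x ≠ 0 ↔ ∀ i, inner ℝ (a i) x ≠ (0 : ℝ) := by
  simp [rootProd, Finset.prod_ne_zero_iff]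

theorem ae_regular [MeasurableSpace U] [BorelSpace U] {a : Fin m → U} (ha : ∀ i, a i ≠ 0) :
    ∀ᵐ x : U, ∀ i, inner ℝ (a i) x ≠ (0 : ℝ) := by
  rw [ae_all_iff]
  intro i
  have h := Measure.addHaar_submodule (volume : Measure U) (LinearMap.ker (innerSL ℝ (a i)).toLinearMap)
    (fun h => ha i (by
      have : a i ∈ LinearMap.ker (innerSL ℝ (a i)).toLinearMap := h ▸ Submodule.mem_top
      simpa using this))
  rw [ae_iff]
  convert h using 2
  ext x; simp

theorem dirD_rootProd (a : Fin m → U) {x : U} (hx : ∀ i, inner ℝ (a i) x ≠ (0 : ℝ)) (v : U) :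
    dirD v (rootProd a) x = rootProd a x * ∑ i, (inner ℝ (a i) x : ℝ)⁻¹ * inner ℝ (a i) v := by
  have h1 : HasFDerivAt (rootProd a) (∑ i, (∏ j ∈ Finset.univ.erase i, (inner ℝ (a j) x : ℝ)) •
      innerSL ℝ (a i)) x :=
    HasFDerivAt.finset_prod (u := Finset.univ) (g := fun i (y : U) => (inner ℝ (a i) y : ℝ)) fun i _ =>
      (innerSL ℝ (a i)).hasFDerivAt
  rw [dirD, h1.fderiv, _root_.sum_apply, Finset.mul_sum]
  refine Finset.sum_congr rfl fun i _ => ?_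
  rw [rootProd, ← Finset.mul_prod_erase _ _ (Finset.mem_univ i)]
  simp only [_root_.smul_apply, innerSL_apply_apply, smul_eq_mul]
  have := hx i
  field_simp

theorem dirD_mul {f g : U → ℝ} {x : U} (hf : DifferentiableAt ℝ f x) (hg : DifferentiableAt ℝ g x)
    (v : U) : dirD v (fun y => f y * g y) x = f x * dirD v g x + g x * dirD v f x := by
  simp only [dirD]
  rw [fderiv_fun_mul hf hg]; simp

theorem dirD_self {F : Type*} [NormedAddCommGroup F] [NormedSpace ℝ F] {k : ℕ} {f : U → F}
    (hf : f ∈ homFun U F k) (x : U) : dirD x f x = (k : ℝ) • f x := by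
  have h1 : HasDerivAt (fun t : ℝ => f (t • x)) (dirD x f x) 1 := by
    have h2 : HasFDerivAt f (fderiv ℝ f x) ((1 : ℝ) • x) := by
      rw [one_smul]; exact (homFun_differentiable hf x).hasFDerivAt
    have h3 : HasDerivAt (fun t : ℝ => t • x) ((1 : ℝ) • x) 1 := (hasDerivAt_id 1).smul_const x
    have h6 := h2.comp_hasDerivAt 1 h3
    rw [one_smul] at h6
    exact h6
  have h4 : HasDerivAt (fun t : ℝ => f (t • x)) ((k : ℝ) • f x) 1 := by
    have h5 : (fun t : ℝ => f (t • x)) = fun t => t ^ k • f x := funext fun t => homFun_smul hf t x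
    rw [h5]
    simpa using (hasDerivAt_pow k (1 : ℝ)).smul_const (f x)
  exact h1.unique h4

/-- Component along `v` of the vector field whose divergence yields Green's identity. -/
noncomputable def greenField (c : ℝ) (f g : U → ℝ) (v x : U) : ℝ :=
  g x * dirD v f x - f x * dirD v g x - c * (inner ℝ v x * (f x * g x))

theorem greenField_contDiff (c : ℝ) {f g : U → ℝ} (hf : ContDiff ℝ ∞ f) (hg : ContDiff ℝ ∞ g) (v : U) :
    ContDiff ℝ ∞ (greenField c f g v) :=
  ((hg.mul (dirD_contDiff hf v)).sub (hf.mul (dirD_contDiff hg v))).sub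
    (contDiff_const.mul ((contDiff_const.inner ℝ contDiff_id).mul (hf.mul hg)))

theorem dirD_greenField (c : ℝ) {f g : U → ℝ} (hf : ContDiff ℝ ∞ f) (hg : ContDiff ℝ ∞ g) (v x : U) :
    dirD v (greenField c f g v) x = g x * dirD v (dirD v f) x - f x * dirD v (dirD v g) x -
      c * (inner ℝ v v * (f x * g x) + inner ℝ v x * (f x * dirD v g x + g x * dirD v f x)) := by
  have f1 := contDiff_diff hf x
  have g1 := contDiff_diff hg x
  have f2 := contDiff_diff (dirD_contDiff hf v) x
  have g2 := contDiff_diff (dirD_contDiff hg v) x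
  have i1 : HasFDerivAt (fun y : U => (inner ℝ v y : ℝ)) (innerSL ℝ v) x := (innerSL ℝ v).hasFDerivAt
  have h := ((g1.hasFDerivAt.mul f2.hasFDerivAt).sub (f1.hasFDerivAt.mul g2.hasFDerivAt)).sub
    ((i1.mul (f1.hasFDerivAt.mul g1.hasFDerivAt)).const_mul c)
  have h' : HasFDerivAt (greenField c f g v) _ x := h
  rw [dirD, h'.fderiv]
  simp only [_root_.sub_apply, _root_.add_apply, _root_.smul_apply, smul_eq_mul, innerSL_apply_apply, Pi.mul_apply]
  simp only [dirD]
  ring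

theorem sum_inner_dirD {κ : Type*} [Fintype κ] (b : OrthonormalBasis κ ℝ U) (u : U) (f : U → ℝ) (x : U) :
    ∑ i, inner ℝ (b i) u * dirD (b i) f x = dirD u f x := by
  conv_rhs => rw [← b.sum_repr' u]
  rw [dirD_sum_left]
  exact Finset.sum_congr rfl fun i _ => (dirD_smul_left _ _ _ _).symm

theorem sum_inner_inner {κ : Type*} [Fintype κ] (b : OrthonormalBasis κ ℝ U) (u x : U) :
    ∑ i, inner ℝ (b i) u * inner ℝ (b i) x = (inner ℝ u x : ℝ) := by
  rw [← b.sum_inner_mul_inner u x]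
  exact Finset.sum_congr rfl fun i _ => by rw [real_inner_comm u]

theorem lineDeriv_green {a : Fin m → U} {c : ℝ} {f g : U → ℝ} (hf : ContDiff ℝ ∞ f) (hg : ContDiff ℝ ∞ g)
    {x : U} (hx : ∀ i, inner ℝ (a i) x ≠ (0 : ℝ)) (v : U) :
    lineDeriv ℝ (fun y => |rootProd a y * bump y| * (bump y * greenField c f g v y)) x v =
      |rootProd a x| * ((bump x) ^ 2 * ((∑ i, (inner ℝ (a i) x : ℝ)⁻¹ * inner ℝ (a i) v) *
        greenField c f g v x + dirD v (greenField c f g v) x) +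
        2 * bump x * dirD v bump x * greenField c f g v x) := by
  have hp : rootProd a x ≠ 0 := rootProd_ne_zero.2 hx
  have hpd : DifferentiableAt ℝ (rootProd a) x := contDiff_diff (rootProd_contDiff a) x
  have hbd : DifferentiableAt ℝ (bump : U → ℝ) x := bump_contDiff.differentiable one_ne_zero x
  have hzd : DifferentiableAt ℝ (greenField c f g v) x := contDiff_diff (greenField_contDiff c hf hg v) x
  have key : ∀ σ : ℝ, (∀ᶠ y in nhds x, |rootProd a y| = σ * rootProd a y) →
      lineDeriv ℝ (fun y => |rootProd a y * bump y| * (bump y * greenField c f g v y)) x v =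
      |rootProd a x| * ((bump x) ^ 2 * ((∑ i, (inner ℝ (a i) x : ℝ)⁻¹ * inner ℝ (a i) v) *
        greenField c f g v x + dirD v (greenField c f g v) x) +
        2 * bump x * dirD v bump x * greenField c f g v x) := by
    intro σ hσ
    have he : (fun y => |rootProd a y * bump y| * (bump y * greenField c f g v y)) =ᶠ[nhds x]
        fun y => σ * (rootProd a y * (bump y * (bump y * greenField c f g v y))) := by
      filter_upwards [hσ] with y hy
      rw [abs_mul, hy, abs_of_nonneg (bump_nonneg y)]; ring
    have h1 : DifferentiableAt ℝ (fun y => bump y * greenField c f g v y) x := hbd.mul hzd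
    have h2 : DifferentiableAt ℝ (fun y => bump y * (bump y * greenField c f g v y)) x := hbd.mul h1
    have h3 : DifferentiableAt ℝ (fun y => rootProd a y * (bump y * (bump y * greenField c f g v y))) x :=
      hpd.mul h2
    rw [he.lineDeriv_eq, (h3.const_mul σ).lineDeriv_eq_fderiv]
    change dirD v _ x = _
    rw [dirD_mul (differentiableAt_const σ) h3, dirD_mul hpd h2, dirD_mul hbd h1, dirD_mul hbd hzd,
      dirD_rootProd a hx, hσ.self_of_nhds]
    have : dirD v (fun _ : U => σ) x = 0 := by simp [dirD]
    rw [this]; ring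
  rcases lt_or_gt_of_ne hp with h | h
  · refine key (-1) ?_
    filter_upwards [hpd.continuousAt.eventually (gt_mem_nhds h)] with y hy
    rw [abs_of_neg hy]; ring
  · refine key 1 ?_
    filter_upwards [hpd.continuousAt.eventually (lt_mem_nhds h)] with y hy
    rw [abs_of_pos hy]; ring

/-- Scalar part of the radial operator. -/
noncomputable def radialScalar (a : Fin m → U) (f : U → ℝ) (x : U) : ℝ :=
  lap f x + ∑ i, (inner ℝ (a i) x : ℝ)⁻¹ * dirD (a i) f x

/-- Eigenvalue in degree `k` of the associated ball operator. -/
def eigen (c : ℝ) (k : ℕ) : ℝ := (k : ℝ) ^ 2 + c * k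

theorem sum_lineDeriv_green {a : Fin m → U} {j k : ℕ} {f g : U → ℝ} (hf : f ∈ homFun U ℝ j)
    (hg : g ∈ homFun U ℝ k) {x : U} (hx : ∀ i, inner ℝ (a i) x ≠ (0 : ℝ)) :
    ∑ l, lineDeriv ℝ (fun y => |rootProd a y * bump y| * (bump y *
        greenField ((j : ℝ) - k) f g (stdOrthonormalBasis ℝ U l) y)) x (stdOrthonormalBasis ℝ U l) =
      |rootProd a x| * (bump x) ^ 2 * (g x * radialScalar a f x - f x * radialScalar a g x -
        (eigen (Module.finrank ℝ U + m + 8) j - eigen (Module.finrank ℝ U + m + 8) k) * (f x * g x)) := by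
  have hf' := homFun_contDiff hf
  have hg' := homFun_contDiff hg
  set b := stdOrthonormalBasis ℝ U
  set c : ℝ := (j : ℝ) - k
  have e0 : ∀ u : U, ∑ l, inner ℝ (b l) u * greenField c f g (b l) x =
      g x * dirD u f x - f x * dirD u g x - c * (inner ℝ u x * (f x * g x)) := by
    intro u
    rw [← sum_inner_dirD b u f, ← sum_inner_dirD b u g, ← sum_inner_inner b u x, Finset.mul_sum,
      Finset.mul_sum, Finset.sum_mul, Finset.mul_sum, ← Finset.sum_sub_distrib, ← Finset.sum_sub_distrib]
    exact Finset.sum_congr rfl fun l _ => by rw [greenField]; ring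
  have e1 : ∑ l, (∑ i, (inner ℝ (a i) x : ℝ)⁻¹ * inner ℝ (a i) (b l)) * greenField c f g (b l) x =
      (∑ i, (inner ℝ (a i) x : ℝ)⁻¹ * (g x * dirD (a i) f x - f x * dirD (a i) g x)) -
        c * m * (f x * g x) := by
    simp only [Finset.sum_mul]
    rw [Finset.sum_comm]
    have : ∀ i, ∑ l, (inner ℝ (a i) x : ℝ)⁻¹ * inner ℝ (a i) (b l) * greenField c f g (b l) x =
        (inner ℝ (a i) x : ℝ)⁻¹ * (g x * dirD (a i) f x - f x * dirD (a i) g x) - c * (f x * g x) := by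
      intro i
      have h := e0 (a i)
      have : ∑ l, (inner ℝ (a i) x : ℝ)⁻¹ * inner ℝ (a i) (b l) * greenField c f g (b l) x =
          (inner ℝ (a i) x : ℝ)⁻¹ * ∑ l, inner ℝ (b l) (a i) * greenField c f g (b l) x := by
        rw [Finset.mul_sum]
        exact Finset.sum_congr rfl fun l _ => by rw [real_inner_comm (a i) (b l)]; ring
      rw [this, h]
      have := hx i
      field_simp
    rw [Finset.sum_congr rfl fun i _ => this i, Finset.sum_sub_distrib]
    simp; ring
  have e2 : ∑ l, dirD (b l) (greenField c f g (b l)) x = g x * lap f x - f x * lap g x -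
      c * ((Module.finrank ℝ U + j + k) * (f x * g x)) := by
    have h1 := sum_inner_dirD b x f x
    have h2 := sum_inner_dirD b x g x
    rw [dirD_self hf, smul_eq_mul] at h1
    rw [dirD_self hg, smul_eq_mul] at h2
    have h3 : ∑ l, (inner ℝ (b l) (b l) : ℝ) = Module.finrank ℝ U := by simp
    have : ∀ l, dirD (b l) (greenField c f g (b l)) x =
        g x * dirD (b l) (dirD (b l) f) x - f x * dirD (b l) (dirD (b l) g) x - c * (
          inner ℝ (b l) (b l) * (f x * g x) + f x * (inner ℝ (b l) x * dirD (b l) g x) +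
          g x * (inner ℝ (b l) x * dirD (b l) f x)) := fun l => by
      rw [dirD_greenField c hf' hg']; ring
    rw [Finset.sum_congr rfl fun l _ => this l, Finset.sum_sub_distrib, Finset.sum_sub_distrib,
      ← Finset.mul_sum, ← Finset.mul_sum, ← Finset.mul_sum, Finset.sum_add_distrib, Finset.sum_add_distrib,
      ← Finset.mul_sum, ← Finset.mul_sum, ← Finset.sum_mul, h1, h2, h3, lap_eq b hf', lap_eq b hg']
    ring
  have e3 : ∑ l, dirD (b l) bump x * greenField c f g (b l) x = -4 * bump x * (c * (f x * g x)) := by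
    have h := e0 x
    rw [dirD_self hf, dirD_self hg, smul_eq_mul, smul_eq_mul, real_inner_self_eq_norm_sq] at h
    have h1 : ∑ l, dirD (b l) bump x * greenField c f g (b l) x =
        -4 * max 0 (1 - ‖x‖ ^ 2) * ∑ l, inner ℝ (b l) x * greenField c f g (b l) x := by
      rw [Finset.mul_sum]
      exact Finset.sum_congr rfl fun l _ => by rw [dirD_bump, real_inner_comm (b l) x]; ring
    rw [h1, h]
    have h2 : max 0 (1 - ‖x‖ ^ 2) * (1 - ‖x‖ ^ 2) = bump x := by
      rw [bump]
      rcases le_total (1 - ‖x‖ ^ 2) 0 with h | h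
      · rw [max_eq_left h]; simp
      · rw [max_eq_right h]; ring
    rw [← h2]; simp only [c]; ring
  rw [Finset.sum_congr rfl fun l _ => lineDeriv_green hf' hg' hx (b l), ← Finset.mul_sum,
    Finset.sum_add_distrib, ← Finset.mul_sum, Finset.sum_add_distrib, e1, e2]
  have : ∑ l, 2 * bump x * dirD (b l) bump x * greenField c f g (b l) x =
      2 * bump x * ∑ l, dirD (b l) bump x * greenField c f g (b l) x := by
    rw [Finset.mul_sum]; exact Finset.sum_congr rfl fun l _ => by ring
  rw [this, e3, radialScalar, radialScalar, eigen, eigen]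
  have : ∑ i, (inner ℝ (a i) x : ℝ)⁻¹ * (g x * dirD (a i) f x - f x * dirD (a i) g x) =
      g x * (∑ i, (inner ℝ (a i) x : ℝ)⁻¹ * dirD (a i) f x) -
      f x * (∑ i, (inner ℝ (a i) x : ℝ)⁻¹ * dirD (a i) g x) := by
    rw [Finset.mul_sum, Finset.mul_sum, ← Finset.sum_sub_distrib]
    exact Finset.sum_congr rfl fun i _ => by ring
  rw [this]
  simp only [c]
  ring

/-- Green's identity for the weight `|∏ ⟪a i, ·⟫| (1 - |x|²)₊⁴`. -/
theorem integral_green [MeasurableSpace U] [BorelSpace U] {a : Fin m → U} (ha : ∀ i, a i ≠ 0) {j k : ℕ}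
    {f g : U → ℝ} (hf : f ∈ homFun U ℝ j) (hg : g ∈ homFun U ℝ k) :
    Integrable (fun x => |rootProd a x| * (bump x) ^ 2 *
      (g x * radialScalar a f x - f x * radialScalar a g x -
      (eigen (Module.finrank ℝ U + m + 8) j - eigen (Module.finrank ℝ U + m + 8) k) * (f x * g x))) ∧
    ∫ x, |rootProd a x| * (bump x) ^ 2 * (g x * radialScalar a f x - f x * radialScalar a g x -
      (eigen (Module.finrank ℝ U + m + 8) j - eigen (Module.finrank ℝ U + m + 8) k) * (f x * g x)) = 0 := by
  have hf' := homFun_contDiff hf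
  have hg' := homFun_contDiff hg
  have h1 : ∀ v : U, ContDiff ℝ 1 (greenField ((j : ℝ) - k) f g v) := fun v =>
    (greenField_contDiff _ hf' hg' v).of_le (by simp)
  have h2 : ContDiff ℝ 1 (rootProd a) := (rootProd_contDiff a).of_le (by simp)
  have h3 := fun v : U => integral_dir_eq_zero v (h2.mul bump_contDiff) bump_hasCompactSupport.mul_left
    (bump_contDiff.mul (h1 v)) bump_hasCompactSupport.mul_right
  have h4 := (ae_regular ha).mono fun x hx => sum_lineDeriv_green (x := x) hf hg hx
  refine ⟨Integrable.congr (integrable_finset_sum _ fun l _ => (h3 _).1) h4, ?_⟩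
  rw [← integral_congr_ae h4]
  exact (integral_finset_sum _ fun l _ => (h3 _).1).trans (Finset.sum_eq_zero fun l _ => (h3 _).2)

end Weight

section Core
variable {X : Type*} [AddCommGroup X] [Module ℝ X]

/-- Two graded families `A ≤ E` and a lowering operator `T` satisfying a Green identity for a
positive form `B`; if `A` is total then `E k` lies in the span of the `A j`, `j ≤ k`. -/
theorem graded_le_of_green (E A : ℕ → Submodule ℝ X) (B : LinearMap.BilinForm ℝ X) (T : ℕ → X → X)
    (μ : ℕ → ℝ) (hμ : Function.Injective μ) (hAE : ∀ k, A k ≤ E k) [∀ k, FiniteDimensional ℝ (A k)]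
    (hsymm : ∀ x y, B x y = B y x)
    (hdef : ∀ x ∈ ⨆ k, E k, B x x = 0 → x = 0)
    (hTE : ∀ k, ∀ x ∈ E k, T k x ∈ ⨆ i, ⨆ _ : i < k, E i)
    (hTA : ∀ k, ∀ x ∈ A k, T k x ∈ ⨆ i, ⨆ _ : i < k, A i)
    (hgreen : ∀ j k, ∀ x ∈ E j, ∀ y ∈ E k, B (T j x) y - B x (T k y) = (μ j - μ k) * B x y)
    (htot : ∀ x ∈ ⨆ k, E k, (∀ l, ∀ y ∈ A l, B x y = 0) → x = 0) (k : ℕ) :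
    E k ≤ ⨆ i, ⨆ _ : i ≤ k, A i := by
  induction k using Nat.strong_induction_on with
  | _ k ih =>
  set W : Submodule ℝ X := ⨆ i, ⨆ _ : i ≤ k, A i with hW
  have hfin : FiniteDimensional ℝ W := by
    have : W = ⨆ i : Fin (k + 1), A i := by
      refine le_antisymm (iSup₂_le fun i hi => le_iSup (fun i : Fin (k + 1) => A i) ⟨i, by omega⟩)
        (iSup_le fun i => le_iSup₂_of_le (i : ℕ) (by omega) le_rfl)
    rw [this]
    infer_instance
  have hWE : W ≤ ⨆ k, E k := iSup₂_le fun i _ => (hAE i).trans (le_iSup E i)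
  have hltW : ∀ j ≤ k, (⨆ i, ⨆ _ : i < j, A i) ≤ W := fun j hj =>
    iSup₂_le fun i hi => le_iSup₂_of_le i (by omega) le_rfl
  have hEW : ∀ j ≤ k, (⨆ i, ⨆ _ : i < j, E i) ≤ W := fun j hj => iSup₂_le fun i hi =>
    (ih i (by omega)).trans (iSup₂_le fun l hl => le_iSup₂_of_le l (by omega) le_rfl)
  intro f hf
  have hz : ∀ x : W, B x x = 0 → x = 0 := fun x hx => Subtype.ext (hdef x (hWE x.2) hx)
  have hnd : (B.restrict W).Nondegenerate := ⟨fun x hx => hz x (hx x), fun x hx => hz x (hx x)⟩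
  set w' : W := (LinearMap.BilinForm.toDual _ hnd).symm ((B f).comp W.subtype) with hw'
  obtain ⟨w, hw, D, hfD, hDW⟩ : ∃ w ∈ W, ∃ D, f = w + D ∧ ∀ y ∈ W, B D y = 0 := by
    refine ⟨w', w'.2, f - w', by abel, fun y hy => ?_⟩
    have h1 : LinearMap.BilinForm.toDual _ hnd w' ⟨y, hy⟩ = B f y := by
      rw [hw', LinearEquiv.apply_symm_apply]; rfl
    rw [LinearMap.BilinForm.toDual_def] at h1
    have h2 : B w' y = B f y := h1
    rw [map_sub, LinearMap.sub_apply, h2, sub_self]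
  subst hfD
  clear_value w'
  have hrep : ∃ D' : ℕ → X, (∀ j ≤ k, D' j ∈ E j) ∧ (∀ j < k, D' j ∈ A j) ∧
      D = ∑ j ∈ Finset.range (k + 1), D' j := by
    have hw' : w ∈ ⨆ i ∈ Finset.range (k + 1), A i := by
      rw [hW] at hw
      convert hw using 5
      simp [Nat.lt_succ_iff]
    obtain ⟨a, ha⟩ := (Submodule.mem_iSup_finset_iff_exists_sum _ _).1 hw'
    refine ⟨fun j => if j = k then w + D - a j else -(a j : X), fun j hj => ?_, fun j hj => ?_, ?_⟩
    · dsimp only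
      split_ifs with h
      · subst h; exact Submodule.sub_mem _ hf (hAE _ (a _).2)
      · exact Submodule.neg_mem _ (hAE _ (a _).2)
    · dsimp only
      rw [if_neg hj.ne]; exact Submodule.neg_mem _ (a _).2
    · rw [Finset.sum_range_succ, if_pos rfl, Finset.sum_congr rfl fun j hj =>
        if_neg (Finset.mem_range.1 hj).ne, Finset.sum_neg_distrib]
      rw [Finset.sum_range_succ] at ha
      rw [← ha]; abel
  obtain ⟨D', hD'E, hD'A, hsum⟩ := hrep
  have hDE : D ∈ ⨆ k, E k := by
    rw [hsum]
    exact Submodule.sum_mem _ fun j hj => (le_iSup E j) (hD'E j (by simp at hj; omega))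
  set R : X := ∑ j ∈ Finset.range (k + 1), (T j (D' j) + (μ k - μ j) • D' j) with hR
  have hRW : R ∈ W := by
    refine Submodule.sum_mem _ fun j hj => ?_
    have hj' : j ≤ k := by simp at hj; omega
    refine Submodule.add_mem _ (hEW j hj' (hTE j _ (hD'E j hj'))) ?_
    rcases hj'.lt_or_eq with h | rfl
    · exact Submodule.smul_mem _ _ (hltW (j + 1) h |> fun H => H
        ((le_iSup₂_of_le (f := fun i (_ : i < j + 1) => A i) j (by omega) le_rfl) (hD'A j h)))
    · simp
  have hBR : ∀ l, ∀ y ∈ A l, B R y = B D (T l y) + (μ k - μ l) * B D y := by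
    intro l y hy
    rw [hR, hsum, map_sum, LinearMap.sum_apply, map_sum, LinearMap.sum_apply, LinearMap.sum_apply,
      Finset.mul_sum, ← Finset.sum_add_distrib]
    refine Finset.sum_congr rfl fun j hj => ?_
    have := hgreen j l _ (hD'E j (by simp at hj; omega)) y (hAE l hy)
    rw [map_add, LinearMap.add_apply, map_smul, LinearMap.smul_apply, smul_eq_mul]
    linarith
  have hR0 : R = 0 := by
    refine hdef R (hWE hRW) ?_
    have : ∀ y ∈ W, B R y = 0 := by
      intro y hy
      have : W ≤ LinearMap.ker (B R) := iSup₂_le fun l hl y hy => by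
        rw [LinearMap.mem_ker, hBR l y hy, hDW _ (hltW l hl (hTA l y hy)),
          hDW y ((le_iSup₂_of_le (f := fun i (_ : i ≤ k) => A i) l hl le_rfl) hy)]
        simp
      exact this hy
    exact this R hRW
  have hD0 : ∀ l, ∀ y ∈ A l, B D y = 0 := by
    intro l
    induction l using Nat.strong_induction_on with
    | _ l ihl =>
    intro y hy
    rcases le_or_gt l k with hl | hl
    · exact hDW y ((le_iSup₂_of_le (f := fun i (_ : i ≤ k) => A i) l hl le_rfl) hy)
    have h1 := hBR l y hy
    have h2 : B D (T l y) = 0 := by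
      have : (⨆ i, ⨆ _ : i < l, A i) ≤ LinearMap.ker (B D) := iSup₂_le fun i hi z hz => ihl i hi z hz
      exact this (hTA l y hy)
    rw [hR0, map_zero, LinearMap.zero_apply, h2, zero_add] at h1
    rcases mul_eq_zero.1 h1.symm with h | h
    · exact absurd (hμ (sub_eq_zero.1 h)) hl.ne
    · exact h
  rw [htot D hDE hD0, add_zero]
  exact hw

end Core

section FormPairing
open Function
variable {U : Type*} [NormedAddCommGroup U] [InnerProductSpace ℝ U] [FiniteDimensional ℝ U] {p : ℕ}

/-- Euclidean pairing of alternating forms (up to a factor `p!`). -/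
noncomputable def formPair (A B : U [⋀^Fin p]→L[ℝ] ℝ) : ℝ :=
  ∑ I : Fin p → Fin (Module.finrank ℝ U), A (stdOrthonormalBasis ℝ U ∘ I) * B (stdOrthonormalBasis ℝ U ∘ I)

theorem formPair_comm (A B : U [⋀^Fin p]→L[ℝ] ℝ) : formPair A B = formPair B A :=
  Finset.sum_congr rfl fun _ _ => mul_comm _ _

theorem formPair_self_nonneg (A : U [⋀^Fin p]→L[ℝ] ℝ) : 0 ≤ formPair A A :=
  Finset.sum_nonneg fun _ _ => mul_self_nonneg _

theorem formPair_self_eq_zero {A : U [⋀^Fin p]→L[ℝ] ℝ} (h : formPair A A = 0) : A = 0 := by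
  have h1 := (Finset.sum_eq_zero_iff_of_nonneg fun _ _ => mul_self_nonneg _).1 h
  have h2 : A.toContinuousMultilinearMap.toMultilinearMap = 0 := by
    refine Module.Basis.ext_multilinear (fun _ => (stdOrthonormalBasis ℝ U).toBasis) fun I => ?_
    have h3 : A (stdOrthonormalBasis ℝ U ∘ I) = 0 := mul_self_eq_zero.1 (h1 I (Finset.mem_univ _))
    simp only [OrthonormalBasis.coe_toBasis]
    exact h3
  ext v
  exact congrArg (fun m => m v) h2

theorem formPair_add_left (A A' B : U [⋀^Fin p]→L[ℝ] ℝ) :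
    formPair (A + A') B = formPair A B + formPair A' B := by
  simp [formPair, add_mul, Finset.sum_add_distrib]

theorem formPair_smul_left (c : ℝ) (A B : U [⋀^Fin p]→L[ℝ] ℝ) :
    formPair (c • A) B = c * formPair A B := by
  simp [formPair, Finset.mul_sum, mul_assoc]

theorem continuous_formPair {X : Type*} [TopologicalSpace X] {f g : X → U [⋀^Fin p]→L[ℝ] ℝ}
    (hf : Continuous f) (hg : Continuous g) : Continuous fun x => formPair (f x) (g x) :=
  continuous_finset_sum _ fun I _ => ((altEval _).continuous.comp hf).mul ((altEval _).continuous.comp hg)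

theorem formPair_slot (a : U) (A B : U [⋀^Fin p]→L[ℝ] ℝ) :
    ∑ I : Fin p → Fin (Module.finrank ℝ U), (∑ c, inner ℝ a (stdOrthonormalBasis ℝ U (I c)) *
      A (update (stdOrthonormalBasis ℝ U ∘ I) c a)) * B (stdOrthonormalBasis ℝ U ∘ I) =
    ∑ I : Fin p → Fin (Module.finrank ℝ U), (∑ c, inner ℝ a (stdOrthonormalBasis ℝ U (I c)) *
      B (update (stdOrthonormalBasis ℝ U ∘ I) c a)) * A (stdOrthonormalBasis ℝ U ∘ I) := by
  set b := stdOrthonormalBasis ℝ U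
  have h1 : ∀ (A : U [⋀^Fin p]→L[ℝ] ℝ) (I : Fin p → Fin (Module.finrank ℝ U)) (c : Fin p),
      A (update (b ∘ I) c a) = ∑ j, inner ℝ a (b j) * A (b ∘ update I c j) := by
    intro A I c
    conv_lhs => rw [← b.sum_repr' a]
    have := MultilinearMap.map_update_sum A.toMultilinearMap Finset.univ c
      (fun j => (inner ℝ (b j) a : ℝ) • b j) (b ∘ I)
    refine this.trans (Finset.sum_congr rfl fun j _ => ?_)
    refine (A.map_update_smul (b ∘ I) c _ (b j)).trans ?_
    rw [smul_eq_mul, real_inner_comm a (b j), comp_update]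
  have h2 : ∀ A B : U [⋀^Fin p]→L[ℝ] ℝ, ∑ I : Fin p → Fin (Module.finrank ℝ U),
      (∑ c, inner ℝ a (b (I c)) * A (update (b ∘ I) c a)) * B (b ∘ I) =
      ∑ c, ∑ x : (Fin p → Fin (Module.finrank ℝ U)) × Fin (Module.finrank ℝ U),
        inner ℝ a (b (x.1 c)) * inner ℝ a (b x.2) * A (b ∘ update x.1 c x.2) * B (b ∘ x.1) := by
    intro A B
    simp only [Finset.sum_mul, h1, Fintype.sum_prod_type]
    rw [Finset.sum_comm]
    refine Finset.sum_congr rfl fun c _ => Finset.sum_congr rfl fun I _ => ?_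
    rw [Finset.mul_sum, Finset.sum_mul]
    exact Finset.sum_congr rfl fun j _ => by ring
  rw [h2, h2]
  refine Finset.sum_congr rfl fun c _ => ?_
  let e : (Fin p → Fin (Module.finrank ℝ U)) × Fin (Module.finrank ℝ U) → 
      (Fin p → Fin (Module.finrank ℝ U)) × Fin (Module.finrank ℝ U) := fun x => (update x.1 c x.2, x.1 c)
  have he : Involutive e := fun x => by simp [e]
  rw [← (Equiv.sum_comp he.toPerm)]
  refine Finset.sum_congr rfl fun x _ => ?_
  simp only [Involutive.coe_toPerm, e, update_idem, update_self, update_eq_self]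
  ring

end FormPairing

namespace PolarRep
open scoped ContDiff
open Function MeasureTheory
variable {Γ : Type*} [Group Γ] [TopologicalSpace Γ] {V : Type*}
    [NormedAddCommGroup V] [InnerProductSpace ℝ V] [FiniteDimensional ℝ V] {U : Type*}
    [NormedAddCommGroup U] [InnerProductSpace ℝ U] [FiniteDimensional ℝ U]
variable {P : PolarRep Γ V U} {p : ℕ} [CompactSpace Γ] [IsTopologicalGroup Γ]

variable (P p) in
/-- Homogeneous Weyl-invariant polynomial forms on the section. -/
def sectionForms (k : ℕ) : Submodule ℝ C(U, U [⋀^Fin p]→L[ℝ] ℝ) where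
  carrier := {q | (q : U → U [⋀^Fin p]→L[ℝ] ℝ) ∈ homFun U (U [⋀^Fin p]→L[ℝ] ℝ) k ∧ P.WInv q}
  zero_mem' := ⟨(homFun U _ k).zero_mem, fun _ _ _ _ => rfl⟩
  add_mem' := fun ha hb => ⟨(homFun U _ k).add_mem ha.1 hb.1, fun w hw s v => by
    simp [ha.2 w hw s v, hb.2 w hw s v]⟩
  smul_mem' := fun c _ ha => ⟨(homFun U _ k).smul_mem c ha.1, fun w hw s v => by
    simp [ha.2 w hw s v]⟩

variable (P p) in
/-- Restrictions to the section of homogeneous basic polynomial forms. -/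
def basicForms (k : ℕ) : Submodule ℝ C(U, U [⋀^Fin p]→L[ℝ] ℝ) where
  carrier := {q | ∃ Q ∈ homFun V (V [⋀^Fin p]→L[ℝ] ℝ) k, P.Basic Q ∧ ∀ s, q s = P.restr Q s}
  zero_mem' := ⟨0, (homFun V _ k).zero_mem, ⟨contDiff_const, fun _ _ _ => rfl, fun _ _ _ _ => rfl⟩,
    fun _ => rfl⟩
  add_mem' := by
    rintro a b ⟨Q, hQ, hB, h⟩ ⟨Q', hQ', hB', h'⟩
    refine ⟨Q + Q', (homFun V _ k).add_mem hQ hQ', ⟨hB.smooth.add hB'.smooth, fun g x v => ?_,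
      fun s v a ha => ?_⟩, fun s => ?_⟩
    · have := hB.inv g x v
      have := hB'.inv g x v
      simp_all
    · have := hB.hor s v a ha
      have := hB'.hor s v a ha
      simp_all
    · rw [ContinuousMap.add_apply, h, h']; rfl
  smul_mem' := by
    rintro c a ⟨Q, hQ, hB, h⟩
    refine ⟨c • Q, (homFun V _ k).smul_mem c hQ, ⟨contDiff_const.smul hB.smooth, fun g x v => ?_,
      fun s v a ha => ?_⟩, fun s => ?_⟩
    · have := hB.inv g x v
      simp_all
    · have := hB.hor s v a ha
      simp_all
    · rw [ContinuousMap.smul_apply, h]; rfl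

theorem basicForms_le (k : ℕ) : P.basicForms p k ≤ P.sectionForms p k := by
  rintro q ⟨Q, hQ, hB, h⟩
  have hq : (q : U → U [⋀^Fin p]→L[ℝ] ℝ) = P.restr Q := funext h
  refine ⟨?_, ?_⟩
  · rw [hq]
    refine ⟨P.restr_contDiff hB.smooth, fun t s => ?_⟩
    ext v
    rw [restr_apply, map_smul, homFun_smul hQ]; rfl
  · intro w hw s v
    obtain ⟨g, hg⟩ := P.mem_weyl.1 hw
    rw [hq, restr_apply, restr_apply, ← hB.inv g (P.ι s), hg]
    congr 1
    funext i
    exact (hg (v i)).symm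

instance (k : ℕ) : FiniteDimensional ℝ (P.sectionForms p k) :=
  FiniteDimensional.of_injective (V₂ := homFun U (U [⋀^Fin p]→L[ℝ] ℝ) k)
    { toFun := fun q => ⟨_, q.2.1⟩, map_add' := fun _ _ => rfl, map_smul' := fun _ _ => rfl }
    fun a b h => Subtype.ext (DFunLike.coe_injective (congrArg Subtype.val h))

instance (k : ℕ) : FiniteDimensional ℝ (P.basicForms p k) :=
  Submodule.finiteDimensional_of_le (P.basicForms_le k)

theorem exists_lowering (R : P.Roots) (k : ℕ) (q : C(U, U [⋀^Fin p]→L[ℝ] ℝ)) (hq : q ∈ P.sectionForms p k) :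
    ∃ q' : C(U, U [⋀^Fin p]→L[ℝ] ℝ), q' ∈ (⨆ i, ⨆ _ : i < k, P.sectionForms p i) ∧
      (q ∈ P.basicForms p k → q' ∈ ⨆ i, ⨆ _ : i < k, P.basicForms p i) ∧
      ∀ s, R.Regular s → ∀ v, q' s v = P.radial R q s v := by
  rcases lt_or_ge k 2 with hk | hk
  · exact ⟨0, Submodule.zero_mem _, fun _ => Submodule.zero_mem _, fun s hs v =>
      (radial_zero R hk hq.1 hq.2 hs v).symm⟩
  obtain ⟨k, rfl⟩ := Nat.exists_eq_add_of_le' hk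
  obtain ⟨q', h1, h2, h3⟩ := exists_radial R hq.1 hq.2
  refine ⟨⟨q', (homFun_contDiff h1).continuous⟩, Submodule.mem_iSup_of_mem k
    (Submodule.mem_iSup_of_mem (by omega) ⟨h1, h2⟩), ?_, h3⟩
  rintro ⟨Q, hQ, hB, h⟩
  refine Submodule.mem_iSup_of_mem k (Submodule.mem_iSup_of_mem (by omega)
    ⟨lap Q, homFun_lap hQ, hB.lap, fun s => ?_⟩)
  refine R.eq_of_regular (homFun_contDiff h1).continuous
    (P.restr_contDiff (lap_contDiff hB.smooth)).continuous (fun s hs => ?_) s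
  ext v
  rw [h3 s hs, hB.restr_lap R hs, show (q : U → _) = P.restr Q from funext h]

theorem radial_sum_pair (R : P.Roots) {q : U → U [⋀^Fin p]→L[ℝ] ℝ} (hq : ContDiff ℝ ∞ q) (s : U)
    (v : Fin p → U) : P.radial R q s v = radialScalar R.a (fun x => q x v) s -
      ∑ i, ((inner ℝ (R.a i) s : ℝ)⁻¹) ^ 2 * ∑ c, inner ℝ (R.a i) (v c) * q s (update v c (R.a i)) := by
  rw [radial, radialScalar, Finset.sum_sub_distrib, add_sub_assoc]
  have h := lap_clm hq (altEval v) s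
  simp only [altEval_apply] at h
  rw [h]
  congr 2
  exact Finset.sum_congr rfl fun i _ => by rw [dirD_altEval hq]

variable [MeasurableSpace U] [BorelSpace U]

/-- The weight in Green's identity. -/
noncomputable def Roots.weight (R : P.Roots) (x : U) : ℝ := |rootProd R.a x| * (bump x) ^ 2

theorem Roots.weight_continuous (R : P.Roots) : Continuous R.weight :=
  (rootProd_contDiff R.a).continuous.abs.mul (bump_contDiff.continuous.pow 2)

theorem Roots.weight_integrable (R : P.Roots) {f : U → ℝ} (hf : Continuous f) :
    Integrable fun x => R.weight x * f x := by
  refine (R.weight_continuous.mul hf).integrable_of_hasCompactSupport ?_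
  refine HasCompactSupport.intro (isCompact_closedBall (0 : U) 1) fun x hx => ?_
  rw [Pi.mul_apply, Roots.weight, bump_eq_zero (by simp at hx; exact hx.le)]
  simp

/-- The weighted `L²` form. -/
noncomputable def Roots.form (R : P.Roots) (p : ℕ) : LinearMap.BilinForm ℝ C(U, U [⋀^Fin p]→L[ℝ] ℝ) :=
  LinearMap.mk₂ ℝ (fun f g => ∫ x, R.weight x * formPair (f x) (g x))
    (fun f f' g => by
      rw [← integral_add (R.weight_integrable (continuous_formPair f.continuous g.continuous))
        (R.weight_integrable (continuous_formPair f'.continuous g.continuous))]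
      refine integral_congr_ae (Filter.Eventually.of_forall fun x => ?_)
      dsimp only
      rw [ContinuousMap.add_apply, formPair_add_left]; ring)
    (fun c f g => by
      rw [smul_eq_mul, ← integral_const_mul]
      refine integral_congr_ae (Filter.Eventually.of_forall fun x => ?_)
      dsimp only
      rw [ContinuousMap.smul_apply, formPair_smul_left]; ring)
    (fun f g g' => by
      rw [← integral_add (R.weight_integrable (continuous_formPair f.continuous g.continuous))
        (R.weight_integrable (continuous_formPair f.continuous g'.continuous))]
      refine integral_congr_ae (Filter.Eventually.of_forall fun x => ?_)
      dsimp only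
      rw [ContinuousMap.add_apply, formPair_comm, formPair_add_left, formPair_comm (g x),
        formPair_comm (g' x)]; ring)
    (fun c f g => by
      rw [smul_eq_mul, ← integral_const_mul]
      refine integral_congr_ae (Filter.Eventually.of_forall fun x => ?_)
      dsimp only
      rw [ContinuousMap.smul_apply, formPair_comm, formPair_smul_left, formPair_comm (g x)]; ring)

theorem Roots.form_apply (R : P.Roots) (f g : C(U, U [⋀^Fin p]→L[ℝ] ℝ)) :
    R.form p f g = ∫ x, R.weight x * formPair (f x) (g x) := rfl

theorem Roots.form_comm (R : P.Roots) (f g : C(U, U [⋀^Fin p]→L[ℝ] ℝ)) : R.form p f g = R.form p g f := by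
  simp only [form_apply, formPair_comm]

/-- The lowering operator. -/
noncomputable def lowering (R : P.Roots) (k : ℕ) (q : C(U, U [⋀^Fin p]→L[ℝ] ℝ)) :
    C(U, U [⋀^Fin p]→L[ℝ] ℝ) :=
  open Classical in if h : q ∈ P.sectionForms p k then (exists_lowering R k q h).choose else 0

theorem lowering_spec (R : P.Roots) {k : ℕ} {q : C(U, U [⋀^Fin p]→L[ℝ] ℝ)} (h : q ∈ P.sectionForms p k) :
    P.lowering R k q ∈ (⨆ i, ⨆ _ : i < k, P.sectionForms p i) ∧
      (q ∈ P.basicForms p k → P.lowering R k q ∈ ⨆ i, ⨆ _ : i < k, P.basicForms p i) ∧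
      ∀ s, R.Regular s → ∀ v, P.lowering R k q s v = P.radial R q s v := by
  rw [lowering, dif_pos h]
  exact (exists_lowering R k q h).choose_spec

theorem form_green (R : P.Roots) (j k : ℕ) (f : C(U, U [⋀^Fin p]→L[ℝ] ℝ)) (hf : f ∈ P.sectionForms p j)
    (g : C(U, U [⋀^Fin p]→L[ℝ] ℝ)) (hg : g ∈ P.sectionForms p k) :
    R.form p (P.lowering R j f) g - R.form p f (P.lowering R k g) =
      (eigen (Module.finrank ℝ U + R.m + 8) j - eigen (Module.finrank ℝ U + R.m + 8) k) *
        R.form p f g := by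
  obtain ⟨-, -, hf3⟩ := lowering_spec R hf
  obtain ⟨-, -, hg3⟩ := lowering_spec R hg
  set f' := P.lowering R j f
  set g' := P.lowering R k g
  set μ : ℝ := eigen (Module.finrank ℝ U + R.m + 8) j - eigen (Module.finrank ℝ U + R.m + 8) k with hμ
  have hcoef : ∀ {l : ℕ} {q : C(U, U [⋀^Fin p]→L[ℝ] ℝ)} (_ : q ∈ P.sectionForms p l) (v : Fin p → U),
      (fun x => q x v) ∈ homFun U ℝ l := fun h v =>
    ⟨(altEval v).contDiff.comp h.1.1, fun t x => by dsimp only; rw [homFun_smul h.1]; rfl⟩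
  have hgr := fun I : Fin p → Fin (Module.finrank ℝ U) => integral_green R.a_ne_zero
    (hcoef hf (stdOrthonormalBasis ℝ U ∘ I)) (hcoef hg (stdOrthonormalBasis ℝ U ∘ I))
  have h0 := (integral_finset_sum Finset.univ fun I _ => (hgr I).1).trans
    (Finset.sum_eq_zero fun I _ => (hgr I).2)
  have i1 := R.weight_integrable (continuous_formPair f'.continuous g.continuous)
  have i2 := R.weight_integrable (continuous_formPair f.continuous g'.continuous)
  have i3 := R.weight_integrable (continuous_formPair f.continuous g.continuous)
  have i12 : Integrable fun x => R.weight x * formPair (f' x) (g x) -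
      R.weight x * formPair (f x) (g' x) := i1.sub i2
  rw [← sub_eq_zero, Roots.form_apply, Roots.form_apply, Roots.form_apply, ← integral_sub i1 i2,
    ← integral_const_mul, ← integral_sub i12 (i3.const_mul μ), ← h0]
  refine integral_congr_ae ((ae_regular R.a_ne_zero).mono fun x hx => ?_)
  have hx' : R.Regular x := hx
  dsimp only
  rw [← hμ, ← Finset.mul_sum, Finset.sum_sub_distrib, Finset.sum_sub_distrib, ← Finset.mul_sum]
  set b := stdOrthonormalBasis ℝ U
  have e1 : ∀ {q q' g : C(U, U [⋀^Fin p]→L[ℝ] ℝ)} {l : ℕ} (_ : q ∈ P.sectionForms p l)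
      (_ : ∀ s, R.Regular s → ∀ v, q' s v = P.radial R q s v),
      formPair (q' x) (g x) = ∑ I : Fin p → Fin (Module.finrank ℝ U), g x (b ∘ I) *
        radialScalar R.a (fun y => q y (b ∘ I)) x - ∑ i, ((inner ℝ (R.a i) x : ℝ)⁻¹) ^ 2 *
        ∑ I : Fin p → Fin (Module.finrank ℝ U), (∑ c, inner ℝ (R.a i) (b (I c)) *
          q x (update (b ∘ I) c (R.a i))) * g x (b ∘ I) := by
    intro q q' g l hq hq'
    rw [formPair]
    simp only [Finset.mul_sum]
    rw [Finset.sum_comm (s := Finset.univ (α := Fin R.m)), ← Finset.sum_sub_distrib]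
    refine Finset.sum_congr rfl fun I _ => ?_
    rw [hq' x hx', radial_sum_pair R hq.1.1, sub_mul, Finset.sum_mul, mul_comm]
    congr 1
    refine Finset.sum_congr rfl fun i _ => ?_
    rw [mul_assoc]; rfl
  have hK : ∑ i, ((inner ℝ (R.a i) x : ℝ)⁻¹) ^ 2 *
        ∑ I : Fin p → Fin (Module.finrank ℝ U), (∑ c, inner ℝ (R.a i) (b (I c)) *
          f x (update (b ∘ I) c (R.a i))) * g x (b ∘ I) =
      ∑ i, ((inner ℝ (R.a i) x : ℝ)⁻¹) ^ 2 *
        ∑ I : Fin p → Fin (Module.finrank ℝ U), (∑ c, inner ℝ (R.a i) (b (I c)) *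
          g x (update (b ∘ I) c (R.a i))) * f x (b ∘ I) :=
    Finset.sum_congr rfl fun i _ => by rw [formPair_slot (R.a i) (f x) (g x)]
  rw [formPair_comm (f x) (g' x), e1 hf hf3, e1 hg hg3, hK]
  have hP : formPair (f x) (g x) = ∑ I : Fin p → Fin (Module.finrank ℝ U),
      f x (b ∘ I) * g x (b ∘ I) := rfl
  rw [hP, Roots.weight]
  ring

end PolarRep

section PolyLE
open scoped ContDiff
universe u v
variable {E : Type u} [NormedAddCommGroup E] [NormedSpace ℝ E] [FiniteDimensional ℝ E]
  {F : Type v} [NormedAddCommGroup F] [NormedSpace ℝ F] [FiniteDimensional ℝ F]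

variable (E F) in
/-- Polynomial maps of degree at most `n`. -/
def polyLE (n : ℕ) : Submodule ℝ (E → F) := ⨆ k : Fin (n + 1), homFun E F k

theorem homFun_le_polyLE {k n : ℕ} (h : k ≤ n) : homFun E F k ≤ polyLE E F n :=
  le_iSup (fun k : Fin (n + 1) => homFun E F k) ⟨k, by omega⟩

theorem polyLE_mono {m n : ℕ} (h : m ≤ n) : polyLE E F m ≤ polyLE E F n :=
  iSup_le fun k => homFun_le_polyLE (by omega)

theorem polyLE_induction {n : ℕ} (p : (E → F) → Prop) {f : E → F} (hf : f ∈ polyLE E F n)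
    (h : ∀ k ≤ n, ∀ f ∈ homFun E F k, p f) (h0 : p 0) (ha : ∀ f g, p f → p g → p (f + g)) : p f :=
  Submodule.iSup_induction _ (motive := p) hf (fun k f hf => h k (by omega) f hf) h0 ha

theorem polyLE_contDiff {n : ℕ} {f : E → F} (hf : f ∈ polyLE E F n) : ContDiff ℝ ∞ f :=
  polyLE_induction (ContDiff ℝ ∞ ·) hf (fun _ _ _ h => homFun_contDiff h) contDiff_const fun _ _ h h' => h.add h'

theorem exists_sum_of_mem_polyLE {n : ℕ} {f : E → F} (hf : f ∈ polyLE E F n) :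
    ∃ q : ℕ → E → F, (∀ j, q j ∈ homFun E F j) ∧ f = ∑ j ∈ Finset.range (n + 1), q j := by
  refine polyLE_induction (fun f => ∃ q : ℕ → E → F, (∀ j, q j ∈ homFun E F j) ∧
    f = ∑ j ∈ Finset.range (n + 1), q j) hf (fun k hk f hf => ⟨Pi.single k f, fun j => ?_, ?_⟩) ⟨0, fun j => Submodule.zero_mem _, by simp⟩ ?_
  · by_cases h : j = k
    · subst h; simpa using hf
    · simp [h]
  · rw [Finset.sum_eq_single k (fun j _ hj => Pi.single_eq_of_ne hj _)
      (fun h => absurd (Finset.mem_range.2 (by omega)) h), Pi.single_eq_same]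
  · rintro f g ⟨q, hq, rfl⟩ ⟨q', hq', rfl⟩
    exact ⟨q + q', fun j => add_mem (hq j) (hq' j), by simp [Finset.sum_add_distrib]⟩

theorem polyLE_smul_mem {m n : ℕ} {f : E → ℝ} {g : E → F} (hf : f ∈ polyLE E ℝ m)
    (hg : g ∈ polyLE E F n) : (fun x => f x • g x) ∈ polyLE E F (m + n) := by
  refine polyLE_induction (fun f => (fun x => f x • g x) ∈ polyLE E F (m + n)) hf
    (fun k hk f hf => ?_) ?_ fun f f' h h' => ?_
  · refine polyLE_induction (fun g => (fun x => f x • g x) ∈ polyLE E F (m + n)) hg (fun l hl g hg => homFun_le_polyLE (by omega) (homFun_smul_mem hf hg)) ?_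
      fun g g' h h' => ?_
    · convert Submodule.zero_mem (polyLE E F (m + n)) using 1
      funext x; simp
    · convert add_mem h h' using 1
      funext x; simp
  · convert Submodule.zero_mem (polyLE E F (m + n)) using 1
    funext x; simp
  · convert add_mem h h' using 1
    funext x; simp [add_smul]

theorem polyLE_mul_mem {m n : ℕ} {f g : E → ℝ} (hf : f ∈ polyLE E ℝ m)
    (hg : g ∈ polyLE E ℝ n) : (fun x => f x * g x) ∈ polyLE E ℝ (m + n) := polyLE_smul_mem hf hg

theorem polyLE_const (c : F) (n : ℕ) : (fun _ => c) ∈ polyLE E F n :=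
  homFun_le_polyLE (Nat.zero_le n) (homFun_const c)

theorem polyLE_clm (A : E →L[ℝ] F) : (fun x => A x) ∈ polyLE E F 1 :=
  homFun_le_polyLE le_rfl (homFun_clm A)

theorem polyLE_prod_mem {ι : Type*} (s : Finset ι) {n : ι → ℕ} {f : ι → E → ℝ}
    (hf : ∀ i ∈ s, f i ∈ polyLE E ℝ (n i)) :
    (fun x => ∏ i ∈ s, f i x) ∈ polyLE E ℝ (∑ i ∈ s, n i) := by
  induction s using Finset.cons_induction with
  | empty => simpa using polyLE_const (E := E) (1 : ℝ) 0
  | cons a s ha ih =>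
    simp only [Finset.prod_cons, Finset.sum_cons]
    exact polyLE_mul_mem (hf a (by simp)) (ih fun i hi => hf i (by simp [hi]))

/-- Polynomials are uniformly dense on compact sets. -/
theorem exists_polyLE_near {K : Set E} (hK : IsCompact K) {f : E → ℝ} (hf : Continuous f) {ε : ℝ}
    (hε : 0 < ε) : ∃ n, ∃ P ∈ polyLE E ℝ n, ∀ x ∈ K, |P x - f x| ≤ ε := by
  have : CompactSpace K := isCompact_iff_compactSpace.1 hK
  set A : Subalgebra ℝ C(K, ℝ) := Algebra.adjoin ℝ
    (Set.range fun l : E →L[ℝ] ℝ => (⟨fun x => l x, by fun_prop⟩ : C(K, ℝ)))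
  have hA : A.SeparatesPoints := by
    intro x y hxy
    have : (x : E) ≠ y := fun h => hxy (Subtype.ext h)
    obtain ⟨l, hl⟩ := SeparatingDual.exists_separating_of_ne (R := ℝ) this
    exact ⟨_, ⟨_, Algebra.subset_adjoin ⟨l, rfl⟩, rfl⟩, hl⟩
  obtain ⟨⟨g, hg⟩, hgf⟩ := ContinuousMap.exists_mem_subalgebra_near_continuous_of_separatesPoints A hA
    (fun x : K => f x) (by fun_prop) ε hε
  have key : ∀ g ∈ A, ∃ n, ∃ P ∈ polyLE E ℝ n, ∀ x : K, g x = P x := by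
    intro g hg
    induction hg using Algebra.adjoin_induction with
    | mem g h =>
      obtain ⟨l, rfl⟩ := h
      exact ⟨1, _, polyLE_clm l, fun x => rfl⟩
    | algebraMap r => exact ⟨0, _, polyLE_const r 0, fun x => rfl⟩
    | add g g' _ _ h h' =>
      obtain ⟨n, P, hP, e⟩ := h
      obtain ⟨n', P', hP', e'⟩ := h'
      exact ⟨max n n', _, add_mem (polyLE_mono (le_max_left _ _) hP)
        (polyLE_mono (le_max_right _ _) hP'), fun x => by simp [e, e']⟩
    | mul g g' _ _ h h' =>
      obtain ⟨n, P, hP, e⟩ := h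
      obtain ⟨n', P', hP', e'⟩ := h'
      exact ⟨_, _, polyLE_mul_mem hP hP', fun x => by simp [e, e']⟩
  obtain ⟨n, P, hP, e⟩ := key g hg
  exact ⟨n, P, hP, fun x hx => by rw [← e ⟨x, hx⟩]; exact (hgf ⟨x, hx⟩).le⟩

/-- In a finite-dimensional space of functions, linear functionals are combinations of evaluations. -/
theorem dual_eq_sum_eval {X : Type*} (L : Submodule ℝ (X → ℝ)) [FiniteDimensional ℝ L]
    (c : Module.Dual ℝ L) : ∃ a : X →₀ ℝ, ∀ f : L, c f = a.sum fun x r => r * (f : X → ℝ) x := by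
  let ev : X → Module.Dual ℝ L := fun x => (LinearMap.proj x).comp L.subtype
  have h : Submodule.span ℝ (Set.range ev) = ⊤ := by
    have h1 : (Submodule.span ℝ (Set.range ev)).dualCoannihilator = ⊥ := by
      refine (Submodule.eq_bot_iff _).2 fun f hf => Subtype.ext (funext fun x => ?_)
      exact (Submodule.mem_dualCoannihilator f).1 hf (ev x) (Submodule.subset_span ⟨x, rfl⟩)
    have h2 := Subspace.dualCoannihilator_dualAnnihilator_eq (W := Submodule.span ℝ (Set.range ev))
    rw [← h2, h1, Submodule.dualAnnihilator_bot]
  have hc : c ∈ Submodule.span ℝ (Set.range ev) := h ▸ Submodule.mem_top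
  obtain ⟨a, rfl⟩ := Finsupp.mem_span_range_iff_exists_finsupp.1 hc
  refine ⟨a, fun f => ?_⟩
  rw [Finsupp.sum, Finsupp.sum, LinearMap.sum_apply]
  rfl

end PolyLE

namespace PolarRep
open MeasureTheory Filter Topology
open scoped ContDiff
variable {Γ : Type*} [Group Γ] [TopologicalSpace Γ] {V : Type*}
    [NormedAddCommGroup V] [InnerProductSpace ℝ V] [FiniteDimensional ℝ V] {U : Type*}
    [NormedAddCommGroup U] [InnerProductSpace ℝ U] [FiniteDimensional ℝ U]
variable (P : PolarRep Γ V U) [CompactSpace Γ] [IsTopologicalGroup Γ]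

/-- Averaging a homogeneous polynomial over the group. -/
theorem exists_average [MeasurableSpace Γ] [BorelSpace Γ] (μ : Measure Γ) [IsFiniteMeasure μ]
    [μ.IsMulLeftInvariant] {k : ℕ} {q : V → ℝ} (hq : q ∈ homFun V ℝ k) :
    ∃ q' ∈ homFun V ℝ k, (∀ g x, q' (P.ρ g x) = q' x) ∧ ∀ x, q' x = ∫ g, q (P.ρ g⁻¹ x) ∂μ := by
  have hcont : ∀ x, Continuous fun g => q (P.ρ g⁻¹ x) := fun x =>
    (homFun_contDiff hq).continuous.comp ((P.cont.comp continuous_inv).clm_apply continuous_const)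
  have hint : ∀ x, Integrable (fun g => q (P.ρ g⁻¹ x)) μ := fun x =>
    (hcont x).integrable_of_hasCompactSupport (HasCompactSupport.of_compactSpace _)
  let T : Γ → homFun V ℝ k := fun g => ⟨_, homFun_comp_right hq (P.ρ g⁻¹)⟩
  let b := Module.finBasis ℝ (homFun V ℝ k)
  choose a ha using fun i => dual_eq_sum_eval (homFun V ℝ k) (b.coord i)
  have hi : ∀ i, Integrable (fun g => b.coord i (T g)) μ := by
    intro i
    simp only [ha i, Finsupp.sum]
    exact integrable_finset_sum _ fun x _ => (hint x).const_mul _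
  have hq' : ∀ x, (∑ i, (∫ g, b.coord i (T g) ∂μ) • (b i : V → ℝ) x) = ∫ g, q (P.ρ g⁻¹ x) ∂μ := by
    intro x
    have : ∀ g, q (P.ρ g⁻¹ x) = ∑ i, b.coord i (T g) * (b i : V → ℝ) x := fun g => by
      have h := congrArg (fun f : homFun V ℝ k => (f : V → ℝ) x) (b.sum_repr (T g))
      simp only [AddSubmonoidClass.coe_finsetSum, Finset.sum_apply] at h
      exact h.symm
    simp only [this]
    rw [integral_finset_sum _ fun i _ => (hi i).mul_const _]
    exact Finset.sum_congr rfl fun i _ => by rw [integral_mul_const, smul_eq_mul]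
  refine ⟨fun x => ∫ g, q (P.ρ g⁻¹ x) ∂μ, ?_, fun h x => ?_, fun x => rfl⟩
  · have : (fun x => ∫ g, q (P.ρ g⁻¹ x) ∂μ) =
        ∑ i, (∫ g, b.coord i (T g) ∂μ) • (b i : V → ℝ) := by
      funext x; rw [← hq' x]; simp
    rw [this]
    exact Submodule.sum_mem _ fun i _ => Submodule.smul_mem _ _ (b i).2
  · dsimp only
    rw [← integral_mul_left_eq_self (fun g => q (P.ρ g⁻¹ (P.ρ h x))) h]
    simp only [← P.mul_apply, _root_.mul_inv_rev, inv_mul_cancel_right]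

theorem isQuotientMap_action : Topology.IsQuotientMap fun x : Γ × U => P.ρ x.1 (P.ι x.2) := by
  have hc : Continuous fun x : Γ × U => P.ρ x.1 (P.ι x.2) :=
    (P.cont.comp continuous_fst).clm_apply (P.ι.continuous.comp continuous_snd)
  have hp : IsProperMap fun x : Γ × U => P.ρ x.1 (P.ι x.2) := by
    refine isProperMap_iff_isCompact_preimage.2 ⟨hc, fun K hK => ?_⟩
    obtain ⟨r, hr⟩ := hK.isBounded.subset_closedBall 0
    refine (isCompact_univ.prod (isCompact_closedBall (0 : U) r)).of_isClosed_subset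
      (hK.isClosed.preimage hc) fun x hx => ⟨trivial, ?_⟩
    have := hr hx
    simpa [P.isom] using this
  refine hp.isClosedMap.isQuotientMap hc fun v => ?_
  obtain ⟨g, u, h⟩ := P.meets v
  exact ⟨(g⁻¹, u), by dsimp only; rw [← h, inv_apply_self]⟩

/-- Continuous Weyl-invariant functions on the section extend to invariant continuous functions. -/
theorem exists_continuous_extension (R : P.Roots) {f : U → ℝ} (hf : Continuous f)
    (hinv : ∀ w ∈ P.weyl, ∀ s, f (w s) = f s) :
    ∃ F : V → ℝ, Continuous F ∧ (∀ g x, F (P.ρ g x) = F x) ∧ ∀ s, F (P.ι s) = f s := by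
  choose g u h using P.meets
  have key : ∀ γ s, f (u (P.ρ γ (P.ι s))) = f s := by
    intro γ s
    have h1 := h (P.ρ γ (P.ι s))
    rw [← P.mul_apply] at h1
    obtain ⟨w, hw, e⟩ := P.exists_weyl_of_orbit R h1
    rw [← e, hinv w hw]
  refine ⟨fun x => f (u x), ?_, fun γ x => ?_, fun s => ?_⟩
  · refine P.isQuotientMap_action.continuous_iff.2 ?_
    convert hf.comp continuous_snd using 1
    funext x
    exact key x.1 x.2
  · have e : x = P.ρ (g x)⁻¹ (P.ι (u x)) := by rw [← h, inv_apply_self]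
    conv_lhs => rw [e, ← P.mul_apply]
    exact key _ _
  · have := key 1 s
    rwa [map_one] at this

theorem exists_invariant_near (R : P.Roots) {f : U → ℝ} (hf : Continuous f)
    (hinv : ∀ w ∈ P.weyl, ∀ s, f (w s) = f s) {ε : ℝ} (hε : 0 < ε) :
    ∃ n, ∃ q : ℕ → V → ℝ, (∀ j, q j ∈ homFun V ℝ j) ∧ (∀ j g x, q j (P.ρ g x) = q j x) ∧
      ∀ s, ‖s‖ ≤ 1 → |∑ j ∈ Finset.range n, q j (P.ι s) - f s| ≤ ε := by
  obtain ⟨F, hF, hFi, hFf⟩ := P.exists_continuous_extension R hf hinv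
  obtain ⟨n, Q, hQ, hQF⟩ := exists_polyLE_near (isCompact_closedBall (0 : V) 1) hF hε
  obtain ⟨q, hq, rfl⟩ := exists_sum_of_mem_polyLE hQ
  let _ : MeasurableSpace Γ := borel Γ
  have : BorelSpace Γ := ⟨rfl⟩
  let μ : Measure Γ := Measure.haarMeasure ⊤
  have hμ : IsProbabilityMeasure μ := ⟨Measure.haarMeasure_self⟩
  choose q' h1 h2 h3 using fun j => P.exists_average μ (hq j)
  refine ⟨n + 1, q', h1, h2, fun s hs => ?_⟩
  have hint : ∀ j, Integrable (fun g => q j (P.ρ g⁻¹ (P.ι s))) μ := fun j =>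
    Continuous.integrable_of_hasCompactSupport ((homFun_contDiff (hq j)).continuous.comp
      ((P.cont.comp continuous_inv).clm_apply continuous_const)) (HasCompactSupport.of_compactSpace _)
  have e : ∑ j ∈ Finset.range (n + 1), q' j (P.ι s) - f s =
      ∫ g, ((∑ j ∈ Finset.range (n + 1), q j (P.ρ g⁻¹ (P.ι s))) - F (P.ρ g⁻¹ (P.ι s))) ∂μ := by
    simp only [hFi, hFf]
    rw [integral_sub (integrable_finset_sum _ fun j _ => hint j) (integrable_const _),
      integral_finset_sum _ fun j _ => hint j]
    simp [h3]
  rw [e, ← Real.norm_eq_abs]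
  refine (norm_integral_le_of_norm_le_const (C := ε) (Eventually.of_forall fun g => ?_)).trans ?_
  · have := hQF (P.ρ g⁻¹ (P.ι s)) (by simpa [P.isom] using hs)
    rwa [Finset.sum_apply] at this
  · simp

variable {P} [MeasurableSpace U] [BorelSpace U]

theorem Roots.eq_zero_of_weight_integral (R : P.Roots) {f : U → ℝ} (hf : Continuous f) (h0 : ∀ x, 0 ≤ f x)
    (h : ∫ x, R.weight x * f x = 0) {s : U} (hs : ‖s‖ < 1) : f s = 0 := by
  have h1 : (fun x => R.weight x * f x) = 0 := by
    have hn : ∀ x, 0 ≤ R.weight x * f x := fun x =>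
      mul_nonneg (mul_nonneg (abs_nonneg _) (sq_nonneg _)) (h0 x)
    have := (integral_eq_zero_iff_of_nonneg hn (R.weight_integrable hf)).1 h
    exact (Continuous.ae_eq_iff_eq volume (R.weight_continuous.mul hf) continuous_const).1 this
  have h2 : (fun x => bump x * f x) = fun _ => 0 := by
    refine funext fun x => R.eq_of_regular (bump_contDiff.continuous.mul hf) continuous_const (fun s hs => ?_) x
    have h3 := congrFun h1 s
    have h4 : rootProd R.a s ≠ 0 := rootProd_ne_zero.2 hs
    simp only [Roots.weight, Pi.zero_apply, mul_eq_zero, abs_eq_zero, h4, false_or, pow_eq_zero_iff,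
      ne_eq, OfNat.ofNat_ne_zero, not_false_eq_true] at h3
    rcases h3 with h3 | h3 <;> simp [h3]
  have h3 := congrFun h2 s
  exact (mul_eq_zero.1 h3).resolve_left (bump_pos hs).ne'

theorem Roots.eq_zero_of_orthogonal (R : P.Roots) {f : U → ℝ} (hf : Continuous f)
    (hinv : ∀ w ∈ P.weyl, ∀ s, f (w s) = f s)
    (h : ∀ k, ∀ q ∈ homFun V ℝ k, (∀ g x, q (P.ρ g x) = q x) → ∫ x, R.weight x * (f x * q (P.ι x)) = 0)
    {s : U} (hs : ‖s‖ < 1) : f s = 0 := by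
  have hI : ∫ x, R.weight x * f x ^ 2 = 0 := by
    set C := ∫ x, R.weight x * |f x|
    have hC : ∀ ε > 0, ∫ x, R.weight x * f x ^ 2 ≤ C * ε := by
      intro ε hε
      obtain ⟨n, q, h1, h2, h3⟩ := P.exists_invariant_near R hf hinv hε
      have hqc : ∀ j, Continuous fun x => q j (P.ι x) := fun j =>
        (homFun_contDiff (h1 j)).continuous.comp P.ι.continuous
      have e : ∫ x, R.weight x * (f x * ∑ j ∈ Finset.range n, q j (P.ι x)) = 0 := by
        simp only [Finset.mul_sum]
        have hi : ∀ j, Integrable fun x => R.weight x * (f x * q j (P.ι x)) := fun j =>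
          R.weight_integrable (hf.mul (hqc j))
        rw [integral_finset_sum _ fun j _ => hi j]
        exact Finset.sum_eq_zero fun j _ => h j _ (h1 j) (h2 j)
      have hs : Continuous fun x => f x * ∑ j ∈ Finset.range n, q j (P.ι x) :=
        hf.mul (continuous_finset_sum _ fun j _ => hqc j)
      have hi : Integrable fun x => R.weight x * f x ^ 2 := R.weight_integrable (hf.pow 2)
      rw [← integral_mul_const, ← sub_zero (∫ x, R.weight x * f x ^ 2), ← e,
        ← integral_sub hi (R.weight_integrable hs)]
      refine integral_mono (hi.sub (R.weight_integrable hs))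
        ((R.weight_integrable hf.abs).mul_const ε) fun x => ?_
      dsimp only
      have hw : 0 ≤ R.weight x := mul_nonneg (abs_nonneg _) (sq_nonneg _)
      rw [← mul_sub, mul_assoc, sq, ← mul_sub]
      by_cases hx : ‖x‖ ≤ 1
      · refine mul_le_mul_of_nonneg_left ((le_abs_self _).trans ?_) hw
        rw [abs_mul, abs_sub_comm]
        exact mul_le_mul_of_nonneg_left (h3 x hx) (abs_nonneg _)
      · rw [Roots.weight, bump_eq_zero (not_le.1 hx).le]; simp
    have hC0 : 0 ≤ C := integral_nonneg fun x => mul_nonneg (mul_nonneg (abs_nonneg _) (sq_nonneg _)) (abs_nonneg _)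
    refine le_antisymm (le_of_forall_pos_le_add fun ε hε => ?_)
      (integral_nonneg fun x => mul_nonneg (mul_nonneg (abs_nonneg _) (sq_nonneg _)) (sq_nonneg _))
    refine (hC (ε / (C + 1)) (by positivity)).trans ?_
    rw [zero_add, mul_div_assoc', div_le_iff₀ (by positivity)]
    nlinarith
  exact pow_eq_zero_iff two_ne_zero |>.1
    (R.eq_zero_of_weight_integral (hf.pow 2) (fun x => sq_nonneg _) hI hs)

end PolarRep

section Wedge
open scoped ContDiff
universe u v
variable {E : Type u} [NormedAddCommGroup E] [NormedSpace ℝ E]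
variable {U : Type v} [NormedAddCommGroup U] [InnerProductSpace ℝ U] [FiniteDimensional ℝ U] {p : ℕ}

theorem alt_ext_basis {A B : U [⋀^Fin p]→L[ℝ] ℝ}
    (h : ∀ I : Fin p → Fin (Module.finrank ℝ U), A (stdOrthonormalBasis ℝ U ∘ I) =
      B (stdOrthonormalBasis ℝ U ∘ I)) : A = B := by
  have h2 : A.toContinuousMultilinearMap.toMultilinearMap = B.toContinuousMultilinearMap.toMultilinearMap := by
    refine Module.Basis.ext_multilinear (fun _ => (stdOrthonormalBasis ℝ U).toBasis) fun I => ?_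
    simp only [OrthonormalBasis.coe_toBasis]
    exact h I
  ext v
  exact congrArg (fun m => m v) h2

/-- Alternating forms are recovered linearly from their coefficients. -/
theorem exists_alt_of_coeff : ∃ L : ((Fin p → Fin (Module.finrank ℝ U)) → ℝ) →L[ℝ] (U [⋀^Fin p]→L[ℝ] ℝ),
    ∀ A : U [⋀^Fin p]→L[ℝ] ℝ, L (fun I => A (stdOrthonormalBasis ℝ U ∘ I)) = A := by
  let T : (U [⋀^Fin p]→L[ℝ] ℝ) →ₗ[ℝ] ((Fin p → Fin (Module.finrank ℝ U)) → ℝ) :=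
    LinearMap.pi fun I => (altEval (stdOrthonormalBasis ℝ U ∘ I)).toLinearMap
  obtain ⟨L, hL⟩ := LinearMap.exists_leftInverse_of_injective T
    (LinearMap.ker_eq_bot.2 fun A B h => alt_ext_basis fun I => congrFun h I)
  exact ⟨L.toContinuousLinearMap, fun A => LinearMap.congr_fun hL A⟩

theorem contDiff_of_coeff {f : E → U [⋀^Fin p]→L[ℝ] ℝ} (h : ∀ v, ContDiff ℝ ∞ fun x => f x v) :
    ContDiff ℝ ∞ f := by
  obtain ⟨L, hL⟩ := exists_alt_of_coeff (U := U) (p := p)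
  have : f = fun x => L fun I => f x (stdOrthonormalBasis ℝ U ∘ I) := funext fun x => (hL _).symm
  rw [this]
  exact L.contDiff.comp (contDiff_pi.2 fun I => h _)

theorem homFun_of_coeff {k : ℕ} {f : E → U [⋀^Fin p]→L[ℝ] ℝ}
    (h : ∀ v, (fun x => f x v) ∈ homFun E ℝ k) : f ∈ homFun E (U [⋀^Fin p]→L[ℝ] ℝ) k :=
  ⟨contDiff_of_coeff fun v => (h v).1, fun t x => by ext v; exact (h v).2 t x⟩

theorem homFun_prod_mem {ι : Type*} (s : Finset ι) {k : ι → ℕ} {f : ι → E → ℝ}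
    (h : ∀ i ∈ s, f i ∈ homFun E ℝ (k i)) : (fun x => ∏ i ∈ s, f i x) ∈ homFun E ℝ (∑ i ∈ s, k i) := by
  induction s using Finset.cons_induction with
  | empty => simpa using homFun_const (E := E) (1 : ℝ)
  | cons a s ha ih =>
    simp only [Finset.prod_cons, Finset.sum_cons]
    exact homFun_mul_mem (h a (by simp)) (ih fun i hi => h i (by simp [hi]))

/-- Exterior product of covectors. -/
noncomputable def wedge (l : Fin p → U →L[ℝ] ℝ) : U [⋀^Fin p]→L[ℝ] ℝ :=
  { (Matrix.detRowAlternating (R := ℝ) (n := Fin p)).compLinearMap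
      (LinearMap.pi fun i => (l i).toLinearMap) with
    cont := by
      refine Continuous.matrix_det (A := fun v : Fin p → U => Matrix.of fun j i => l i (v j)) ?_
      exact continuous_matrix fun i j => (l j).continuous.comp (continuous_apply i) }

theorem wedge_apply (l : Fin p → U →L[ℝ] ℝ) (v : Fin p → U) :
    wedge l v = ∑ σ : Equiv.Perm (Fin p), (Equiv.Perm.sign σ : ℝ) * ∏ i, l i (v (σ i)) := by
  have : wedge l v = Matrix.det (Matrix.of fun j i => l i (v j)) := rfl
  rw [this, Matrix.det_apply']
  rfl

theorem formPair_wedge (A : U [⋀^Fin p]→L[ℝ] ℝ) (y : Fin p → U) :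
    formPair A (wedge fun i => innerSL ℝ (y i)) = (p ! : ℝ) * A y := by
  set b := stdOrthonormalBasis ℝ U with hb
  have h1 : ∀ z : Fin p → U, A z = ∑ I : Fin p → Fin (Module.finrank ℝ U),
      (∏ i, (inner ℝ (z i) (b (I i)) : ℝ)) * A (b ∘ I) := by
    intro z
    have e : z = fun i => ∑ j, (inner ℝ (z i) (b j) : ℝ) • b j := by
      funext i
      conv_lhs => rw [← b.sum_repr' (z i)]
      exact Finset.sum_congr rfl fun j _ => by rw [real_inner_comm (z i) (b j)]
    conv_lhs => rw [e]
    refine (MultilinearMap.map_sum A.toMultilinearMap _).trans (Finset.sum_congr rfl fun I _ => ?_)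
    exact MultilinearMap.map_smul_univ A.toMultilinearMap (fun i => inner ℝ (z i) (b (I i))) (b ∘ I)
  simp only [formPair, ← hb, wedge_apply, Finset.mul_sum, Function.comp_apply, innerSL_apply_apply]
  rw [Finset.sum_comm]
  have h2 : ∀ σ : Equiv.Perm (Fin p), ∑ I : Fin p → Fin (Module.finrank ℝ U), A (b ∘ I) *
      ((Equiv.Perm.sign σ : ℝ) * ∏ i, (inner ℝ (y i) (b (I (σ i))) : ℝ)) = A y := by
    intro σ
    have h3 : A (y ∘ ⇑σ⁻¹) = (Equiv.Perm.sign σ⁻¹ : ℝ) * A y := by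
      have := AlternatingMap.map_perm A.toAlternatingMap y σ⁻¹
      rw [Units.smul_def, zsmul_eq_mul] at this
      exact this
    have h4 : ((Equiv.Perm.sign σ : ℤ) : ℝ) * ((Equiv.Perm.sign σ : ℤ) : ℝ) = 1 := by
      rw [← Int.cast_mul]; simp
    have h5 : (Equiv.Perm.sign σ : ℝ) * A (y ∘ ⇑σ⁻¹) = A y := by
      rw [h3, Equiv.Perm.sign_inv, ← mul_assoc, h4, one_mul]
    rw [← h5, h1, Finset.mul_sum]
    refine Finset.sum_congr rfl fun I _ => ?_
    rw [← Equiv.prod_comp σ fun i => (inner ℝ ((y ∘ ⇑σ⁻¹) i) (b (I i)) : ℝ)]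
    have h6 : ∀ i, (σ⁻¹ : Equiv.Perm (Fin p)) (σ i) = i := σ.symm_apply_apply
    simp only [Function.comp_apply, h6]
    ring
  rw [Finset.sum_congr rfl fun σ _ => h2 σ, Finset.sum_const, Finset.card_univ, Fintype.card_perm,
    Fintype.card_fin, nsmul_eq_mul]

end Wedge

namespace PolarRep
open MeasureTheory Filter Topology
open scoped ContDiff
variable {Γ : Type*} [Group Γ] [TopologicalSpace Γ] {V : Type*}
    [NormedAddCommGroup V] [InnerProductSpace ℝ V] [FiniteDimensional ℝ V] {U : Type*}
    [NormedAddCommGroup U] [InnerProductSpace ℝ U] [FiniteDimensional ℝ U]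
variable (P : PolarRep Γ V U) [CompactSpace Γ] [IsTopologicalGroup Γ] {p : ℕ}

/-- Homogeneous invariant polynomials. -/
def invPoly (k : ℕ) : Submodule ℝ (V → ℝ) where
  carrier := {f | f ∈ homFun V ℝ k ∧ ∀ g x, f (P.ρ g x) = f x}
  zero_mem' := ⟨zero_mem _, fun _ _ => rfl⟩
  add_mem' := fun ha hb => ⟨add_mem ha.1 hb.1, fun g x => by simp [ha.2, hb.2]⟩
  smul_mem' := fun c _ ha => ⟨Submodule.smul_mem _ c ha.1, fun g x => by simp [ha.2]⟩

variable {P}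

theorem fderiv_invariant {f : V → ℝ} (hf : ∀ g x, f (P.ρ g x) = f x) (hd : Differentiable ℝ f) (g : Γ) (x v : V) :
    fderiv ℝ f (P.ρ g x) (P.ρ g v) = fderiv ℝ f x v := by
  have h : f ∘ P.ρ g = f := funext (hf g)
  conv_rhs => rw [← h]
  rw [fderiv_comp x (hd _) (P.ρ g).differentiableAt, ContinuousLinearMap.fderiv]
  rfl

theorem fderiv_horizontal (R : P.Roots) {f : V → ℝ} (hf : ∀ g x, f (P.ρ g x) = f x) (hd : ContDiff ℝ ∞ f)
    (s : U) {v : V} (hv : v ∈ P.tan) : fderiv ℝ f (P.ι s) v = 0 := by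
  have he : ∀ i, ∀ s, fderiv ℝ f (P.ι s) (R.e i) = 0 := by
    intro i s
    refine R.eq_of_regular (f := fun s => fderiv ℝ f (P.ι s) (R.e i)) (g := fun _ => 0)
      (((hd.continuous_fderiv (by simp)).comp P.ι.continuous).clm_apply continuous_const)
      continuous_const (fun s hs => ?_) s
    have h1 := (hd.differentiable (by simp) (P.ι s)).hasFDerivAt.comp_hasDerivAt_of_eq (0 : ℝ)
      (lie_curve_hasDerivAt (R.X i) (P.ι s)) (by simp)
    have h2 : f ∘ (fun t : ℝ => NormedSpace.exp (t • R.X i) (P.ι s)) = fun _ => f (P.ι s) := by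
      funext t
      obtain ⟨g, hg⟩ := R.X_lie i t
      simp only [Function.comp_apply, ← hg, hf]
    rw [h2] at h1
    have h3 := h1.unique (hasDerivAt_const _ _)
    rw [R.X_apply, map_smul, smul_eq_mul] at h3
    exact (mul_eq_zero.1 h3).resolve_left (hs i)
  rw [R.decomp v, (P.mem_tan_iff_pr).1 hv, map_zero, zero_add, map_sum]
  exact Finset.sum_eq_zero fun i _ => by rw [map_smul, he, smul_zero]

/-- Exterior products of differentials of invariants are basic. -/
theorem wedge_basic (R : P.Roots) {k : Fin p → ℕ} {f : Fin p → V → ℝ}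
    (hf : ∀ i, f i ∈ P.invPoly (k i + 1)) {l : ℕ} {g : V → ℝ} (hg : g ∈ P.invPoly l) :
    (fun x => g x • wedge fun i => fderiv ℝ (f i) x) ∈ homFun V (V [⋀^Fin p]→L[ℝ] ℝ) (l + ∑ i, k i) ∧
      P.Basic fun x => g x • wedge fun i => fderiv ℝ (f i) x := by
  have h1 : (fun x => g x • wedge fun i => fderiv ℝ (f i) x) ∈
      homFun V (V [⋀^Fin p]→L[ℝ] ℝ) (l + ∑ i, k i) := by
    refine homFun_smul_mem hg.1 (homFun_of_coeff fun v => ?_)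
    have : (fun x => wedge (fun i => fderiv ℝ (f i) x) v) = ∑ σ : Equiv.Perm (Fin p),
        (Equiv.Perm.sign σ : ℝ) • fun x => ∏ i, dirD (v (σ i)) (f i) x := by
      funext x; rw [wedge_apply]; simp [dirD]
    rw [this]
    exact Submodule.sum_mem _ fun σ _ => Submodule.smul_mem _ _
      (homFun_prod_mem _ fun i _ => homFun_dirD (hf i).1 _)
  refine ⟨h1, homFun_contDiff h1, fun γ x v => ?_, fun s v a ha => ?_⟩
  · have : ∀ i w, fderiv ℝ (f i) (P.ρ γ x) (P.ρ γ w) = fderiv ℝ (f i) x w :=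
      fun i w => fderiv_invariant (hf i).2 (homFun_differentiable (hf i).1) γ x w
    simp only [ContinuousAlternatingMap.smul_apply, wedge_apply, this, hg.2]
  · simp only [ContinuousAlternatingMap.smul_apply, wedge_apply]
    rw [Finset.sum_eq_zero, smul_zero]
    intro σ _
    rw [Finset.prod_eq_zero (Finset.mem_univ (σ⁻¹ a)), mul_zero]
    rw [show σ (σ⁻¹ a) = a from σ.apply_symm_apply a]
    exact fderiv_horizontal R (hf _).2 (homFun_contDiff (hf _).1) s ha

end PolarRep

section Grad
open scoped ContDiff
variable {U : Type*} [NormedAddCommGroup U] [InnerProductSpace ℝ U] [FiniteDimensional ℝ U]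

/-- The gradient of a function. -/
noncomputable def gr (h : U → ℝ) (s : U) : U :=
  ∑ i, (fderiv ℝ h s (stdOrthonormalBasis ℝ U i)) • stdOrthonormalBasis ℝ U i

theorem inner_gr (h : U → ℝ) (s v : U) : inner ℝ (gr h s) v = fderiv ℝ h s v := by
  conv_rhs => rw [← (stdOrthonormalBasis ℝ U).sum_repr' v]
  simp [gr, sum_inner, real_inner_smul_left, mul_comm]

theorem innerSL_gr (h : U → ℝ) (s : U) : innerSL ℝ (gr h s) = fderiv ℝ h s := by
  ext v; rw [innerSL_apply_apply, inner_gr]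

theorem gr_map {h : U → ℝ} (hd : Differentiable ℝ h) {w : U ≃ₗᵢ[ℝ] U} (hw : ∀ s, h (w s) = h s) (s : U) :
    gr h (w s) = w (gr h s) := by
  refine ext_inner_right ℝ fun v => ?_
  obtain ⟨v, rfl⟩ := w.surjective v
  rw [w.inner_map_map, inner_gr, inner_gr]
  have e : h ∘ w = h := funext hw
  conv_rhs => rw [← e]
  rw [fderiv_comp s (hd _) w.differentiable.differentiableAt,
    show fderiv ℝ w s = w.toContinuousLinearEquiv from w.toContinuousLinearEquiv.fderiv]
  rfl

theorem fderiv_mul_norm_sub_sq {f : U → ℝ} (hf : Differentiable ℝ f) (y : U) :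
    fderiv ℝ (fun x => f x * ‖x - y‖ ^ 2) y = 0 := by
  have h2 : HasFDerivAt (fun x : U => ‖x - y‖ ^ 2) (0 : U →L[ℝ] ℝ) y := by
    have := ((hasFDerivAt_id (𝕜 := ℝ) y).sub_const y).norm_sq
    simpa using this
  have : HasFDerivAt (fun x => f x * ‖x - y‖ ^ 2) _ y := (hf y).hasFDerivAt.mul h2
  simpa using this.fderiv

theorem polyLE_norm_sub_sq (y : U) : (fun x => ‖x - y‖ ^ 2) ∈ polyLE U ℝ 2 := by
  have e : (fun x : U => ‖x - y‖ ^ 2) = (fun x => ‖x‖ ^ 2) + (fun x => (-2 : ℝ) * innerSL ℝ y x) +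
      fun _ => ‖y‖ ^ 2 := by
    funext x
    simp only [Pi.add_apply, innerSL_apply_apply]
    rw [norm_sub_sq_real, real_inner_comm x y]; ring
  rw [e]
  refine add_mem (add_mem (homFun_le_polyLE le_rfl ⟨contDiff_norm_sq ℝ, fun t x => ?_⟩)
    (polyLE_mono one_le_two ?_)) (polyLE_const _ _)
  · dsimp only
    rw [norm_smul, mul_pow, Real.norm_eq_abs, sq_abs, smul_eq_mul]
  · exact Submodule.smul_mem _ (-2 : ℝ) (polyLE_clm (innerSL ℝ y))

/-- A polynomial with prescribed gradient at `s` and vanishing gradients at finitely many other points. -/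
theorem exists_poly_gradient (a s : U) (T : Finset U) (hT : s ∉ T) :
    ∃ n, ∃ h ∈ polyLE U ℝ n, fderiv ℝ h s = innerSL ℝ a ∧ ∀ y ∈ T, fderiv ℝ h y = 0 := by
  classical
  let g : Finset U → U → ℝ := fun T x => ∏ y ∈ T, ((‖s - y‖ ^ 2)⁻¹ * ‖x - y‖ ^ 2)
  have hg : ∀ T, g T ∈ polyLE U ℝ (∑ y ∈ T, (0 + 2)) := fun T => polyLE_prod_mem T fun y _ =>
    polyLE_mul_mem (polyLE_const _ 0) (polyLE_norm_sub_sq y)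
  let l : U → ℝ := fun x => innerSL ℝ a x - inner ℝ a s
  have hl : l ∈ polyLE U ℝ 1 := sub_mem (polyLE_clm (innerSL ℝ a)) (polyLE_const _ 1)
  refine ⟨_, fun x => l x * g T x, polyLE_mul_mem hl (hg T), ?_, fun y hy => ?_⟩
  · have h1 : HasFDerivAt l (innerSL ℝ a) s := (innerSL ℝ a).hasFDerivAt.sub_const _
    have h2 := ((polyLE_contDiff (hg T)).differentiable (by simp) s).hasFDerivAt
    have h5 : HasFDerivAt (fun x => l x * g T x) _ s := h1.mul h2
    rw [h5.fderiv]
    have h3 : l s = 0 := by simp [l]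
    have h4 : g T s = 1 := Finset.prod_eq_one fun y hy => by
      refine inv_mul_cancel₀ (pow_ne_zero 2 (norm_ne_zero_iff.2 (sub_ne_zero.2 ?_)))
      rintro rfl; exact hT hy
    rw [h3, h4, zero_smul, zero_add, one_smul]
  · have e : (fun x => l x * g T x) = fun x => ((l x * g (T.erase y) x) * (‖s - y‖ ^ 2)⁻¹) * ‖x - y‖ ^ 2 := by
      funext x
      simp only [g]
      rw [← Finset.mul_prod_erase T _ hy]; ring
    rw [e]
    exact fderiv_mul_norm_sub_sq (((((polyLE_contDiff hl).mul (polyLE_contDiff (hg _))).mul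
      contDiff_const).differentiable (by simp))) y

end Grad

namespace PolarRep
open MeasureTheory Filter Topology
open scoped ContDiff
variable {Γ : Type*} [Group Γ] [TopologicalSpace Γ] {V : Type*}
    [NormedAddCommGroup V] [InnerProductSpace ℝ V] [FiniteDimensional ℝ V] {U : Type*}
    [NormedAddCommGroup U] [InnerProductSpace ℝ U] [FiniteDimensional ℝ U]
variable {P : PolarRep Γ V U} [CompactSpace Γ] [IsTopologicalGroup Γ] {p : ℕ}

theorem invPoly_weyl {k : ℕ} {f : V → ℝ} (hf : f ∈ P.invPoly k) {w : U ≃ₗᵢ[ℝ] U} (hw : w ∈ P.weyl) (s : U) :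
    f (P.ι (w s)) = f (P.ι s) := by
  obtain ⟨g, hg⟩ := P.mem_weyl.1 hw
  rw [← hg, hf.2]

theorem invPoly_restr {k : ℕ} {f : V → ℝ} (hf : f ∈ P.invPoly k) :
    (fun s => f (P.ι s)) ∈ homFun U ℝ k := homFun_comp_right hf.1 P.ι.toContinuousLinearMap

section Orth
variable [MeasurableSpace U] [BorelSpace U]

theorem wedge_gr_eq {k : Fin p → ℕ} {f : Fin p → V → ℝ} (hf : ∀ i, f i ∈ P.invPoly (k i + 1)) (s : U) :
    P.restr (fun x => wedge fun i => fderiv ℝ (f i) x) s =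
      wedge fun i => innerSL ℝ (gr (fun s => f i (P.ι s)) s) := by
  ext v
  rw [restr_apply, wedge_apply, wedge_apply]
  simp only [innerSL_gr]
  refine Finset.sum_congr rfl fun σ _ => ?_
  congr 1
  refine Finset.prod_congr rfl fun i _ => ?_
  have : fderiv ℝ (f i ∘ P.ι) s = _ := ((homFun_differentiable (hf i).1 (P.ι s)).hasFDerivAt.comp s
    P.ι.toContinuousLinearMap.hasFDerivAt).fderiv
  rw [show (fun s => f i (P.ι s)) = f i ∘ P.ι from rfl, this]
  rfl

theorem Roots.eval_gr_eq_zero (R : P.Roots) {D : C(U, U [⋀^Fin p]→L[ℝ] ℝ)} (hD : P.WInv D)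
    (h : ∀ l, ∀ y ∈ P.basicForms p l, R.form p D y = 0) {k : Fin p → ℕ} {f : Fin p → V → ℝ}
    (hf : ∀ i, f i ∈ P.invPoly (k i + 1)) {s : U} (hs : ‖s‖ < 1) :
    D s (fun i => gr (fun s => f i (P.ι s)) s) = 0 := by
  have hone : (fun _ => 1 : V → ℝ) ∈ P.invPoly 0 := ⟨homFun_const _, fun _ _ => rfl⟩
  have hQ := wedge_basic R hf hone
  simp only [one_smul] at hQ
  have hc : Continuous fun s => wedge fun i => innerSL ℝ (gr (fun s => f i (P.ι s)) s) := by
    have := P.restr_contDiff hQ.2.smooth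
    rw [funext (wedge_gr_eq hf)] at this
    exact this.continuous
  have e : ∀ s, formPair (D s) (wedge fun i => innerSL ℝ (gr (fun s => f i (P.ι s)) s)) =
      (p ! : ℝ) * D s (fun i => gr (fun s => f i (P.ι s)) s) := fun s => formPair_wedge _ _
  have hF : Continuous fun s => (p ! : ℝ) * D s (fun i => gr (fun s => f i (P.ι s)) s) := by
    simp only [← e]
    exact continuous_formPair D.continuous hc
  have := R.eq_zero_of_orthogonal hF (fun w hw s => ?_) (fun l q hq hqi => ?_) hs
  · exact (mul_eq_zero.1 this).resolve_left (by positivity)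
  · have h1 : ∀ i, gr (fun s => f i (P.ι s)) (w s) = w (gr (fun s => f i (P.ι s)) s) := fun i =>
      gr_map (homFun_differentiable (invPoly_restr (hf i))) (fun s => invPoly_weyl (hf i) hw s) s
    simp only [h1]
    rw [hD w hw]
  · obtain ⟨h1, h2⟩ := wedge_basic R hf (l := l) (g := q) ⟨hq, hqi⟩
    have h3 := h _ ⟨P.restr _, (P.restr_contDiff h2.smooth).continuous⟩ ⟨_, h1, h2, fun s => rfl⟩
    rw [form_apply] at h3
    rw [← h3]
    refine integral_congr_ae (Eventually.of_forall fun x => ?_)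
    have h4 : P.restr (fun x => q x • wedge fun i => fderiv ℝ (f i) x) x =
        q (P.ι x) • wedge fun i => innerSL ℝ (gr (fun s => f i (P.ι s)) x) := by
      rw [← wedge_gr_eq hf]; rfl
    dsimp only [ContinuousMap.coe_mk]
    rw [h4, formPair_comm, formPair_smul_left, formPair_comm, e]
    ring

theorem exists_sum_of_mem_iSup {X : Type*} [AddCommGroup X] [Module ℝ X] {S : ℕ → Submodule ℝ X} {x : X}
    (hx : x ∈ ⨆ k, S k) : ∃ N, ∃ q : ℕ → X, (∀ j, q j ∈ S j) ∧ x = ∑ j ∈ Finset.range N, q j := by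
  obtain ⟨f, hf, rfl⟩ := (Submodule.mem_iSup_iff_exists_finsupp S x).1 hx
  obtain ⟨N, hN⟩ := f.support.exists_nat_subset_range
  refine ⟨N, f, hf, Finset.sum_subset hN fun i _ hi => Finsupp.notMem_support_iff.1 hi⟩

theorem eq_zero_of_ball {D : C(U, U [⋀^Fin p]→L[ℝ] ℝ)} (hD : D ∈ ⨆ k, P.sectionForms p k)
    (h : ∀ s, ‖s‖ < 1 → D s = 0) : D = 0 := by
  obtain ⟨N, q, hq, rfl⟩ := exists_sum_of_mem_iSup hD
  have := homFun_sum_eq_zero (N := N) (q := fun j => q j) (fun j _ => (hq j).1) one_pos fun x hx => by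
    have := h x hx
    rwa [ContinuousMap.sum_apply] at this
  exact Finset.sum_eq_zero fun j hj => DFunLike.coe_injective (this j (Finset.mem_range.1 hj))

theorem Roots.forms_le_of_total (R : P.Roots) (htot : ∀ D : C(U, U [⋀^Fin p]→L[ℝ] ℝ), P.WInv D →
    (∀ l, ∀ y ∈ P.basicForms p l, R.form p D y = 0) → ∀ s, ‖s‖ < 1 → D s = 0) (k : ℕ) :
    P.sectionForms p k ≤ ⨆ i, ⨆ _ : i ≤ k, P.basicForms p i := by
  have hW : ∀ D ∈ ⨆ k, P.sectionForms p k, P.WInv D := by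
    intro D hD
    refine Submodule.iSup_induction _ (motive := fun D : C(U, U [⋀^Fin p]→L[ℝ] ℝ) => P.WInv D) hD
      (fun i D hD => hD.2) (fun w hw s v => rfl) fun D D' h h' w hw s v => ?_
    simp [h w hw s v, h' w hw s v]
  refine graded_le_of_green (P.sectionForms p) (P.basicForms p) (R.form p) (P.lowering R)
    (eigen (Module.finrank ℝ U + R.m + 8)) ?_ basicForms_le R.form_comm ?_
    (fun k x hx => (lowering_spec R hx).1)
    (fun k x hx => (lowering_spec R (basicForms_le k hx)).2.1 hx)
    (fun j k x hx y hy => form_green R j k x hx y hy)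
    (fun D hD hl => eq_zero_of_ball hD (htot D (hW D hD) hl)) k
  · have : StrictMono (eigen (Module.finrank ℝ U + R.m + 8)) := by
      refine strictMono_nat_of_lt_succ fun k => ?_
      simp only [eigen]; push_cast
      nlinarith [(Nat.cast_nonneg k : (0 : ℝ) ≤ k), (Nat.cast_nonneg R.m : (0 : ℝ) ≤ R.m),
        (Nat.cast_nonneg (Module.finrank ℝ U) : (0 : ℝ) ≤ Module.finrank ℝ U)]
    exact this.injective
  · intro D hD h0
    refine eq_zero_of_ball hD fun s hs => formPair_self_eq_zero ?_
    exact R.eq_zero_of_weight_integral (continuous_formPair D.continuous D.continuous)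
      (fun x => formPair_self_nonneg _) h0 hs

end Orth
end PolarRep

namespace PolarRep
open MeasureTheory Filter Topology
open scoped ContDiff
variable {Γ : Type*} [Group Γ] [TopologicalSpace Γ] {V : Type*}
    [NormedAddCommGroup V] [InnerProductSpace ℝ V] [FiniteDimensional ℝ V] {U : Type*}
    [NormedAddCommGroup U] [InnerProductSpace ℝ U] [FiniteDimensional ℝ U]
variable {P : PolarRep Γ V U} [CompactSpace Γ] [IsTopologicalGroup Γ] {p : ℕ}

variable (P) in
/-- Restrictions to the section of invariant polynomials. -/
def restrPoly : Submodule ℝ (U → ℝ) :=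
  Submodule.span ℝ {h | ∃ k, ∃ f ∈ P.invPoly k, h = fun s => f (P.ι s)}

theorem basicForms_zero_apply {k : ℕ} {q : C(U, U [⋀^Fin 0]→L[ℝ] ℝ)} (hq : q ∈ P.basicForms 0 k) :
    (fun s => q s 0) ∈ P.restrPoly := by
  obtain ⟨Q, hQ, hB, h⟩ := hq
  refine Submodule.subset_span ⟨k, fun x => Q x 0, ⟨homFun_comp_clm hQ (altEval 0), fun g x => ?_⟩, ?_⟩
  · dsimp only
    rw [← hB.inv g x 0]
    congr 1
    exact Subsingleton.elim _ _
  · funext s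
    rw [h, restr_apply]
    congr 1
    exact Subsingleton.elim _ _

section Orth
variable [MeasurableSpace U] [BorelSpace U]

theorem Roots.forms_zero_le (R : P.Roots) (k : ℕ) :
    P.sectionForms 0 k ≤ ⨆ i, ⨆ _ : i ≤ k, P.basicForms 0 i := by
  refine R.forms_le_of_total (fun D hD h s hs => ?_) k
  ext v
  have := R.eval_gr_eq_zero hD h (k := fun _ => 0) (f := fun _ => 0) (fun i => i.elim0) hs
  rw [Subsingleton.elim v _, this]; rfl

theorem Roots.mem_restrPoly (R : P.Roots) {k : ℕ} {h : U → ℝ} (hh : h ∈ homFun U ℝ k)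
    (hw : ∀ w ∈ P.weyl, ∀ s, h (w s) = h s) : h ∈ P.restrPoly := by
  let A : U [⋀^Fin 0]→L[ℝ] ℝ := ContinuousAlternatingMap.constOfIsEmpty ℝ U (Fin 0) 1
  have h1 : (fun s => h s • A) ∈ homFun U (U [⋀^Fin 0]→L[ℝ] ℝ) k :=
    homFun_comp_clm hh (ContinuousLinearMap.toSpanSingleton ℝ A)
  let D : C(U, U [⋀^Fin 0]→L[ℝ] ℝ) := ⟨_, (homFun_contDiff h1).continuous⟩
  have hD : D ∈ P.sectionForms 0 k := ⟨h1, fun w hw' s v => by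
    change h (w s) • A _ = h s • A v
    rw [hw w hw', Subsingleton.elim (fun i => w (v i)) v]⟩
  have h2 : ∀ D ∈ ⨆ i, ⨆ _ : i ≤ k, P.basicForms 0 i, (fun s => D s 0) ∈ P.restrPoly := by
    intro D hD
    refine Submodule.iSup_induction _ (motive := fun D : C(U, U [⋀^Fin 0]→L[ℝ] ℝ) =>
      (fun s => D s 0) ∈ P.restrPoly) hD (fun i D hD => ?_) (zero_mem P.restrPoly) fun D D' h h' => add_mem h h'
    refine Submodule.iSup_induction _ (motive := fun D : C(U, U [⋀^Fin 0]→L[ℝ] ℝ) =>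
      (fun s => D s 0) ∈ P.restrPoly) hD (fun i D hD => basicForms_zero_apply hD) (zero_mem P.restrPoly)
      fun D D' h h' => add_mem h h'
  have h3 := h2 D (R.forms_zero_le k hD)
  convert h3 using 2 with s
  change h s = h s • (1 : ℝ)
  simp

theorem gr_induction {T : Submodule ℝ U} {s : U} {X : Set (U → ℝ)}
    (hX : ∀ f ∈ X, Differentiable ℝ f ∧ gr f s ∈ T) {h : U → ℝ} (hh : h ∈ Submodule.span ℝ X) :
    Differentiable ℝ h ∧ gr h s ∈ T := by
  have key : ∀ {f : U → ℝ} {a : U}, fderiv ℝ f s = innerSL ℝ a → gr f s = a := fun hf =>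
    ext_inner_right ℝ fun v => by rw [inner_gr, hf, innerSL_apply_apply]
  refine Submodule.span_induction (p := fun h _ => Differentiable ℝ h ∧ gr h s ∈ T) hX ?_ ?_ ?_ hh
  · have : gr (0 : U → ℝ) s = 0 := key (by simp)
    exact ⟨differentiable_const _, this ▸ zero_mem _⟩
  · intro f g _ _ hf hg
    have : gr (f + g) s = gr f s + gr g s := key (by
      rw [fderiv_add (hf.1 s) (hg.1 s), map_add, innerSL_gr, innerSL_gr])
    exact ⟨hf.1.add hg.1, this ▸ add_mem hf.2 hg.2⟩
  · intro c f _ hf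
    have : gr (c • f) s = c • gr f s := key (by
      rw [fderiv_const_smul (hf.1 s), map_smul, innerSL_gr])
    exact ⟨hf.1.const_smul c, this ▸ Submodule.smul_mem _ _ hf.2⟩

/-- At points with trivial stabilizer, gradients of invariant polynomials span. -/
theorem Roots.gr_span (R : P.Roots) [Finite P.weyl] {s : U} (hs : ∀ w ∈ P.weyl, w s = s → w = 1) :
    Submodule.span ℝ {a | ∃ k, ∃ f ∈ P.invPoly (k + 1), a = gr (fun s => f (P.ι s)) s} = ⊤ := by
  classical
  set T := Submodule.span ℝ {a | ∃ k, ∃ f ∈ P.invPoly (k + 1), a = gr (fun s => f (P.ι s)) s} with hT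
  have hres : ∀ h ∈ P.restrPoly, Differentiable ℝ h ∧ gr h s ∈ T := by
    refine fun h hh => gr_induction ?_ hh
    rintro _ ⟨k, f, hf, rfl⟩
    refine ⟨homFun_differentiable (invPoly_restr hf), ?_⟩
    rcases k with _ | k
    · have : gr (fun s => f (P.ι s)) s = 0 := ext_inner_right ℝ fun v => by
        rw [inner_gr, homFun_fderiv_zero (invPoly_restr hf)]; simp
      rw [this]; exact zero_mem _
    · exact Submodule.subset_span ⟨k, f, hf, rfl⟩
  refine Submodule.eq_top_iff'.2 fun a => ?_
  have : Fintype P.weyl := Fintype.ofFinite _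
  let O : Finset U := (Finset.univ.filter fun w : P.weyl => w ≠ 1).image fun w : P.weyl => (w : U ≃ₗᵢ[ℝ] U) s
  have hO : s ∉ O := by
    simp only [O, Finset.mem_image, Finset.mem_filter, Finset.mem_univ, true_and, not_exists, not_and]
    exact fun w hw h => hw (Subtype.ext (hs w w.2 h))
  obtain ⟨n, h, hh, h1, h2⟩ := exists_poly_gradient a s O hO
  obtain ⟨q, hq, rfl⟩ := exists_sum_of_mem_polyLE hh
  have hav : (fun x => ∑ w : P.weyl, (∑ j ∈ Finset.range (n + 1), q j) ((w : U ≃ₗᵢ[ℝ] U) x)) ∈ P.restrPoly := by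
    have e : (fun x => ∑ w : P.weyl, (∑ j ∈ Finset.range (n + 1), q j) ((w : U ≃ₗᵢ[ℝ] U) x)) =
        ∑ j ∈ Finset.range (n + 1), fun x => ∑ w : P.weyl, q j ((w : U ≃ₗᵢ[ℝ] U) x) := by
      funext x
      simp only [Finset.sum_apply]
      exact Finset.sum_comm
    rw [e]
    refine Submodule.sum_mem _ fun j _ => R.mem_restrPoly (k := j) ?_ fun w hw x => ?_
    · have : (∑ w : P.weyl, fun x => q j ((w : U ≃ₗᵢ[ℝ] U) x)) ∈ homFun U ℝ j :=
        Submodule.sum_mem _ fun w _ => homFun_comp_right (hq j)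
          ((w : U ≃ₗᵢ[ℝ] U).toContinuousLinearEquiv : U →L[ℝ] U)
      convert this using 1
      funext x; simp
    · exact Fintype.sum_equiv (Equiv.mulRight (⟨w, hw⟩ : P.weyl)) _ _ fun v => rfl
  have hd : Differentiable ℝ (∑ j ∈ Finset.range (n + 1), q j) := (polyLE_contDiff hh).differentiable (by simp)
  have hgr := (hres _ hav).2
  convert hgr
  refine ext_inner_right ℝ fun v => ?_
  rw [inner_gr]
  have hf : ∀ w : P.weyl, HasFDerivAt (fun x => (∑ j ∈ Finset.range (n + 1), q j) ((w : U ≃ₗᵢ[ℝ] U) x))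
      ((fderiv ℝ (∑ j ∈ Finset.range (n + 1), q j) ((w : U ≃ₗᵢ[ℝ] U) s)).comp
        ((w : U ≃ₗᵢ[ℝ] U).toContinuousLinearEquiv : U →L[ℝ] U)) s := fun w =>
    (hd _).hasFDerivAt.comp s ((w : U ≃ₗᵢ[ℝ] U).toContinuousLinearEquiv : U →L[ℝ] U).hasFDerivAt
  have hF := HasFDerivAt.fun_sum (u := Finset.univ) fun w _ => hf w
  rw [hF.fderiv, Finset.sum_eq_single_of_mem 1 (Finset.mem_univ _)]
  · have : ((1 : P.weyl) : U ≃ₗᵢ[ℝ] U) s = s := rfl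
    rw [this, h1]
    rfl
  · intro w _ hw
    rw [h2 _ (Finset.mem_image.2 ⟨w, by simp [hw], rfl⟩), ContinuousLinearMap.zero_comp]

theorem dense_free [Finite P.weyl] : Dense {s : U | ∀ w ∈ P.weyl, w s = s → w = 1} := by
  refine Measure.dense_of_ae (μ := (volume : Measure U)) ?_
  have : ∀ᵐ s : U, ∀ w : P.weyl, (w : U ≃ₗᵢ[ℝ] U) s = s → (w : U ≃ₗᵢ[ℝ] U) = 1 := by
    refine ae_all_iff.2 fun w => ?_
    by_cases hw : (w : U ≃ₗᵢ[ℝ] U) = 1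
    · exact Eventually.of_forall fun _ _ => hw
    let K : Submodule ℝ U := LinearMap.eqLocus ((w : U ≃ₗᵢ[ℝ] U).toLinearEquiv : U →ₗ[ℝ] U) LinearMap.id
    have hK : K ≠ ⊤ := fun h => hw (LinearIsometryEquiv.ext fun s => by
      have : s ∈ K := h ▸ Submodule.mem_top
      exact this)
    have := Measure.addHaar_submodule (volume : Measure U) K hK
    filter_upwards [measure_eq_zero_iff_ae_notMem.1 this] with s hs h
    exact absurd h hs
  filter_upwards [this] with s hs w hw using hs ⟨w, hw⟩

/-- Every Weyl invariant homogeneous polynomial form on the section is a sum of restrictions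
of homogeneous basic forms of at most the same degree. -/
theorem Roots.sectionForms_le (R : P.Roots) [Finite P.weyl] (k : ℕ) :
    P.sectionForms p k ≤ ⨆ i, ⨆ _ : i ≤ k, P.basicForms p i := by
  refine R.forms_le_of_total (fun D hD h s hs => ?_) k
  have hfree : Metric.ball (0 : U) 1 ∩ {s : U | ∀ w ∈ P.weyl, w s = s → w = 1} ⊆ {s | D s = 0} := by
    rintro s ⟨hs, hw⟩
    have hspan := R.gr_span hw
    let b := Module.Basis.ofSpan hspan.ge
    have hb : ∀ i, ∃ k, ∃ f ∈ P.invPoly (k + 1), b i = gr (fun s => f (P.ι s)) s := fun i =>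
      Module.Basis.ofSpan_subset hspan.ge ⟨i, rfl⟩
    choose k f hf hbe using hb
    refine ContinuousAlternatingMap.toContinuousMultilinearMap_injective
      (ContinuousMultilinearMap.toMultilinearMap_injective ?_)
    refine Module.Basis.ext_multilinear (fun _ => b) fun v => ?_
    have := R.eval_gr_eq_zero hD h (k := fun i => k (v i)) (f := fun i => f (v i)) (fun i => hf _)
      (mem_ball_zero_iff.1 hs)
    simp only [← hbe] at this
    exact this
  have hcl : IsClosed {s | D s = 0} := isClosed_eq D.continuous continuous_const
  exact closure_minimal hfree hcl (dense_free.open_subset_closure_inter Metric.isOpen_ball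
    (mem_ball_zero_iff.2 hs))

end Orth
end PolarRep

namespace PolarRep
open MeasureTheory Filter Topology
open scoped ContDiff
variable {Γ : Type*} [Group Γ] [TopologicalSpace Γ] {V : Type*}
    [NormedAddCommGroup V] [InnerProductSpace ℝ V] [FiniteDimensional ℝ V] {U : Type*}
    [NormedAddCommGroup U] [InnerProductSpace ℝ U] [FiniteDimensional ℝ U]
variable {P : PolarRep Γ V U} [CompactSpace Γ] [IsTopologicalGroup Γ] {p : ℕ}

theorem Basic.apply_pr {Q : V → V [⋀^Fin p]→L[ℝ] ℝ} (hQ : P.Basic Q) (s : U) (v : Fin p → V) :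
    Q (P.ι s) v = P.restr Q s fun i => P.pr (v i) := by
  classical
  have key : ∀ T : Finset (Fin p), Q (P.ι s) v = Q (P.ι s) (T.piecewise (fun i => P.ι (P.pr (v i))) v) := by
    intro T
    induction T using Finset.induction_on with
    | empty => simp
    | insert a T ha ih =>
      rw [ih, Finset.piecewise_insert]
      have : T.piecewise (fun i => P.ι (P.pr (v i))) v =
          Function.update (T.piecewise (fun i => P.ι (P.pr (v i))) v) a (v a) := by
        rw [eq_comm, Function.update_eq_self_iff, Finset.piecewise_eq_of_notMem _ _ _ ha]
      conv_lhs => rw [this]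
      exact hQ.hor_update s _ a (v a)
  have := key Finset.univ
  rwa [Finset.piecewise_univ] at this

theorem mem_iSup_basicForms {k : ℕ} {D : C(U, U [⋀^Fin p]→L[ℝ] ℝ)}
    (hD : D ∈ ⨆ i, ⨆ _ : i ≤ k, P.basicForms p i) :
    ∃ Q ∈ polyLE V (V [⋀^Fin p]→L[ℝ] ℝ) k, P.Basic Q ∧ ∀ s, P.restr Q s = D s := by
  have h0 : ∃ Q ∈ polyLE V (V [⋀^Fin p]→L[ℝ] ℝ) k, P.Basic Q ∧
      ∀ s, P.restr Q s = (0 : C(U, U [⋀^Fin p]→L[ℝ] ℝ)) s :=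
    ⟨0, zero_mem _, ⟨contDiff_const, fun _ _ _ => rfl, fun _ _ _ _ => rfl⟩, fun _ => rfl⟩
  have ha : ∀ D D' : C(U, U [⋀^Fin p]→L[ℝ] ℝ),
      (∃ Q ∈ polyLE V (V [⋀^Fin p]→L[ℝ] ℝ) k, P.Basic Q ∧ ∀ s, P.restr Q s = D s) →
      (∃ Q ∈ polyLE V (V [⋀^Fin p]→L[ℝ] ℝ) k, P.Basic Q ∧ ∀ s, P.restr Q s = D' s) →
      ∃ Q ∈ polyLE V (V [⋀^Fin p]→L[ℝ] ℝ) k, P.Basic Q ∧ ∀ s, P.restr Q s = (D + D') s := by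
    rintro D D' ⟨Q, hQ, hB, h⟩ ⟨Q', hQ', hB', h'⟩
    refine ⟨Q + Q', add_mem hQ hQ', ⟨hB.smooth.add hB'.smooth, fun g x v => ?_,
      fun s v a ha => ?_⟩, fun s => ?_⟩
    · simp [hB.inv g x v, hB'.inv g x v]
    · simp [hB.hor s v a ha, hB'.hor s v a ha]
    · rw [ContinuousMap.add_apply, ← h, ← h']; rfl
  refine Submodule.iSup_induction _ (motive := fun D => ∃ Q ∈ polyLE V (V [⋀^Fin p]→L[ℝ] ℝ) k,
    P.Basic Q ∧ ∀ s, P.restr Q s = D s) hD (fun i D hD => ?_) h0 ha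
  refine Submodule.iSup_induction _ (motive := fun D => ∃ Q ∈ polyLE V (V [⋀^Fin p]→L[ℝ] ℝ) k,
    P.Basic Q ∧ ∀ s, P.restr Q s = D s) hD (fun hi D hD => ?_) h0 ha
  obtain ⟨Q, hQ, hB, h⟩ := hD
  exact ⟨Q, homFun_le_polyLE hi hQ, hB, fun s => (h s).symm⟩

variable [MeasurableSpace U] [BorelSpace U]

/-- A polynomial form close to an invariant form on a ball of the section yields a basic polynomial
form close to it. -/
theorem Roots.exists_basic_near (R : P.Roots) [Finite P.weyl] {om : U → U [⋀^Fin p]→L[ℝ] ℝ} (hom : P.WInv om)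
    {n : ℕ} {r ε : ℝ} {q : U → U [⋀^Fin p]→L[ℝ] ℝ} (hq : q ∈ polyLE U (U [⋀^Fin p]→L[ℝ] ℝ) n)
    (h : ∀ s, ‖s‖ ≤ r → ‖om s - q s‖ ≤ ε) :
    ∃ Q ∈ polyLE V (V [⋀^Fin p]→L[ℝ] ℝ) n, P.Basic Q ∧ ∀ s, ‖s‖ ≤ r → ∀ v : Fin p → U,
      |om s v - P.restr Q s v| ≤ ε * ∏ i, ‖v i‖ := by
  classical
  have : Fintype P.weyl := Fintype.ofFinite _
  obtain ⟨q, hqj, rfl⟩ := exists_sum_of_mem_polyLE hq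
  let c : ℝ := (Fintype.card P.weyl : ℝ)⁻¹
  have hc : (Fintype.card P.weyl : ℝ) ≠ 0 := by simp
  let a : ℕ → U → U [⋀^Fin p]→L[ℝ] ℝ := fun j s =>
    c • ∑ w : P.weyl, ContinuousAlternatingMap.compContinuousLinearMapCLM
      ((w : U ≃ₗᵢ[ℝ] U).toContinuousLinearEquiv : U →L[ℝ] U) (q j ((w : U ≃ₗᵢ[ℝ] U) s))
  have ha : ∀ j, a j ∈ homFun U (U [⋀^Fin p]→L[ℝ] ℝ) j := fun j => by
    refine Submodule.smul_mem _ c ?_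
    have : (∑ w : P.weyl, fun s => ContinuousAlternatingMap.compContinuousLinearMapCLM
      ((w : U ≃ₗᵢ[ℝ] U).toContinuousLinearEquiv : U →L[ℝ] U) (q j ((w : U ≃ₗᵢ[ℝ] U) s))) ∈
        homFun U (U [⋀^Fin p]→L[ℝ] ℝ) j :=
      Submodule.sum_mem _ fun w _ => homFun_comp_clm (homFun_comp_right (hqj j)
          ((w : U ≃ₗᵢ[ℝ] U).toContinuousLinearEquiv : U →L[ℝ] U)) _
    convert this using 1
    funext x; simp
  have hav : ∀ j s v, a j s v = c * ∑ w : P.weyl, q j ((w : U ≃ₗᵢ[ℝ] U) s) fun i => (w : U ≃ₗᵢ[ℝ] U) (v i) := by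
    intro j s v
    change (c • ∑ w : P.weyl, _ : U [⋀^Fin p]→L[ℝ] ℝ) v = _
    rw [ContinuousAlternatingMap.smul_apply, ContinuousAlternatingMap.sum_apply, smul_eq_mul]
    rfl
  let A : ℕ → C(U, U [⋀^Fin p]→L[ℝ] ℝ) := fun j => ⟨a j, (homFun_contDiff (ha j)).continuous⟩
  have hA : ∀ j, A j ∈ P.sectionForms p j := fun j => ⟨ha j, fun w hw s v => by
    change a j (w s) _ = a j s v
    rw [hav, hav]
    congr 1
    exact Fintype.sum_equiv (Equiv.mulRight (⟨w, hw⟩ : P.weyl)) _ _ fun v => rfl⟩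
  have hA' : ∑ j ∈ Finset.range (n + 1), A j ∈ ⨆ i, ⨆ _ : i ≤ n, P.basicForms p i := by
    refine Submodule.sum_mem _ fun j hj => ?_
    have hj' : j ≤ n := Nat.lt_succ_iff.1 (Finset.mem_range.1 hj)
    have hle : ⨆ i, ⨆ _ : i ≤ j, P.basicForms p i ≤ ⨆ i, ⨆ _ : i ≤ n, P.basicForms p i :=
      iSup_mono fun i => iSup_mono' fun hi => ⟨le_trans hi hj', le_rfl⟩
    exact hle (R.sectionForms_le j (hA j))
  obtain ⟨Q, hQ, hB, hr⟩ := mem_iSup_basicForms hA'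
  refine ⟨Q, hQ, hB, fun s hs v => ?_⟩
  have e : om s v - P.restr Q s v = c * ∑ w : P.weyl,
      ((om ((w : U ≃ₗᵢ[ℝ] U) s) - (∑ j ∈ Finset.range (n + 1), q j) ((w : U ≃ₗᵢ[ℝ] U) s))
        fun i => (w : U ≃ₗᵢ[ℝ] U) (v i)) := by
    have h1 : ∀ w : P.weyl, ((om ((w : U ≃ₗᵢ[ℝ] U) s) - (∑ j ∈ Finset.range (n + 1), q j) ((w : U ≃ₗᵢ[ℝ] U) s))
        fun i => (w : U ≃ₗᵢ[ℝ] U) (v i)) = om s v - ∑ j ∈ Finset.range (n + 1),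
          q j ((w : U ≃ₗᵢ[ℝ] U) s) fun i => (w : U ≃ₗᵢ[ℝ] U) (v i) := fun w => by
      rw [ContinuousAlternatingMap.sub_apply, hom w w.2, Finset.sum_apply, ContinuousAlternatingMap.sum_apply]
    rw [Finset.sum_congr rfl fun w _ => h1 w, Finset.sum_sub_distrib, Finset.sum_const, Finset.card_univ,
      Finset.sum_comm, mul_sub, nsmul_eq_mul, ← mul_assoc, inv_mul_cancel₀ hc, one_mul, hr,
      ContinuousMap.sum_apply, ContinuousAlternatingMap.sum_apply, Finset.mul_sum]
    congr 1
    exact Finset.sum_congr rfl fun j _ => hav j s v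
  have hb : ∀ w : P.weyl, |((om ((w : U ≃ₗᵢ[ℝ] U) s) - (∑ j ∈ Finset.range (n + 1), q j) ((w : U ≃ₗᵢ[ℝ] U) s))
        fun i => (w : U ≃ₗᵢ[ℝ] U) (v i))| ≤ ε * ∏ i, ‖v i‖ := fun w => by
    rw [← Real.norm_eq_abs]
    refine (ContinuousAlternatingMap.le_opNorm _ _).trans ?_
    have h2 := h ((w : U ≃ₗᵢ[ℝ] U) s) (by rwa [LinearIsometryEquiv.norm_map])
    simp only [LinearIsometryEquiv.norm_map]
    exact mul_le_mul_of_nonneg_right h2 (Finset.prod_nonneg fun _ _ => norm_nonneg _)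
  rw [e, abs_mul]
  have h3 : |c| = (Fintype.card P.weyl : ℝ)⁻¹ := abs_of_nonneg (by positivity)
  have h4 := (Finset.abs_sum_le_sum_abs _ _).trans (Finset.sum_le_card_nsmul Finset.univ
    (fun w : P.weyl => |((om ((w : U ≃ₗᵢ[ℝ] U) s) - (∑ j ∈ Finset.range (n + 1), q j) ((w : U ≃ₗᵢ[ℝ] U) s))
        fun i => (w : U ≃ₗᵢ[ℝ] U) (v i))|) _ fun w _ => hb w)
  rw [h3]
  calc _ ≤ _ := mul_le_mul_of_nonneg_left h4 (by positivity)
    _ = _ := by rw [Finset.card_univ, nsmul_eq_mul, ← mul_assoc, inv_mul_cancel₀ hc, one_mul]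

theorem Roots.exists_extension (R : P.Roots) [Finite P.weyl] {om : U → U [⋀^Fin p]→L[ℝ] ℝ} (hom : P.WInv om)
    (happ : ∀ r : ℝ, ∀ ε > 0, ∃ n, ∃ q ∈ polyLE U (U [⋀^Fin p]→L[ℝ] ℝ) n, ∀ s, ‖s‖ ≤ r → ‖om s - q s‖ ≤ ε) :
    ∃ η : V → V [⋀^Fin p]→L[ℝ] ℝ,
      (∀ g x s v, P.ρ g x = P.ι s → η x v = om s fun i => P.pr (P.ρ g (v i))) ∧
      ∀ n (r ε : ℝ), ∀ q ∈ polyLE U (U [⋀^Fin p]→L[ℝ] ℝ) n, (∀ s, ‖s‖ ≤ r → ‖om s - q s‖ ≤ ε) →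
        ∃ Q ∈ polyLE V (V [⋀^Fin p]→L[ℝ] ℝ) n, ∀ x, ‖x‖ ≤ r → ‖η x - Q x‖ ≤ ε := by
  choose g s hgs using P.meets
  let η : V → V [⋀^Fin p]→L[ℝ] ℝ := fun x => (om (s x)).compContinuousLinearMap (P.pr.comp (P.ρ (g x)))
  have hη : ∀ x v, η x v = om (s x) fun i => P.pr (P.ρ (g x) (v i)) := fun x v => rfl
  have key : ∀ {Q : V → V [⋀^Fin p]→L[ℝ] ℝ}, P.Basic Q → ∀ g x s v, P.ρ g x = P.ι s →
      Q x v = P.restr Q s fun i => P.pr (P.ρ g (v i)) := fun {Q} hQ g x s v h => by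
    rw [← hQ.inv g x v, h, hQ.apply_pr]
  have hpr : ∀ v : V, ‖P.pr v‖ ≤ ‖v‖ := fun v => by
    refine (P.pr.le_opNorm v).trans ?_
    have : ‖P.pr‖ ≤ 1 := by
      rw [pr, LinearIsometryEquiv.norm_map]
      exact P.ι.norm_toContinuousLinearMap_le
    nlinarith [norm_nonneg v]
  have near : ∀ {n : ℕ} {r ε : ℝ} {q : U → U [⋀^Fin p]→L[ℝ] ℝ}, q ∈ polyLE U (U [⋀^Fin p]→L[ℝ] ℝ) n →
      (∀ s, ‖s‖ ≤ r → ‖om s - q s‖ ≤ ε) → ∃ Q ∈ polyLE V (V [⋀^Fin p]→L[ℝ] ℝ) n, P.Basic Q ∧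
        ∀ g x s v, ‖x‖ ≤ r → P.ρ g x = P.ι s →
          |(om s fun i => P.pr (P.ρ g (v i))) - Q x v| ≤ ε * ∏ i, ‖v i‖ := by
    intro n r ε q hq h
    obtain ⟨Q, hQ, hB, hn⟩ := R.exists_basic_near hom hq h
    refine ⟨Q, hQ, hB, fun g x s v hx hgx => ?_⟩
    have hs : ‖s‖ = ‖x‖ := by rw [← P.isom g x, hgx, P.ι.norm_map]
    rw [key hB g x s v hgx]
    refine (hn s (hs.trans_le hx) _).trans ?_
    have hε : 0 ≤ ε := (norm_nonneg _).trans (h s (hs.trans_le hx))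
    refine mul_le_mul_of_nonneg_left (Finset.prod_le_prod (fun _ _ => norm_nonneg _) fun i _ => ?_) hε
    exact (hpr _).trans (P.isom g _).le
  refine ⟨η, fun g' x s' v h => ?_, fun n r ε q hq h => ?_⟩
  · rw [hη]
    by_contra hne
    have hpos : 0 < |(om (s x) fun i => P.pr (P.ρ (g x) (v i))) - om s' fun i => P.pr (P.ρ g' (v i))| :=
      abs_pos.2 (sub_ne_zero.2 hne)
    set δ := |(om (s x) fun i => P.pr (P.ρ (g x) (v i))) - om s' fun i => P.pr (P.ρ g' (v i))|
    have hprod : 0 ≤ ∏ i, ‖v i‖ := Finset.prod_nonneg fun _ _ => norm_nonneg _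
    obtain ⟨n, q, hq, hn⟩ := happ ‖x‖ (δ / (4 * (∏ i, ‖v i‖ + 1))) (by positivity)
    obtain ⟨Q, _, hB, hQ⟩ := near hq hn
    have h1 := hQ (g x) x (s x) v le_rfl (hgs x)
    have h2 := hQ g' x s' v le_rfl h
    have h3 : δ ≤ _ := abs_sub_le (om (s x) fun i => P.pr (P.ρ (g x) (v i))) (Q x v) (om s' fun i => P.pr (P.ρ g' (v i)))
    rw [abs_sub_comm (Q x v)] at h3
    have h4 : δ / (4 * (∏ i, ‖v i‖ + 1)) * ∏ i, ‖v i‖ ≤ δ / 4 := by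
      rw [div_mul_eq_mul_div, div_le_div_iff₀ (by positivity) (by positivity)]
      nlinarith
    linarith
  · obtain ⟨Q, hQ, hB, hn⟩ := near hq h
    refine ⟨Q, hQ, fun x hx => ?_⟩
    have hε : 0 ≤ ε := (norm_nonneg _).trans (h (s x) (by
      rw [← P.ι.norm_map, ← hgs x, P.isom]; exact hx))
    refine ContinuousAlternatingMap.opNorm_le_bound _ hε fun v => ?_
    rw [ContinuousAlternatingMap.sub_apply, hη]
    exact hn _ _ _ _ hx (hgs x)

end PolarRep

section Approximation

open scoped ContDiff

/-- The properties of `k ↦ k! M_k`, for a DC-weight sequence `M`, that drive the approximation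
theory. -/
structure WtSeq (m : ℕ → ℝ) : Prop where
  pos : ∀ k, 0 < m k
  mono : ∀ k : ℕ, (k + 1 : ℝ) * m k ≤ m (k + 1)
  shift : ∃ A : ℝ, 1 ≤ A ∧ ∀ k : ℕ, m (k + 1) ≤ A ^ (k + 1) * m k

namespace WtSeq

variable {m : ℕ → ℝ}

theorem shift_add (h : WtSeq m) (a : ℕ) :
    ∃ A : ℝ, 1 ≤ A ∧ ∀ k : ℕ, m (k + a) ≤ A ^ (k + 1) * m k := by
  obtain ⟨A, hA, hs⟩ := h.shift
  induction a with
  | zero => exact ⟨1, le_rfl, fun k => by simp⟩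
  | succ a ih =>
    obtain ⟨B, hB, hb⟩ := ih
    refine ⟨A ^ (a + 1) * B, one_le_mul_of_one_le_of_one_le (one_le_pow₀ hA) hB, fun k => ?_⟩
    calc m (k + (a + 1)) ≤ A ^ (k + a + 1) * m (k + a) := hs (k + a)
      _ ≤ A ^ ((a + 1) * (k + 1)) * (B ^ (k + 1) * m k) := by
          have h1 : A ^ (k + a + 1) ≤ A ^ ((a + 1) * (k + 1)) :=
            pow_le_pow_right₀ hA (by nlinarith [Nat.zero_le (a * k)])
          have h2 := (h.pos (k + a)).le
          have h3 := hb k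
          have h4 : 0 ≤ A ^ ((a + 1) * (k + 1)) := by positivity
          exact mul_le_mul h1 h3 h2 h4
      _ = _ := by rw [mul_pow, ← pow_mul]; ring

theorem absorb (h : WtSeq m) {C ρ : ℝ} (hC : 0 < C) (hρ : 0 < ρ) (a : ℕ) :
    ∃ C' > 0, ∃ ρ' > 0, ∀ x : ℝ, 0 < x → ∀ k,
      x ^ a * (C * (ρ / x) ^ (k + a) * m (k + a)) ≤ C' * (ρ' / x) ^ k * m k := by
  obtain ⟨A, hA, hs⟩ := h.shift_add a
  refine ⟨C * ρ ^ a * A, by positivity, ρ * A, by positivity, fun x hx k => ?_⟩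
  have h0 := h.pos k
  calc x ^ a * (C * (ρ / x) ^ (k + a) * m (k + a))
      = C * ρ ^ a * (ρ / x) ^ k * m (k + a) := by
        rw [pow_add, div_pow, div_pow]; field_simp
    _ ≤ C * ρ ^ a * (ρ / x) ^ k * (A ^ (k + 1) * m k) := by gcongr; exact hs k
    _ = _ := by rw [div_pow, div_pow, mul_pow]; ring

end WtSeq

theorem DCWeightSeq.wtSeq {M : ℕ → ℝ}
    (hM : DCWeightSeq M) :
    WtSeq fun k => (k ! : ℝ) * M k := by
  obtain ⟨-, hp, hm, -, C, hC⟩ := hM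
  refine ⟨fun k => mul_pos (by positivity) (hp k), fun k => ?_, ?_⟩
  · rw [Nat.factorial_succ]
    push_cast
    rw [← mul_assoc]
    have := hm k
    gcongr
  · set B := max (max C 1) (M 1 / M 0)
    have hB : 1 ≤ B := (le_max_right C 1).trans (le_max_left _ _)
    have key : ∀ k, M (k + 1) ≤ B ^ (k + 1) * M k := by
      intro k
      rw [← div_le_iff₀ (hp k)]
      rcases Nat.eq_zero_or_pos k with rfl | hk
      · simp only [zero_add, pow_one]
        exact le_max_right (max C 1) (M 1 / M 0)
      · have h1 := hC k hk
        have h0 : 0 ≤ M (k + 1) / M k := (div_pos (hp _) (hp _)).le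
        have h2 : M (k + 1) / M k ≤ B ^ k := by
          calc M (k + 1) / M k = ((M (k + 1) / M k) ^ ((1 : ℝ) / k)) ^ k := by
                rw [one_div, Real.rpow_inv_natCast_pow h0 hk.ne']
            _ ≤ B ^ k := by
                gcongr
                exact h1.trans ((le_max_left C 1).trans (le_max_left _ _))
        exact h2.trans (pow_le_pow_right₀ hB (Nat.le_succ k))
    refine ⟨2 * B, by linarith, fun k => ?_⟩
    have h2 : ((k : ℝ) + 1) ≤ 2 ^ (k + 1) := by
      exact_mod_cast (Nat.lt_two_pow_self (n := k + 1)).le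
    have := (hp (k + 1)).le
    rw [Nat.factorial_succ, mul_pow]
    push_cast
    calc ((k : ℝ) + 1) * k ! * M (k + 1) ≤ 2 ^ (k + 1) * k ! * (B ^ (k + 1) * M k) := by
          gcongr; exact key k
      _ = _ := by ring

/-- Derivatives of `h ∘ cos` in terms of those of `h`. -/
theorem iteratedDeriv_comp_cos_le {m : ℕ → ℝ} (hm : WtSeq m) {h : ℝ → ℝ} (hh : ContDiff ℝ ∞ h)
    {C ρ : ℝ} (hC : 0 ≤ C) (hρ : 1 ≤ ρ)
    (hb : ∀ k, ∀ x, |x| ≤ 1 → |iteratedDeriv k h x| ≤ C * ρ ^ k * m k) (k : ℕ) (θ : ℝ) :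
    |iteratedDeriv k (fun t => h (Real.cos t)) θ| ≤ C * (2 * ρ) ^ k * m k := by
  set H : ℕ → ℝ → ℝ := fun j => iteratedDeriv j h
  have hH : ∀ j, ContDiff ℝ ∞ (H j) := fun j => by
    show ContDiff ℝ ∞ (iteratedDeriv j h)
    rw [iteratedDeriv_eq_iterate]
    exact hh.iterate_deriv j
  have hHd : ∀ j x, HasDerivAt (H j) (H (j + 1) x) x := fun j x => by
    have h1 : H (j + 1) = deriv (H j) := iteratedDeriv_succ
    rw [h1]
    exact ((hH j).differentiable (by simp) x).hasDerivAt
  set e : ℕ → ℕ → ℕ → ℝ → ℝ := fun a b j t =>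
    Real.sin t ^ a * Real.cos t ^ b * H j (Real.cos t) with he
  have hes : ∀ a b j, ContDiff ℝ ∞ (e a b j) := fun a b j =>
    ((Real.contDiff_sin.pow a).mul (Real.contDiff_cos.pow b)).mul ((hH j).comp Real.contDiff_cos)
  have hed : ∀ a b j, deriv (e a b j) = fun t =>
      (a : ℝ) * e (a - 1) (b + 1) j t - (b : ℝ) * e (a + 1) (b - 1) j t - e (a + 1) b (j + 1) t := by
    intro a b j
    funext t
    have h1 := (((Real.hasDerivAt_sin t).pow a).mul ((Real.hasDerivAt_cos t).pow b)).mul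
      ((hHd j (Real.cos t)).comp t (Real.hasDerivAt_cos t))
    refine (h1.congr_deriv ?_).deriv
    simp only [he, Pi.pow_apply, Pi.mul_apply, Function.comp_apply]
    ring
  have key : ∀ k a b j, a + b = j → ∀ t,
      |iteratedDeriv k (e a b j) t| ≤ C * 2 ^ k * ρ ^ (k + j) * m (k + j) := by
    intro k
    induction k with
    | zero =>
      intro a b j _ t
      simp only [iteratedDeriv_zero, he, abs_mul, abs_pow, pow_zero, mul_one, zero_add]
      have h1 : |Real.sin t| ^ a ≤ 1 := pow_le_one₀ (abs_nonneg _) (Real.abs_sin_le_one t)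
      have h2 : |Real.cos t| ^ b ≤ 1 := pow_le_one₀ (abs_nonneg _) (Real.abs_cos_le_one t)
      have h3 := hb j _ (Real.abs_cos_le_one t)
      calc _ ≤ 1 * 1 * |H j (Real.cos t)| := by gcongr
        _ ≤ _ := by simpa using h3
    | succ k ih =>
      intro a b j hab t
      have hc : ∀ a b j, ContDiffAt ℝ k (e a b j) t := fun a b j =>
        ((hes a b j).of_le (by exact_mod_cast le_top)).contDiffAt
      rw [iteratedDeriv_succ', hed, iteratedDeriv_fun_sub
        ((contDiffAt_const.mul (hc _ _ _)).sub (contDiffAt_const.mul (hc _ _ _))) (hc _ _ _),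
        iteratedDeriv_fun_sub (contDiffAt_const.mul (hc _ _ _)) (contDiffAt_const.mul (hc _ _ _)),
        iteratedDeriv_const_mul_field, iteratedDeriv_const_mul_field]
      set K := C * 2 ^ k * ρ ^ (k + j) * m (k + j)
      have h1 : |(a : ℝ) * iteratedDeriv k (e (a - 1) (b + 1) j) t| ≤ a * K := by
        rcases Nat.eq_zero_or_pos a with rfl | ha
        · simp
        · rw [abs_mul, Nat.abs_cast]
          gcongr
          exact ih _ _ _ (by omega) t
      have h2 : |(b : ℝ) * iteratedDeriv k (e (a + 1) (b - 1) j) t| ≤ b * K := by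
        rcases Nat.eq_zero_or_pos b with rfl | ha
        · simp
        · rw [abs_mul, Nat.abs_cast]
          gcongr
          exact ih _ _ _ (by omega) t
      have h3 := ih (a + 1) b (j + 1) (by omega) t
      have h4 : (a + b : ℝ) * K ≤ C * 2 ^ k * ρ ^ (k + (j + 1)) * m (k + (j + 1)) := by
        have hK : (a + b : ℝ) * m (k + j) ≤ m (k + (j + 1)) := by
          refine le_trans ?_ (hm.mono (k + j))
          refine mul_le_mul_of_nonneg_right ?_ (hm.pos (k + j)).le
          push_cast
          have : (a + b : ℝ) = j := by exact_mod_cast hab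
          have : (0 : ℝ) ≤ k := by positivity
          linarith
        have hρ' : ρ ^ (k + j) ≤ ρ ^ (k + (j + 1)) := pow_le_pow_right₀ hρ (by omega)
        have := (hm.pos (k + (j + 1))).le
        have := (hm.pos (k + j)).le
        calc (a + b : ℝ) * K = C * 2 ^ k * ρ ^ (k + j) * ((a + b : ℝ) * m (k + j)) := by
              simp only [K]; ring
          _ ≤ _ := by gcongr
      have h5 : k + 1 + j = k + (j + 1) := by omega
      rw [h5, pow_succ]
      calc _ ≤ _ := (abs_sub _ _).trans (add_le_add (abs_sub _ _) le_rfl)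
        _ ≤ a * K + b * K + C * 2 ^ k * ρ ^ (k + (j + 1)) * m (k + (j + 1)) := by gcongr
        _ ≤ _ := by linarith
  have := key k 0 0 0 rfl θ
  simp only [he, H, pow_zero, one_mul, iteratedDeriv_zero, add_zero] at this
  rwa [mul_pow, ← mul_assoc]

section Fourier

/-- Rapid approximation of an even `2π`-periodic function by polynomials in `cos θ`. -/
theorem exists_polynomial_cos_near {g : ℝ → ℝ} (hg : ContDiff ℝ ∞ g)
    (hper : Function.Periodic g (2 * Real.pi)) (heven : ∀ t, g (-t) = g t) {B : ℕ → ℝ}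
    (hB : ∀ k t, |iteratedDeriv k g t| ≤ B k) (N : ℕ) (hN : 1 ≤ N) :
    ∃ p : Polynomial ℝ, p.natDegree ≤ N ∧
      ∀ θ k, |g θ - p.eval (Real.cos θ)| ≤ (∑' n : ℤ, 1 / (n : ℝ) ^ 2) * (B (k + 2) / N ^ k) := by
  have hab : -Real.pi < Real.pi := by linarith [Real.pi_pos]
  have hT : Fact (0 < Real.pi - -Real.pi) := ⟨by linarith [Real.pi_pos]⟩
  set f : ℝ → ℂ := fun t => (g t : ℂ) with hf
  have hT2 : Real.pi - -Real.pi = 2 * Real.pi := by ring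
  have hfper : Function.Periodic f (Real.pi - -Real.pi) := fun t => by
    simp only [hf, hT2]; rw [hper t]
  have hfc : Continuous f := Complex.continuous_ofReal.comp hg.continuous
  let G : C(AddCircle (Real.pi - -Real.pi), ℂ) := ⟨hfper.lift, continuous_coinduced_dom.mpr hfc⟩
  have hcoef : ∀ n, fourierCoeff G n = fourierCoeffOn hab f n := fun n => by
    rw [fourierCoeff_eq_intervalIntegral G n (-Real.pi), fourierCoeffOn_eq_integral]
    have h1 : -Real.pi + (Real.pi - -Real.pi) = Real.pi := by ring
    rw [h1]
    rfl
  have hdper : ∀ k t, iteratedDeriv k g (t + 2 * Real.pi) = iteratedDeriv k g t := fun k t => by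
    have h1 := congrFun (iteratedDeriv_comp_add_const k g (2 * Real.pi)) t
    rw [← h1]
    congr 1
    funext z
    exact hper z
  have hdc : ∀ k, ContDiff ℝ ∞ (iteratedDeriv k g) := fun k => by
    rw [iteratedDeriv_eq_iterate]
    exact hg.iterate_deriv k
  set D : ℕ → ℝ → ℂ := fun k t => Complex.ofReal (iteratedDeriv k g t) with hD
  have hDd : ∀ k t, HasDerivAt (D k) (D (k + 1) t) t := fun k t => by
    have h1 : HasDerivAt (iteratedDeriv k g) (iteratedDeriv (k + 1) g t) t := by
      rw [iteratedDeriv_succ]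
      exact ((hdc k).differentiable (by simp) t).hasDerivAt
    exact h1.ofReal_comp
  have hDc : ∀ k, Continuous (D k) := fun k => Complex.continuous_ofReal.comp (hdc k).continuous
  have hcD : ∀ k n, ‖fourierCoeffOn hab (D k) n‖ ≤ B k := fun k n => by
    rw [fourierCoeffOn_eq_integral, norm_smul]
    have h1 := intervalIntegral.norm_integral_le_of_norm_le_const (a := -Real.pi) (b := Real.pi)
      (f := fun x : ℝ => fourier (-n) (x : AddCircle (Real.pi - -Real.pi)) • D k x) (C := B k)
      fun x _ => by
        rw [norm_smul, fourier_apply, Circle.norm_coe, one_mul]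
        simpa [hD] using hB k x
    have h2 := hT.out
    rw [abs_of_pos h2] at h1
    rw [Real.norm_eq_abs, abs_of_pos (by positivity)]
    calc _ ≤ 1 / (Real.pi - -Real.pi) * (B k * (Real.pi - -Real.pi)) := by gcongr
      _ = B k := by field_simp
  have hstep : ∀ k (n : ℤ), n ≠ 0 → ‖fourierCoeffOn hab (D k) n‖ =
      ‖fourierCoeffOn hab (D (k + 1)) n‖ / |(n : ℝ)| := fun k n hn => by
    rw [fourierCoeffOn_of_hasDerivAt hab hn (fun x _ => hDd k x)
      ((hDc (k + 1)).intervalIntegrable _ _)]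
    have h1 : D k Real.pi = D k (-Real.pi) := by
      simp only [hD]
      rw [← hdper k (-Real.pi)]
      congr 2
      ring
    have hpi := Real.pi_pos
    have hn' : |(n : ℝ)| ≠ 0 := by simpa using hn
    rw [h1, sub_self, mul_zero, zero_sub, norm_mul, norm_neg, norm_mul, norm_div, norm_mul,
      norm_mul, norm_mul]
    have h3 : ‖((Real.pi : ℝ) : ℂ) - ((-Real.pi : ℝ) : ℂ)‖ = 2 * Real.pi := by
      rw [← Complex.ofReal_sub, Complex.norm_real, Real.norm_eq_abs, abs_of_pos hT.out, hT2]
    rw [h3]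
    simp only [norm_one, norm_neg, Complex.norm_ofNat, Complex.norm_real, Complex.norm_I,
      Complex.norm_intCast, Real.norm_eq_abs, abs_of_pos hpi]
    field_simp
  have hdecay : ∀ k (n : ℤ), n ≠ 0 → ‖fourierCoeff G n‖ ≤ B k / |(n : ℝ)| ^ k := by
    intro k n hn
    have hn' : 0 < |(n : ℝ)| := by positivity
    have : ∀ k, ‖fourierCoeff G n‖ = ‖fourierCoeffOn hab (D k) n‖ / |(n : ℝ)| ^ k := by
      intro k
      induction k with
      | zero => simp [hcoef, hD, hf]
      | succ k ih => rw [ih, hstep k n hn, pow_succ]; field_simp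
    rw [this k]
    gcongr
    exact hcD k n
  have hs2 : Summable fun n : ℤ => 1 / (n : ℝ) ^ 2 := Real.summable_one_div_int_pow.2 one_lt_two
  have hsum : Summable (fourierCoeff G) := by
    refine Summable.of_norm_bounded_eventually (hs2.mul_left (B 2)) ?_
    refine (Set.finite_singleton (0 : ℤ)).subset fun n hn => ?_
    by_contra h0
    refine hn ?_
    have := hdecay 2 n h0
    rwa [sq_abs, div_eq_mul_one_div] at this
  set c : ℤ → ℝ := fun n => (fourierCoeff G n).re with hc
  have hser : ∀ θ, HasSum (fun n : ℤ => c n * Real.cos (n * θ)) (g θ) := by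
    intro θ
    have h1 : ∀ θ : ℝ, HasSum (fun n : ℤ => c n * Real.cos (n * θ)
        - (fourierCoeff G n).im * Real.sin (n * θ)) (g θ) := fun θ => by
      have h2 := has_pointwise_sum_fourier_series_of_summable hsum
        (θ : AddCircle (Real.pi - -Real.pi))
      have h3 := Complex.hasSum_re h2
      have h4 : (G (θ : AddCircle (Real.pi - -Real.pi))).re = g θ := by
        have : G (θ : AddCircle (Real.pi - -Real.pi)) = f θ := rfl
        rw [this]; simp [hf]
      rw [h4] at h3
      refine h3.congr_fun fun n => ?_
      have h5 : 2 * (Real.pi : ℂ) * Complex.I * n * θ / ((Real.pi - -Real.pi : ℝ) : ℂ) =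
          ((n * θ : ℝ) : ℂ) * Complex.I := by
        have : (Real.pi : ℂ) ≠ 0 := by exact_mod_cast Real.pi_pos.ne'
        rw [hT2]; push_cast; field_simp
      rw [fourier_coe_apply, h5, smul_eq_mul, Complex.mul_re, Complex.exp_ofReal_mul_I_re,
        Complex.exp_ofReal_mul_I_im]
    have h2 := ((h1 θ).add (h1 (-θ))).mul_left (1 / 2)
    rw [heven] at h2
    rw [show 1 / 2 * (g θ + g θ) = g θ by ring] at h2
    refine h2.congr_fun fun n => ?_
    rw [mul_neg, Real.cos_neg, Real.sin_neg]; ring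
  refine ⟨∑ n ∈ Finset.Icc (-(N : ℤ)) N, Polynomial.C (c n) * Polynomial.Chebyshev.T ℝ n,
    Polynomial.natDegree_sum_le_of_forall_le _ _ fun n hn => ?_, fun θ k => ?_⟩
  · refine (Polynomial.natDegree_C_mul_le _ _).trans ?_
    rw [Polynomial.Chebyshev.natDegree_T]
    rw [Finset.mem_Icc] at hn
    omega
  · have he : (∑ n ∈ Finset.Icc (-(N : ℤ)) N,
        Polynomial.C (c n) * Polynomial.Chebyshev.T ℝ n).eval (Real.cos θ) =
        ∑ n ∈ Finset.Icc (-(N : ℤ)) N, c n * Real.cos (n * θ) := by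
      rw [Polynomial.eval_finsetSum]
      exact Finset.sum_congr rfl fun n _ => by
        rw [Polynomial.eval_mul, Polynomial.eval_C, Polynomial.Chebyshev.T_real_cos]
    rw [he]
    have h1 := (Finset.hasSum_compl_iff (a := g θ - ∑ n ∈ Finset.Icc (-(N : ℤ)) N,
      c n * Real.cos (n * θ)) (Finset.Icc (-(N : ℤ)) N)).2 (by rw [sub_add_cancel]; exact hser θ)
    have hB2 : 0 ≤ B (k + 2) := (abs_nonneg _).trans (hB (k + 2) 0)
    have hs3 : Summable fun n : ℤ => 1 / (n : ℝ) ^ 2 * (B (k + 2) / N ^ k) := hs2.mul_right _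
    have h2 := h1.norm_le_of_bounded
      (hs3.subtype (fun n => n ∉ Finset.Icc (-(N : ℤ)) N)).hasSum fun n => by
        obtain ⟨n, hn⟩ := n
        have hnN : (N : ℝ) ≤ |(n : ℝ)| := by
          rw [Finset.mem_Icc] at hn
          have : (N : ℤ) ≤ |n| := by
            rw [le_abs]; omega
          exact_mod_cast this
        have hN0 : (0 : ℝ) < N := by exact_mod_cast hN
        have hn0 : n ≠ 0 := by
          rintro rfl
          simp at hnN; linarith
        have hc1 : |c n| ≤ B (k + 2) / |(n : ℝ)| ^ (k + 2) :=
          (Complex.abs_re_le_norm _).trans (hdecay (k + 2) n hn0)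
        show ‖c n * Real.cos (n * θ)‖ ≤ 1 / (n : ℝ) ^ 2 * (B (k + 2) / N ^ k)
        rw [norm_mul, Real.norm_eq_abs, Real.norm_eq_abs]
        calc |c n| * |Real.cos (n * θ)| ≤ B (k + 2) / |(n : ℝ)| ^ (k + 2) * 1 := by
              gcongr
              exact Real.abs_cos_le_one _
          _ = 1 / (n : ℝ) ^ 2 * (B (k + 2) / |(n : ℝ)| ^ k) := by
              rw [pow_add, sq_abs]
              have : (n : ℝ) ≠ 0 := by exact_mod_cast hn0
              field_simp
          _ ≤ _ := by gcongr
    refine (Real.norm_eq_abs _ ▸ h2).trans ?_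
    rw [← tsum_mul_right]
    exact hs3.tsum_subtype_le _ _ fun n => by positivity

end Fourier

/-- One-dimensional Jackson-type theorem in Denjoy–Carleman classes. -/
theorem exists_polynomial_near {m : ℕ → ℝ} (hm : WtSeq m) {C ρ : ℝ} (hC : 0 < C) (hρ : 1 ≤ ρ) :
    ∃ C' > 0, ∃ ρ' > 0, ∀ h : ℝ → ℝ, ContDiff ℝ ∞ h →
      (∀ k x, |x| ≤ 1 → |iteratedDeriv k h x| ≤ C * ρ ^ k * m k) → ∀ N : ℕ, 1 ≤ N →
      ∃ p : Polynomial ℝ, p.natDegree ≤ N ∧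
        ∀ x, |x| ≤ 1 → ∀ k, |h x - p.eval x| ≤ C' * (ρ' / N) ^ k * m k := by
  obtain ⟨A, hA, hs⟩ := hm.shift_add 2
  set Z := ∑' n : ℤ, 1 / (n : ℝ) ^ 2
  have hZ : 0 ≤ Z := tsum_nonneg fun n => by positivity
  refine ⟨(Z + 1) * (C * (2 * ρ) ^ 2 * A), by positivity, 2 * ρ * A, by positivity,
    fun h hh hb N hN => ?_⟩
  obtain ⟨p, hp, hpe⟩ := exists_polynomial_cos_near (g := fun t => h (Real.cos t))
    (hh.comp Real.contDiff_cos) (fun t => by simp) (fun t => by simp)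
    (iteratedDeriv_comp_cos_le hm hh hC.le hρ hb) N hN
  refine ⟨p, hp, fun x hx k => ?_⟩
  have h1 := hpe (Real.arccos x) k
  rw [Real.cos_arccos (abs_le.1 hx).1 (abs_le.1 hx).2] at h1
  refine h1.trans ?_
  have hN0 : (0 : ℝ) < N := by exact_mod_cast hN
  have := (hm.pos k).le
  calc Z * (C * (2 * ρ) ^ (k + 2) * m (k + 2) / N ^ k)
      ≤ (Z + 1) * (C * (2 * ρ) ^ (k + 2) * (A ^ (k + 1) * m k) / N ^ k) := by
        have := hs k
        have := (hm.pos (k + 2)).le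
        gcongr
        linarith
    _ = _ := by rw [div_pow, mul_pow, mul_pow, mul_pow]; ring

/-- Interpolation nodes in `[-1, 1]` whose Lagrange basis is bounded by one there. -/
theorem exists_fekete (N : ℕ) :
    ∃ t : Fin (N + 1) → ℝ, (∀ a, |t a| ≤ 1) ∧ ∃ l : Fin (N + 1) → Polynomial ℝ,
      (∀ a, (l a).natDegree ≤ N) ∧ (∀ a x, |x| ≤ 1 → |(l a).eval x| ≤ 1) ∧
      ∀ p : Polynomial ℝ, p.natDegree ≤ N → ∀ x,
        p.eval x = ∑ a, (l a).eval x * p.eval (t a) := by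
  set K : Set (Fin (N + 1) → ℝ) := Set.univ.pi fun _ => Set.Icc (-1) 1 with hKdef
  have hK : IsCompact K := isCompact_univ_pi fun _ => isCompact_Icc
  have hcont : Continuous fun t : Fin (N + 1) → ℝ => |(vandermonde t).det| := by
    refine Continuous.abs (Continuous.matrix_det ?_)
    refine continuous_matrix fun i j => ?_
    simp only [vandermonde_apply]
    fun_prop
  have hmemK : ∀ t, t ∈ K ↔ ∀ a, |t a| ≤ 1 := fun t => by
    simp only [hKdef, Set.mem_univ_pi, Set.mem_Icc, abs_le]
  obtain ⟨t, htK, hmax⟩ := hK.exists_isMaxOn ⟨0, by rw [hmemK]; simp⟩ hcont.continuousOn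
  have hdet : (vandermonde t).det ≠ 0 := by
    let t0 : Fin (N + 1) → ℝ := fun a => (a : ℝ) / (N + 1)
    have ht0 : t0 ∈ K := by
      rw [hmemK]
      intro a
      have : (a : ℝ) ≤ N + 1 := by exact_mod_cast a.2.le
      rw [abs_of_nonneg (by positivity)]
      exact div_le_one_of_le₀ this (by positivity)
    have hd0 : (vandermonde t0).det ≠ 0 := by
      rw [det_vandermonde_ne_zero_iff]
      intro a b h
      have h1 : (N + 1 : ℝ) ≠ 0 := by positivity
      have h2 : (a : ℝ) = b := by
        have h3 : (a : ℝ) / (N + 1) = b / (N + 1) := h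
        rwa [div_left_inj' h1] at h3
      exact Fin.ext (by exact_mod_cast h2)
    have h1 : |(vandermonde t0).det| ≤ |(vandermonde t).det| := hmax ht0
    intro h0
    rw [h0, abs_zero] at h1
    exact hd0 (abs_nonpos_iff.1 h1)
  have hinj := det_vandermonde_ne_zero_iff.1 hdet
  set l : Fin (N + 1) → Polynomial ℝ := fun a => Lagrange.basis Finset.univ t a
  have hrep : ∀ p : Polynomial ℝ, p.natDegree ≤ N → ∀ x,
      p.eval x = ∑ a, (l a).eval x * p.eval (t a) := by
    intro p hp x
    have h1 : p.degree < (Finset.univ : Finset (Fin (N + 1))).card := by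
      rw [Finset.card_univ, Fintype.card_fin]
      exact Polynomial.degree_le_natDegree.trans_lt (by exact_mod_cast Nat.lt_succ_of_le hp)
    have h2 := congrArg (Polynomial.eval x) (Lagrange.eq_interpolate (hinj.injOn) h1)
    rw [Lagrange.interpolate_apply, Polynomial.eval_finsetSum] at h2
    rw [h2]
    exact Finset.sum_congr rfl fun a _ => by
      rw [Polynomial.eval_mul, Polynomial.eval_C, mul_comm]
  refine ⟨t, (hmemK t).1 htK, l, fun a => ?_, fun a x hx => ?_, hrep⟩
  · have h1 := Lagrange.natDegree_basis (v := t) (hinj.injOn (s := ↑(Finset.univ : Finset (Fin (N + 1)))))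
      (Finset.mem_univ a)
    rw [Finset.card_univ, Fintype.card_fin] at h1
    exact h1.le
  · have h1 : vandermonde (Function.update t a x) =
        (vandermonde t).updateRow a (∑ b, (l b).eval x • (vandermonde t) b) := by
      ext i j
      by_cases hi : i = a
      · subst hi
        rw [updateRow_self, Finset.sum_apply, vandermonde_apply, Function.update_self]
        have h2 := hrep (Polynomial.X ^ (j : ℕ))
          ((Polynomial.natDegree_X_pow_le _).trans (Nat.lt_succ_iff.1 j.2)) x
        simpa [vandermonde_apply] using h2
      · rw [updateRow_ne hi, vandermonde_apply, vandermonde_apply, Function.update_of_ne hi]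
    have h2 : (vandermonde (Function.update t a x)).det = (l a).eval x * (vandermonde t).det := by
      rw [h1, det_updateRow_sum, smul_eq_mul]
    have h3 : |(vandermonde (Function.update t a x)).det| ≤ |(vandermonde t).det| := by
      refine hmax ?_
      show Function.update t a x ∈ K
      rw [hmemK]
      intro b
      by_cases hb : b = a
      · subst hb; rwa [Function.update_self]
      · rw [Function.update_of_ne hb]; exact (hmemK t).1 htK b
    rw [h2, abs_mul] at h3
    exact le_of_mul_le_mul_right (by rwa [one_mul]) (abs_pos.2 hdet)

section

variable {E : Type*} [NormedAddCommGroup E] [NormedSpace ℝ E] [FiniteDimensional ℝ E]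
  {F : Type*} [NormedAddCommGroup F] [NormedSpace ℝ F] [FiniteDimensional ℝ F]
  {E' : Type*} [NormedAddCommGroup E'] [NormedSpace ℝ E'] [FiniteDimensional ℝ E']

theorem polyLE_eval_clm (L : E →L[ℝ] ℝ) {p : Polynomial ℝ} {n : ℕ} (hp : p.natDegree ≤ n) :
    (fun x => p.eval (L x)) ∈ polyLE E ℝ n := by
  have h1 : (fun x => p.eval (L x)) =
      ∑ i ∈ Finset.range (n + 1), fun x => p.coeff i * (L x) ^ i := by
    funext x
    rw [Finset.sum_apply, Polynomial.eval_eq_sum_range' (Nat.lt_succ_of_le hp)]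
  rw [h1]
  refine Submodule.sum_mem _ fun i hi => ?_
  refine homFun_le_polyLE (Nat.lt_succ_iff.1 (Finset.mem_range.1 hi)) ⟨?_, fun t x => ?_⟩
  · exact contDiff_const.mul (L.contDiff.pow i)
  · simp only [map_smul, smul_eq_mul, mul_pow]; ring

theorem polyLE_comp_clm {n : ℕ} {f : E → F} (hf : f ∈ polyLE E F n) (A : E' →L[ℝ] E) :
    (fun x => f (A x)) ∈ polyLE E' F n := by
  refine polyLE_induction (fun f => (fun x => f (A x)) ∈ polyLE E' F n) hf
    (fun k hk f hf => homFun_le_polyLE hk (homFun_comp_right hf A)) (Submodule.zero_mem _)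
    fun f g hf hg => Submodule.add_mem _ hf hg

end

/-- The derivatives of the restriction of a function to a coordinate line. -/
theorem iteratedDeriv_update_le {d : ℕ} {f : (Fin d → ℝ) → ℝ} (hf : ContDiff ℝ ∞ f)
    (x : Fin d → ℝ) (i : Fin d) (k : ℕ) (t : ℝ) :
    |iteratedDeriv k (fun t => f (Function.update x i t)) t| ≤
      ‖iteratedFDeriv ℝ k f (Function.update x i t)‖ := by
  set L : ℝ →L[ℝ] (Fin d → ℝ) := ContinuousLinearMap.toSpanSingleton ℝ (Pi.single i (1 : ℝ)) with hL
  have hupd : ∀ t, Function.update x i t = Function.update x i 0 + L t := by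
    intro t
    ext j
    by_cases hj : j = i
    · subst hj; simp [hL]
    · simp [hL, hj]
  have h1 : (fun t => f (Function.update x i t)) =
      (fun y => f (Function.update x i 0 + y)) ∘ L := by
    funext t
    simp only [Function.comp_apply]
    rw [hupd]
  have hL1 : ‖L‖ ≤ 1 := by
    rw [hL, ContinuousLinearMap.norm_toSpanSingleton, Pi.norm_single, norm_one]
  have h2 : ContDiff ℝ ∞ fun y => f (Function.update x i 0 + y) :=
    hf.comp (contDiff_const.add contDiff_id)
  rw [← Real.norm_eq_abs, ← norm_iteratedFDeriv_eq_norm_iteratedDeriv, h1,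
    L.iteratedFDeriv_comp_right h2 t (by exact_mod_cast le_top)]
  refine (ContinuousMultilinearMap.norm_compContinuousLinearMap_le _ _).trans ?_
  rw [iteratedFDeriv_comp_add_left, ← hupd, Finset.prod_const]
  exact mul_le_of_le_one_right (norm_nonneg _) (pow_le_one₀ (norm_nonneg _) hL1)

/-- Rapid polynomial approximation on a cube. -/
theorem exists_polyLE_near_cube {m : ℕ → ℝ} (hm : WtSeq m) (d : ℕ) {C ρ : ℝ} (hC : 0 < C)
    (hρ : 1 ≤ ρ) :
    ∃ C' > 0, ∃ ρ' > 0, ∀ f : (Fin d → ℝ) → ℝ, ContDiff ℝ ∞ f →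
      (∀ k x, ‖x‖ ≤ 1 → ‖iteratedFDeriv ℝ k f x‖ ≤ C * ρ ^ k * m k) → ∀ N : ℕ, 1 ≤ N →
      ∃ q ∈ polyLE (Fin d → ℝ) ℝ (d * N),
        ∀ x, ‖x‖ ≤ 1 → ∀ k, |f x - q x| ≤ C' * (ρ' / N) ^ k * m k := by
  obtain ⟨C₁, hC₁, ρ₁, hρ₁, h1⟩ := exists_polynomial_near hm hC hρ
  obtain ⟨C₂, hC₂, ρ₂, hρ₂, habs⟩ := hm.absorb hC₁ hρ₁ d
  refine ⟨(d + 1) * 3 ^ d * C₂, by positivity, ρ₂, hρ₂, fun f hf hb N hN => ?_⟩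
  obtain ⟨t, ht, l, hld, hl1, hrep⟩ := exists_fekete N
  set e : ℕ → ℝ := fun k => C₁ * (ρ₁ / N) ^ k * m k
  have he : ∀ k, 0 ≤ e k := fun k => by
    have := (hm.pos k).le
    positivity
  have hupd : ∀ (x : Fin d → ℝ) i s, ‖x‖ ≤ 1 → |s| ≤ 1 → ‖Function.update x i s‖ ≤ 1 := by
    intro x i s hx hs
    rw [pi_norm_le_iff_of_nonneg zero_le_one] at hx ⊢
    intro j
    by_cases hj : j = i
    · subst hj; rwa [Function.update_self]
    · rw [Function.update_of_ne hj]; exact hx j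
  have hline : ∀ (x : Fin d → ℝ) i, ‖x‖ ≤ 1 → ∀ k,
      |∑ a, (l a).eval (x i) * f (Function.update x i (t a)) - f x| ≤ (N + 2) * e k := by
    intro x i hx k
    obtain ⟨p, hp, hpe⟩ := h1 (fun s => f (Function.update x i s))
      (hf.comp (contDiff_update _ x i)) (fun k s hs =>
        (iteratedDeriv_update_le hf x i k s).trans (hb k _ (hupd x i s hx hs))) N hN
    have hxi : |x i| ≤ 1 := (norm_le_pi_norm x i).trans hx
    have h2 := hrep p hp (x i)
    have h3 : ∑ a, (l a).eval (x i) * f (Function.update x i (t a)) - f x =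
        ∑ a, (l a).eval (x i) * (f (Function.update x i (t a)) - p.eval (t a)) -
          (f (Function.update x i (x i)) - p.eval (x i)) := by
      simp only [mul_sub, Finset.sum_sub_distrib]
      rw [← h2, Function.update_eq_self]
      ring
    rw [h3]
    calc _ ≤ |∑ a, (l a).eval (x i) * (f (Function.update x i (t a)) - p.eval (t a))| +
          |f (Function.update x i (x i)) - p.eval (x i)| := abs_sub _ _
      _ ≤ ∑ a : Fin (N + 1), 1 * e k + e k := by
          refine add_le_add ((Finset.abs_sum_le_sum_abs _ _).trans (Finset.sum_le_sum fun a _ => ?_))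
            (hpe _ hxi k)
          rw [abs_mul]
          exact mul_le_mul (hl1 a _ hxi) (hpe _ (ht a) k) (abs_nonneg _) zero_le_one
      _ = _ := by simp; ring
  have key : ∀ s : Finset (Fin d), ∃ G : (Fin d → ℝ) → ℝ,
      (∀ x, (fun y => G (s.piecewise y x)) ∈ polyLE (Fin d → ℝ) ℝ (s.card * N)) ∧
      ∀ x, ‖x‖ ≤ 1 → ∀ k, |G x - f x| ≤ s.card * (N + 2) ^ s.card * e k := by
    intro s
    induction s using Finset.induction_on with
    | empty => exact ⟨f, fun x => by simpa using polyLE_const (f x) _, fun x _ k => by simp⟩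
    | insert i s hi ih =>
      obtain ⟨G, hG, hGe⟩ := ih
      refine ⟨fun x => ∑ a, (l a).eval (x i) * G (Function.update x i (t a)), fun x => ?_,
        fun x hx k => ?_⟩
      · have h2 : (fun y => ∑ a, (l a).eval ((insert i s).piecewise y x i) *
            G (Function.update ((insert i s).piecewise y x) i (t a))) =
            ∑ a, fun y => (l a).eval (ContinuousLinearMap.proj (R := ℝ) i y) *
              G (s.piecewise y (Function.update x i (t a))) := by
          funext y
          rw [Finset.sum_apply]
          refine Finset.sum_congr rfl fun a _ => ?_
          congr 2
          · simp
          · ext j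
            by_cases hj : j = i
            · subst hj; simp [hi]
            · by_cases hjs : j ∈ s <;> simp [hj, hjs, Finset.piecewise, Function.update_of_ne]
        rw [h2, Finset.card_insert_of_notMem hi, add_mul, one_mul, add_comm]
        exact Submodule.sum_mem _ fun a _ => polyLE_mul_mem (polyLE_eval_clm _ (hld a)) (hG _)
      · rw [Finset.card_insert_of_notMem hi]
        have hxi : |x i| ≤ 1 := (norm_le_pi_norm x i).trans hx
        set c := s.card
        have h2 : ∑ a, (l a).eval (x i) * G (Function.update x i (t a)) - f x =
            ∑ a, (l a).eval (x i) * (G (Function.update x i (t a)) - f (Function.update x i (t a)))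
            + (∑ a, (l a).eval (x i) * f (Function.update x i (t a)) - f x) := by
          simp only [mul_sub, Finset.sum_sub_distrib]; ring
        have h4 : (1 : ℝ) ≤ (N + 2) ^ c := one_le_pow₀ (by linarith [Nat.cast_nonneg (α := ℝ) N])
        have h5 := he k
        rw [h2]
        calc _ ≤ _ := abs_add_le _ _
          _ ≤ ∑ a : Fin (N + 1), 1 * (c * (N + 2) ^ c * e k) + (N + 2) * e k := by
              refine add_le_add ((Finset.abs_sum_le_sum_abs _ _).trans
                (Finset.sum_le_sum fun a _ => ?_)) (hline x i hx k)
              rw [abs_mul]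
              exact mul_le_mul (hl1 a _ hxi) (hGe _ (hupd x i _ hx (ht a)) k) (abs_nonneg _)
                zero_le_one
          _ = (N + 1) * (c * (N + 2) ^ c * e k) + (N + 2) * 1 * e k := by
              rw [Finset.sum_const, Finset.card_univ, Fintype.card_fin, nsmul_eq_mul]
              push_cast
              ring
          _ ≤ (N + 2) * (c * (N + 2) ^ c * e k) + (N + 2) * (N + 2) ^ c * e k := by
              have h6 : 0 ≤ (c : ℝ) * (N + 2) ^ c * e k :=
                mul_nonneg (mul_nonneg c.cast_nonneg (zero_le_one.trans h4)) h5
              have h7 : (0 : ℝ) ≤ N + 2 := by linarith [Nat.cast_nonneg (α := ℝ) N]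
              exact add_le_add (mul_le_mul_of_nonneg_right (by linarith) h6)
                (mul_le_mul_of_nonneg_right (mul_le_mul_of_nonneg_left h4 h7) h5)
          _ = _ := by push_cast; ring
  obtain ⟨G, hG, hGe⟩ := key Finset.univ
  refine ⟨G, by simpa using hG 0, fun x hx k => ?_⟩
  rw [abs_sub_comm]
  refine (hGe x hx (k + d)).trans ?_
  rw [Finset.card_univ, Fintype.card_fin]
  have hN1 : (1 : ℝ) ≤ N := by exact_mod_cast hN
  have h2 : (N + 2 : ℝ) ≤ 3 * N := by linarith
  have h3 := habs N (by linarith) k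
  have h4 := he (k + d)
  calc (d : ℝ) * (N + 2) ^ d * e (k + d) ≤ (d + 1) * (3 * N) ^ d * e (k + d) := by
        gcongr
        linarith
    _ = (d + 1) * 3 ^ d * (N ^ d * e (k + d)) := by rw [mul_pow]; ring
    _ ≤ (d + 1) * 3 ^ d * (C₂ * (ρ₂ / N) ^ k * m k) := by gcongr
    _ = _ := by ring

section

variable {E : Type*} [NormedAddCommGroup E] [NormedSpace ℝ E] [FiniteDimensional ℝ E]
  {F : Type*} [NormedAddCommGroup F] [NormedSpace ℝ F] [FiniteDimensional ℝ F]

/-- `f` is approximated on the ball of radius `r`, at the rate prescribed by the weight sequence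
`m`, by polynomial maps of linearly growing degree. -/
def FastApprox (m : ℕ → ℝ) (r : ℝ) (f : E → F) : Prop :=
  ∃ c : ℕ, ∃ C > 0, ∃ ρ > 0, ∀ N : ℕ, 1 ≤ N → ∃ q ∈ polyLE E F (c * N),
    ∀ x, ‖x‖ ≤ r → ∀ k, ‖f x - q x‖ ≤ C * (ρ / N) ^ k * m k

theorem fastApprox_of_bounds {m : ℕ → ℝ} (hm : WtSeq m) {f : E → F} (hf : ContDiff ℝ ∞ f)
    (hb : ∀ R : ℝ, ∃ C > 0, ∃ ρ > 0, ∀ k x, ‖x‖ ≤ R → ‖iteratedFDeriv ℝ k f x‖ ≤ C * ρ ^ k * m k)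
    (r : ℝ) : FastApprox m r f := by
  set d := Module.finrank ℝ E
  let e : E ≃L[ℝ] (Fin d → ℝ) :=
    (Module.finBasis ℝ E).equivFun.toContinuousLinearEquiv
  let b := Module.finBasis ℝ F
  set R : ℝ := ‖(e : E →L[ℝ] (Fin d → ℝ))‖ * |r| + 1
  have hR : 0 < R := by positivity
  set A : (Fin d → ℝ) →L[ℝ] E := R • (e.symm : (Fin d → ℝ) →L[ℝ] E)
  set B : E →L[ℝ] (Fin d → ℝ) := R⁻¹ • (e : E →L[ℝ] (Fin d → ℝ))
  have hAB : ∀ x, A (B x) = x := fun x => by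
    simp [A, B, smul_smul, hR.ne']
  have hB1 : ∀ x, ‖x‖ ≤ r → ‖B x‖ ≤ 1 := fun x hx => by
    have h1 : ‖(e : E →L[ℝ] (Fin d → ℝ)) x‖ ≤ R := by
      refine ((e : E →L[ℝ] (Fin d → ℝ)).le_opNorm x).trans ?_
      have : ‖x‖ ≤ |r| := hx.trans (le_abs_self r)
      have h2 := norm_nonneg (e : E →L[ℝ] (Fin d → ℝ))
      nlinarith
    show ‖R⁻¹ • (e : E →L[ℝ] (Fin d → ℝ)) x‖ ≤ 1
    rw [norm_smul, norm_inv, Real.norm_of_nonneg hR.le]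
    exact (inv_mul_le_one₀ hR).2 h1
  obtain ⟨C, hC, ρ, hρ, hfb⟩ := hb ‖A‖
  let coord : Fin (Module.finrank ℝ F) → F →L[ℝ] ℝ := fun j =>
    LinearMap.toContinuousLinearMap (b.coord j)
  set L : ℝ := ∑ j, ‖coord j‖ + 1
  have hL : ∀ j, ‖coord j‖ ≤ L := fun j => by
    have := Finset.single_le_sum (f := fun j => ‖coord j‖) (fun i _ => norm_nonneg _)
      (Finset.mem_univ j)
    linarith
  have hL0 : 0 < L := by
    have : 0 ≤ ∑ j, ‖coord j‖ := Finset.sum_nonneg fun j _ => norm_nonneg _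
    linarith
  set ρ₁ := max (ρ * ‖A‖) 1
  obtain ⟨C', hC', ρ', hρ', happ⟩ := exists_polyLE_near_cube hm d (C := L * C) (ρ := ρ₁)
    (by positivity) (le_max_right _ _)
  set D : ℝ := ∑ j, ‖b j‖ + 1
  have hD : 0 < D := by
    have : 0 ≤ ∑ j, ‖b j‖ := Finset.sum_nonneg fun j _ => norm_nonneg _
    linarith
  refine ⟨d, C' * D, by positivity, ρ', hρ', fun N hN => ?_⟩
  have hcomp : ∀ j, ∃ q ∈ polyLE (Fin d → ℝ) ℝ (d * N),
      ∀ y, ‖y‖ ≤ 1 → ∀ k, |coord j (f (A y)) - q y| ≤ C' * (ρ' / N) ^ k * m k := by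
    intro j
    have h1 : ContDiff ℝ ∞ fun y => coord j (f y) := (coord j).contDiff.comp hf
    refine happ (fun y => coord j (f (A y))) (h1.comp A.contDiff) (fun k y hy => ?_) N hN
    have h2 : (fun y => coord j (f (A y))) = (fun y => coord j (f y)) ∘ A := rfl
    have hy' : ‖A y‖ ≤ ‖A‖ := (A.le_opNorm y).trans (mul_le_of_le_one_right (norm_nonneg _) hy)
    have h3 : ‖iteratedFDeriv ℝ k (fun y => coord j (f y)) (A y)‖ ≤
        ‖coord j‖ * ‖iteratedFDeriv ℝ k f (A y)‖ :=
      (coord j).norm_iteratedFDeriv_comp_left (hf.contDiffAt (x := A y))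
        (by exact_mod_cast le_top)
    rw [h2, A.iteratedFDeriv_comp_right h1 y (by exact_mod_cast le_top)]
    refine (ContinuousMultilinearMap.norm_compContinuousLinearMap_le _ _).trans ?_
    rw [Finset.prod_const, Finset.card_univ, Fintype.card_fin]
    have h4 := (hm.pos k).le
    calc _ ≤ (L * (C * ρ ^ k * m k)) * ‖A‖ ^ k := by
          gcongr
          refine h3.trans ?_
          gcongr
          · exact hL j
          · exact hfb k _ hy'
      _ = L * C * (ρ * ‖A‖) ^ k * m k := by rw [mul_pow]; ring
      _ ≤ _ := by
          gcongr
          exact le_max_left _ _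
  choose q hq hqe using hcomp
  refine ⟨∑ j, fun x => q j (B x) • b j, Submodule.sum_mem _ fun j _ => ?_, fun x hx k => ?_⟩
  · have := polyLE_smul_mem (polyLE_comp_clm (hq j) B) (polyLE_const (E := E) (b j) 0)
    simpa using this
  · have h1 : f x - (∑ j, fun x => q j (B x) • b j) x =
        ∑ j, (coord j (f x) - q j (B x)) • b j := by
      rw [Finset.sum_apply]
      simp only [sub_smul, Finset.sum_sub_distrib]
      congr 1
      exact (b.sum_repr (f x)).symm
    rw [h1]
    have h0 := (hm.pos k).le
    calc _ ≤ ∑ j, ‖(coord j (f x) - q j (B x)) • b j‖ := norm_sum_le _ _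
      _ ≤ ∑ j, C' * (ρ' / N) ^ k * m k * ‖b j‖ := by
          refine Finset.sum_le_sum fun j _ => ?_
          rw [norm_smul, Real.norm_eq_abs]
          gcongr
          have := hqe j (B x) (hB1 x hx) k
          rwa [hAB] at this
      _ = C' * (ρ' / N) ^ k * m k * ∑ j, ‖b j‖ := by rw [Finset.mul_sum]
      _ ≤ C' * (ρ' / N) ^ k * m k * D := by gcongr; simp [D]
      _ = _ := by ring

end

section Bernstein

open Polynomial

theorem abs_iterate_derivative_chebyshev_zero_le (n k : ℕ) :
    |(derivative^[k] (Chebyshev.T ℝ n)).eval 0| ≤ (n : ℝ) ^ k := by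
  induction k using Nat.twoStepInduction with
  | zero =>
    have h := Chebyshev.T_real_cos (Real.pi / 2) n
    rw [Real.cos_pi_div_two] at h
    simp only [Function.iterate_zero, id, pow_zero, h]
    exact Real.abs_cos_le_one _
  | one =>
    have h := Chebyshev.U_real_cos (Real.pi / 2) (n - 1)
    rw [Real.cos_pi_div_two, Real.sin_pi_div_two, mul_one] at h
    rw [Function.iterate_one, Chebyshev.T_derivative_eq_U, eval_mul, h, abs_mul, pow_one]
    have h2 : ((n : ℤ) : ℝ[X]).eval 0 = (n : ℝ) := by simp
    rw [h2, Nat.abs_cast]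
    exact mul_le_of_le_one_right n.cast_nonneg (Real.abs_sin_le_one _)
  | more k ih _ =>
    rcases lt_or_ge n k with h | h
    · rw [iterate_derivative_eq_zero (by rw [Chebyshev.natDegree_T]; simp; omega)]
      simp
    · rw [Chebyshev.iterate_derivative_T_eval_zero_recurrence, abs_mul, abs_neg, pow_add, mul_comm]
      have h1 : (k : ℝ) ≤ n := by exact_mod_cast h
      have h2 : |((n : ℤ) : ℝ) ^ 2 - (k : ℝ) ^ 2| ≤ (n : ℝ) ^ 2 := by
        have h3 : (k : ℝ) ^ 2 ≤ (n : ℝ) ^ 2 := by gcongr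
        rw [Int.cast_natCast, abs_of_nonneg (by linarith)]
        linarith [sq_nonneg (k : ℝ)]
      exact mul_le_mul ih h2 (abs_nonneg _) (by positivity)

theorem exists_chebyshev_expansion (n : ℕ) (p : ℝ[X]) (hp : p.natDegree ≤ n) :
    ∃ a : ℕ → ℝ, p = ∑ j ∈ Finset.range (n + 1), C (a j) * Chebyshev.T ℝ j := by
  induction n generalizing p with
  | zero =>
    refine ⟨fun _ => p.coeff 0, ?_⟩
    simpa using eq_C_of_natDegree_le_zero hp
  | succ n ih =>
    have hlc : (Chebyshev.T ℝ ((n + 1 : ℕ) : ℤ)).coeff (n + 1) ≠ 0 := by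
      have h1 := Chebyshev.natDegree_T (R := ℝ) ((n + 1 : ℕ) : ℤ)
      rw [Int.natAbs_natCast] at h1
      have h2 : Chebyshev.T ℝ ((n + 1 : ℕ) : ℤ) ≠ 0 := fun h0 => by
        rw [h0, natDegree_zero] at h1
        omega
      have h3 := leadingCoeff_ne_zero.2 h2
      rwa [leadingCoeff, h1] at h3
    set c := p.coeff (n + 1) / (Chebyshev.T ℝ ((n + 1 : ℕ) : ℤ)).coeff (n + 1)
    obtain ⟨a, ha⟩ := ih (p - C c * Chebyshev.T ℝ ((n + 1 : ℕ) : ℤ)) (by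
      rw [natDegree_le_iff_coeff_eq_zero]
      intro i hi
      rw [coeff_sub, coeff_C_mul]
      rcases eq_or_lt_of_le (Nat.succ_le_of_lt hi) with h | h
      · rw [← h]
        simp only [c, Nat.succ_eq_add_one]
        rw [div_mul_cancel₀ _ hlc, sub_self]
      · rw [coeff_eq_zero_of_natDegree_lt (hp.trans_lt h), coeff_eq_zero_of_natDegree_lt
          (by rw [Chebyshev.natDegree_T, Int.natAbs_natCast]; exact h)]
        simp)
    refine ⟨fun j => if j = n + 1 then c else a j, ?_⟩
    rw [Finset.sum_range_succ]
    dsimp only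
    rw [if_pos rfl]
    have h2 : ∑ j ∈ Finset.range (n + 1), C (if j = n + 1 then c else a j) * Chebyshev.T ℝ j =
        ∑ j ∈ Finset.range (n + 1), C (a j) * Chebyshev.T ℝ j :=
      Finset.sum_congr rfl fun j hj => by
        rw [if_neg (by rw [Finset.mem_range] at hj; omega)]
    rw [h2, ← ha, sub_add_cancel]

/-- A Bernstein-type inequality at the centre of `[-1, 1]`. -/
theorem abs_iterate_derivative_zero_le {n : ℕ} {p : ℝ[X]} (hp : p.natDegree ≤ n) {ε : ℝ}
    (hb : ∀ x, |x| ≤ 1 → |p.eval x| ≤ ε) (k : ℕ) :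
    |(derivative^[k] p).eval 0| ≤ 2 * (n + 1) * (n : ℝ) ^ k * ε := by
  have hε : 0 ≤ ε := (abs_nonneg _).trans (hb 0 (by simp))
  obtain ⟨a, ha⟩ := exists_chebyshev_expansion n p hp
  have hint : ∀ q : ℝ[X], MeasureTheory.Integrable (fun x => q.eval x) Chebyshev.measureT :=
    fun q => Chebyshev.integrable_measureT q.continuous.continuousOn
  have hcoef : ∀ j ∈ Finset.range (n + 1), |a j| ≤ 2 * ε := by
    intro j hj
    have h1 : ∫ x, p.eval x * (Chebyshev.T ℝ j).eval x ∂Chebyshev.measureT =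
        a j * ∫ x, (Chebyshev.T ℝ j).eval x * (Chebyshev.T ℝ j).eval x ∂Chebyshev.measureT := by
      have h2 : ∀ x, p.eval x * (Chebyshev.T ℝ j).eval x = ∑ i ∈ Finset.range (n + 1),
          a i * (Chebyshev.T ℝ i * Chebyshev.T ℝ j).eval x := fun x => by
        rw [ha, eval_finsetSum, Finset.sum_mul]
        exact Finset.sum_congr rfl fun i _ => by simp only [eval_mul, eval_C]; ring
      simp only [h2]
      rw [MeasureTheory.integral_finsetSum _ fun i _ => (hint _).const_mul _,
        Finset.sum_eq_single j]
      · rw [MeasureTheory.integral_const_mul]; simp only [eval_mul]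
      · intro i _ hij
        rw [MeasureTheory.integral_const_mul]
        simp only [eval_mul]
        rw [Chebyshev.integral_eval_T_real_mul_eval_T_real_measureT_of_ne hij, mul_zero]
      · exact fun h => absurd hj h
    have h3 : |∫ x, p.eval x * (Chebyshev.T ℝ j).eval x ∂Chebyshev.measureT| ≤ ε * Real.pi := by
      rw [Chebyshev.integral_measureT_eq_integral_cos (f := fun x =>
        p.eval x * (Chebyshev.T ℝ j).eval x), ← Real.norm_eq_abs]
      refine (intervalIntegral.norm_integral_le_of_norm_le_const (C := ε) fun θ _ => ?_).trans ?_
      · rw [norm_mul, Chebyshev.T_real_cos]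
        exact (mul_le_mul (hb _ (Real.abs_cos_le_one θ)) (Real.abs_cos_le_one _) (abs_nonneg _)
          hε).trans (mul_one ε).le
      · rw [sub_zero, abs_of_pos Real.pi_pos]
    have h4 : Real.pi / 2 ≤
        ∫ x, (Chebyshev.T ℝ j).eval x * (Chebyshev.T ℝ j).eval x ∂Chebyshev.measureT := by
      rcases Nat.eq_zero_or_pos j with rfl | h
      · have := Chebyshev.integral_eval_T_real_mul_self_measureT_zero
        push_cast
        rw [this]
        linarith [Real.pi_pos]
      · rw [Chebyshev.integral_T_real_mul_self_measureT_of_ne_zero h.ne']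
    have hpi := Real.pi_pos
    rw [h1, abs_mul, abs_of_pos ((half_pos hpi).trans_le h4)] at h3
    have h5 : |a j| * (Real.pi / 2) ≤ ε * Real.pi :=
      (mul_le_mul_of_nonneg_left h4 (abs_nonneg _)).trans h3
    by_contra! hlt
    have := mul_lt_mul_of_pos_right hlt (half_pos hpi)
    linarith
  have h6 : (derivative^[k] p).eval 0 = ∑ j ∈ Finset.range (n + 1),
      a j * (derivative^[k] (Chebyshev.T ℝ j)).eval 0 := by
    conv_lhs => rw [ha]
    rw [iterate_derivative_sum, eval_finsetSum]
    exact Finset.sum_congr rfl fun j _ => by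
      rw [iterate_derivative_C_mul, eval_mul, eval_C]
  rw [h6]
  calc _ ≤ ∑ j ∈ Finset.range (n + 1), |a j * (derivative^[k] (Chebyshev.T ℝ j)).eval 0| :=
        Finset.abs_sum_le_sum_abs _ _
    _ ≤ ∑ j ∈ Finset.range (n + 1), 2 * ε * (n : ℝ) ^ k := by
        refine Finset.sum_le_sum fun j hj => ?_
        rw [abs_mul]
        refine mul_le_mul (hcoef j hj) ((abs_iterate_derivative_chebyshev_zero_le j k).trans ?_)
          (abs_nonneg _) (by positivity)
        have : (j : ℝ) ≤ n := by
          rw [Finset.mem_range] at hj; exact_mod_cast Nat.lt_succ_iff.1 hj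
        gcongr
    _ = _ := by
        rw [Finset.sum_const, Finset.card_range, nsmul_eq_mul]; push_cast; ring

end Bernstein

section Polarization

variable {E : Type*} [NormedAddCommGroup E] [NormedSpace ℝ E]
  {F : Type*} [NormedAddCommGroup F] [NormedSpace ℝ F]

theorem sum_sign_prod {k : ℕ} (r : Fin k → Fin k) :
    ∑ s : Fin k → ℤˣ, (∏ i, ((s i : ℤ) : ℝ)) * ∏ i, ((s (r i) : ℤ) : ℝ) =
      if Function.Bijective r then 2 ^ k else 0 := by
  have hsq : ∀ u : ℤˣ, ((u : ℤ) : ℝ) * ((u : ℤ) : ℝ) = 1 := fun u => by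
    rcases Int.units_eq_one_or u with rfl | rfl <;> simp
  split_ifs with hr
  · have h1 : ∀ s : Fin k → ℤˣ,
        (∏ i, ((s i : ℤ) : ℝ)) * ∏ i, ((s (r i) : ℤ) : ℝ) = 1 := fun s => by
      have h2 : ∏ i, ((s (r i) : ℤ) : ℝ) = ∏ i, ((s i : ℤ) : ℝ) :=
        (Equiv.ofBijective r hr).prod_comp fun i => ((s i : ℤ) : ℝ)
      rw [h2, ← Finset.prod_mul_distrib]
      exact Finset.prod_eq_one fun i _ => hsq _
    simp only [h1]
    simp
  · have hs : ¬ Function.Surjective r := fun h => hr (Finite.surjective_iff_bijective.1 h)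
    obtain ⟨j, hj⟩ := not_forall.1 hs
    push Not at hj
    refine Finset.sum_involution (fun s _ => Function.update s j (-s j)) (fun s _ => ?_)
      (fun s _ _ h => ?_) (fun s _ => Finset.mem_univ _) (fun s _ => ?_)
    · have h1 : ∏ i, ((Function.update s j (-s j) (r i) : ℤ) : ℝ) = ∏ i, ((s (r i) : ℤ) : ℝ) :=
        Finset.prod_congr rfl fun i _ => by rw [Function.update_of_ne (hj i)]
      have h2 : ∏ i, ((Function.update s j (-s j) i : ℤ) : ℝ) = - ∏ i, ((s i : ℤ) : ℝ) := by
        rw [← Finset.mul_prod_erase _ _ (Finset.mem_univ j),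
          ← Finset.mul_prod_erase _ (fun i => ((s i : ℤ) : ℝ)) (Finset.mem_univ j)]
        have h3 : ∏ i ∈ Finset.univ.erase j, ((Function.update s j (-s j) i : ℤ) : ℝ) =
            ∏ i ∈ Finset.univ.erase j, ((s i : ℤ) : ℝ) :=
          Finset.prod_congr rfl fun i hi => by
            rw [Function.update_of_ne (Finset.ne_of_mem_erase hi)]
        rw [h3, Function.update_self]
        push_cast
        ring
      rw [h1, h2]
      ring
    · have h1 := congrFun h j
      rw [Function.update_self] at h1
      rcases Int.units_eq_one_or (s j) with h2 | h2 <;> rw [h2] at h1 <;> revert h1 <;> decide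
    · ext i
      by_cases hi : i = j
      · subst hi; simp
      · simp [Function.update_of_ne hi]

/-- The norm of a symmetric multilinear map is controlled by its diagonal. -/
theorem ContinuousMultilinearMap.opNorm_le_of_diag {k : ℕ}
    (A : ContinuousMultilinearMap ℝ (fun _ : Fin k => E) F)
    (hsym : ∀ (σ : Equiv.Perm (Fin k)) v, A (v ∘ σ) = A v) {B : ℝ} (hB0 : 0 ≤ B)
    (hB : ∀ v, ‖A fun _ => v‖ ≤ B * ‖v‖ ^ k) : ‖A‖ ≤ B * Real.exp k := by
  have hpol : ∀ v : Fin k → E, ∑ s : Fin k → ℤˣ, (∏ i, ((s i : ℤ) : ℝ)) •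
      A (fun _ => ∑ j, ((s j : ℤ) : ℝ) • v j) = ((2 : ℝ) ^ k * k !) • A v := by
    intro v
    have h1 : ∀ s : Fin k → ℤˣ, A (fun _ => ∑ j, ((s j : ℤ) : ℝ) • v j) =
        ∑ r : Fin k → Fin k, (∏ i, ((s (r i) : ℤ) : ℝ)) • A (v ∘ r) := by
      intro s
      have h2 := A.toMultilinearMap.map_sum (fun (_ : Fin k) (j : Fin k) => ((s j : ℤ) : ℝ) • v j)
      refine h2.trans (Finset.sum_congr rfl fun r _ => ?_)
      exact A.toMultilinearMap.map_smul_univ (fun i => ((s (r i) : ℤ) : ℝ)) (fun i => v (r i))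
    simp only [h1, Finset.smul_sum, smul_smul]
    rw [Finset.sum_comm]
    simp only [← Finset.sum_smul, sum_sign_prod, ite_smul, zero_smul]
    rw [← Finset.sum_filter]
    have h3 : ∀ r ∈ Finset.univ.filter (fun r : Fin k → Fin k => Function.Bijective r),
        (2 : ℝ) ^ k • A (v ∘ r) = (2 : ℝ) ^ k • A v := fun r hr => by
      rw [Finset.mem_filter] at hr
      rw [← hsym (Equiv.ofBijective r hr.2) v]
      rfl
    rw [Finset.sum_congr rfl h3, Finset.sum_const, ← Nat.cast_smul_eq_nsmul ℝ, smul_smul]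
    congr 1
    have h4 : (Finset.univ.filter fun r : Fin k → Fin k => Function.Bijective r).card = k ! := by
      rw [← Fintype.card_subtype, ← Fintype.card_congr (Equiv.bijectiveEquiv (α := Fin k) (β := Fin k)).symm,
        Fintype.card_perm, Fintype.card_fin]
    rw [h4, mul_comm]
  have hunit : ∀ v : Fin k → E, (∀ i, ‖v i‖ ≤ 1) → ‖A v‖ ≤ B * Real.exp k := by
    intro v hv
    have h1 := congrArg norm (hpol v)
    rw [norm_smul, Real.norm_of_nonneg (by positivity)] at h1
    have h2 : (2 : ℝ) ^ k * k ! * ‖A v‖ ≤ 2 ^ k * (B * (k : ℝ) ^ k) := by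
      rw [← h1]
      refine (norm_sum_le _ _).trans ?_
      have h3 : ∀ s : Fin k → ℤˣ, ‖(∏ i, ((s i : ℤ) : ℝ)) •
          A (fun _ => ∑ j, ((s j : ℤ) : ℝ) • v j)‖ ≤ B * (k : ℝ) ^ k := by
        intro s
        have hu : ∀ u : ℤˣ, ‖((u : ℤ) : ℝ)‖ = 1 := fun u => by
          rcases Int.units_eq_one_or u with rfl | rfl <;> simp
        rw [norm_smul, norm_prod, Finset.prod_congr rfl fun i _ => hu (s i), Finset.prod_const_one,
          one_mul]
        refine (hB _).trans ?_
        gcongr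
        refine (norm_sum_le _ _).trans ?_
        calc _ ≤ ∑ _j : Fin k, (1 : ℝ) := Finset.sum_le_sum fun j _ => by
              rw [norm_smul, hu, one_mul]; exact hv j
          _ = k := by simp
      calc _ ≤ ∑ _s : Fin k → ℤˣ, B * (k : ℝ) ^ k := Finset.sum_le_sum fun s _ => h3 s
        _ = _ := by simp
    have h4 : (k : ℝ) ^ k ≤ k ! * Real.exp k := by
      have := Real.pow_div_factorial_le_exp (k : ℝ) k.cast_nonneg k
      rwa [div_le_iff₀ (by positivity), mul_comm] at this
    have h5 : ((2 : ℝ) ^ k * k !) * ‖A v‖ ≤ (2 ^ k * k !) * (B * Real.exp k) := by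
      refine h2.trans ?_
      calc 2 ^ k * (B * (k : ℝ) ^ k) ≤ 2 ^ k * (B * (k ! * Real.exp k)) := by gcongr
        _ = _ := by ring
    exact le_of_mul_le_mul_left h5 (by positivity)
  refine A.opNorm_le_bound (by positivity) fun v => ?_
  have h1 : v = fun i => ‖v i‖ • (‖v i‖⁻¹ • v i) := by
    funext i
    by_cases h : v i = 0
    · simp [h]
    · rw [smul_smul, mul_inv_cancel₀ (norm_ne_zero_iff.2 h), one_smul]
  have h2 : A v = (∏ i, ‖v i‖) • A fun i => ‖v i‖⁻¹ • v i := by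
    conv_lhs => rw [h1]
    exact A.toMultilinearMap.map_smul_univ _ _
  rw [h2, norm_smul, norm_prod, mul_comm]
  simp only [norm_norm]
  gcongr
  refine hunit _ fun i => ?_
  rw [norm_smul, norm_inv, norm_norm]
  exact inv_mul_le_one

end Polarization

section PolynomialDerivatives

variable {E : Type*} [NormedAddCommGroup E] [NormedSpace ℝ E] [FiniteDimensional ℝ E]
  {F : Type*} [NormedAddCommGroup F] [NormedSpace ℝ F]

theorem homFun_fderiv_self {k : ℕ} {f : E → F} (hf : f ∈ homFun E F k) (x : E) :
    fderiv ℝ f x x = (k : ℝ) • f x := by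
  have h1 : HasDerivAt (fun t : ℝ => f (t • x)) (fderiv ℝ f x x) 1 := by
    have h := ((hasDerivAt_id (1 : ℝ)).smul_const x)
    have h2 : HasFDerivAt f (fderiv ℝ f x) (id (1 : ℝ) • x) := by
      rw [id, one_smul]; exact (homFun_differentiable hf x).hasFDerivAt
    have h3 := h2.comp_hasDerivAt 1 h
    rw [one_smul] at h3
    exact h3
  have h2 : HasDerivAt (fun t : ℝ => t ^ k • f x) ((k : ℝ) • f x) 1 := by
    have h := (hasDerivAt_pow k (1 : ℝ)).smul_const (f x)
    rwa [one_pow, mul_one] at h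
  simp only [homFun_smul hf] at h1
  exact h1.unique h2

theorem homFun_contDiff_omega {k : ℕ} {f : E → F} (hf : f ∈ homFun E F k) : ContDiff ℝ ω f := by
  induction k generalizing f with
  | zero =>
    have h : f = fun _ => f 0 := funext fun x => homFun_zero_const hf x
    rw [h]; exact contDiff_const
  | succ k ih =>
    let b := Module.finBasis ℝ E
    have h : f = fun x => ((k + 1 : ℕ) : ℝ)⁻¹ • ∑ i, LinearMap.toContinuousLinearMap (b.coord i) x •
        dirD (b i) f x := by
      funext x
      rw [eq_inv_smul_iff₀ (by positivity), ← homFun_fderiv_self hf]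
      conv_lhs => rw [← b.sum_repr x, map_sum, b.sum_repr x]
      exact Finset.sum_congr rfl fun i _ => by rw [map_smul]; rfl
    rw [h]
    exact contDiff_const.smul (ContDiff.sum fun i _ =>
      (ContinuousLinearMap.contDiff _).smul (ih (homFun_dirD hf (b i))))

variable [FiniteDimensional ℝ F]

theorem polyLE_contDiff_omega {n : ℕ} {f : E → F} (hf : f ∈ polyLE E F n) : ContDiff ℝ ω f :=
  polyLE_induction (ContDiff ℝ ω ·) hf (fun _ _ _ h => homFun_contDiff_omega h) contDiff_const
    fun _ _ h h' => h.add h'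

theorem exists_line_coeff {n : ℕ} {q : E → F} (hq : q ∈ polyLE E F n) (x u : E) :
    ∃ c : ℕ → F, ∀ t : ℝ, q (x + t • u) = ∑ j ∈ Finset.range (n + 1), t ^ j • c j := by
  refine polyLE_induction (fun q => ∃ c : ℕ → F, ∀ t : ℝ, q (x + t • u) =
    ∑ j ∈ Finset.range (n + 1), t ^ j • c j) hq (fun k hk f hf => ?_) ⟨0, by simp⟩ ?_
  · refine ⟨fun j => if j < k + 1 then (j ! : ℝ)⁻¹ • ((dirD u)^[j] f) x else 0, fun t => ?_⟩
    rw [homFun_taylor hf]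
    have hs : Finset.range (k + 1) ⊆ Finset.range (n + 1) :=
      Finset.range_mono (by omega)
    refine (Finset.sum_congr rfl fun j hj => ?_).trans
      (Finset.sum_subset hs fun j _ hj => ?_)
    · dsimp only
      rw [if_pos (Finset.mem_range.1 hj), smul_smul, div_eq_mul_inv]
    · rw [Finset.mem_range] at hj
      dsimp only
      rw [if_neg hj, smul_zero]
  · rintro f g ⟨c, hc⟩ ⟨c', hc'⟩
    refine ⟨c + c', fun t => ?_⟩
    simp only [Pi.add_apply, smul_add, Finset.sum_add_distrib, ← hc, ← hc']

theorem iteratedDeriv_line {f : E → F} (hf : ContDiff ℝ ∞ f) (x u : E) (k : ℕ) :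
    iteratedDeriv k (fun t : ℝ => f (x + t • u)) 0 = iteratedFDeriv ℝ k f x fun _ => u := by
  set L : ℝ →L[ℝ] E := ContinuousLinearMap.toSpanSingleton ℝ u
  have h1 : (fun t : ℝ => f (x + t • u)) = (fun y => f (x + y)) ∘ L := rfl
  have h2 : ContDiff ℝ ∞ fun y => f (x + y) := hf.comp (contDiff_const.add contDiff_id)
  rw [iteratedDeriv_eq_iteratedFDeriv, h1, L.iteratedFDeriv_comp_right h2 0
    (by exact_mod_cast le_top), ContinuousMultilinearMap.compContinuousLinearMap_apply,
    iteratedFDeriv_comp_add_left, map_zero, add_zero]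
  simp [L]

open Polynomial in
theorem iteratedDeriv_polynomial_eval (P : ℝ[X]) (k : ℕ) (t : ℝ) :
    iteratedDeriv k (fun t => P.eval t) t = (derivative^[k] P).eval t := by
  induction k generalizing P with
  | zero => simp
  | succ k ih =>
    rw [iteratedDeriv_succ', Function.iterate_succ_apply, ← ih]
    congr 1
    funext t
    exact P.deriv

open Polynomial in
theorem norm_iteratedFDeriv_diag_le {n : ℕ} {q : E → F} (hq : q ∈ polyLE E F n) {x u : E} {ε : ℝ}
    (hb : ∀ t : ℝ, |t| ≤ 1 → ‖q (x + t • u)‖ ≤ ε) (k : ℕ) :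
    ‖iteratedFDeriv ℝ k q x fun _ => u‖ ≤ 2 * (n + 1) * (n : ℝ) ^ k * ε := by
  obtain ⟨c, hc⟩ := exists_line_coeff hq x u
  have hε : 0 ≤ ε := (norm_nonneg _).trans (hb 0 (by simp))
  obtain ⟨L, hL1, hL⟩ := exists_dual_vector'' ℝ (iteratedFDeriv ℝ k q x fun _ => u)
  set P : ℝ[X] := ∑ j ∈ Finset.range (n + 1), C (L (c j)) * X ^ j
  have hP : ∀ t : ℝ, P.eval t = L (q (x + t • u)) := fun t => by
    rw [hc, map_sum]
    simp only [P, eval_finsetSum, eval_mul, eval_C, eval_pow, eval_X, map_smul, smul_eq_mul]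
    exact Finset.sum_congr rfl fun j _ => mul_comm _ _
  have hdeg : P.natDegree ≤ n := natDegree_sum_le_of_forall_le _ _ fun j hj =>
    (natDegree_C_mul_X_pow_le _ _).trans (by rw [Finset.mem_range] at hj; omega)
  have h1 := abs_iterate_derivative_zero_le hdeg (ε := ε) (fun t ht => by
    rw [hP, ← Real.norm_eq_abs]
    exact (L.le_opNorm _).trans ((mul_le_mul hL1 (hb t ht) (norm_nonneg _) zero_le_one).trans
      (one_mul ε).le)) k
  have hLq : ContDiff ℝ ∞ fun y => L (q y) := L.contDiff.comp (polyLE_contDiff hq)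
  have h2 : iteratedDeriv k (fun t => P.eval t) 0 = L (iteratedFDeriv ℝ k q x fun _ => u) := by
    have h3 : (fun t => P.eval t) = fun t : ℝ => (fun y => L (q y)) (x + t • u) := funext hP
    have h4 := L.iteratedFDeriv_comp_left (polyLE_contDiff hq).contDiffAt (x := x) (i := k)
      (by exact_mod_cast le_top)
    rw [h3, iteratedDeriv_line hLq]
    exact congrArg (fun A => A fun _ => u) h4
  rw [← iteratedDeriv_polynomial_eval, h2, hL] at h1
  simpa using h1

theorem norm_iteratedFDeriv_polyLE_le {n : ℕ} {q : E → F} (hq : q ∈ polyLE E F n) {r ε : ℝ}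
    (hr : 0 < r) (hb : ∀ x, ‖x‖ ≤ r → ‖q x‖ ≤ ε) (k : ℕ) {x : E} (hx : ‖x‖ ≤ r / 2) :
    ‖iteratedFDeriv ℝ k q x‖ ≤ 2 * (n + 1) * (2 * n / r) ^ k * ε * Real.exp k := by
  have hε : 0 ≤ ε := (norm_nonneg _).trans (hb 0 (by simpa using hr.le))
  refine ContinuousMultilinearMap.opNorm_le_of_diag _ (fun σ v =>
    (polyLE_contDiff_omega hq).contDiffAt.iteratedFDeriv_comp_perm v σ) (by positivity)
    fun v => ?_
  rcases eq_or_ne v 0 with rfl | hv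
  · rcases Nat.eq_zero_or_pos k with rfl | hk
    · simp only [iteratedFDeriv_zero_apply, pow_zero, mul_one]
      have h1 := hb x (hx.trans (by linarith))
      nlinarith [n.cast_nonneg (α := ℝ)]
    · have : NeZero k := ⟨hk.ne'⟩
      rw [ContinuousMultilinearMap.map_coord_zero _ (0 : Fin k) rfl, norm_zero]
      positivity
  · have hv0 : 0 < ‖v‖ := norm_pos_iff.2 hv
    set s : ℝ := r / 2 / ‖v‖
    have hs : 0 < s := by positivity
    have h1 := norm_iteratedFDeriv_diag_le hq (x := x) (u := s • v) (ε := ε) (fun t ht => hb _ (by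
      refine (norm_add_le _ _).trans ?_
      rw [norm_smul, norm_smul, Real.norm_eq_abs, Real.norm_of_nonneg hs.le, div_mul_cancel₀ _ hv0.ne']
      have := mul_le_mul_of_nonneg_right ht (half_pos hr).le
      linarith)) k
    have h2 : (iteratedFDeriv ℝ k q x fun _ => s • v) =
        s ^ k • iteratedFDeriv ℝ k q x fun _ => v := by
      rw [ContinuousMultilinearMap.map_smul_univ _ (fun _ => s) fun _ => v]
      simp
    rw [h2, norm_smul, Real.norm_of_nonneg (by positivity)] at h1
    have h3 : (2 * n / r) ^ k * ‖v‖ ^ k * s ^ k = (n : ℝ) ^ k := by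
      rw [← mul_pow, ← mul_pow]
      congr 1
      simp only [s]
      field_simp
    refine le_of_mul_le_mul_left (h1.trans (le_of_eq ?_)) (pow_pos hs k)
    rw [← h3]
    ring


theorem exists_telescope_bound {m : ℕ → ℝ} (hm : WtSeq m) {r : ℝ} (hr : 0 < r) {f : E → F}
    (h : FastApprox m r f) : ∃ R : ℕ → E → F, (∀ i, ContDiff ℝ ∞ (R i)) ∧
      (∀ x, ‖x‖ ≤ r → Filter.Tendsto (fun n => ∑ i ∈ Finset.range n, R i x) Filter.atTop
        (nhds (f x))) ∧
      ∃ K > 0, ∃ σ > 0, ∀ i k x, ‖x‖ ≤ r / 2 →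
        ‖iteratedFDeriv ℝ k (R i) x‖ ≤ K * σ ^ k * m k * (1 / 2) ^ i := by
  obtain ⟨c, C, hC, ρ, hρ, h⟩ := h
  choose q hq hqe using fun i : ℕ => h (2 ^ i) Nat.one_le_two_pow
  have hqe' : ∀ i x, ‖x‖ ≤ r → ∀ k, ‖f x - q i x‖ ≤ C * (ρ / 2 ^ i) ^ k * m k := fun i x hx k => by
    have := hqe i x hx k
    push_cast at this
    exact this
  set R : ℕ → E → F := fun i => if i = 0 then q 0 else q i - q (i - 1) with hRdef
  have hR0 : R 0 = q 0 := if_pos rfl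
  have hR1 : ∀ i, R (i + 1) = q (i + 1) - q i := fun i => if_neg (Nat.succ_ne_zero i)
  have hRmem : ∀ i, R (i + 1) ∈ polyLE E F (c * 2 ^ (i + 1)) := fun i => by
    rw [hR1]
    exact Submodule.sub_mem _ (hq (i + 1)) (polyLE_mono (by gcongr <;> omega) (hq i))
  have hRs : ∀ i, ContDiff ℝ ∞ (R i) := fun i => by
    cases i with
    | zero => rw [hR0]; exact polyLE_contDiff (hq 0)
    | succ i => exact polyLE_contDiff (hRmem i)
  have hsum : ∀ n x, ∑ i ∈ Finset.range (n + 1), R i x = q n x := fun n x => by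
    induction n with
    | zero => rw [Finset.sum_range_one, hR0]
    | succ n ih => rw [Finset.sum_range_succ, ih, hR1, Pi.sub_apply, add_sub_cancel]
  refine ⟨R, hRs, fun x hx => ?_, ?_⟩
  · rw [← Filter.tendsto_add_atTop_iff_nat 1]
    simp only [hsum]
    rw [tendsto_iff_norm_sub_tendsto_zero]
    have hlim : Filter.Tendsto (fun n : ℕ => C * ρ * m 1 * (1 / 2 : ℝ) ^ n) Filter.atTop (nhds 0) := by
      rw [← mul_zero (C * ρ * m 1)]
      exact (tendsto_pow_atTop_nhds_zero_of_lt_one (by norm_num) (by norm_num)).const_mul _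
    refine squeeze_zero (fun _ => norm_nonneg _) (fun n => ?_) hlim
    rw [norm_sub_rev]
    refine (hqe' n x hx 1).trans (le_of_eq ?_)
    rw [pow_one, one_div, inv_pow]
    ring
  · obtain ⟨A, hA, hs⟩ := hm.shift_add 2
    obtain ⟨B, hB⟩ := (isCompact_closedBall (0 : E) r).exists_bound_of_continuousOn
      (polyLE_contDiff (hq 0)).continuous.continuousOn
    have hB' : ∀ x, ‖x‖ ≤ r → ‖q 0 x‖ ≤ |B| := fun x hx =>
      (hB x (by simpa using hx)).trans (le_abs_self B)
    have hm0 : ∀ k, m 0 ≤ m k := fun k => by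
      induction k with
      | zero => exact le_rfl
      | succ k ih =>
        have h1 := hm.mono k
        have h2 := (hm.pos k).le
        nlinarith [k.cast_nonneg (α := ℝ)]
    set K0 : ℝ := 2 * (c + 1) * |B| / m 0
    set K1 : ℝ := 4 * C * (2 * c + 1) * ρ ^ 2 * A
    set σ0 : ℝ := 2 * c / r * Real.exp 1
    set σ1 : ℝ := 2 * 2 * c / r * ρ * Real.exp 1 * A
    have hm0p := hm.pos 0
    have hK0 : 0 ≤ K0 := by positivity
    have hK1 : 0 < K1 := by positivity
    have hσ0 : 0 ≤ σ0 := by positivity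
    have hσ1 : 0 ≤ σ1 := by positivity
    have hexp : ∀ k : ℕ, Real.exp k = Real.exp 1 ^ k := fun k => by
      rw [← Real.exp_nat_mul, mul_one]
    refine ⟨K0 + 2 * K1, by positivity, σ0 + σ1 + 1, by positivity, fun i k x hx => ?_⟩
    have hmk := hm.pos k
    cases i with
    | zero =>
      rw [hR0, pow_zero, mul_one]
      have h1 := norm_iteratedFDeriv_polyLE_le (hq 0) hr hB' k hx
      calc _ ≤ _ := h1
        _ = K0 * σ0 ^ k * m 0 := by
          rw [hexp]
          simp only [K0, σ0, mul_pow, pow_zero, mul_one]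
          field_simp
        _ ≤ (K0 + 2 * K1) * (σ0 + σ1 + 1) ^ k * m k := by
          have := hm0 k
          gcongr <;> linarith
    | succ i =>
      have hb : ∀ x, ‖x‖ ≤ r → ‖R (i + 1) x‖ ≤ 2 * C * (ρ / 2 ^ i) ^ (k + 2) * m (k + 2) := by
        intro x hx
        have h1 := hqe' (i + 1) x hx (k + 2)
        have h2 := hqe' i x hx (k + 2)
        have h3 : C * (ρ / 2 ^ (i + 1)) ^ (k + 2) * m (k + 2) ≤
            C * (ρ / 2 ^ i) ^ (k + 2) * m (k + 2) := by
          have := (hm.pos (k + 2)).le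
          gcongr <;> norm_num
        have h4 : R (i + 1) x = (f x - q i x) - (f x - q (i + 1) x) := by
          rw [hR1, Pi.sub_apply]; abel
        rw [h4]
        refine (norm_sub_le _ _).trans ?_
        linarith
      have h1 := norm_iteratedFDeriv_polyLE_le (hRmem i) hr hb k hx
      set T : ℝ := 2 ^ i
      have hT : 1 ≤ T := one_le_pow₀ (by norm_num)
      have hn : ((c * 2 ^ (i + 1) : ℕ) : ℝ) = 2 * c * T := by
        push_cast; rw [pow_succ]; ring
      rw [hn] at h1
      have hT2 : (1 / 2 : ℝ) ^ (i + 1) = T⁻¹ / 2 := by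
        rw [pow_succ, one_div, inv_pow]; ring
      calc _ ≤ _ := h1
        _ ≤ 2 * ((2 * c + 1) * T) * (2 * (2 * c * T) / r) ^ k *
            (2 * C * (ρ / T) ^ (k + 2) * (A ^ (k + 1) * m k)) * Real.exp k := by
          have h2 := hs k
          have h3 : 2 * c * T + 1 ≤ (2 * c + 1) * T := by linarith
          have h4 := hm.pos (k + 2)
          gcongr
        _ = K1 * σ1 ^ k * m k * T⁻¹ := by
          rw [hexp]
          simp only [K1, σ1, mul_pow, div_pow, pow_add]
          field_simp
          ring
        _ = 2 * K1 * σ1 ^ k * m k * (T⁻¹ / 2) := by ring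
        _ ≤ (K0 + 2 * K1) * (σ0 + σ1 + 1) ^ k * m k * (1 / 2) ^ (i + 1) := by
          rw [hT2]
          gcongr <;> linarith

theorem contDiffOn_of_fastApprox {m : ℕ → ℝ} (hm : WtSeq m) {r : ℝ} (hr : 0 < r) {f : E → F}
    (h : FastApprox m r f) : ContDiffOn ℝ ∞ f (Metric.ball 0 (r / 2)) ∧
      ∃ C > 0, ∃ ρ > 0, ∀ k, ∀ x ∈ Metric.ball (0 : E) (r / 2),
        ‖iteratedFDeriv ℝ k f x‖ ≤ C * ρ ^ k * m k := by
  obtain ⟨R, hR, hlim, K, hK, σ, hσ, hb⟩ := exists_telescope_bound hm hr h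
  set s := Metric.ball (0 : E) (r / 2)
  have hso : IsOpen s := Metric.isOpen_ball
  have hs : ∀ x ∈ s, ‖x‖ ≤ r / 2 := fun x hx => by
    rw [mem_ball_zero_iff] at hx; exact hx.le
  have hb' : ∀ k i, ∀ x ∈ s, ‖iteratedFDeriv ℝ k (R i) x‖ ≤ K * σ ^ k * m k * (1 / 2) ^ i :=
    fun k i x hx => hb i k x (hs x hx)
  have hu : ∀ k, HasSum (fun i : ℕ => K * σ ^ k * m k * (1 / 2 : ℝ) ^ i) (K * σ ^ k * m k * 2) :=
    fun k => hasSum_geometric_two.mul_left _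
  set P : E → FormalMultilinearSeries ℝ E F := fun x k => ∑' i, iteratedFDeriv ℝ k (R i) x
  have hsm : ∀ k, ∀ x ∈ s, Summable fun i => iteratedFDeriv ℝ k (R i) x := fun k x hx =>
    Summable.of_norm_bounded (hu k).summable fun i => hb' k i x hx
  have hder : ∀ k, ∀ x ∈ s, HasFDerivAt (fun y => P y k) (P x (k + 1)).curryLeft x := by
    intro k x hx
    have h1 := hasFDerivAt_tsum_of_isPreconnected (hu (k + 1)).summable hso
      (convex_ball (0 : E) (r / 2)).isPreconnected
      (f := fun i => iteratedFDeriv ℝ k (R i)) (f' := fun i => fderiv ℝ (iteratedFDeriv ℝ k (R i)))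
      (fun i y _ => ((hR i).differentiable_iteratedFDeriv (m := k)
        (by exact_mod_cast WithTop.coe_lt_top k) y).hasFDerivAt)
      (fun i y hy => by rw [norm_fderiv_iteratedFDeriv]; exact hb' (k + 1) i y hy)
      hx (hsm k x hx) hx
    have h2 : (P x (k + 1)).curryLeft = ∑' i, fderiv ℝ (iteratedFDeriv ℝ k (R i)) x := by
      have h3 := ((continuousMultilinearCurryLeftEquiv ℝ (fun _ : Fin (k + 1) => E)
        F).toContinuousLinearEquiv).map_tsum
          (L := .unconditional ℕ) (f := fun i => iteratedFDeriv ℝ (k + 1) (R i) x)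
      refine h3.trans (tsum_congr fun i => ?_)
      rw [iteratedFDeriv_succ_eq_comp_left]
      exact (continuousMultilinearCurryLeftEquiv ℝ (fun _ : Fin (k + 1) => E) F).apply_symm_apply _
    rw [h2]
    exact h1
  have hT : HasFTaylorSeriesUpToOn ∞ f P s := by
    refine ⟨fun x hx => ?_, fun k _ x hx => (hder k x hx).hasFDerivWithinAt,
      fun k _ x hx => (hder k x hx).continuousAt.continuousWithinAt⟩
    have h1 := (continuousMultilinearCurryFin0 ℝ E F).toContinuousLinearEquiv.map_tsum
      (L := .unconditional ℕ) (f := fun i => iteratedFDeriv ℝ 0 (R i) x)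
    have h2 : (P x 0).curry0 = ∑' i, R i x := by
      refine h1.trans (tsum_congr fun i => ?_)
      rw [iteratedFDeriv_zero_eq_comp]
      exact (continuousMultilinearCurryFin0 ℝ E F).apply_symm_apply _
    have h3 : Summable fun i => R i x := Summable.of_norm_bounded (hu 0).summable fun i => by
      have := hb' 0 i x hx
      rwa [norm_iteratedFDeriv_zero] at this
    rw [h2]
    exact tendsto_nhds_unique h3.hasSum.tendsto_sum_nat (hlim x ((hs x hx).trans (by linarith)))
  refine ⟨hT.contDiffOn, K * 2, by positivity, σ, hσ, fun k x hx => ?_⟩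
  rw [← iteratedFDerivWithin_of_isOpen k hso hx,
    ← hT.eq_iteratedFDerivWithin_of_uniqueDiffOn (by exact_mod_cast le_top) hso.uniqueDiffOn hx]
  refine (tsum_of_norm_bounded (hu k) fun i => hb' k i x hx).trans (le_of_eq ?_)
  ring

theorem bounds_of_fastApprox {m : ℕ → ℝ} (hm : WtSeq m) {f : E → F}
    (h : ∀ r, FastApprox m r f) : ContDiff ℝ ∞ f ∧ ∀ R : ℝ, ∃ C > 0, ∃ ρ > 0, ∀ k x, ‖x‖ ≤ R →
      ‖iteratedFDeriv ℝ k f x‖ ≤ C * ρ ^ k * m k := by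
  have key : ∀ R : ℝ, 0 < 2 * (|R| + 1) ∧ ∀ x : E, ‖x‖ ≤ R →
      x ∈ Metric.ball (0 : E) (2 * (|R| + 1) / 2) := fun R => by
    refine ⟨by positivity, fun x hx => ?_⟩
    rw [mem_ball_zero_iff]
    have := le_abs_self R
    linarith
  refine ⟨contDiff_iff_contDiffAt.2 fun x => ?_, fun R => ?_⟩
  · exact (contDiffOn_of_fastApprox hm (key ‖x‖).1 (h _)).1.contDiffAt
      (Metric.isOpen_ball.mem_nhds ((key ‖x‖).2 x le_rfl))
  · obtain ⟨C, hC, ρ, hρ, hb⟩ := (contDiffOn_of_fastApprox hm (key R).1 (h _)).2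
    exact ⟨C, hC, ρ, hρ, fun k x hx => hb k x ((key R).2 x hx)⟩

end PolynomialDerivatives

section WeightClass

variable {E : Type*} [NormedAddCommGroup E] [NormedSpace ℝ E]
  {F : Type*} [NormedAddCommGroup F] [NormedSpace ℝ F]
  {E' : Type*} [NormedAddCommGroup E'] [NormedSpace ℝ E']
  {F' : Type*} [NormedAddCommGroup F'] [NormedSpace ℝ F']

/-- Smooth maps whose derivatives are bounded on balls as prescribed by the weight sequence. -/
def WtClass (m : ℕ → ℝ) (f : E → F) : Prop :=
  ContDiff ℝ ∞ f ∧ ∀ R : ℝ, ∃ C > 0, ∃ ρ > 0, ∀ k x, ‖x‖ ≤ R →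
    ‖iteratedFDeriv ℝ k f x‖ ≤ C * ρ ^ k * m k

theorem WtClass.clm_comp {m : ℕ → ℝ} (hm : ∀ k, 0 < m k) {f : E → F} (hf : WtClass m f)
    (A : F →L[ℝ] F') : WtClass m fun x => A (f x) := by
  refine ⟨A.contDiff.comp hf.1, fun R => ?_⟩
  obtain ⟨C, hC, ρ, hρ, hb⟩ := hf.2 R
  refine ⟨(‖A‖ + 1) * C, by positivity, ρ, hρ, fun k x hx => ?_⟩
  refine (A.norm_iteratedFDeriv_comp_left hf.1.contDiffAt (by exact_mod_cast le_top)).trans ?_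
  have h1 := hb k x hx
  have h2 := hm k
  calc _ ≤ (‖A‖ + 1) * (C * ρ ^ k * m k) := by gcongr; linarith
    _ = _ := by ring

theorem WtClass.comp_clm {m : ℕ → ℝ} (hm : ∀ k, 0 < m k) {f : E → F} (hf : WtClass m f)
    (A : E' →L[ℝ] E) : WtClass m fun x => f (A x) := by
  refine ⟨hf.1.comp A.contDiff, fun R => ?_⟩
  obtain ⟨C, hC, ρ, hρ, hb⟩ := hf.2 (‖A‖ * R)
  refine ⟨C, hC, ρ * (‖A‖ + 1), by positivity, fun k x hx => ?_⟩
  have h1 : iteratedFDeriv ℝ k (fun x => f (A x)) x =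
      (iteratedFDeriv ℝ k f (A x)).compContinuousLinearMap fun _ => A :=
    A.iteratedFDeriv_comp_right hf.1 x (by exact_mod_cast le_top)
  rw [h1]
  refine (ContinuousMultilinearMap.norm_compContinuousLinearMap_le _ _).trans ?_
  rw [Finset.prod_const, Finset.card_univ, Fintype.card_fin]
  have h2 := hb k (A x) ((A.le_opNorm x).trans (by gcongr))
  have h3 := hm k
  calc _ ≤ (C * ρ ^ k * m k) * (‖A‖ + 1) ^ k := by gcongr; linarith
    _ = _ := by rw [mul_pow]; ring

theorem wtClass_of_cmClassOn [FiniteDimensional ℝ E] {M : ℕ → ℝ} {f : E → F}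
    (hf : CMClassOn M Set.univ f) :
    WtClass (fun k => (k ! : ℝ) * M k) f := by
  refine ⟨contDiffOn_univ.1 hf.1, fun R => ?_⟩
  have := FiniteDimensional.proper ℝ E
  obtain ⟨C, hC, ρ, hρ, hb⟩ := hf.2 _ (Set.subset_univ _) (isCompact_closedBall (0 : E) R)
  refine ⟨C, hC, ρ, hρ, fun k x hx => ?_⟩
  have h1 := hb k x (by simpa using hx)
  rwa [iteratedFDerivWithin_univ, mul_assoc] at h1

theorem WtClass.cmClassOn {M : ℕ → ℝ} {f : E → F} (hf : WtClass (fun k => (k ! : ℝ) * M k) f)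
    {N : ℕ → ℝ} {A : ℝ} (hA : 0 < A) (hM : ∀ k, M k ≤ A ^ k * N k) :
    CMClassOn N Set.univ f := by
  refine ⟨contDiffOn_univ.2 hf.1, fun K _ hK => ?_⟩
  obtain ⟨R, hR⟩ := hK.isBounded.exists_norm_le
  obtain ⟨C, hC, ρ, hρ, hb⟩ := hf.2 R
  refine ⟨C, hC, ρ * A, by positivity, fun k x hx => ?_⟩
  rw [iteratedFDerivWithin_univ]
  refine (hb k x (hR x hx)).trans ?_
  calc _ ≤ C * ρ ^ k * (k ! * (A ^ k * N k)) := by have := hM k; dsimp only; gcongr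
    _ = _ := by rw [mul_pow]; ring

end WeightClass

section FiniteDimensional

variable {E : Type*} [NormedAddCommGroup E] [NormedSpace ℝ E] [FiniteDimensional ℝ E]

instance ContinuousMultilinearMap.finiteDimensional_real (p : ℕ) :
    FiniteDimensional ℝ (ContinuousMultilinearMap ℝ (fun _ : Fin p => E) ℝ) :=
  FiniteDimensional.of_injective
    (ContinuousMultilinearMap.toMultilinearMapLinear : ContinuousMultilinearMap ℝ
      (fun _ : Fin p => E) ℝ →ₗ[ℝ] MultilinearMap ℝ (fun _ : Fin p => E) ℝ)
    ContinuousMultilinearMap.toMultilinearMap_injective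

instance ContinuousAlternatingMap.finiteDimensional_real (p : ℕ) :
    FiniteDimensional ℝ (E [⋀^Fin p]→L[ℝ] ℝ) :=
  FiniteDimensional.of_injective (ContinuousAlternatingMap.toContinuousMultilinearMapLinear
    (R := ℝ) (A := ℝ) (M := E) (N := ℝ) (ι := Fin p))
    ContinuousAlternatingMap.toContinuousMultilinearMap_injective

end FiniteDimensional

section Extension

variable {Γ : Type*} [Group Γ] [TopologicalSpace Γ] {V : Type*}
    [NormedAddCommGroup V] [InnerProductSpace ℝ V] [FiniteDimensional ℝ V] {U : Type*}
    [NormedAddCommGroup U] [InnerProductSpace ℝ U] [FiniteDimensional ℝ U]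

theorem PolarRep.exists_wtClass_extension (P : PolarRep Γ V U) [CompactSpace Γ]
    [IsTopologicalGroup Γ] [Finite P.weyl] {p : ℕ} {om : U → U [⋀^Fin p]→L[ℝ] ℝ}
    (hom : P.WInv om) {m : ℕ → ℝ} (hm : WtSeq m) (hom' : WtClass m om) :
    ∃ η : V → V [⋀^Fin p]→L[ℝ] ℝ,
      (∀ g x s v, P.ρ g x = P.ι s → η x v = om s fun i => P.pr (P.ρ g (v i))) ∧
      WtClass m η := by
  obtain ⟨R⟩ := P.exists_roots
  let _ : MeasurableSpace U := borel U
  have _ : BorelSpace U := ⟨rfl⟩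
  have hfast : ∀ r, FastApprox m r om := fastApprox_of_bounds hm hom'.1 hom'.2
  obtain ⟨η, hη, hQ⟩ := R.exists_extension hom fun r ε hε => by
    obtain ⟨c, C, hC, ρ, hρ, h⟩ := hfast r
    have hm1 := hm.pos 1
    obtain ⟨N, hN⟩ := exists_nat_gt (C * ρ * m 1 / ε)
    have hN0 : (0 : ℝ) < N := lt_of_le_of_lt (by positivity) hN
    obtain ⟨q, hq, hqe⟩ := h N (by exact_mod_cast hN0)
    refine ⟨c * N, q, hq, fun s hs => (hqe s hs 1).trans ?_⟩
    rw [div_lt_iff₀ hε] at hN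
    rw [pow_one]
    have : C * (ρ / N) * m 1 = C * ρ * m 1 / N := by ring
    rw [this, div_le_iff₀ hN0]
    linarith
  refine ⟨η, hη, bounds_of_fastApprox hm fun r => ?_⟩
  obtain ⟨c, C, hC, ρ, hρ, h⟩ := hfast r
  refine ⟨c, C, hC, ρ, hρ, fun N hN => ?_⟩
  obtain ⟨q, hq, hqe⟩ := h N hN
  have hbd : BddBelow (Set.range fun k => C * (ρ / N) ^ k * m k) :=
    ⟨0, by rintro _ ⟨k, rfl⟩; have := (hm.pos k).le; positivity⟩
  obtain ⟨Q, hQm, hQe⟩ := hQ _ r (⨅ k, C * (ρ / N) ^ k * m k) q hq fun s hs =>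
    le_ciInf fun k => hqe s hs k
  exact ⟨Q, hQm, fun x hx k => (hQe x hx).trans (ciInf_le hbd k)⟩

end Extension

section Orthogonal

theorem exists_weight_bound {m : ℕ} (hm : 0 < m) {M N : ℕ → ℝ} (hM : DCWeightSeq M)
    (hN : DCWeightSeq N) (hMN : ∃ C : ℝ, ∀ k : ℕ, 1 ≤ k → (M (k * m) / N k) ^ ((1 : ℝ) / k) ≤ C) :
    ∃ A : ℝ, 0 < A ∧ ∀ k, M k ≤ A ^ k * N k := by
  obtain ⟨C, hC⟩ := hMN
  refine ⟨max C 1, by positivity, fun k => ?_⟩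
  rcases Nat.eq_zero_or_pos k with rfl | hk
  · rw [hM.1, hN.1, pow_zero, one_mul]
  · have hmono : Monotone M := monotone_nat_of_le_succ hM.2.2.1
    have h1 : M k ≤ M (k * m) := hmono (Nat.le_mul_of_pos_right k hm)
    have hNk := hN.2.1 k
    have h2 : 0 ≤ M (k * m) / N k := div_nonneg (hM.2.1 _).le hNk.le
    have h3 : M (k * m) / N k ≤ max C 1 ^ k := by
      have h4 := pow_le_pow_left₀ (Real.rpow_nonneg h2 _) ((hC k hk).trans (le_max_left C 1)) k
      rwa [one_div, Real.rpow_inv_natCast_pow h2 hk.ne'] at h4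
    rw [div_le_iff₀ hNk] at h3
    exact h1.trans h3

theorem compactSpace_of_orthogonal {n : ℕ} {G : Subgroup (GL (Fin n) ℝ)}
    (hGorth : ∀ g ∈ G, g.val * g.valᵀ = 1)
    (hGcpt : IsCompact ((Units.val : GL (Fin n) ℝ → Matrix (Fin n) (Fin n) ℝ) ''
      (G : Set (GL (Fin n) ℝ)))) : CompactSpace G := by
  suffices hG : IsCompact (G : Set (GL (Fin n) ℝ)) from isCompact_iff_compactSpace.1 hG
  rw [Units.isEmbedding_embedProduct.isCompact_iff]
  have h : Units.embedProduct (Matrix (Fin n) (Fin n) ℝ) '' (G : Set (GL (Fin n) ℝ)) =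
      (fun A => (A, MulOpposite.op Aᵀ)) '' ((Units.val : GL (Fin n) ℝ → Matrix (Fin n) (Fin n) ℝ) ''
        (G : Set (GL (Fin n) ℝ))) := by
    rw [Set.image_image]
    refine Set.image_congr fun g hg => ?_
    have h1 : ((g⁻¹ : GL (Fin n) ℝ) : Matrix (Fin n) (Fin n) ℝ) = g.valᵀ :=
      Units.inv_eq_of_mul_eq_one_right (hGorth g hg)
    rw [Units.embedProduct_apply, h1]
  rw [h]
  exact hGcpt.image (continuous_id.prodMk
    (MulOpposite.continuous_op.comp continuous_id.matrix_transpose))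

theorem toEuclideanCLM_norm {n : ℕ} {A : Matrix (Fin n) (Fin n) ℝ} (hA : A * Aᵀ = 1)
    (x : EuclideanSpace ℝ (Fin n)) : ‖Matrix.toEuclideanCLM (n := Fin n) (𝕜 := ℝ) A x‖ = ‖x‖ := by
  refine ContinuousLinearMap.norm_map_of_mem_unitary ?_ x
  rw [← Matrix.conjTranspose_eq_transpose_of_trivial] at hA
  exact ⟨by rw [← map_star, ← map_mul, Matrix.star_eq_conjTranspose, mul_eq_one_comm.1 hA, map_one],
    by rw [← map_star, ← map_mul, Matrix.star_eq_conjTranspose, hA, map_one]⟩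

/-- A polar action by orthogonal matrices, in Euclidean coordinates on the ambient space and on
the section. -/
theorem exists_polarRep {n : ℕ} {G : Subgroup (GL (Fin n) ℝ)}
    (hGorth : ∀ g ∈ G, g.val * g.valᵀ = 1)
    (S : Submodule ℝ (Fin n → ℝ))
    (hSmeets : ∀ v : Fin n → ℝ, ∃ g ∈ G, g.val.mulVec v ∈ S)
    (hSorth : ∀ s ∈ S, ∀ c : ℝ → (Fin n → ℝ), ContDiff ℝ 1 c → c 0 = s →
      (∀ t : ℝ, ∃ g ∈ G, c t = g.val.mulVec s) →
      ∀ u ∈ S, ∑ i, deriv c 0 i * u i = 0) :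
    ∃ (d : ℕ) (P : PolarRep G (EuclideanSpace ℝ (Fin n)) (EuclideanSpace ℝ (Fin d))),
      (∀ (g : G) x, (P.ρ g x).ofLp = g.val.val.mulVec x.ofLp) ∧
      ∃ e : EuclideanSpace ℝ (Fin d) ≃ₗ[ℝ] S, ∀ u, (P.ι u).ofLp = e u := by
  let W : Submodule ℝ (EuclideanSpace ℝ (Fin n)) :=
    S.comap (WithLp.linearEquiv 2 ℝ (Fin n → ℝ)).toLinearMap
  let b := stdOrthonormalBasis ℝ W
  let j : EuclideanSpace ℝ (Fin (Module.finrank ℝ W)) →ₗᵢ[ℝ] EuclideanSpace ℝ (Fin n) :=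
    W.subtypeₗᵢ.comp b.repr.symm.toLinearIsometry
  let e0 : W ≃ₗ[ℝ] S := (WithLp.linearEquiv 2 ℝ (Fin n → ℝ)).ofSubmodule' S
  let e : EuclideanSpace ℝ (Fin (Module.finrank ℝ W)) ≃ₗ[ℝ] S := b.repr.symm.toLinearEquiv.trans e0
  have he : ∀ u, (j u).ofLp = e u := fun u => rfl
  let ρ : G →* (EuclideanSpace ℝ (Fin n) →L[ℝ] EuclideanSpace ℝ (Fin n)) :=
    ((Matrix.toEuclideanCLM (n := Fin n) (𝕜 := ℝ) : Matrix (Fin n) (Fin n) ℝ →* _).comp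
      (Units.coeHom _)).comp G.subtype
  have hρ : ∀ (g : G) x, (ρ g x).ofLp = g.val.val.mulVec x.ofLp := fun g x => rfl
  have hjS : ∀ y : EuclideanSpace ℝ (Fin n), y.ofLp ∈ S → ∃ u, y = j u := fun y hy => by
    refine ⟨e.symm ⟨y.ofLp, hy⟩, ?_⟩
    apply WithLp.ofLp_injective
    rw [he, LinearEquiv.apply_symm_apply]
  refine ⟨_, ⟨ρ, ?_, fun g x => toEuclideanCLM_norm (hGorth g g.2) x, j, fun v => ?_,
    fun s c hc h0 hcG u => ?_⟩, hρ, e, he⟩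
  · have h1 : Continuous fun A : Matrix (Fin n) (Fin n) ℝ =>
        Matrix.toEuclideanCLM (n := Fin n) (𝕜 := ℝ) A :=
      (Matrix.toEuclideanCLM (n := Fin n) (𝕜 := ℝ)).toAlgEquiv.toLinearMap.continuous_of_finiteDimensional
    exact h1.comp (Units.continuous_val.comp continuous_subtype_val)
  · obtain ⟨g, hg, hgv⟩ := hSmeets v.ofLp
    obtain ⟨u, hu⟩ := hjS (ρ ⟨g, hg⟩ v) hgv
    exact ⟨⟨g, hg⟩, u, hu⟩
  · let L := EuclideanSpace.equiv (Fin n) ℝ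
    have h1 := hSorth (j s).ofLp (by rw [he]; exact (e s).2) (fun t => L (c t))
      (L.contDiff.comp hc) (by rw [h0]; rfl)
      (fun t => by
        obtain ⟨g, hg⟩ := hcG t
        refine ⟨g, g.2, ?_⟩
        rw [hg]
        exact hρ g _) (j u).ofLp (by rw [he]; exact (e u).2)
    have h2 : HasDerivAt (fun t => L (c t)) (L (deriv c 0)) 0 :=
      L.hasFDerivAt.comp_hasDerivAt 0 (hc.differentiable (by simp) 0).hasDerivAt
    rw [h2.deriv] at h1
    rw [PiLp.inner_apply]
    refine Eq.trans (Finset.sum_congr rfl fun i _ => ?_) h1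
    exact mul_comm _ _

end Orthogonal

end Approximation

section Assembly

variable {U : Type*} [NormedAddCommGroup U] [NormedSpace ℝ U] [FiniteDimensional ℝ U]
  {W : Type*} [NormedAddCommGroup W] [NormedSpace ℝ W] [FiniteDimensional ℝ W]

/-- Pullback of multilinear forms to alternating forms, inverse to the inclusion on alternating
forms. -/
theorem exists_alternating_pullback (A : U →L[ℝ] W) (p : ℕ) :
    ∃ T : ContinuousMultilinearMap ℝ (fun _ : Fin p => W) ℝ →L[ℝ] U [⋀^Fin p]→L[ℝ] ℝ,
      ∀ f, (∀ (v : Fin p → W) (i j : Fin p), i ≠ j → v i = v j → f v = 0) →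
        ∀ v, T f v = f fun i => A (v i) := by
  let T : ContinuousMultilinearMap ℝ (fun _ : Fin p => W) ℝ →ₗ[ℝ] U [⋀^Fin p]→L[ℝ] ℝ :=
    { toFun := fun f => ((p ! : ℝ)⁻¹) • ContinuousMultilinearMap.alternatization
        (f.compContinuousLinearMap fun _ => A)
      map_add' := fun f g => by
        ext v
        simp only [ContinuousAlternatingMap.smul_apply, ContinuousAlternatingMap.add_apply,
          ContinuousMultilinearMap.alternatization_apply_apply, ← smul_add,
          ← Finset.sum_add_distrib]
        rfl
      map_smul' := fun c f => by
        ext v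
        simp only [ContinuousAlternatingMap.smul_apply, RingHom.id_apply,
          ContinuousMultilinearMap.alternatization_apply_apply]
        rw [smul_comm c, Finset.smul_sum (r := c)]
        congr 1
        refine Finset.sum_congr rfl fun σ _ => ?_
        rw [smul_comm c]
        rfl }
  refine ⟨T.toContinuousLinearMap, fun f hf v => ?_⟩
  let a : W [⋀^Fin p]→ₗ[ℝ] ℝ :=
    { f.toMultilinearMap with map_eq_zero_of_eq' := fun v i j h hij => hf v i j hij h }
  have h1 : ∀ σ : Equiv.Perm (Fin p),
      Equiv.Perm.sign σ • f (fun i => A (v (σ i))) = f fun i => A (v i) := fun σ => by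
    have h2 : f (fun i => A (v (σ i))) = Equiv.Perm.sign σ • f fun i => A (v i) :=
      a.map_perm (fun i => A (v i)) σ
    rw [h2, smul_smul, Int.units_mul_self, one_smul]
  change (p ! : ℝ)⁻¹ • (ContinuousMultilinearMap.alternatization
    (f.compContinuousLinearMap fun _ => A)) v = _
  rw [ContinuousMultilinearMap.alternatization_apply_apply]
  have h3 : ∑ σ : Equiv.Perm (Fin p), Equiv.Perm.sign σ •
      (f.compContinuousLinearMap fun _ => A) (v ∘ σ) =
      ∑ _σ : Equiv.Perm (Fin p), f fun i => A (v i) := Finset.sum_congr rfl fun σ _ => h1 σ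
  rw [h3, Finset.sum_const, Finset.card_univ, Fintype.card_perm, Fintype.card_fin,
    ← Nat.cast_smul_eq_nsmul ℝ, smul_smul, inv_mul_cancel₀ (by positivity), one_smul]

theorem exists_multilinear_pullback (A : U →L[ℝ] W) (p : ℕ) :
    ∃ T : (W [⋀^Fin p]→L[ℝ] ℝ) →L[ℝ] ContinuousMultilinearMap ℝ (fun _ : Fin p => U) ℝ,
      ∀ f v, T f v = f fun i => A (v i) := by
  let T : (W [⋀^Fin p]→L[ℝ] ℝ) →ₗ[ℝ] ContinuousMultilinearMap ℝ (fun _ : Fin p => U) ℝ :=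
    { toFun := fun f => f.toContinuousMultilinearMap.compContinuousLinearMap fun _ => A
      map_add' := fun _ _ => rfl
      map_smul' := fun _ _ => rfl }
  exact ⟨T.toContinuousLinearMap, fun _ _ => rfl⟩

end Assembly

theorem PolarRep.exists_cmClassOn_extension {Γ : Type*} [Group Γ] [TopologicalSpace Γ]
    [CompactSpace Γ] [IsTopologicalGroup Γ] {V : Type*} [NormedAddCommGroup V]
    [InnerProductSpace ℝ V] [FiniteDimensional ℝ V] {U : Type*} [NormedAddCommGroup U]
    [InnerProductSpace ℝ U] [FiniteDimensional ℝ U] (P : PolarRep Γ V U) [Finite P.weyl]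
    {W : Type*} [NormedAddCommGroup W] [NormedSpace ℝ W] [FiniteDimensional ℝ W] (e : U ≃ₗ[ℝ] W)
    {V' : Type*} [NormedAddCommGroup V'] [NormedSpace ℝ V'] [FiniteDimensional ℝ V']
    (L : V' ≃L[ℝ] V) {p : ℕ} {M N : ℕ → ℝ} (hM : DCWeightSeq M) {A : ℝ} (hA : 0 < A)
    (hMN : ∀ k, M k ≤ A ^ k * N k)
    {ω : W → ContinuousMultilinearMap ℝ (fun _ : Fin p => W) ℝ}
    (hωalt : ∀ (s : W) (v : Fin p → W) (i j : Fin p), i ≠ j → v i = v j → ω s v = 0)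
    (hωCM : CMClassOn M Set.univ ω)
    (hωinv : ∀ w ∈ P.weyl, ∀ s (v : Fin p → U),
      ω (e (w s)) (fun i => e (w (v i))) = ω (e s) fun i => e (v i)) :
    ∃ η : V' → ContinuousMultilinearMap ℝ (fun _ : Fin p => V') ℝ,
      (∀ (x : V') (v : Fin p → V') (i j : Fin p), i ≠ j → v i = v j → η x v = 0) ∧
      CMClassOn N Set.univ η ∧
      (∀ g x y (v u : Fin p → V'), P.ρ g (L x) = L y → (∀ i, P.ρ g (L (v i)) = L (u i)) →
        η y u = η x v) ∧
      (∀ x (v : Fin p → V') i, (∃ c : ℝ → V', ContDiff ℝ 1 c ∧ c 0 = x ∧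
        (∀ t, ∃ g, L (c t) = P.ρ g (L x)) ∧ deriv c 0 = v i) → η x v = 0) ∧
      ∀ x s (v : Fin p → V') (u : Fin p → W), L x = P.ι (e.symm s) →
        (∀ i, L (v i) = P.ι (e.symm (u i))) → η x v = ω s u := by
  let e' := e.toContinuousLinearEquiv
  obtain ⟨T, hT⟩ := exists_alternating_pullback (e' : U →L[ℝ] W) p
  obtain ⟨T', hT'⟩ := exists_multilinear_pullback (L : V' →L[ℝ] V) p
  have hm := hM.wtSeq
  have hom : ∀ s v, T (ω (e s)) v = ω (e s) fun i => e (v i) := fun s v => hT _ (hωalt _) v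
  have hcl : WtClass (fun k => (k ! : ℝ) * M k) fun s => T (ω (e s)) :=
    (((wtClass_of_cmClassOn hωCM).clm_comp hm.pos T).comp_clm hm.pos (e' : U →L[ℝ] W) :)
  obtain ⟨η, hη, hηm⟩ := P.exists_wtClass_extension (om := fun s => T (ω (e s)))
    (fun w hw s v => by simp only [hom]; exact hωinv w hw s v) hm hcl
  have hform : ∀ g x s v, P.ρ g (L x) = P.ι s →
      T' (η (L x)) v = ω (e s) fun i => e (P.pr (P.ρ g (L (v i)))) := fun g x s v h => by
    rw [hT', hη g (L x) s _ h, hom]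
    rfl
  refine ⟨fun x => T' (η (L x)), fun x v i j hij h => ?_,
    ((hηm.clm_comp hm.pos T').comp_clm hm.pos (L : V' →L[ℝ] V)).cmClassOn hA hMN,
    fun g x y v u hxy hvu => ?_, fun x v i hc => ?_, fun x s v u hx hv => ?_⟩
  · rw [hT']
    exact (η (L x)).map_eq_zero_of_eq _ (congrArg L h) hij
  · obtain ⟨h, s, hs⟩ := P.meets (L x)
    dsimp only
    rw [hform h x s v hs, hform (h * g⁻¹) y s u (by rw [← hxy, P.mul_apply, P.inv_apply_self, hs])]
    simp only [← hvu, P.mul_apply, P.inv_apply_self]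
  · obtain ⟨c, hc1, rfl, hcG, hcv⟩ := hc
    obtain ⟨h, s, hs⟩ := P.meets (L (c 0))
    have hder : HasDerivAt (fun t => P.ρ h (L (c t))) (P.ρ h (L (v i))) 0 := by
      have h1 := (hc1.differentiable (by simp) 0).hasDerivAt
      rw [hcv] at h1
      exact (P.ρ h).hasFDerivAt.comp_hasDerivAt 0 (L.hasFDerivAt.comp_hasDerivAt 0 h1)
    have hzero : P.pr (P.ρ h (L (v i))) = 0 := by
      refine ext_inner_right ℝ fun u => ?_
      rw [P.inner_pr, inner_zero_left, ← hder.deriv]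
      refine P.orth s _ ((P.ρ h).contDiff.comp (L.contDiff.comp hc1)) hs (fun t => ?_) u
      obtain ⟨g, hg⟩ := hcG t
      exact ⟨h * g * h⁻¹, by
        rw [← hs, P.mul_apply, P.inv_apply_self, P.mul_apply, Function.comp_apply,
          Function.comp_apply, hg]⟩
    dsimp only
    rw [hform h _ s v hs]
    refine (ω (e s)).map_coord_zero i ?_
    rw [hzero, map_zero]
  · have h1 : ∀ y, P.ρ 1 y = y := fun y => by rw [map_one]; rfl
    dsimp only
    rw [hform 1 x (e.symm s) v ((h1 _).trans hx)]
    simp only [h1, hv, P.pr_ι, LinearEquiv.apply_symm_apply]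

/-- Let `G` be a compact subgroup of `O(n)` acting on `ℝⁿ` with a section
`Σ` and generalized Weyl group `W(Σ)` finite of order `m`.  Let `M`, `N` be DC-weight
sequences with `N` strongly regular and `sup_k (M (km) / N k)^(1/k) < ∞`.  Then every
`W`-invariant `p`-form `ω` of class `C^M` on `Σ` (a smooth map into alternating `p`-linear
forms, here encoded as continuous multilinear maps that are alternating) extends to a
`G`-invariant horizontal `p`-form `η` of class `C^N` on `ℝⁿ`. -/
theorem basic_form_extension_from_section
    (n m p : ℕ) (hm : 0 < m)
    (G : Subgroup (GL (Fin n) ℝ))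
    (hGorth : ∀ g ∈ G, g.val * g.valᵀ = 1)
    (hGcpt : IsCompact ((Units.val : GL (Fin n) ℝ → Matrix (Fin n) (Fin n) ℝ) ''
      (G : Set (GL (Fin n) ℝ))))
    (S : Submodule ℝ (Fin n → ℝ))
    (hSmeets : ∀ v : Fin n → ℝ, ∃ g ∈ G, g.val.mulVec v ∈ S)
    (hSorth : ∀ s ∈ S, ∀ c : ℝ → (Fin n → ℝ), ContDiff ℝ 1 c → c 0 = s →
      (∀ t : ℝ, ∃ g ∈ G, c t = g.val.mulVec s) →
      ∀ u ∈ S, ∑ i, deriv c 0 i * u i = 0)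
    (hW : Nat.card {φW : S → (Fin n → ℝ) // ∃ g ∈ G,
      Submodule.map (Matrix.mulVecLin g.val) S = S ∧
      ∀ s : S, φW s = g.val.mulVec (s : Fin n → ℝ)} = m)
    (M N : ℕ → ℝ) (hM : DCWeightSeq M) (hN : DCWeightSeq N)
    (hNsr : StronglyRegular N)
    (hMN : ∃ C : ℝ, ∀ k : ℕ, 1 ≤ k → (M (k * m) / N k) ^ ((1 : ℝ) / k) ≤ C)
    (ω : S → ContinuousMultilinearMap ℝ (fun _ : Fin p => S) ℝ)
    (hωalt : ∀ (s : S) (v : Fin p → S) (i j : Fin p), i ≠ j → v i = v j → ω s v = 0)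
    (hωCM : CMClassOn M Set.univ ω)
    (hωinv : ∀ g ∈ G, Submodule.map (Matrix.mulVecLin g.val) S = S →
      ∀ s t : S, ∀ v u : Fin p → S, (t : Fin n → ℝ) = g.val.mulVec (s : Fin n → ℝ) →
        (∀ i, (u i : Fin n → ℝ) = g.val.mulVec (v i : Fin n → ℝ)) → ω t u = ω s v) :
    ∃ η : (Fin n → ℝ) → ContinuousMultilinearMap ℝ (fun _ : Fin p => (Fin n → ℝ)) ℝ,
      (∀ (x : Fin n → ℝ) (v : Fin p → (Fin n → ℝ)) (i j : Fin p),
        i ≠ j → v i = v j → η x v = 0) ∧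
      CMClassOn N Set.univ η ∧
      (∀ g ∈ G, ∀ x : Fin n → ℝ, ∀ v : Fin p → (Fin n → ℝ),
        η (g.val.mulVec x) (fun i => g.val.mulVec (v i)) = η x v) ∧
      (∀ (x : Fin n → ℝ) (v : Fin p → (Fin n → ℝ)) (i : Fin p),
        (∃ c : ℝ → (Fin n → ℝ), ContDiff ℝ 1 c ∧ c 0 = x ∧
          (∀ t : ℝ, ∃ g ∈ G, c t = g.val.mulVec x) ∧ deriv c 0 = v i) → η x v = 0) ∧
      ∀ (s : S) (v : Fin p → S),
        η (s : Fin n → ℝ) (fun i => (v i : Fin n → ℝ)) = ω s v := by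
  obtain ⟨A, hA, hMA⟩ := exists_weight_bound hm hM hN hMN
  have := compactSpace_of_orthogonal hGorth hGcpt
  obtain ⟨d, P, hρ, e, he⟩ := exists_polarRep hGorth S hSmeets hSorth
  have hact : ∀ (g : G) x y, P.ρ g (WithLp.toLp 2 x) = WithLp.toLp 2 y ↔
      g.val.val.mulVec x = y := fun g x y => by
    rw [← (WithLp.ofLp_injective 2).eq_iff, hρ]
  have hweyl : ∀ w : P.weyl, ∃ g : G, ∀ s, g.val.val.mulVec (e s) = e (w.1 s) := fun w => by
    obtain ⟨g, hg⟩ := P.mem_weyl.1 w.2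
    refine ⟨g, fun s => ?_⟩
    rw [← he, ← he, ← hg, hρ]
  have hmap : ∀ (w : P.weyl) (g : G), (∀ s, g.val.val.mulVec (e s) = e (w.1 s)) →
      Submodule.map (Matrix.mulVecLin g.val.val) S = S := fun w g hg => by
    ext x
    rw [Submodule.mem_map]
    constructor
    · rintro ⟨y, hy, rfl⟩
      obtain ⟨s, hs⟩ := e.surjective ⟨y, hy⟩
      have h1 := hg s
      rw [hs] at h1
      rw [Matrix.mulVecLin_apply, h1]
      exact (e (w.1 s)).2
    · intro hx
      refine ⟨e (w.1.symm (e.symm ⟨x, hx⟩)), (e _).2, ?_⟩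
      rw [Matrix.mulVecLin_apply, hg, LinearIsometryEquiv.apply_symm_apply,
        LinearEquiv.apply_symm_apply]
  have hfin : Finite P.weyl := by
    have hcard : Finite {φW : S → (Fin n → ℝ) // ∃ g ∈ G,
        Submodule.map (Matrix.mulVecLin g.val) S = S ∧
        ∀ s : S, φW s = g.val.mulVec (s : Fin n → ℝ)} :=
      Nat.finite_of_card_ne_zero (by rw [hW]; exact hm.ne')
    choose γ hγ using hweyl
    refine Finite.of_injective (fun w => (⟨fun s => (γ w).val.val.mulVec (s : Fin n → ℝ), γ w,
      (γ w).2, hmap w (γ w) (hγ w), fun _ => rfl⟩ : {φW : S → (Fin n → ℝ) // ∃ g ∈ G,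
        Submodule.map (Matrix.mulVecLin g.val) S = S ∧
        ∀ s : S, φW s = g.val.mulVec (s : Fin n → ℝ)})) fun w w' h => ?_
    have h1 := congrArg Subtype.val h
    apply Subtype.ext
    ext1 s
    have h2 := congrFun h1 (e s)
    dsimp only at h2
    rw [hγ, hγ] at h2
    exact e.injective (Subtype.ext h2)
  obtain ⟨η, hηalt, hηN, hηinv, hηhor, hηext⟩ := P.exists_cmClassOn_extension e
    (EuclideanSpace.equiv (Fin n) ℝ).symm hM hA hMA hωalt hωCM fun w hw s v => by
      obtain ⟨g, hg⟩ := hweyl ⟨w, hw⟩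
      exact hωinv g g.2 (hmap ⟨w, hw⟩ g hg) _ _ _ _ (hg s).symm fun i => (hg (v i)).symm
  refine ⟨η, hηalt, hηN, fun g hg x v => ?_, fun x v i hc => ?_, fun s v => ?_⟩
  · exact hηinv ⟨g, hg⟩ _ _ _ _ ((hact _ _ _).2 rfl) fun i => (hact _ _ _).2 rfl
  · obtain ⟨c, hc1, hc0, hcG, hcv⟩ := hc
    refine hηhor x v i ⟨c, hc1, hc0, fun t => ?_, hcv⟩
    obtain ⟨g, hg, hgt⟩ := hcG t
    exact ⟨⟨g, hg⟩, ((hact ⟨g, hg⟩ x _).2 hgt.symm).symm⟩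
  · have hS : ∀ t : S, (WithLp.toLp 2 (t : Fin n → ℝ)) = P.ι (e.symm t) := fun t => by
      apply WithLp.ofLp_injective
      rw [he, LinearEquiv.apply_symm_apply]
    exact hηext _ s _ v (hS s) fun i => hS (v i)
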